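/- Let ℂ* denote the one-point compactification of ℂ, let Z ⊂ ℂ be a continuum regarded as a subset of ℂ*, and let h : Z × [0,1] → ℂ* be a continuous map such that each h^t := h(·,t) is injective and h^0 is the inclusion of Z into ℂ*. Then there exists a continuous map H : ℂ* × [0,1] → ℂ* such that H^0 = id_{ℂ*}, each H^t is a homeomorphism of ℂ* onto ℂ*, and H(z,t) = h(z,t) for all z ∈ Z and all t ∈ [0,1]. -/

import Mathlib

open Set Metric Topology Filter

section
open Set Metric Topology Filter

namespace IsoExt

/-- `f` and `g` differ on `K` by a factor with a continuous logarithm. -/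
def LogRel {α : Type*} [TopologicalSpace α] (K : Set α) (f g : α → ℂ) : Prop :=
  ∃ l : α → ℂ, ContinuousOn l K ∧ ∀ w ∈ K, f w = g w * Complex.exp (l w)

section LogRelBasic
variable {α : Type*} [TopologicalSpace α] {K K' : Set α} {f g k : α → ℂ}

lemma LogRel.refl : LogRel K f f := ⟨fun _ => 0, continuousOn_const, by simp⟩

lemma LogRel.symm (h : LogRel K f g) : LogRel K g f := by
  obtain ⟨l, hl, h⟩ := h
  refine ⟨fun w => - l w, hl.neg, fun w hw => ?_⟩
  rw [h w hw, mul_assoc, ← Complex.exp_add]; simp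

lemma LogRel.trans (h : LogRel K f g) (h' : LogRel K g k) : LogRel K f k := by
  obtain ⟨l, hl, h⟩ := h
  obtain ⟨l', hl', h'⟩ := h'
  refine ⟨fun w => l' w + l w, hl'.add hl, fun w hw => ?_⟩
  rw [h w hw, h' w hw, mul_assoc, ← Complex.exp_add]

lemma LogRel.mono (h : LogRel K f g) (hK : K' ⊆ K) : LogRel K' f g := by
  obtain ⟨l, hl, h⟩ := h
  exact ⟨l, hl.mono hK, fun w hw => h w (hK hw)⟩

lemma slit_of_near {a b : ℂ} (h : ‖a - b‖ < ‖b‖) : a / b ∈ Complex.slitPlane := by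
  have hb : b ≠ 0 := by rintro rfl; simp at h; exact absurd h (not_lt.2 (norm_nonneg a))
  have : ‖(a - b) / b‖ < 1 := by rw [norm_div]; exact (div_lt_one (norm_pos_iff.2 hb)).2 h
  have h2 := Complex.mem_slitPlane_of_norm_lt_one this
  convert h2 using 1; field_simp; ring

lemma exp_log_near {a b : ℂ} (h : ‖a - b‖ < ‖b‖) : a = b * Complex.exp (Complex.log (a / b)) := by
  have hb : b ≠ 0 := by rintro rfl; simp at h; exact absurd h (not_lt.2 (norm_nonneg a))
  rw [Complex.exp_log (Complex.slitPlane_ne_zero (slit_of_near h))]; field_simp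

lemma LogRel.of_near (hf : ContinuousOn f K) (hg : ContinuousOn g K)
    (h : ∀ w ∈ K, ‖f w - g w‖ < ‖g w‖) : LogRel K f g := by
  refine ⟨fun w => Complex.log (f w / g w), ?_, fun w hw => exp_log_near (h w hw)⟩
  have hg0 : ∀ w ∈ K, g w ≠ 0 := fun w hw h0 => by
    have := h w hw; rw [h0] at this; simp at this; exact absurd this (not_lt.2 (norm_nonneg _))
  exact ContinuousOn.clog (hf.div hg hg0) fun w hw => slit_of_near (h w hw)

lemma LogRel.union (h1 : LogRel K f g) (h2 : LogRel K' f g) (hK : IsClosed K) (hK' : IsClosed K')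
    (hd : Disjoint K K') : LogRel (K ∪ K') f g := by
  classical
  obtain ⟨l, hl, h⟩ := h1
  obtain ⟨l', hl', h'⟩ := h2
  refine ⟨fun w => if w ∈ K then l w else l' w, ?_, ?_⟩
  · refine ContinuousOn.union_of_isClosed ?_ ?_ hK hK'
    · exact hl.congr fun w hw => by simp [hw]
    · exact hl'.congr fun w hw => by simp [Set.disjoint_right.1 hd hw]
  · intro w hw
    by_cases hwK : w ∈ K
    · simp [hwK, h w hwK]
    · simp [hwK, h' w (hw.resolve_left hwK)]

/-- difference of two continuous logs of the same function is constant on preconnected sets. -/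
lemma log_unique {S : Set α} (hS : IsPreconnected S) {l l' : α → ℂ} (hl : ContinuousOn l S)
    (hl' : ContinuousOn l' S) (h : ∀ w ∈ S, Complex.exp (l w) = Complex.exp (l' w))
    {a b : α} (ha : a ∈ S) (hb : b ∈ S) : l a - l' a = l b - l' b := by
  have h1 : ∀ w ∈ S, ∃ n : ℤ, l w - l' w = n * (2 * Real.pi * Complex.I) := by
    intro w hw
    obtain ⟨n, hn⟩ := Complex.exp_eq_exp_iff_exists_int.1 (h w hw)
    exact ⟨n, by rw [hn]; ring⟩
  have hc : ContinuousOn (fun w => ((l w - l' w) / (2 * Real.pi * Complex.I)).re) S :=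
    Complex.continuous_re.comp_continuousOn ((hl.sub hl').div_const _)
  have h2pi : (2 * Real.pi * Complex.I : ℂ) ≠ 0 := Complex.two_pi_I_ne_zero
  have h2 : ∀ w ∈ S, ∃ n : ℤ, ((l w - l' w) / (2 * Real.pi * Complex.I)).re = n ∧
      l w - l' w = n * (2 * Real.pi * Complex.I) := by
    intro w hw
    obtain ⟨n, hn⟩ := h1 w hw
    refine ⟨n, ?_, hn⟩
    rw [hn, mul_div_cancel_right₀ _ h2pi]; simp
  have himg : (fun w => ((l w - l' w) / (2 * Real.pi * Complex.I)).re) '' S ⊆ range ((↑) : ℤ → ℝ) := by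
    rintro _ ⟨w, hw, rfl⟩
    obtain ⟨n, hn, -⟩ := h2 w hw
    exact ⟨n, hn.symm⟩
  have hsub := (hS.image _ hc)
  obtain ⟨n, hn, hna⟩ := h2 a ha
  obtain ⟨m, hm, hmb⟩ := h2 b hb
  have : (n : ℝ) = m := by
    have hsub2 : ((fun w => ((l w - l' w) / (2 * Real.pi * Complex.I)).re) '' S).Subsingleton := by
      exact (Set.countable_range ((↑) : ℤ → ℝ)).isTotallyDisconnected _ himg hsub
    exact hn ▸ hm ▸ hsub2 (mem_image_of_mem _ ha) (mem_image_of_mem _ hb)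
  rw [hna, hmb]; norm_cast at this; rw [this]

/-- If two continuous logs agree at a point they agree on a preconnected set. -/
lemma log_unique' {S : Set α} (hS : IsPreconnected S) {l l' : α → ℂ} (hl : ContinuousOn l S)
    (hl' : ContinuousOn l' S) (h : ∀ w ∈ S, Complex.exp (l w) = Complex.exp (l' w))
    {a b : α} (ha : a ∈ S) (hb : b ∈ S) (hab : l a = l' a) : l b = l' b := by
  have := log_unique hS hl hl' h ha hb
  rw [hab, sub_self] at this
  exact (sub_eq_zero.1 this.symm)

end LogRelBasic

/-- Homotopy lifting for `exp`. -/
lemma exp_lift_homotopy {A : Type*} [TopologicalSpace A] (F : unitInterval × A → ℂ)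
    (hF : Continuous F) (hF0 : ∀ x, F x ≠ 0) (l0 : A → ℂ) (hl0 : Continuous l0)
    (h0 : ∀ a, Complex.exp (l0 a) = F (0, a)) :
    ∃ L : unitInterval × A → ℂ, Continuous L ∧ (∀ x, Complex.exp (L x) = F x) ∧
      ∀ a, L (0, a) = l0 a := by
  let H : C(unitInterval × A, {z : ℂ // z ≠ 0}) := ⟨fun x => ⟨F x, hF0 x⟩, by fun_prop⟩
  let f : C(A, ℂ) := ⟨l0, hl0⟩
  have hH : ∀ a, H (0, a) = ⟨Complex.exp (f a), Complex.exp_ne_zero _⟩ := fun a =>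
    Subtype.ext (h0 a).symm
  refine ⟨Complex.isCoveringMap_exp.liftHomotopy H f hH, ContinuousMap.continuous _, ?_, ?_⟩
  · intro x
    have := congr_fun (Complex.isCoveringMap_exp.liftHomotopy_lifts H f hH) x
    exact congr_arg Subtype.val this
  · exact Complex.isCoveringMap_exp.liftHomotopy_zero H f hH

lemma tietze_on {K : Set ℂ} (hK : IsClosed K) {g : ℂ → ℂ} (hg : ContinuousOn g K) :
    ∃ G : ℂ → ℂ, Continuous G ∧ ∀ w ∈ K, G w = g w := by
  obtain ⟨G, hG⟩ := ContinuousMap.exists_restrict_eq hK (⟨K.domRestrict g, hg.domRestrict⟩ : C(K, ℂ))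
  refine ⟨G, G.continuous, fun w hw => ?_⟩
  exact congr_arg (fun f : C(K, ℂ) => f ⟨w, hw⟩) hG

lemma plane_log {F : ℂ → ℂ} (hF : Continuous F) (h0 : ∀ w, F w ≠ 0) :
    ∃ L : ℂ → ℂ, Continuous L ∧ ∀ w, Complex.exp (L w) = F w := by
  obtain ⟨L, hL, hLF, -⟩ := exp_lift_homotopy (A := ℂ) (fun x => F (x.1.1 * x.2))
    (by fun_prop) (fun x => h0 _) (fun _ => Complex.log (F 0)) continuous_const
    (fun a => by simp [Complex.exp_log (h0 0)])
  exact ⟨fun w => L (1, w), by fun_prop, fun w => by rw [hLF]; simp⟩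

/-- No continuous nonvanishing extension over a bounded open set containing `p`. -/
lemma skeleton {V : Set ℂ} (hVb : Bornology.IsBounded V) {p : ℂ} (hp : p ∈ V)
    {k g : ℂ → ℂ} (hk : ContinuousOn k (closure V)) (hk0 : ∀ w ∈ closure V, k w ≠ 0)
    (hg : ContinuousOn g (frontier V))
    (h : ∀ w ∈ frontier V, w - p = k w * Complex.exp (g w)) : False := by
  classical
  obtain ⟨G, hG, hGg⟩ := tietze_on isClosed_frontier hg
  let F : ℂ → ℂ := fun w => if w ∈ V then k w * Complex.exp (G w) else w - p
  have hFc : Continuous F := by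
    rw [← continuousOn_univ]
    refine ContinuousOn.if ?_ ?_ ?_
    · rintro a ⟨-, ha⟩
      rw [hGg a ha, ← h a ha]
    · simp only [univ_inter]
      exact hk.mul (Complex.continuous_exp.comp hG).continuousOn
    · fun_prop
  have hF0 : ∀ w, F w ≠ 0 := by
    intro w
    by_cases hw : w ∈ V
    · simp only [F, hw, if_true]
      exact mul_ne_zero (hk0 w (subset_closure hw)) (Complex.exp_ne_zero _)
    · simp only [F, hw, if_false]
      intro h0
      rw [sub_eq_zero] at h0; exact hw (h0 ▸ hp)
  obtain ⟨L, hL, hLF⟩ := plane_log hFc hF0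
  obtain ⟨R, hR0, hR⟩ := hVb.subset_ball_lt 0 p
  have hcirc : ∀ θ : ℝ, Complex.exp (L (p + R * Complex.exp (θ * Complex.I)))
      = Complex.exp (Real.log R + θ * Complex.I) := by
    intro θ
    rw [hLF]
    have : p + R * Complex.exp (θ * Complex.I) ∉ V := by
      intro hv
      have := hR hv
      rw [mem_ball, dist_eq_norm] at this
      simp [Complex.norm_exp_ofReal_mul_I, abs_of_pos hR0] at this
    simp only [F, this, if_false]
    rw [Complex.exp_add, ← Complex.ofReal_exp, Real.exp_log hR0]; ring
  have := log_unique (S := (univ : Set ℝ)) isPreconnected_univ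
    (l := fun θ : ℝ => L (p + R * Complex.exp (θ * Complex.I)))
    (l' := fun θ : ℝ => Real.log R + θ * Complex.I) (by fun_prop) (by fun_prop)
    (fun θ _ => hcirc θ) (mem_univ 0) (mem_univ (2 * Real.pi))
  simp at this

/-- Second form. -/
lemma eilenberg {V K : Set ℂ} (hVb : Bornology.IsBounded V)
    (hK : frontier V ⊆ K) {p q : ℂ} (hp : p ∈ V) (hqV : q ∉ V) (hqK : q ∉ K)
    (h : LogRel K (fun w => w - p) (fun w => w - q)) : False := by
  obtain ⟨l, hl, h⟩ := h
  refine skeleton hVb hp (k := fun w => w - q) (g := l) (by fun_prop) ?_ (hl.mono hK)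
    fun w hw => h w (hK hw)
  intro w hw h0
  rw [sub_eq_zero] at h0
  subst h0
  rw [closure_eq_self_union_frontier] at hw
  exact hw.elim hqV fun h => hqK (hK h)

/-- Local constancy of the class of `w - q`. -/
lemma logRel_nhds {α : Type*} [TopologicalSpace α] {K : Set α} {f : α → ℂ} (hf : ContinuousOn f K)
    {p q : ℂ} (h : ∀ w ∈ K, dist q p < dist p (f w)) :
    LogRel K (fun w => f w - q) (fun w => f w - p) := by
  refine LogRel.of_near (by fun_prop) (by fun_prop) fun w hw => ?_
  have := h w hw
  rw [dist_eq_norm, dist_eq_norm, ← norm_neg, ← norm_neg (p - f w)] at this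
  rwa [show f w - q - (f w - p) = -(q - p) by ring, show f w - p = -(p - f w) by ring]

/-- far away points have trivial class -/
lemma logRel_far {α : Type*} [TopologicalSpace α] {K : Set α} {f : α → ℂ} (hf : ContinuousOn f K)
    {q : ℂ} (h : ∀ w ∈ K, ‖f w‖ < ‖q‖) : LogRel K (fun w => f w - q) (fun _ => 1) := by
  have hq : LogRel K (fun _ => -q) (fun _ => 1) := by
    by_cases hK : K.Nonempty
    · obtain ⟨w, hw⟩ := hK
      have : -q ≠ 0 := by
        rw [neg_ne_zero]; rintro rfl
        have := h w hw; simp at this; exact absurd this (not_lt.2 (norm_nonneg _))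
      exact ⟨fun _ => Complex.log (-q), continuousOn_const, fun w _ => by
        rw [Complex.exp_log this, one_mul]⟩
    · exact ⟨fun _ => 0, continuousOn_const, fun w hw => (hK ⟨w, hw⟩).elim⟩
  refine (LogRel.of_near (by fun_prop) continuousOn_const fun w hw => ?_).trans hq
  simpa using h w hw

/-- The class of `w - q` is constant on preconnected subsets of the complement. -/
lemma logRel_of_preconnected {α : Type*} [TopologicalSpace α] {K : Set α} (hK : IsCompact K)
    {f : α → ℂ} (hf : ContinuousOn f K) {C : Set ℂ} (hC : IsPreconnected C)
    (hCK : ∀ w ∈ K, f w ∉ C) {p q : ℂ} (hp : p ∈ C) (hq : q ∈ C) :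
    LogRel K (fun w => f w - q) (fun w => f w - p) := by
  have key : ∀ a ∈ C, ∃ ε > 0, ∀ b ∈ ball a ε, LogRel K (fun w => f w - b) (fun w => f w - a) := by
    intro a ha
    have hcl : IsClosed (f '' K) := (hK.image_of_continuousOn hf).isClosed
    have hop : (f '' K)ᶜ ∈ 𝓝 a := hcl.isOpen_compl.mem_nhds (by
      rintro ⟨w, hw, rfl⟩; exact hCK w hw ha)
    obtain ⟨ε, hε, hb⟩ := Metric.mem_nhds_iff.1 hop
    refine ⟨ε, hε, fun b hba => logRel_nhds hf fun w hw => ?_⟩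
    by_contra hcon
    push Not at hcon
    exact hb (a := f w) (by rw [mem_ball, dist_comm]; exact hcon.trans_lt hba) (mem_image_of_mem _ hw)
  let S : Set ℂ := {a | ∃ ε > 0, ∀ b ∈ ball a ε, LogRel K (fun w => f w - b) (fun w => f w - p)}
  let T : Set ℂ := {a | ∃ ε > 0, ∀ b ∈ ball a ε, ¬ LogRel K (fun w => f w - b) (fun w => f w - p)}
  have hSo : IsOpen S := by
    rw [Metric.isOpen_iff]
    rintro a ⟨ε, hε, h⟩
    refine ⟨ε / 2, by positivity, fun b hb => ⟨ε / 2, by positivity, fun c hc => h c ?_⟩⟩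
    rw [mem_ball] at *; linarith [dist_triangle c b a]
  have hTo : IsOpen T := by
    rw [Metric.isOpen_iff]
    rintro a ⟨ε, hε, h⟩
    refine ⟨ε / 2, by positivity, fun b hb => ⟨ε / 2, by positivity, fun c hc => h c ?_⟩⟩
    rw [mem_ball] at *; linarith [dist_triangle c b a]
  have hcov : C ⊆ S ∪ T := by
    intro a ha
    obtain ⟨ε, hε, h⟩ := key a ha
    by_cases hr : LogRel K (fun w => f w - a) (fun w => f w - p)
    · exact Or.inl ⟨ε, hε, fun b hb => (h b hb).trans hr⟩
    · exact Or.inr ⟨ε, hε, fun b hb hb' => hr ((h b hb).symm.trans hb')⟩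
  by_contra hcon
  have hpS : p ∈ S := key p hp
  have hqT : q ∈ T := (hcov hq).resolve_left fun ⟨ε, hε, h⟩ => hcon (h q (mem_ball_self hε))
  obtain ⟨a, -, ⟨ε, hε, h⟩, ⟨ε', hε', h'⟩⟩ := hC S T hSo hTo hcov ⟨p, hp, hpS⟩ ⟨q, hq, hqT⟩
  exact h' a (mem_ball_self hε') (h a (mem_ball_self hε))

end IsoExt
end

section
open Set Metric Topology Filter

namespace IsoExt

/-- A planar isotopy of a compact space. -/
structure Isot (X : Type*) [TopologicalSpace X] where
  g : unitInterval → X → ℂ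
  cont : Continuous fun p : unitInterval × X => g p.1 p.2
  inj : ∀ t, Function.Injective (g t)

namespace Isot
variable {X : Type*} [MetricSpace X] [CompactSpace X] (G : Isot X)

lemma cont_t (t : unitInterval) : Continuous (G.g t) :=
  G.cont.comp (Continuous.prodMk_right t)

/-- complementary region at time `t` in the class `κ`. -/
def U (κ : X → ℂ) (t : unitInterval) : Set ℂ :=
  {q | LogRel univ (fun z => G.g t z - q) κ}

variable {κ : X → ℂ}

lemma emb (t : unitInterval) : IsClosedEmbedding (G.g t) :=
  (G.cont_t t).isClosedEmbedding (G.inj t)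

lemma extend (t : unitInterval) {m : X → ℂ} (hm : Continuous m) :
    ∃ M : ℂ → ℂ, Continuous M ∧ ∀ z, M (G.g t z) = m z := by
  obtain ⟨M, hM⟩ := ContinuousMap.exists_extension (G.emb t) ⟨m, hm⟩
  exact ⟨M, M.continuous, fun z => congr_arg (fun f : C(X, ℂ) => f z) hM⟩

lemma isCompact_range (t : unitInterval) : IsCompact (range (G.g t)) :=
  _root_.isCompact_range (G.cont_t t)

lemma time_unif (t0 : unitInterval) {ε : ℝ} (hε : 0 < ε) :
    ∀ᶠ t in 𝓝 t0, ∀ z, dist (G.g t z) (G.g t0 z) < ε := by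
  have h := isCompact_univ.eventually_forall_of_forall_eventually
    (x₀ := t0) (K := (univ : Set X)) (P := fun t z => dist (G.g t z) (G.g t0 z) < ε) ?_
  · filter_upwards [h] with t ht z using ht z (mem_univ z)
  · intro z _
    have hc : Continuous fun p : unitInterval × X => dist (G.g p.1 p.2) (G.g t0 p.2) :=
      G.cont.dist ((G.cont_t t0).comp continuous_snd)
    exact hc.continuousAt.eventually_lt continuousAt_const (by simpa using hε)

lemma U_notMem (hκ : ∀ z, κ z ≠ 0) {t : unitInterval} {q : ℂ} (hq : q ∈ G.U κ t) :
    q ∉ range (G.g t) := by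
  rintro ⟨z, rfl⟩
  obtain ⟨l, -, h⟩ := hq
  have := h z (mem_univ z)
  simp [hκ z, Complex.exp_ne_zero] at this

lemma U_near {t t0 : unitInterval} {q q0 : ℂ}
    (h : ∀ z, dist (G.g t z) (G.g t0 z) + dist q q0 < dist q0 (G.g t0 z)) :
    q ∈ G.U κ t ↔ q0 ∈ G.U κ t0 := by
  have : LogRel univ (fun z => G.g t z - q) (fun z => G.g t0 z - q0) := by
    have h1 := G.cont_t t
    have h2 := G.cont_t t0
    refine LogRel.of_near (by fun_prop) (by fun_prop) fun z _ => ?_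
    have h3 := h z
    rw [dist_eq_norm, dist_eq_norm, dist_comm, dist_eq_norm] at h3
    calc ‖G.g t z - q - (G.g t0 z - q0)‖ = ‖(G.g t z - G.g t0 z) - (q - q0)‖ := by ring_nf
      _ ≤ _ := norm_sub_le _ _
      _ < _ := h3
  exact ⟨fun hq => this.symm.trans hq, fun hq => this.trans hq⟩

lemma dist_range_pos (t : unitInterval) {q : ℂ} (hq : q ∉ range (G.g t)) :
    ∃ d > 0, ∀ z, d ≤ dist q (G.g t z) := by
  have hop : (range (G.g t))ᶜ ∈ 𝓝 q := (G.isCompact_range t).isClosed.isOpen_compl.mem_nhds hq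
  obtain ⟨ε, hε, hb⟩ := Metric.mem_nhds_iff.1 hop
  refine ⟨ε, hε, fun z => ?_⟩
  by_contra hcon
  push Not at hcon
  exact hb (a := G.g t z) (by rwa [mem_ball, dist_comm]) (mem_range_self z)

/-- joint local constancy of membership in `U`. -/
lemma U_joint (t0 : unitInterval) {q0 : ℂ} (hq : q0 ∉ range (G.g t0)) :
    ∀ᶠ p : unitInterval × ℂ in 𝓝 (t0, q0), (p.2 ∈ G.U κ p.1 ↔ q0 ∈ G.U κ t0) := by
  obtain ⟨d, hd, h⟩ := G.dist_range_pos t0 hq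
  have h1 := G.time_unif t0 (half_pos hd)
  have h2 : ∀ᶠ q in 𝓝 q0, dist q q0 < d / 2 := Metric.ball_mem_nhds q0 (half_pos hd)
  rw [nhds_prod_eq]
  filter_upwards [h1.prod_mk h2] with p hp
  refine G.U_near fun z => ?_
  linarith [hp.1 z, hp.2, h z]

lemma U_open (hκ : ∀ z, κ z ≠ 0) (t : unitInterval) : IsOpen (G.U κ t) := by
  rw [isOpen_iff_mem_nhds]
  intro q hq
  have h := G.U_joint (κ := κ) t (G.U_notMem hκ hq)
  have h2 : Tendsto (fun q' : ℂ => (t, q')) (𝓝 q) (𝓝 (t, q)) :=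
    (Continuous.prodMk_right t).tendsto q
  filter_upwards [h2.eventually h] with q' h' using h'.2 hq

lemma U_preconn {t : unitInterval} {C : Set ℂ} (hC : IsPreconnected C)
    (hCZ : Disjoint C (range (G.g t))) {p : ℂ} (hp : p ∈ C) (hpU : p ∈ G.U κ t) :
    C ⊆ G.U κ t := by
  intro q hq
  exact (logRel_of_preconnected isCompact_univ (G.cont_t t).continuousOn hC
    (fun z _ hz => Set.disjoint_left.1 hCZ hz (mem_range_self z)) hp hq).trans hpU

lemma U_frontier (hκ : ∀ z, κ z ≠ 0) (t : unitInterval) :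
    frontier (G.U κ t) ⊆ range (G.g t) := by
  intro q hq
  by_contra hcon
  have h := G.U_joint (κ := κ) t hcon
  have h2 : Tendsto (fun q' : ℂ => (t, q')) (𝓝 q) (𝓝 (t, q)) :=
    (Continuous.prodMk_right t).tendsto q
  have h3 := h2.eventually h
  rw [(G.U_open hκ t).frontier_eq] at hq
  obtain ⟨q', h', hq'⟩ := (h3.and_frequently (mem_closure_iff_frequently.1 hq.1)).exists
  exact hq.2 (h'.1 hq')

lemma exists_bound (t : unitInterval) : ∃ M, ∀ z, ‖G.g t z‖ ≤ M := by
  obtain ⟨M, hM⟩ := (G.isCompact_range t).isBounded.exists_norm_le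
  exact ⟨M, fun z => hM _ (mem_range_self z)⟩

lemma U_bounded (hκ1 : ¬ LogRel univ κ (fun _ => 1)) (t : unitInterval) :
    Bornology.IsBounded (G.U κ t) := by
  obtain ⟨M, hM⟩ := G.exists_bound t
  rw [isBounded_iff_forall_norm_le]
  refine ⟨M, fun q hq => ?_⟩
  by_contra hcon
  push Not at hcon
  exact hκ1 (hq.symm.trans (logRel_far (G.cont_t t).continuousOn fun z _ => (hM z).trans_lt hcon))

/-- two points of `U` have related functions on the range -/
lemma U_logRel (t : unitInterval) {p q : ℂ} (hp : p ∈ G.U κ t) (hq : q ∈ G.U κ t) :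
    LogRel (range (G.g t)) (fun w => w - p) (fun w => w - q) := by
  obtain ⟨l, hl, h⟩ := hp.trans hq.symm
  obtain ⟨M, hM, hMl⟩ := G.extend t (continuousOn_univ.1 hl)
  refine ⟨M, hM.continuousOn, ?_⟩
  rintro _ ⟨z, rfl⟩
  rw [hMl]; exact h z (mem_univ z)

lemma U_isPreconnected (hκ : ∀ z, κ z ≠ 0) (hκ1 : ¬ LogRel univ κ (fun _ => 1)) (t : unitInterval) :
    IsPreconnected (G.U κ t) := by
  rintro S T hS hT hST ⟨p, hp, hpS⟩ ⟨q, hq, hqT⟩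
  by_contra hcon
  rw [Set.not_nonempty_iff_eq_empty] at hcon
  have hVo : IsOpen (G.U κ t ∩ S) := (G.U_open hκ t).inter hS
  refine eilenberg (V := G.U κ t ∩ S) (K := range (G.g t))
    ((G.U_bounded hκ1 t).subset inter_subset_left) ?_ ⟨hp, hpS⟩ (q := q) ?_ (G.U_notMem hκ hq)
    (G.U_logRel t hp hq)
  · intro w hw
    by_contra hwr
    rw [hVo.frontier_eq] at hw
    have hwU : w ∈ G.U κ t := by
      by_contra hwU
      apply hwr
      apply G.U_frontier hκ t
      rw [(G.U_open hκ t).frontier_eq]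
      exact ⟨closure_mono inter_subset_left hw.1, hwU⟩
    rcases hST hwU with h | h
    · exact hw.2 ⟨hwU, h⟩
    · obtain ⟨v, hv1, hv2⟩ := mem_closure_iff.1 hw.1 T hT h
      have : v ∈ G.U κ t ∩ (S ∩ T) := ⟨hv2.1, hv2.2, hv1⟩
      rw [hcon] at this; exact this
  · rintro ⟨-, hqS⟩
    have : q ∈ G.U κ t ∩ (S ∩ T) := ⟨hq, hqS, hqT⟩
    rw [hcon] at this; exact this

lemma U_nonempty (hκc : Continuous κ) (hκ : ∀ z, κ z ≠ 0)
    (hκ1 : ¬ LogRel univ κ (fun _ => 1)) {s : unitInterval} (hs : (G.U κ s).Nonempty)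
    (t : unitInterval) : (G.U κ t).Nonempty := by
  have hopen : IsOpen {t | (G.U κ t).Nonempty} := by
    rw [isOpen_iff_mem_nhds]
    rintro t ⟨q, hq⟩
    have h := G.U_joint (κ := κ) t (G.U_notMem hκ hq)
    have h2 : Tendsto (fun t' : unitInterval => (t', q)) (𝓝 t) (𝓝 (t, q)) :=
      (Continuous.prodMk_left q).tendsto t
    filter_upwards [h2.eventually h] with t' h' using ⟨q, h'.2 hq⟩
  have hclosed : IsClosed {t | (G.U κ t).Nonempty} := by
    rw [isClosed_iff_frequently]
    intro t ht
    obtain ⟨k, hk, hkκ⟩ := G.extend t hκc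
    -- k nonvanishing near the range
    have hK := G.isCompact_range t
    have hop : IsOpen {w | k w ≠ 0} := isOpen_ne_fun hk continuous_const
    obtain ⟨d, hd, hdk⟩ := hK.exists_cthickening_subset_open hop
      (by rintro _ ⟨z, rfl⟩; simpa [hkκ] using hκ z)
    have hclose : ∀ᶠ t' in 𝓝 t, ∀ z, ‖κ z - k (G.g t' z)‖ < ‖k (G.g t' z)‖ := by
      have h := isCompact_univ.eventually_forall_of_forall_eventually
        (x₀ := t) (K := (univ : Set X))
        (P := fun t' z => ‖κ z - k (G.g t' z)‖ < ‖k (G.g t' z)‖) ?_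
      · filter_upwards [h] with t ht z using ht z (mem_univ z)
      · intro z _
        have hc1 : Continuous fun p : unitInterval × X => ‖κ p.2 - k (G.g p.1 p.2)‖ := by
          have := G.cont; fun_prop
        have hc2 : Continuous fun p : unitInterval × X => ‖k (G.g p.1 p.2)‖ := by
          have := G.cont; fun_prop
        exact hc1.continuousAt.eventually_lt hc2.continuousAt (by simpa [hkκ] using hκ z)
    obtain ⟨t', ⟨q, hq⟩, hc, hdist⟩ := (ht.and_eventually (hclose.and (G.time_unif t hd))).exists
    by_contra hemp
    have hsub : closure (G.U κ t') ⊆ Metric.cthickening d (range (G.g t)) := by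
      refine closure_minimal (fun w hw => ?_) Metric.isClosed_cthickening
      by_contra hwd
      have hfar : ∀ z, d < dist w (G.g t z) := by
        intro z
        by_contra hz
        push Not at hz
        exact hwd (Metric.mem_cthickening_of_dist_le w (G.g t z) d _ (mem_range_self z) hz)
      refine hemp ⟨w, (G.U_near (t := t') (q := w) fun z => ?_).1 hw⟩
      rw [dist_self, add_zero]
      exact (hdist z).trans (hfar z)
    obtain ⟨l, hl, hlq⟩ := hq
    have hgt := G.cont_t t'
    obtain ⟨M, hM, hMm⟩ := G.extend t'
      (m := fun z => l z + Complex.log (κ z / k (G.g t' z))) (by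
        refine (continuousOn_univ.1 hl).add (Continuous.clog (hκc.div (by fun_prop) fun z h0 => ?_)
          fun z => slit_of_near (hc z))
        have := hc z; rw [h0] at this; simp at this; exact hκ z (norm_le_zero_iff.1 this.le))
    refine skeleton (G.U_bounded hκ1 t') (p := q) ⟨l, hl, hlq⟩ (k := k) (g := M)
      hk.continuousOn (fun w hw => hdk (hsub hw)) hM.continuousOn fun w hw => ?_
    obtain ⟨z, rfl⟩ := G.U_frontier hκ t' hw
    have h3 : G.g t' z - q = κ z * Complex.exp (l z) := hlq z (mem_univ z)
    have h4 := exp_log_near (hc z)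
    rw [hMm, Complex.exp_add, h3]
    nth_rewrite 1 [h4]
    ring
  have : IsClopen {t | (G.U κ t).Nonempty} := ⟨hclosed, hopen⟩
  rcases isClopen_iff.1 this with h | h
  · have h1 : s ∈ {t | (G.U κ t).Nonempty} := hs
    rw [h] at h1; exact absurd h1 (by simp)
  · have h1 : t ∈ {t | (G.U κ t).Nonempty} := by rw [h]; exact mem_univ t
    exact h1

end Isot
end IsoExt
end

section
open Set Metric Topology Filter

set_option linter.unusedSectionVars false
namespace IsoExt
namespace Isot
variable {X : Type*} [MetricSpace X] [CompactSpace X] (G : Isot X) {κ : X → ℂ}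

lemma U_isPathConnected (hκ : ∀ z, κ z ≠ 0)
    (hκ1 : ¬ LogRel univ κ (fun _ => 1)) (t : unitInterval) (hne : (G.U κ t).Nonempty) :
    IsPathConnected (G.U κ t) :=
  (G.U_open hκ t).isConnected_iff_isPathConnected.1 ⟨hne, G.U_isPreconnected hκ hκ1 t⟩

lemma U_time (hκ : ∀ z, κ z ≠ 0) {t : unitInterval} {q : ℂ} (hq : q ∈ G.U κ t) :
    ∃ ε > 0, ∀ t', dist t' t < ε → q ∈ G.U κ t' := by
  have h := G.U_joint (κ := κ) t (G.U_notMem hκ hq)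
  have h2 : Tendsto (fun t' : unitInterval => (t', q)) (𝓝 t) (𝓝 (t, q)) :=
    (Continuous.prodMk_left q).tendsto t
  obtain ⟨ε, hε, h3⟩ := Metric.eventually_nhds_iff.1 (h2.eventually h)
  exact ⟨ε, hε, fun t' ht' => (h3 ht').2 hq⟩

lemma U_time_compact (hκ : ∀ z, κ z ≠ 0) {t : unitInterval} {K : Set ℂ} (hK : IsCompact K)
    (hq : K ⊆ G.U κ t) : ∃ ε > 0, ∀ t', dist t' t < ε → K ⊆ G.U κ t' := by
  have h := hK.eventually_forall_of_forall_eventually (x₀ := t)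
    (P := fun t' q => q ∈ G.U κ t') (fun q hqK => by
      filter_upwards [G.U_joint (κ := κ) t (G.U_notMem hκ (hq hqK))] with p hp
      exact hp.2 (hq hqK))
  obtain ⟨ε, hε, h3⟩ := Metric.eventually_nhds_iff.1 h
  exact ⟨ε, hε, fun t' ht' q hq => h3 ht' q hq⟩

/-- a continuous choice of base points -/
lemma exists_base (hκc : Continuous κ) (hκ : ∀ z, κ z ≠ 0)
    (hκ1 : ¬ LogRel univ κ (fun _ => 1)) {s : unitInterval} (hs : (G.U κ s).Nonempty) :
    ∃ P : unitInterval → ℂ, Continuous P ∧ ∀ t, P t ∈ G.U κ t := by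
  have hne := G.U_nonempty hκc hκ hκ1 hs
  set S : Set unitInterval := {t | ∃ P : unitInterval → ℂ, Continuous P ∧ ∀ t' ≤ t, P t' ∈ G.U κ t'}
    with hS
  have h0 : (0 : unitInterval) ∈ S := by
    obtain ⟨q, hq⟩ := hne 0
    refine ⟨fun _ => q, continuous_const, fun t' ht' => ?_⟩
    have : t' = 0 := le_antisymm ht' t'.2.1
    rw [this]; exact hq
  have hopen : IsOpen S := by
    rw [Metric.isOpen_iff]
    rintro t ⟨P, hP, hPt⟩
    obtain ⟨ε, hε, h⟩ := G.U_time hκ (hPt t le_rfl)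
    refine ⟨ε, hε, fun t1 ht1 => ⟨fun t' => P (min t' t), by fun_prop, fun t' ht' => ?_⟩⟩
    beta_reduce
    rcases le_total t' t with h1 | h1
    · rw [min_eq_left h1]; exact hPt t' h1
    · rw [min_eq_right h1]; refine h t' (lt_of_le_of_lt ?_ ht1)
      rw [Subtype.dist_eq, Subtype.dist_eq, Real.dist_eq, Real.dist_eq]
      have h2 : (t' : ℝ) ≤ t1 := ht'
      have h3 : (t : ℝ) ≤ t' := h1
      rw [abs_of_nonneg (by linarith), abs_of_nonneg (by linarith)]; linarith
  have hclosed : IsClosed S := by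
    rw [isClosed_iff_frequently]
    intro t0 ht0
    obtain ⟨p0, hp0⟩ := hne t0
    obtain ⟨ε, hε, h⟩ := G.U_time hκ hp0
    obtain ⟨a, ⟨P, hP, hPa⟩, ha⟩ := (ht0.and_eventually (Metric.ball_mem_nhds t0 hε)).exists
    rcases le_or_gt t0 a with hle | hlt
    · exact ⟨P, hP, fun t' ht' => hPa t' (ht'.trans hle)⟩
    obtain ⟨γ, hγ⟩ := (G.U_isPathConnected hκ hκ1 a (hne a)).joinedIn _ (hPa a le_rfl) p0 (h a ha)
    obtain ⟨δ, hδ, hδγ⟩ := G.U_time_compact hκ (t := a) (_root_.isCompact_range γ.continuous)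
      (by rintro _ ⟨s, rfl⟩; exact hγ s)
    set δ' := δ / 2 with hδ'
    have hδ'0 : 0 < δ' := by positivity
    refine ⟨fun t' => P (min t' a) + (γ (projIcc 0 1 zero_le_one (((t' : ℝ) - a) / δ')) - γ 0),
      by fun_prop, fun t' ht' => ?_⟩
    beta_reduce
    rcases le_total t' a with h1 | h1
    · have h3 : (t' : ℝ) ≤ a := h1
      rw [min_eq_left h1, projIcc_of_le_left _ (div_nonpos_of_nonpos_of_nonneg (by linarith) hδ'0.le)]
      simpa using hPa t' h1
    · have h3 : (a : ℝ) ≤ t' := h1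
      have h4 : (t' : ℝ) ≤ t0 := ht'
      have e : P (min t' a) + (γ (projIcc 0 1 zero_le_one (((t' : ℝ) - a) / δ')) - γ 0)
        = γ (projIcc 0 1 zero_le_one (((t' : ℝ) - a) / δ')) := by
        rw [min_eq_right h1, γ.source]; ring
      show P (min t' a) + (γ (projIcc 0 1 zero_le_one (((t' : ℝ) - a) / δ')) - γ 0) ∈ _
      rw [e]
      rcases le_or_gt ((t' : ℝ) - a) δ' with h2 | h2
      · refine hδγ t' ?_ (mem_range_self _)
        rw [Subtype.dist_eq, Real.dist_eq, abs_of_nonneg (by linarith)]; linarith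
      · rw [projIcc_of_right_le _ ((one_le_div hδ'0).2 h2.le)]
        have : γ ⟨1, by simp⟩ = p0 := γ.target
        rw [this]
        refine h t' ?_
        rw [Subtype.dist_eq, Real.dist_eq] at ha
        rw [Subtype.dist_eq, Real.dist_eq]
        rw [abs_of_nonpos (by linarith)] at ha ⊢
        linarith
  have : S = univ := by
    rcases isClopen_iff.1 ⟨hclosed, hopen⟩ with h | h
    · rw [h] at h0; exact absurd h0 (by simp)
    · exact h
  have h1 : (1 : unitInterval) ∈ S := by rw [this]; trivial
  obtain ⟨P, hP, h⟩ := h1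
  exact ⟨P, hP, fun t => h t t.2.2⟩

/-- translate of an isotopy -/
def shift (P : unitInterval → ℂ) (hP : Continuous P) : Isot X where
  g t z := G.g t z - P t
  cont := by have := G.cont; fun_prop
  inj t a b h := G.inj t (by simpa using h)

lemma shift_U (P : unitInterval → ℂ) (hP : Continuous P) (t : unitInterval) (q : ℂ) :
    q ∈ (G.shift P hP).U κ t ↔ q + P t ∈ G.U κ t := by
  unfold U shift
  simp only [mem_ofPred_eq]
  have : (fun z => G.g t z - P t - q) = fun z => G.g t z - (q + P t) := by funext z; ring
  rw [this]

end Isot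
end IsoExt
end

section
open Set Metric Topology Filter
set_option linter.unusedSectionVars false
namespace IsoExt
namespace Isot
variable {X : Type*} [MetricSpace X] [CompactSpace X] (G : Isot X)

/-- normalized isotopy: the origin is a base point of a bounded complementary domain -/
structure Nice : Prop where
  ne0 : ∀ t z, G.g t z ≠ 0
  bdd : ¬ LogRel univ (G.g 0) (fun _ => 1)

/-- domain of the origin -/
def D (t : unitInterval) : Set ℂ :=
  {q | ∃ l : X → ℂ, Continuous l ∧ ∀ z, G.g t z - q = G.g t z * Complex.exp (l z)}

variable {G}
lemma Nice.rel (hn : G.Nice) (t : unitInterval) : LogRel univ (G.g t) (G.g 0) := by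
  obtain ⟨L, hL, hLF, -⟩ := exp_lift_homotopy (A := X) (fun x => G.g x.1 x.2 / G.g 0 x.2)
    (by have := G.cont; have := G.cont_t 0
        exact Continuous.div (by fun_prop) (by fun_prop) fun x => hn.ne0 _ _)
    (fun x => div_ne_zero (hn.ne0 _ _) (hn.ne0 _ _)) (fun _ => 0) continuous_const
    (fun a => by simp [hn.ne0 0 a])
  refine ⟨fun z => L (t, z), by fun_prop, fun z _ => ?_⟩
  rw [hLF, mul_div_cancel₀ _ (hn.ne0 0 z)]

lemma Nice.D_eq (hn : G.Nice) (t : unitInterval) : G.D t = G.U (G.g 0) t := by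
  ext q
  constructor
  · rintro ⟨l, hl, h⟩
    have : LogRel univ (fun z => G.g t z - q) (G.g t) := ⟨l, hl.continuousOn, fun z _ => h z⟩
    exact this.trans (hn.rel t)
  · intro h
    obtain ⟨l, hl, h⟩ := LogRel.trans h (hn.rel t).symm
    exact ⟨l, continuousOn_univ.1 hl, fun z => h z (mem_univ z)⟩

lemma zero_mem_D (t : unitInterval) : (0:ℂ) ∈ G.D t := ⟨fun _ => 0, continuous_const, by simp⟩

lemma Nice.D_open (hn : G.Nice) (t : unitInterval) : IsOpen (G.D t) := by
  rw [hn.D_eq]; exact G.U_open (hn.ne0 0) t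

lemma Nice.D_preconn (hn : G.Nice) (t : unitInterval) : IsPreconnected (G.D t) := by
  rw [hn.D_eq]; exact G.U_isPreconnected (hn.ne0 0) hn.bdd t

lemma Nice.D_path (hn : G.Nice) (t : unitInterval) : IsPathConnected (G.D t) :=
  (hn.D_open t).isConnected_iff_isPathConnected.1 ⟨⟨0, zero_mem_D t⟩, hn.D_preconn t⟩

lemma Nice.D_bounded (hn : G.Nice) (t : unitInterval) : Bornology.IsBounded (G.D t) := by
  rw [hn.D_eq]; exact G.U_bounded hn.bdd t

lemma Nice.D_notMem (hn : G.Nice) {t : unitInterval} {q : ℂ} (hq : q ∈ G.D t) :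
    q ∉ range (G.g t) := by
  rw [hn.D_eq] at hq; exact G.U_notMem (hn.ne0 0) hq

lemma Nice.D_frontier (hn : G.Nice) (t : unitInterval) : frontier (G.D t) ⊆ range (G.g t) := by
  rw [hn.D_eq]; exact G.U_frontier (hn.ne0 0) t

lemma Nice.D_joint (hn : G.Nice) (t0 : unitInterval) {q0 : ℂ} (hq : q0 ∉ range (G.g t0)) :
    ∀ᶠ p : unitInterval × ℂ in 𝓝 (t0, q0), (p.2 ∈ G.D p.1 ↔ q0 ∈ G.D t0) := by
  simp only [hn.D_eq]; exact G.U_joint t0 hq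

lemma Nice.D_max (hn : G.Nice) {t : unitInterval} {C : Set ℂ} (hC : IsPreconnected C)
    (hCZ : Disjoint C (range (G.g t))) {p : ℂ} (hp : p ∈ C) (hpU : p ∈ G.D t) : C ⊆ G.D t := by
  rw [hn.D_eq] at *; exact G.U_preconn hC hCZ hp hpU

/-- additivity of principal logarithms in the right half plane -/
lemma log_mul_re {A B : ℂ} (hA : 0 < A.re) (hB : 0 < B.re) :
    Complex.log (A * B) = Complex.log A + Complex.log B := by
  have hA0 : A ≠ 0 := by rintro rfl; simp at hA
  have hB0 : B ≠ 0 := by rintro rfl; simp at hB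
  have h1 := abs_lt.1 (Complex.abs_arg_lt_pi_div_two_iff.2 (Or.inl hA))
  have h2 := abs_lt.1 (Complex.abs_arg_lt_pi_div_two_iff.2 (Or.inl hB))
  exact Complex.log_mul hA0 hB0 ⟨by linarith [h1.1, h2.1], by linarith [h1.2, h2.2]⟩

lemma re_pos_of_near {a b : ℂ} (h : ‖a - b‖ < ‖b‖) : 0 < (a / b).re := by
  have hb : b ≠ 0 := by rintro rfl; simp at h; exact absurd h (not_lt.2 (norm_nonneg a))
  have : ‖(a - b) / b‖ < 1 := by rw [norm_div]; exact (div_lt_one (norm_pos_iff.2 hb)).2 h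
  have h2 := (abs_lt.1 ((Complex.abs_re_le_norm _).trans_lt this)).1
  have e : (a - b) / b = a / b - 1 := by field_simp
  rw [e] at h2; simp at h2; linarith

lemma re_pos_sub {z a c : ℂ} (h : dist a c < dist z c) : 0 < ((z - a) / (z - c)).re := by
  refine re_pos_of_near ?_
  rw [dist_eq_norm, dist_eq_norm] at h
  rwa [show z - a - (z - c) = -(a - c) by ring, norm_neg]

lemma log_id {z a b c : ℂ} (h1 : 0 < ((z - a) / (z - c)).re) (h2 : 0 < ((z - b) / (z - a)).re) :
    Complex.log ((z - b) / (z - c)) =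
      Complex.log ((z - a) / (z - c)) + Complex.log ((z - b) / (z - a)) := by
  rw [← log_mul_re h1 h2]
  congr 1
  have : z - a ≠ 0 := by intro h; rw [h] at h2; simp at h2
  field_simp

/-- local component with prescribed logarithms away from the ball -/
def WW (f κ : X → ℂ) (c : ℂ) (R : ℝ) (μ : X → ℂ) : Set ℂ :=
  {q | dist q c < R ∧ ∃ l : X → ℂ, Continuous l ∧ (∀ z, f z - q = κ z * Complex.exp (l z)) ∧
    ∀ z, R ≤ dist (f z) c → l z = μ z + Complex.log ((f z - q) / (f z - c))}

lemma WW_local {f κ : X → ℂ} (hf : Continuous f) {c : ℂ} {R : ℝ} {μ : X → ℂ} {q q' : ℂ}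
    (hq : q ∈ WW f κ c R μ)
    (hq' : dist q' c < R) (hd : ∀ z, dist q' q < dist (f z) q) : q' ∈ WW f κ c R μ := by
  obtain ⟨h1, l, hl, hlq, hfar⟩ := hq
  have hre : ∀ z, 0 < ((f z - q') / (f z - q)).re := fun z => re_pos_sub (hd z)
  have h0 : ∀ z, f z - q ≠ 0 := fun z h => by have := hre z; rw [h] at this; simp at this
  refine ⟨hq', fun z => l z + Complex.log ((f z - q') / (f z - q)), ?_, fun z => ?_,
    fun z hz => ?_⟩
  · exact hl.add (Continuous.clog (Continuous.div (by fun_prop) (by fun_prop) h0)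
      fun z => Or.inl (hre z))
  · rw [Complex.exp_add, ← mul_assoc, ← hlq, Complex.exp_log, mul_div_cancel₀ _ (h0 z)]
    intro h; have := hre z; rw [h] at this; simp at this
  · beta_reduce
    rw [hfar z hz, log_id (re_pos_sub (h1.trans_le hz)) (hre z)]; ring

lemma WW_key {f κ : X → ℂ} (hf : Continuous f) {c : ℂ} {R : ℝ} {μ : X → ℂ} {q : ℂ}
    (hq : q ∉ range f) (hqb : q ∈ ball c R) : ∃ δ > 0, ∀ q', dist q' q < δ →
      (q' ∈ WW f κ c R μ ↔ q ∈ WW f κ c R μ) ∧ q' ∉ range f ∧ q' ∈ ball c R := by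
  obtain ⟨d, hd, h⟩ : ∃ d > 0, ∀ z, d ≤ dist q (f z) := by
    have hop : (range f)ᶜ ∈ 𝓝 q :=
      (_root_.isCompact_range hf).isClosed.isOpen_compl.mem_nhds hq
    obtain ⟨ε, hε, hb⟩ := Metric.mem_nhds_iff.1 hop
    refine ⟨ε, hε, fun z => ?_⟩
    by_contra hcon
    push Not at hcon
    exact hb (a := f z) (by rwa [mem_ball, dist_comm]) (mem_range_self z)
  have hqb' : 0 < R - dist q c := sub_pos.2 hqb
  refine ⟨min (d / 2) (R - dist q c), lt_min (half_pos hd) hqb', fun q' hq' => ?_⟩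
  have h1 : dist q' q < d / 2 := hq'.trans_le (min_le_left _ _)
  have h2 : dist q' c < R := by
    have := hq'.trans_le (min_le_right _ _)
    linarith [dist_triangle q' q c]
  have h3 : ∀ z, d / 2 < dist (f z) q' := fun z => by
    have := h z; rw [dist_comm] at this
    have := dist_triangle (f z) q' q
    linarith
  refine ⟨⟨fun hw => WW_local hf hw hqb fun z => ?_, fun hw => WW_local hf hw h2 fun z => ?_⟩, ?_, h2⟩
  · rw [dist_comm]; exact h1.trans (h3 z)
  · have := h z; rw [dist_comm] at this; linarith
  · rintro ⟨z, rfl⟩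
    have := h3 z; simp at this; linarith

lemma WW_notMem {f κ : X → ℂ} (hκ : ∀ z, κ z ≠ 0) {c : ℂ} {R : ℝ} {μ : X → ℂ} {q : ℂ}
    (hq : q ∈ WW f κ c R μ) : q ∉ range f := by
  rintro ⟨z, rfl⟩
  obtain ⟨-, l, -, h, -⟩ := hq
  have := h z
  simp [hκ z] at this

variable (G)
/-- local component with prescribed logarithms away from the ball -/
abbrev W (t : unitInterval) (c : ℂ) (R : ℝ) (μ : X → ℂ) : Set ℂ := WW (G.g t) (G.g t) c R μ

variable {G}
lemma W_subset_D {t : unitInterval} {c : ℂ} {R : ℝ} {μ : X → ℂ} : G.W t c R μ ⊆ G.D t :=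
  fun _ ⟨_, l, hl, h, _⟩ => ⟨l, hl, h⟩

lemma W_subset_ball {t : unitInterval} {c : ℂ} {R : ℝ} {μ : X → ℂ} : G.W t c R μ ⊆ ball c R :=
  fun _ ⟨h, _⟩ => h

lemma Nice.W_max (hn : G.Nice) {t : unitInterval} {c : ℂ} {R : ℝ} {μ : X → ℂ} {C : Set ℂ}
    (hC : IsPreconnected C) (hCZ : Disjoint C (range (G.g t))) (hCb : C ⊆ ball c R) {p : ℂ}
    (hp : p ∈ C) (hpW : p ∈ G.W t c R μ) : C ⊆ G.W t c R μ := by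
  have key : ∀ q ∉ range (G.g t), q ∈ ball c R → ∃ δ > 0, ∀ q', dist q' q < δ →
      (q' ∈ G.W t c R μ ↔ q ∈ G.W t c R μ) ∧ q' ∉ range (G.g t) ∧ q' ∈ ball c R := by
    intro q hq hqb
    exact WW_key (G.cont_t t) hq hqb
  have hopen1 : IsOpen {q | q ∈ G.W t c R μ} := by
    rw [Metric.isOpen_iff]
    intro q hq
    obtain ⟨δ, hδ, h⟩ := key q (hn.D_notMem (W_subset_D hq)) (W_subset_ball hq)
    exact ⟨δ, hδ, fun q' hq' => (h q' hq').1.2 hq⟩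
  have hopen2 : IsOpen {q | q ∉ range (G.g t) ∧ q ∈ ball c R ∧ q ∉ G.W t c R μ} := by
    rw [Metric.isOpen_iff]
    rintro q ⟨hq1, hq2, hq3⟩
    obtain ⟨δ, hδ, h⟩ := key q hq1 hq2
    exact ⟨δ, hδ, fun q' hq' => ⟨(h q' hq').2.1, (h q' hq').2.2, fun hh => hq3 ((h q' hq').1.1 hh)⟩⟩
  refine hC.subset_left_of_subset_union hopen1 hopen2 ?_ ?_ ⟨p, hp, hpW⟩
  · rw [Set.disjoint_left]; rintro q h1 ⟨-, -, h2⟩; exact h2 h1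
  · intro q hq
    by_cases h : q ∈ G.W t c R μ
    · exact Or.inl h
    · exact Or.inr ⟨Set.disjoint_left.1 hCZ hq, hCb hq, h⟩

lemma Nice.W_open (hn : G.Nice) (t : unitInterval) (c : ℂ) (R : ℝ) (μ : X → ℂ) :
    IsOpen (G.W t c R μ) := by
  rw [Metric.isOpen_iff]
  intro q hq
  have : IsOpen (ball c R ∩ G.D t) := isOpen_ball.inter (hn.D_open t)
  obtain ⟨δ, hδ, h⟩ := Metric.isOpen_iff.1 this q ⟨W_subset_ball hq, W_subset_D hq⟩
  refine ⟨δ, hδ, hn.W_max (convex_ball q δ).isPreconnected ?_ (fun q' hq' => (h hq').1)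
    (mem_ball_self hδ) hq⟩
  rw [Set.disjoint_left]
  exact fun q' hq' => hn.D_notMem (h hq').2

lemma Nice.W_preconn (hn : G.Nice) (t : unitInterval) (c : ℂ) (R : ℝ) (μ : X → ℂ) :
    IsPreconnected (G.W t c R μ) := by
  classical
  rintro S T hS hT hST ⟨p, hp, hpS⟩ ⟨q, hq, hqT⟩
  by_contra hcon
  rw [Set.not_nonempty_iff_eq_empty] at hcon
  have hWo := hn.W_open t c R μ
  have hVo : IsOpen (G.W t c R μ ∩ S) := hWo.inter hS
  have hqr := hn.D_notMem (W_subset_D hq)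
  have hpr := hn.D_notMem (W_subset_D hp)
  refine eilenberg (V := G.W t c R μ ∩ S) (K := range (G.g t) ∪ {w | R ≤ dist w c})
    (isBounded_ball.subset (inter_subset_left.trans W_subset_ball)) ?_ ⟨hp, hpS⟩ (q := q) ?_ ?_ ?_
  · intro w hw
    by_contra hwr
    rw [mem_union, not_or] at hwr
    have hwb : dist w c < R := not_le.1 hwr.2
    rw [hVo.frontier_eq] at hw
    have hwW : w ∈ G.W t c R μ := by
      have ho : IsOpen (ball c R ∩ (range (G.g t))ᶜ) :=
        isOpen_ball.inter (G.isCompact_range t).isClosed.isOpen_compl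
      obtain ⟨δ, hδ, h⟩ := Metric.isOpen_iff.1 ho w ⟨hwb, hwr.1⟩
      obtain ⟨v, hv1, hv2⟩ := mem_closure_iff.1 hw.1 (ball w δ) isOpen_ball (mem_ball_self hδ)
      refine hn.W_max (convex_ball w δ).isPreconnected ?_ (fun q' hq' => (h hq').1) hv1 hv2.1
        (mem_ball_self hδ)
      rw [Set.disjoint_left]
      exact fun q' hq' => (h hq').2
    rcases hST hwW with h | h
    · exact hw.2 ⟨hwW, h⟩
    · obtain ⟨v, hv1, hv2⟩ := mem_closure_iff.1 hw.1 T hT h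
      have : v ∈ G.W t c R μ ∩ (S ∩ T) := ⟨hv2.1, hv2.2, hv1⟩
      rw [hcon] at this; exact this
  · rintro ⟨-, hqS⟩
    have : q ∈ G.W t c R μ ∩ (S ∩ T) := ⟨hq, hqS, hqT⟩
    rw [hcon] at this; exact this
  · rintro (h | h)
    · exact hqr h
    · exact absurd (mem_ball.1 (W_subset_ball hq)) (not_lt.2 h)
  · obtain ⟨hpb, lp, hlp, hlpe, hlpf⟩ := hp
    obtain ⟨hqb, lq, hlq, hlqe, hlqf⟩ := hq
    obtain ⟨M, hM, hMm⟩ := G.extend t (m := fun z => lp z - lq z) (hlp.sub hlq)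
    set B : ℂ → ℂ := fun w => Complex.log ((w - p) / (w - c)) - Complex.log ((w - q) / (w - c))
    have hBc : ContinuousOn B {w | R ≤ dist w c} := by
      have h0 : ∀ w ∈ {w | R ≤ dist w c}, w - c ≠ 0 := fun w hw h => by
        rw [sub_eq_zero] at h
        have : R ≤ dist w c := hw
        rw [h, dist_self] at this; linarith [dist_nonneg (x := p) (y := c)]
      refine ContinuousOn.sub (ContinuousOn.clog (ContinuousOn.div (by fun_prop) (by fun_prop) h0)
        fun w hw => Or.inl (re_pos_sub (hpb.trans_le hw))) (ContinuousOn.clog (ContinuousOn.div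
        (by fun_prop) (by fun_prop) h0) fun w hw => Or.inl (re_pos_sub (hqb.trans_le hw)))
    have hMB : ∀ z, R ≤ dist (G.g t z) c → M (G.g t z) = B (G.g t z) := fun z hz => by
      rw [hMm, hlpf z hz, hlqf z hz]; simp only [B]; ring
    refine ⟨fun w => if R ≤ dist w c then B w else M w, ?_, ?_⟩
    · refine ContinuousOn.union_of_isClosed ?_ ?_ (G.isCompact_range t).isClosed
        (isClosed_le continuous_const (by fun_prop))
      · refine hM.continuousOn.congr ?_
        rintro _ ⟨z, rfl⟩
        by_cases h : R ≤ dist (G.g t z) c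
        · simp only [h, if_true]; exact (hMB z h).symm
        · simp only [h, if_false]
      · refine hBc.congr fun w hw => ?_
        have : R ≤ dist w c := hw
        simp only [this, if_true]
    · intro w hw
      by_cases h : R ≤ dist w c
      · simp only [h, if_true, B]
        have e1 := re_pos_sub (z := w) (hpb.trans_le h)
        have e2 := re_pos_sub (z := w) (hqb.trans_le h)
        have n1 : (w - p) / (w - c) ≠ 0 := fun h => by rw [h] at e1; simp at e1
        have n2 : (w - q) / (w - c) ≠ 0 := fun h => by rw [h] at e2; simp at e2
        rw [Complex.exp_sub, Complex.exp_log n1, Complex.exp_log n2]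
        rw [div_ne_zero_iff] at n1 n2
        have := n1.2; have := n2.1
        field_simp
      · simp only [h, if_false]
        rcases hw with ⟨z, rfl⟩ | hw
        · have e1 := hlpe z
          have e2 := hlqe z
          rw [hMm, Complex.exp_sub, e1, e2]
          have := Complex.exp_ne_zero (lq z)
          field_simp
        · exact absurd hw h

/-- comparison of local components with different centers -/
lemma W_mono {t : unitInterval} {c x : ℂ} {R r : ℝ} {μ ν : X → ℂ} (hr : 0 < r)
    (hxr : dist x c + r ≤ R)
    (hμ : ∀ z, R ≤ dist (G.g t z) c →
      ν z = μ z + Complex.log ((G.g t z - x) / (G.g t z - c))) :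
    G.W t x r ν ⊆ G.W t c R μ := by
  rintro q ⟨hq, l, hl, hle, hlf⟩
  refine ⟨by linarith [dist_triangle q x c], l, hl, hle, fun z hz => ?_⟩
  have h1 : r ≤ dist (G.g t z) x := by linarith [dist_triangle (G.g t z) x c]
  rw [hlf z h1, hμ z hz, log_id (z := G.g t z) (a := x) (b := q) (c := c) (re_pos_sub (by linarith)) (re_pos_sub (by linarith))]
  ring

/-- conversely, a common point forces the relation -/
lemma W_mono_self {t : unitInterval} {c : ℂ} {R r : ℝ} {μ : X → ℂ} (hr : 0 < r) (h : r ≤ R) :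
    G.W t c r μ ⊆ G.W t c R μ := by
  refine W_mono hr (by simpa using h) fun z hz => ?_
  rw [div_self, Complex.log_one, add_zero]
  intro h0; rw [sub_eq_zero] at h0; rw [h0, dist_self] at hz; linarith

end Isot
end IsoExt
end

section
open Set Metric Topology Filter
set_option linter.unusedSectionVars false
namespace IsoExt

lemma eq_zero_of_exp {d : ℂ} (h : Complex.exp d = 1) (hd : ‖d‖ < 1) : d = 0 := by
  obtain ⟨n, hn⟩ := Complex.exp_eq_one_iff.1 h
  have hn0 : n = 0 := by
    by_contra hne
    have h1 : (1:ℝ) ≤ |(n:ℝ)| := by exact_mod_cast Int.one_le_abs hne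
    have h2 : ‖d‖ = |(n:ℝ)| * (2 * Real.pi) := by
      rw [hn]; simp [abs_of_pos Real.pi_pos]
    nlinarith [Real.pi_gt_three]
  rw [hn, hn0]; simp

lemma ev_zero {T X : Type*} [TopologicalSpace T] [TopologicalSpace X] [CompactSpace X] {t0 : T}
    {Far : T → X → Prop} {D : T → X → ℂ}
    (h1 : ∀ z, Far t0 z → ContinuousAt (fun p : T × X => D p.1 p.2) (t0, z))
    (h0 : ∀ z, Far t0 z → D t0 z = 0)
    (hF : ∀ z, ¬ Far t0 z → ∀ᶠ p : T × X in 𝓝 (t0, z), ¬ Far p.1 p.2)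
    (hexp : ∀ᶠ t in 𝓝 t0, ∀ z, Far t z → Complex.exp (D t z) = 1) :
    ∀ᶠ t in 𝓝 t0, ∀ z, Far t z → D t z = 0 := by
  have h := isCompact_univ.eventually_forall_of_forall_eventually
    (x₀ := t0) (K := (univ : Set X)) (P := fun t z => Far t z → ‖D t z‖ < 1) ?_
  · filter_upwards [h, hexp] with t h1 h2 z hz
    exact eq_zero_of_exp (h2 z hz) (h1 z (mem_univ z) hz)
  · intro z _
    by_cases hz : Far t0 z
    · have := (h1 z hz).norm.eventually_lt (continuousAt_const (y := (1:ℝ))) (by simp [h0 z hz])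
      filter_upwards [this] with p hp _ using hp
    · filter_upwards [hF z hz] with p hp h using absurd h hp

namespace Isot
variable {X : Type*} [MetricSpace X] [CompactSpace X] (G : Isot X)

/-- a point of the boundary with a branch of the logarithm -/
structure PreEnd where
  x : X
  μ : unitInterval → X → ℂ
  cont : ContinuousOn (fun p : unitInterval × X => μ p.1 p.2) {p | p.2 ≠ x}
  eq : ∀ t z, z ≠ x → G.g t z * Complex.exp (μ t z) = G.g t z - G.g t x

variable {G}
/-- the local neighbourhoods of an end -/
abbrev PreEnd.W (e : G.PreEnd) (t : unitInterval) (r : ℝ) : Set ℂ := G.W t (G.g t e.x) r (e.μ t)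

lemma PreEnd.contAt (e : G.PreEnd) {t : unitInterval} {z : X} (hz : z ≠ e.x) :
    ContinuousAt (fun p : unitInterval × X => e.μ p.1 p.2) (t, z) :=
  e.cont.continuousAt ((isOpen_ne_fun continuous_snd continuous_const).mem_nhds hz)

lemma PreEnd.cont_t (e : G.PreEnd) (t : unitInterval) : ContinuousOn (e.μ t) {z | z ≠ e.x} :=
  fun _ hz => ((e.contAt hz).comp
    (Continuous.prodMk_right t).continuousAt).continuousWithinAt

lemma Nice.exists_preEnd (hn : G.Nice) (x : X) (s : unitInterval) {lam : X → ℂ}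
    (hlam : ContinuousOn lam {z | z ≠ x})
    (h : ∀ z, z ≠ x → G.g s z * Complex.exp (lam z) = G.g s z - G.g s x) :
    ∃ e : G.PreEnd, e.x = x ∧ ∀ z, z ≠ x → e.μ s z = lam z := by
  classical
  have hgc := G.cont
  have hsub : ∀ t z, z ≠ x → G.g t z - G.g t x ≠ 0 := fun t z hz h0 =>
    hz (G.inj t (sub_eq_zero.1 h0))
  set F : unitInterval × {z : X // z ≠ x} → ℂ := fun p =>
    ((G.g p.1 p.2 - G.g p.1 x) / G.g p.1 p.2) / ((G.g 0 p.2 - G.g 0 x) / G.g 0 p.2) with hF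
  have c1 : Continuous fun p : unitInterval × {z : X // z ≠ x} => G.g p.1 p.2 :=
    G.cont.comp (by fun_prop : Continuous fun p : unitInterval × {z : X // z ≠ x} => (p.1, (p.2 : X)))
  have c2 : Continuous fun p : unitInterval × {z : X // z ≠ x} => G.g p.1 x :=
    G.cont.comp (by fun_prop : Continuous fun p : unitInterval × {z : X // z ≠ x} => (p.1, x))
  have c3 : Continuous fun p : unitInterval × {z : X // z ≠ x} => G.g 0 p.2 :=
    G.cont.comp (by fun_prop : Continuous fun p : unitInterval × {z : X // z ≠ x} =>
      ((0 : unitInterval), (p.2 : X)))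
  have hFc : Continuous F := by
    refine Continuous.div ((c1.sub c2).div c1 fun p => hn.ne0 _ _)
      ((c3.sub continuous_const).div c3 fun p => hn.ne0 _ _) fun p => ?_
    exact div_ne_zero (hsub 0 _ p.2.2) (hn.ne0 _ _)
  have hF0 : ∀ p, F p ≠ 0 := fun p => div_ne_zero (div_ne_zero (hsub _ _ p.2.2) (hn.ne0 _ _))
    (div_ne_zero (hsub _ _ p.2.2) (hn.ne0 _ _))
  obtain ⟨L, hL, hLF, -⟩ := exp_lift_homotopy F hFc hF0 (fun _ => 0) continuous_const
    (fun a => by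
      simp only [hF, Complex.exp_zero]
      rw [div_self (div_ne_zero (hsub 0 _ a.2) (hn.ne0 _ _))])
  refine ⟨⟨x, fun t z => if hz : z ≠ x then lam z + (L (t, ⟨z, hz⟩) - L (s, ⟨z, hz⟩)) else 0,
    ?_, ?_⟩, rfl, ?_⟩
  · rw [continuousOn_iff_continuous_domRestrict]
    have hl : Continuous fun p : {p : unitInterval × X | p.2 ≠ x} => lam p.1.2 := by
      have h1 : ContinuousOn (fun p : unitInterval × X => lam p.2) {p | p.2 ≠ x} :=
        hlam.comp continuous_snd.continuousOn fun p hp => hp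
      exact continuousOn_iff_continuous_domRestrict.1 h1
    have h2 : Continuous fun p : {p : unitInterval × X | p.2 ≠ x} =>
        lam p.1.2 + (L (p.1.1, ⟨p.1.2, p.2⟩) - L (s, ⟨p.1.2, p.2⟩)) := by
      refine hl.add (Continuous.sub (hL.comp ?_) (hL.comp ?_))
      · exact Continuous.prodMk (by fun_prop) (by fun_prop)
      · exact Continuous.prodMk (by fun_prop) (by fun_prop)
    convert h2 using 2 with p
    have := p.2
    simp only [Set.domRestrict_apply]
    rw [dif_pos]
  · intro t z hz
    simp only [dif_pos hz]
    have e : Complex.exp (lam z) = (G.g s z - G.g s x) / G.g s z :=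
      eq_div_of_mul_eq (hn.ne0 s z) (by rw [mul_comm]; exact h z hz)
    rw [Complex.exp_add, Complex.exp_sub, hLF, hLF, e]
    simp only [hF]
    have := hsub t z hz; have := hsub s z hz; have := hsub 0 z hz
    have := hn.ne0 t z; have := hn.ne0 s z; have := hn.ne0 0 z
    field_simp
  · intro z hz
    simp [hz]


lemma PreEnd.W_time (e : G.PreEnd) (hn : G.Nice) {t0 : unitInterval} {r : ℝ} (hr : 0 < r) {q : ℂ}
    (hq : q ∈ e.W t0 r) : ∀ᶠ t in 𝓝 t0, q ∈ e.W t r := by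
  have hqD := W_subset_D hq
  obtain ⟨d, hd, hdz⟩ := G.dist_range_pos t0 (hn.D_notMem hqD)
  obtain ⟨h1, l, hl, hle, hlf⟩ := hq
  have hgc := G.cont
  have cx : Continuous fun t => G.g t e.x := G.cont.comp (Continuous.prodMk_left e.x)
  set m : unitInterval → X → ℂ := fun t z =>
    G.g t0 z / G.g t z * ((G.g t z - q) / (G.g t0 z - q)) with hm
  have ht := hn.D_notMem hqD
  have hq0 : ∀ z, G.g t0 z - q ≠ 0 := fun z h0 => ht ⟨z, sub_eq_zero.1 h0⟩
  have cg0 : Continuous fun p : unitInterval × X => G.g t0 p.2 := (G.cont_t t0).comp continuous_snd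
  have hmc : Continuous fun p : unitInterval × X => m p.1 p.2 :=
    (cg0.div G.cont fun p => hn.ne0 _ _).mul
      ((G.cont.sub continuous_const).div (cg0.sub continuous_const) fun p => hq0 _)
  have hm1 : ∀ z, m t0 z = 1 := fun z => by
    simp only [hm]; rw [div_self (hn.ne0 _ _), div_self (hq0 z), one_mul]
  have hms : ∀ᶠ t in 𝓝 t0, ∀ z, 0 < (m t z).re := by
    have h := isCompact_univ.eventually_forall_of_forall_eventually
      (x₀ := t0) (K := (univ : Set X)) (P := fun t z => 0 < (m t z).re) ?_
    · filter_upwards [h] with t ht z using ht z (mem_univ z)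
    · intro z _
      exact continuousAt_const.eventually_lt (Complex.continuous_re.comp hmc).continuousAt
        (by simp [hm1])
  have hball : ∀ᶠ t in 𝓝 t0, dist q (G.g t e.x) < r :=
    (continuous_const.dist cx).continuousAt.eventually_lt continuousAt_const h1
  set D : unitInterval → X → ℂ := fun t z => l z + Complex.log (m t z) -
    (e.μ t z + Complex.log ((G.g t z - q) / (G.g t z - G.g t e.x))) with hD
  have hlt : ∀ t z, m t z ≠ 0 → G.g t z - q = G.g t z * Complex.exp (l z + Complex.log (m t z)) := by
    intro t z hmz
    rw [Complex.exp_add, Complex.exp_log hmz]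
    have e1 : Complex.exp (l z) = (G.g t0 z - q) / G.g t0 z :=
      eq_div_of_mul_eq (hn.ne0 t0 z) (by rw [mul_comm]; exact (hle z).symm)
    rw [e1]
    simp only [hm]
    have := hn.ne0 t z; have := hn.ne0 t0 z; have := hq0 z
    field_simp
  have hmz : ∀ t z, 0 < (m t z).re → m t z ≠ 0 := fun t z h h0 => by rw [h0] at h; simp at h
  have hfarx : ∀ t z, r ≤ dist (G.g t z) (G.g t e.x) → z ≠ e.x := by
    rintro t z h rfl; rw [dist_self] at h; linarith
  have key := ev_zero (t0 := t0) (Far := fun t z => r ≤ dist (G.g t z) (G.g t e.x)) (D := D) ?_ ?_ ?_ ?_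
  · filter_upwards [key, hms, hball] with t h2 h3 h4
    refine ⟨h4, fun z => l z + Complex.log (m t z), ?_, fun z => hlt t z (hmz t z (h3 z)), ?_⟩
    · refine hl.add (Continuous.clog ?_ fun z => Or.inl (h3 z))
      exact hmc.comp (Continuous.prodMk_right t)
    · intro z hz
      exact sub_eq_zero.1 (h2 z hz)
  · intro z hz
    have hz1 := hfarx _ _ hz
    have hre : 0 < ((G.g t0 z - q) / (G.g t0 z - G.g t0 e.x)).re := re_pos_sub (h1.trans_le hz)
    have c1 : ContinuousAt (fun p : unitInterval × X => Complex.log (m p.1 p.2)) (t0, z) :=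
      hmc.continuousAt.clog (by simp [hm1])
    have c2 : ContinuousAt (fun p : unitInterval × X => Complex.log ((G.g p.1 p.2 - q) /
        (G.g p.1 p.2 - G.g p.1 e.x))) (t0, z) := by
      refine ContinuousAt.clog (ContinuousAt.div ?_ ?_ ?_) (Or.inl hre)
      · exact (G.cont.sub continuous_const).continuousAt
      · exact (G.cont.sub (cx.comp continuous_fst)).continuousAt
      · intro h0; exact hz1 (G.inj t0 (sub_eq_zero.1 h0))
    exact (((hl.comp continuous_snd).continuousAt).add c1).sub ((e.contAt hz1).add c2)
  · intro z hz
    simp only [hD]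
    rw [hm1, hlf z hz]; simp
  · intro z hz
    have : Continuous fun p : unitInterval × X => dist (G.g p.1 p.2) (G.g p.1 e.x) :=
      G.cont.dist (cx.comp continuous_fst)
    filter_upwards [this.continuousAt.eventually_lt continuousAt_const (not_le.1 hz)] with p hp
      using not_le.2 hp
  · filter_upwards [hms, hball] with t h3 h4 z hz
    have hz1 := hfarx _ _ hz
    have hre : 0 < ((G.g t z - q) / (G.g t z - G.g t e.x)).re := re_pos_sub (h4.trans_le hz)
    have n1 : (G.g t z - q) / (G.g t z - G.g t e.x) ≠ 0 := fun h0 => by rw [h0] at hre; simp at hre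
    have e2 := hlt t z (hmz t z (h3 z))
    have e3 := e.eq t z hz1
    simp only [hD]
    rw [Complex.exp_sub, Complex.exp_add (e.μ t z), Complex.exp_log n1, div_eq_one_iff_eq]
    · have n2 := div_ne_zero_iff.1 n1
      have := n2.2
      apply mul_left_cancel₀ (hn.ne0 t z)
      rw [← e2, ← mul_assoc, e3]; field_simp
    · exact mul_ne_zero (Complex.exp_ne_zero _) n1

end Isot
end IsoExt
end

section
open Set Metric Topology Filter
set_option linter.unusedSectionVars false
namespace IsoExt
open Classical in
/-- square root function attached to a logarithm with a singularity at `x` -/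
noncomputable def vf {X : Type*} (x : X) (m : X → ℂ) (z : X) : ℂ := if z = x then 0 else Complex.exp (m z / 2)

section
variable {X : Type*} {x : X} {m : X → ℂ}
lemma vf_self : vf x m x = 0 := by simp [vf]
lemma vf_ne {z : X} (h : z ≠ x) : vf x m z = Complex.exp (m z / 2) := by simp [vf, h]
lemma vf_sq {f : X → ℂ} {p : ℂ} (hne : ∀ z, f z ≠ p)
    (hm : ∀ z, z ≠ x → Complex.exp (m z) * (f z - p) = f z - f x) (z : X) :
    vf x m z ^ 2 = (f z - f x) / (f z - p) := by
  by_cases h : z = x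
  · subst h; simp [vf_self]
  · rw [vf_ne h, ← Complex.exp_nat_mul, ← hm z h, mul_div_cancel_right₀ _ (sub_ne_zero.2 (hne z))]
    congr 1; push_cast; ring
lemma vf_sq_inj {f : X → ℂ} (hf : Function.Injective f) {p : ℂ} (hne : ∀ z, f z ≠ p)
    (hm : ∀ z, z ≠ x → Complex.exp (m z) * (f z - p) = f z - f x) {z z' : X}
    (h : vf x m z ^ 2 = vf x m z' ^ 2) : z = z' := by
  rw [vf_sq hne hm, vf_sq hne hm, div_eq_div_iff (sub_ne_zero.2 (hne z)) (sub_ne_zero.2 (hne z'))] at h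
  have h1 : (f z - f z') * (f x - p) = 0 := by linear_combination h
  rcases mul_eq_zero.1 h1 with h2 | h2
  · exact hf (sub_eq_zero.1 h2)
  · exact absurd (sub_eq_zero.1 h2) (hne x)
lemma vf_zero {z : X} (h : vf x m z = 0) : z = x := by
  by_contra hz
  rw [vf_ne hz] at h; exact Complex.exp_ne_zero _ h
lemma vf_add_ne {f : X → ℂ} (hf : Function.Injective f) {p : ℂ} (hne : ∀ z, f z ≠ p)
    (hm : ∀ z, z ≠ x → Complex.exp (m z) * (f z - p) = f z - f x) {z z' : X}
    (h : vf x m z + vf x m z' = 0) : z = x ∧ z' = x := by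
  have h1 : z = z' := vf_sq_inj hf hne hm (by rw [eq_neg_of_add_eq_zero_left h]; ring)
  subst h1
  have h2 : vf x m z = 0 := by
    have : 2 * vf x m z = 0 := by rw [two_mul]; exact h
    simpa using this
  exact ⟨vf_zero h2, vf_zero h2⟩
lemma vf_cont {T : Type*} [TopologicalSpace T] [TopologicalSpace X] [T1Space X] {f : T × X → ℂ} (hf : Continuous f)
    {p : T → ℂ} (hp : Continuous p) (hne : ∀ y, f y ≠ p y.1) {m : T × X → ℂ}
    (hmc : ContinuousOn m {y | y.2 ≠ x})
    (hm : ∀ y, y.2 ≠ x → Complex.exp (m y) * (f y - p y.1) = f y - f (y.1, x)) :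
    Continuous fun y : T × X => vf x (fun z => m (y.1, z)) y.2 := by
  rw [continuous_iff_continuousAt]
  rintro ⟨s, z⟩
  by_cases hz : z = x
  · subst hz
    have h1 : ∀ y : T × X, ‖vf z (fun w => m (y.1, w)) y.2‖ = √(‖(f y - f (y.1, z)) / (f y - p y.1)‖) := by
      intro y
      have := vf_sq (x := z) (m := fun w => m (y.1, w)) (f := fun w => f (y.1, w)) (p := p y.1)
        (fun w => hne (y.1, w)) (fun w hw => hm (y.1, w) hw) y.2
      rw [← this, norm_pow, Real.sqrt_sq (norm_nonneg _)]
    have h2 : Continuous fun y : T × X => √(‖(f y - f (y.1, z)) / (f y - p y.1)‖) := by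
      refine Real.continuous_sqrt.comp (Continuous.norm (Continuous.div ?_ ?_ fun y => sub_ne_zero.2 (hne y)))
      · exact hf.sub (hf.comp (by fun_prop))
      · exact hf.sub (hp.comp continuous_fst)
    have h3 : vf z (fun w => m (s, w)) z = 0 := vf_self
    rw [ContinuousAt]; simp only [h3]
    rw [tendsto_zero_iff_norm_tendsto_zero]
    simp only [h1]
    have := h2.tendsto (s, z)
    simpa using this
  · have h1 : ContinuousAt (fun y => Complex.exp (m y / 2)) (s, z) :=
      ((hmc.continuousAt ((isOpen_compl_singleton.preimage continuous_snd).mem_nhds hz)).div_const 2).cexp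
    refine h1.congr ?_
    filter_upwards [(isOpen_compl_singleton.preimage continuous_snd).mem_nhds
      (show (s, z) ∈ Prod.snd ⁻¹' {x}ᶜ from hz)] with y hy
    rw [vf_ne hy]
end

/-- existence of a coherent logarithm of `v z + v z'` -/
def Lam {X : Type*} [TopologicalSpace X] (x : X) (f : X → ℂ) (p : ℂ) (μ : X → ℂ) : Prop :=
  ∃ η : X → ℂ, Continuous η ∧ (∀ z, f z - p = f z * Complex.exp (η z)) ∧
    ∃ Ψ : X × X → ℂ, ContinuousOn Ψ {(x, x)}ᶜ ∧
      (∀ y, y ≠ (x, x) → Complex.exp (Ψ y) = vf x (fun z => μ z - η z) y.1 + vf x (fun z => μ z - η z) y.2) ∧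
      ∀ z, z ≠ x → Ψ (z, x) = (μ z - η z) / 2

namespace Isot
variable {X : Type*} [MetricSpace X] [CompactSpace X] {G : Isot X}

lemma PreEnd.lam_transport (e : G.PreEnd) (hn : G.Nice) {τ : unitInterval → unitInterval} (hτ : Continuous τ)
    {γ : unitInterval → ℂ} (hγ : Continuous γ) (hD : ∀ s, γ s ∈ G.D (τ s))
    (h : Lam e.x (G.g (τ 0)) (γ 0) (e.μ (τ 0))) : Lam e.x (G.g (τ 1)) (γ 1) (e.μ (τ 1)) := by
  obtain ⟨η0, hη0, hηe, Ψ0, hΨ0, hΨe, hΨx⟩ := h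
  have cg : Continuous fun y : unitInterval × X => G.g (τ y.1) y.2 :=
    G.cont.comp (by fun_prop : Continuous fun y : unitInterval × X => (τ y.1, y.2))
  have hne : ∀ y : unitInterval × X, G.g (τ y.1) y.2 ≠ γ y.1 := fun y h =>
    hn.D_notMem (hD y.1) ⟨y.2, h⟩
  obtain ⟨η, hη, hηF, hη0'⟩ := exp_lift_homotopy (A := X)
    (fun y => (G.g (τ y.1) y.2 - γ y.1) / G.g (τ y.1) y.2)
    ((cg.sub (hγ.comp continuous_fst)).div cg fun y => hn.ne0 _ _)
    (fun y => div_ne_zero (sub_ne_zero.2 (hne y)) (hn.ne0 _ _)) η0 hη0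
    (fun z => by simp only; rw [hηe z, mul_div_cancel_left₀ _ (hn.ne0 _ _)])
  set m : unitInterval × X → ℂ := fun y => e.μ (τ y.1) y.2 - η y with hm
  have hmc : ContinuousOn m {y | y.2 ≠ e.x} := by
    refine ContinuousOn.sub ?_ hη.continuousOn
    exact e.cont.comp (f := fun y : unitInterval × X => (τ y.1, y.2)) (by fun_prop) fun y hy => hy
  have hme : ∀ y : unitInterval × X, y.2 ≠ e.x → Complex.exp (m y) * (G.g (τ y.1) y.2 - γ y.1) =
      G.g (τ y.1) y.2 - G.g (τ y.1) e.x := by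
    intro y hy
    rw [← e.eq _ _ hy, hm]
    simp only
    rw [Complex.exp_sub, hηF]
    have := sub_ne_zero.2 (hne y)
    have := hn.ne0 (τ y.1) y.2
    field_simp
  have hV := vf_cont (x := e.x) (f := fun y : unitInterval × X => G.g (τ y.1) y.2) cg hγ hne hmc hme
  have hV0 : ∀ s (y : X × X), y ≠ (e.x, e.x) →
      vf e.x (fun z => m (s, z)) y.1 + vf e.x (fun z => m (s, z)) y.2 ≠ 0 := by
    intro s y hy h
    have := vf_add_ne (p := γ s) (G.inj (τ s)) (fun z => hne (s, z)) (fun z hz => hme (s, z) hz) h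
    exact hy (Prod.ext this.1 this.2)
  obtain ⟨Ψ, hΨ, hΨF, hΨ0'⟩ := exp_lift_homotopy (A := {y : X × X // y ≠ (e.x, e.x)})
    (fun y => vf e.x (fun z => m (y.1, z)) y.2.1.1 + vf e.x (fun z => m (y.1, z)) y.2.1.2)
    ((hV.comp (by fun_prop : Continuous fun y : unitInterval × {y : X × X // y ≠ (e.x, e.x)} => (y.1, y.2.1.1))).add
      (hV.comp (by fun_prop : Continuous fun y : unitInterval × {y : X × X // y ≠ (e.x, e.x)} => (y.1, y.2.1.2))))
    (fun y => hV0 y.1 _ y.2.2) (fun y => Ψ0 y.1)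
    (continuousOn_iff_continuous_domRestrict.1 hΨ0)
    (fun y => by
      have := hΨe y.1 y.2
      simp only [hm, hη0']; exact this)
  refine ⟨fun z => η (1, z), hη.comp (by fun_prop), fun z => ?_, ?_⟩
  · rw [hηF, mul_div_cancel₀ _ (hn.ne0 _ _)]
  classical
  refine ⟨fun y => if h : y ≠ (e.x, e.x) then Ψ (1, ⟨y, h⟩) else 0, ?_, ?_, ?_⟩
  · rw [continuousOn_iff_continuous_domRestrict]
    have h2 : Continuous fun y : {y : X × X // y ≠ (e.x, e.x)} => Ψ (1, y) := hΨ.comp (by fun_prop)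
    refine h2.congr fun y => ?_
    have := y.2
    change Ψ (1, y) = if h : y.1 ≠ (e.x, e.x) then Ψ (1, ⟨y.1, h⟩) else 0
    rw [dif_pos this]
  · intro y hy
    beta_reduce
    rw [dif_pos hy, hΨF]
  · intro z hz
    have hzx : (z, e.x) ≠ (e.x, e.x) := fun h => hz (congrArg Prod.fst h)
    beta_reduce
    rw [dif_pos hzx]
    refine log_unique' (S := (univ : Set unitInterval)) isPreconnected_univ
      (l := fun s => Ψ (s, ⟨(z, e.x), hzx⟩)) (l' := fun s => m (s, z) / 2) ?_ ?_ ?_ (mem_univ 0) (mem_univ 1) ?_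
    · exact (hΨ.comp (by fun_prop)).continuousOn
    · refine ContinuousOn.div_const (hmc.comp (f := fun s => (s, z)) (by fun_prop) fun s _ => hz) 2
    · intro s _
      rw [hΨF]; simp only [vf_self, vf_ne hz, add_zero]
    · simp only [hΨ0', hm, hη0']
      exact hΨx z hz
end Isot
end IsoExt
end

section
open Set Metric Topology Filter
set_option linter.unusedSectionVars false
namespace IsoExt

lemma re_pos_of_norm {A : ℂ} (h : ‖1 - A‖ ≤ 1) (h0 : A ≠ 0) : 0 < A.re := by
  have h1 : ‖1 - A‖ ^ 2 ≤ 1 := by nlinarith [norm_nonneg (1 - A)]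
  have h2 : 0 < Complex.normSq A := Complex.normSq_pos.2 h0
  rw [← Complex.normSq_eq_norm_sq] at h1
  simp only [Complex.normSq_apply, Complex.sub_re, Complex.one_re, Complex.sub_im, Complex.one_im] at h1 h2
  nlinarith

lemma re_pos_half {A : ℂ} (h : 0 < A.re) : 0 < (Complex.exp (Complex.log A / 2)).re := by
  rw [Complex.exp_re]
  refine mul_pos (Real.exp_pos _) (Real.cos_pos_of_mem_Ioo ?_)
  have := Complex.abs_arg_lt_pi_div_two_iff.2 (Or.inl h)
  rw [abs_lt] at this
  simp only [Complex.div_ofNat_im, Complex.log_im]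
  constructor <;> linarith [Real.pi_pos]

namespace Isot
variable {X : Type*} [MetricSpace X] [CompactSpace X] {G : Isot X}

lemma Nice.landing (hn : G.Nice) {s : unitInterval} {p : ℂ} (hp : p ∈ G.D s) {x : X}
    (hx : ∀ z, dist p (G.g s x) ≤ dist p (G.g s z)) :
    ∃ e : G.PreEnd, e.x = x ∧ Lam x (G.g s) p (e.μ s) ∧
      ∀ c ∈ Ioc (0:ℝ) 1, ∀ r, c * dist p (G.g s x) < r → G.g s x + c * (p - G.g s x) ∈ e.W s r := by
  have hpr := hn.D_notMem hp
  obtain ⟨η, hη, hηe⟩ := hp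
  have hne : ∀ z, G.g s z ≠ p := fun z h => hpr ⟨z, h⟩
  set A : X → ℂ := fun z => (G.g s z - G.g s x) / (G.g s z - p) with hA
  have hAc : Continuous A := by
    have := G.cont_t s
    exact (this.sub continuous_const).div (this.sub continuous_const) fun z => sub_ne_zero.2 (hne z)
  have hA0 : ∀ z, z ≠ x → A z ≠ 0 := fun z hz =>
    div_ne_zero (sub_ne_zero.2 fun h => hz (G.inj s h)) (sub_ne_zero.2 (hne z))
  have hAre : ∀ z, z ≠ x → 0 < (A z).re := by
    intro z hz
    refine re_pos_of_norm ?_ (hA0 z hz)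
    have h1 : 1 - A z = (G.g s x - p) / (G.g s z - p) := by
      have := sub_ne_zero.2 (hne z)
      simp only [hA]; field_simp; ring
    rw [h1, norm_div, div_le_one (norm_pos_iff.2 (sub_ne_zero.2 (hne z)))]
    have := hx z
    rwa [dist_comm, dist_comm p, dist_eq_norm, dist_eq_norm] at this
  obtain ⟨e, hex, hem⟩ := hn.exists_preEnd x s (lam := fun z => η z + Complex.log (A z))
    (hη.continuousOn.add (ContinuousOn.clog hAc.continuousOn fun z hz => Or.inl (hAre z hz)))
    (fun z hz => by
      rw [Complex.exp_add, Complex.exp_log (hA0 z hz), ← mul_assoc, ← hηe]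
      simp only [hA]
      rw [mul_div_cancel₀ _ (sub_ne_zero.2 (hne z))])
  refine ⟨e, hex, ⟨η, hη, hηe, ?_⟩, ?_⟩
  · set m : X → ℂ := fun z => e.μ s z - η z with hm
    have hmA : ∀ z, z ≠ x → m z = Complex.log (A z) := fun z hz => by
      simp only [hm]; rw [hem z hz]; ring
    have hvc : Continuous (vf x m) := by
      have := vf_cont (T := Unit) (x := x) (f := fun y => G.g s y.2) (p := fun _ => p) (m := fun y => m y.2)
        ((G.cont_t s).comp continuous_snd) continuous_const (fun y => hne _)
        (by
          have h1 : ContinuousOn m {z | z ≠ x} := by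
            refine ContinuousOn.sub ?_ hη.continuousOn
            have := e.cont_t s
            rwa [hex] at this
          exact h1.comp continuous_snd.continuousOn fun y hy => hy)
        (fun y hy => by
          simp only
          rw [hmA _ hy, Complex.exp_log (hA0 _ hy)]
          simp only [hA]
          rw [div_mul_cancel₀ _ (sub_ne_zero.2 (hne _))])
      exact this.comp (by fun_prop : Continuous fun z : X => ((), z))
    have hvre : ∀ z, z ≠ x → 0 < (vf x m z).re := fun z hz => by
      rw [vf_ne hz, hmA z hz]; exact re_pos_half (hAre z hz)
    have hvre0 : ∀ z, 0 ≤ (vf x m z).re := fun z => by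
      by_cases hz : z = x
      · rw [hz, vf_self]; simp
      · exact (hvre z hz).le
    have hsum : ∀ y : X × X, y ≠ (x, x) → 0 < (vf x m y.1 + vf x m y.2).re := by
      rintro ⟨a, b⟩ hy
      rw [Complex.add_re]
      by_cases ha : a = x
      · have hb : b ≠ x := fun hb => hy (by rw [ha, hb])
        linarith [hvre b hb, hvre0 a]
      · linarith [hvre a ha, hvre0 b]
    refine ⟨fun y => Complex.log (vf x m y.1 + vf x m y.2), ?_, ?_, ?_⟩
    · refine ContinuousOn.clog (by fun_prop) fun y hy => Or.inl (hsum y hy)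
    · intro y hy
      beta_reduce
      rw [Complex.exp_log]
      intro h0; have := hsum y hy; rw [h0] at this; simp at this
    · intro z hz
      beta_reduce
      rw [vf_self, add_zero, vf_ne hz, Complex.log_exp]
      · have := Complex.abs_arg_lt_pi_div_two_iff.2 (Or.inl (hAre z hz))
        rw [abs_lt] at this
        rw [hmA z hz]
        simp only [Complex.div_ofNat_im, Complex.log_im]; linarith [Real.pi_pos]
      · have := Complex.abs_arg_lt_pi_div_two_iff.2 (Or.inl (hAre z hz))
        rw [abs_lt] at this
        rw [hmA z hz]
        simp only [Complex.div_ofNat_im, Complex.log_im]; linarith [Real.pi_pos]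
  · intro c hc r hr
    set q : ℂ := G.g s x + c * (p - G.g s x) with hq
    have hqx : dist q (G.g s x) < r := by
      rw [dist_eq_norm, hq, add_sub_cancel_left, norm_mul, Complex.norm_real, Real.norm_of_nonneg hc.1.le,
        ← dist_eq_norm]
      exact hr
    have hpx : 0 < dist p (G.g s x) := dist_pos.2 (hne x).symm
    have hqp : ∀ z, 0 < ((G.g s z - q) / (G.g s z - p)).re := by
      intro z
      refine re_pos_sub ?_
      rw [dist_comm (G.g s z)]
      refine lt_of_lt_of_le ?_ (hx z)
      have : q - p = ((1 - c : ℝ) : ℂ) * (G.g s x - p) := by rw [hq]; push_cast; ring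
      rw [dist_eq_norm, this, norm_mul, Complex.norm_real, Real.norm_of_nonneg (by linarith [hc.2]),
        ← dist_eq_norm, dist_comm]
      nlinarith [hc.1]
    refine ⟨by rw [hex]; exact hqx, fun z => η z + Complex.log ((G.g s z - q) / (G.g s z - p)), ?_, ?_, ?_⟩
    · refine hη.add (Continuous.clog ?_ fun z => Or.inl (hqp z))
      have := G.cont_t s
      exact (this.sub continuous_const).div (this.sub continuous_const) fun z => sub_ne_zero.2 (hne z)
    · intro z
      rw [Complex.exp_add, Complex.exp_log, ← mul_assoc, ← hηe, mul_div_cancel₀ _ (sub_ne_zero.2 (hne z))]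
      intro h0; have := hqp z; rw [h0] at this; simp at this
    · intro z hz
      rw [hex] at hz ⊢
      have hr0 : 0 < r := lt_of_le_of_lt dist_nonneg hqx
      have hzx : z ≠ x := by rintro rfl; rw [dist_self] at hz; linarith
      beta_reduce
      rw [hem z hzx, log_id (z := G.g s z) (a := G.g s x) (b := q) (c := p) (hAre z hzx)
        (re_pos_sub (hqx.trans_le hz))]
      simp only [hA]; ring

end Isot
end IsoExt
end

section
open Set Metric Topology Filter
set_option linter.unusedSectionVars false
namespace IsoExt
namespace Isot
variable {X : Type*} [MetricSpace X] [CompactSpace X]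

section
variable {x : X} {v m : X → ℂ} {Ψ : X × X → ℂ}

lemma ex_claim1 (hv : Continuous v) (hvx : v x = 0) (hv0 : ∀ z, v z = 0 → z = x)
    (hmc : ContinuousOn m {z | z ≠ x}) (hvm : ∀ z, z ≠ x → v z = Complex.exp (m z / 2))
    (hΨ : ContinuousOn Ψ {(x, x)}ᶜ) (hΨe : ∀ y, y ≠ (x, x) → Complex.exp (Ψ y) = v y.1 + v y.2)
    (hΨx : ∀ z, z ≠ x → Ψ (z, x) = m z / 2) {ρ : ℝ} (hρ : 0 < ρ) :
    ∀ᶠ z' in 𝓝 x, z' ≠ x → - v z' ∈ WW v (fun _ => 1) 0 ρ (fun z => m z / 2) := by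
  have hfar : ∀ z, ρ ≤ ‖v z‖ → z ≠ x := by
    rintro z hz rfl; rw [hvx, norm_zero] at hz; linarith
  have hΨat : ∀ z z', (z, z') ≠ (x, x) → ContinuousAt Ψ (z, z') := fun z z' h =>
    hΨ.continuousAt (isOpen_compl_singleton.mem_nhds h)
  have key := ev_zero (t0 := x) (Far := fun _ z => ρ ≤ ‖v z‖)
    (D := fun z' z => Ψ (z, z') - (m z / 2 + Complex.log ((v z + v z') / v z))) ?_ ?_ ?_ ?_
  · have hsm : ∀ᶠ z' in 𝓝 x, ‖v z'‖ < ρ :=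
      hv.norm.continuousAt.eventually_lt continuousAt_const (by rw [hvx, norm_zero]; exact hρ)
    filter_upwards [key, hsm] with z' h1 h2 hz'
    refine ⟨by rwa [dist_zero_right, norm_neg], fun z => Ψ (z, z'), ?_, ?_, ?_⟩
    · rw [continuous_iff_continuousAt]
      intro z
      exact (hΨat z z' fun h => hz' (congrArg Prod.snd h)).comp (f := fun z => (z, z')) (by fun_prop)
    · intro z
      rw [hΨe (z, z') fun h => hz' (congrArg Prod.snd h)]; ring
    · intro z hz
      rw [dist_zero_right] at hz
      have := sub_eq_zero.1 (h1 z hz)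
      beta_reduce
      rw [this, sub_neg_eq_add, sub_zero]
  · intro z hz
    have hzx := hfar z hz
    have hvz : v z ≠ 0 := fun h => hzx (hv0 z h)
    have c1 : ContinuousAt (fun p : X × X => Ψ (p.2, p.1)) (x, z) :=
      (hΨat z x fun h => hzx (congrArg Prod.fst h)).comp (f := fun p : X × X => (p.2, p.1)) (x := (x, z)) (by fun_prop)
    have c2 : ContinuousAt (fun p : X × X => m p.2) (x, z) :=
      ContinuousAt.comp (f := Prod.snd) (hmc.continuousAt (isOpen_compl_singleton.mem_nhds hzx)) continuousAt_snd
    refine c1.sub ((c2.div_const 2).add (ContinuousAt.clog (ContinuousAt.div ?_ ?_ hvz) ?_))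
    · exact (by fun_prop : Continuous fun p : X × X => v p.2 + v p.1).continuousAt
    · exact (by fun_prop : Continuous fun p : X × X => v p.2).continuousAt
    · simp [hvx, hvz]
  · intro z hz
    have hzx := hfar z hz
    have hvz : v z ≠ 0 := fun h => hzx (hv0 z h)
    simp only [hΨx z hzx, hvx, add_zero, div_self hvz]
    simp
  · intro z hz
    have : Continuous fun p : X × X => ‖v p.2‖ := by fun_prop
    filter_upwards [this.continuousAt.eventually_lt continuousAt_const (not_le.1 hz)] with p hp
      using not_le.2 hp
  · filter_upwards with z' z hz
    have hzx := hfar z hz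
    have hvz : v z ≠ 0 := fun h => hzx (hv0 z h)
    have hne : (z, z') ≠ (x, x) := fun h => hzx (congrArg Prod.fst h)
    have h0 : v z + v z' ≠ 0 := by
      have := hΨe _ hne; simp only at this; rw [← this]; exact Complex.exp_ne_zero _
    rw [Complex.exp_sub, Complex.exp_add, Complex.exp_log (div_ne_zero h0 hvz), hΨe _ hne, ← hvm z hzx,
      mul_div_cancel₀ _ hvz, div_self h0]

lemma ex_claim2 (hv : Continuous v) (hvx : v x = 0) (hv0 : ∀ z, v z = 0 → z = x)
    (hmc : ContinuousOn m {z | z ≠ x}) (hvm : ∀ z, z ≠ x → v z = Complex.exp (m z / 2))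
    (hΨ : ContinuousOn Ψ {(x, x)}ᶜ) (hΨe : ∀ y, y ≠ (x, x) → Complex.exp (Ψ y) = v y.1 + v y.2)
    (hΨx : ∀ z, z ≠ x → Ψ (z, x) = m z / 2) {ρ : ℝ} (hρ : 0 < ρ) [hxne : (𝓝[≠] x).NeBot] :
    ∃ a, a ∈ WW v (fun _ => 1) 0 ρ (fun z => m z / 2) ∧ -a ∈ WW v (fun _ => 1) 0 ρ (fun z => m z / 2) := by
  set O := WW v (fun _ => 1) 0 ρ (fun z => m z / 2) with hO
  have h1 := ex_claim1 hv hvx hv0 hmc hvm hΨ hΨe hΨx hρ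
  have hOopen : IsOpen O := by
    rw [Metric.isOpen_iff]
    intro q hq
    obtain ⟨δ, hδ, h⟩ := WW_key hv (WW_notMem (fun _ => one_ne_zero) hq) (show q ∈ ball 0 ρ from hq.1)
    exact ⟨δ, hδ, fun q' hq' => (h q' hq').1.2 hq⟩
  obtain ⟨N, hN, hNo, hxN⟩ := _root_.mem_nhds_iff.1 h1
  obtain ⟨c0, hc0, hc0N⟩ : ∃ c0 > 0, ∀ z, z ∉ N → c0 ≤ ‖v z‖ := by
    rcases (Nᶜ : Set X).eq_empty_or_nonempty with he | hne
    · exact ⟨1, one_pos, fun z hz => absurd (show z ∈ (Nᶜ : Set X) from hz) (by rw [he]; simp)⟩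
    · obtain ⟨z0, hz0, hmin⟩ := hNo.isClosed_compl.isCompact.exists_isMinOn hne hv.norm.continuousOn
      refine ⟨‖v z0‖, norm_pos_iff.2 fun h => hz0 ((hv0 z0 h) ▸ hxN), fun z hz => hmin hz⟩
  have hsm : ∀ᶠ z' in 𝓝 x, ‖v z'‖ < min ρ c0 :=
    hv.norm.continuousAt.eventually_lt continuousAt_const (by rw [hvx, norm_zero]; exact lt_min hρ hc0)
  obtain ⟨z1, ⟨hz1N, hz1s⟩, hz1x⟩ : ∃ z1, (z1 ∈ N ∧ ‖v z1‖ < min ρ c0) ∧ z1 ≠ x :=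
    ((((hNo.eventually_mem hxN).and hsm).filter_mono nhdsWithin_le_nhds : ∀ᶠ z in 𝓝[≠] x, _).and
      (self_mem_nhdsWithin (s := {x}ᶜ))).exists
  have hb : ∃ b ∈ sphere (0:ℂ) ‖v z1‖, b ∈ closure O ∧ b ∉ O := by
    by_contra hcon
    push Not at hcon
    have hs : IsPreconnected (sphere (0:ℂ) ‖v z1‖) :=
      isPreconnected_sphere (by rw [Complex.rank_real_complex]; norm_num) _ _
    have := hs.subset_of_closure_inter_subset hOopen ⟨- v z1, by simp, hN hz1N hz1x⟩
      (fun b hb => hcon b hb.2 hb.1)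
    exact WW_notMem (fun _ => one_ne_zero) (this (show v z1 ∈ _ by simp)) (mem_range_self z1)
  obtain ⟨b, hbs, hbc, hbO⟩ := hb
  rw [mem_sphere_zero_iff_norm] at hbs
  have hbr : b ∈ range v := by
    by_contra hbr
    obtain ⟨δ, hδ, h⟩ := WW_key hv hbr (show b ∈ ball 0 ρ by
      rw [mem_ball_zero_iff, hbs]; exact hz1s.trans_le (min_le_left _ _))
      (κ := fun _ => 1) (μ := fun z => m z / 2)
    obtain ⟨a, ha, hab⟩ := Metric.mem_closure_iff.1 hbc δ hδ
    exact hbO ((h a (by rwa [dist_comm])).1.1 ha)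
  obtain ⟨z2, rfl⟩ := hbr
  have hz2N : z2 ∈ N := by
    by_contra h
    have := hc0N z2 h
    rw [hbs] at this
    linarith [hz1s.trans_le (min_le_right _ _)]
  have hz2x : z2 ≠ x := by
    rintro rfl
    rw [hvx, norm_zero] at hbs
    exact hz1x (hv0 z1 (norm_eq_zero.1 hbs.symm))
  have hm : -v z2 ∈ O := hN hz2N hz2x
  obtain ⟨a, ha, haO⟩ := mem_closure_iff.1 hbc (Neg.neg ⁻¹' O) (hOopen.preimage continuous_neg) hm
  exact ⟨a, haO, ha⟩
end

lemma ex_W {x : X} {f μ : X → ℂ} (hf : Continuous f) (hinj : Function.Injective f) (hf0 : ∀ z, f z ≠ 0)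
    (hμc : ContinuousOn μ {z | z ≠ x}) (hμ : ∀ z, z ≠ x → f z * Complex.exp (μ z) = f z - f x)
    (hL : Lam x f 0 μ) {r : ℝ} (hr : 0 < r) [hxne : (𝓝[≠] x).NeBot] :
    (WW f f (f x) r μ).Nonempty := by
  obtain ⟨η, hη, hηe, Ψ, hΨ, hΨe, hΨx⟩ := hL
  have hη1 : ∀ z, Complex.exp (η z) = 1 := fun z => by
    have := hηe z
    rw [sub_zero] at this
    exact mul_left_cancel₀ (hf0 z) (by rw [← this, mul_one])
  set m : X → ℂ := fun z => μ z - η z with hm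
  have hmc : ContinuousOn m {z | z ≠ x} := hμc.sub hη.continuousOn
  have hme : ∀ z, z ≠ x → Complex.exp (m z) * (f z - 0) = f z - f x := fun z hz => by
    simp only [hm]
    rw [Complex.exp_sub, hη1, div_one, sub_zero, mul_comm]; exact hμ z hz
  set v := vf x m with hv
  have hvc : Continuous v := by
    have := vf_cont (T := Unit) (x := x) (f := fun y => f y.2) (p := fun _ => 0) (m := fun y => m y.2)
      (hf.comp continuous_snd) continuous_const (fun y => hf0 _)
      (hmc.comp continuous_snd.continuousOn fun y hy => hy) (fun y hy => hme y.2 hy)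
    exact this.comp (by fun_prop : Continuous fun z : X => ((), z))
  have hvsq : ∀ z, v z ^ 2 = (f z - f x) / f z := fun z => by
    have := vf_sq (p := 0) hf0 hme z; rwa [sub_zero] at this
  obtain ⟨M, hM0, hM⟩ : ∃ M > 0, ∀ z, ‖f z‖ ≤ M := by
    obtain ⟨M, hM⟩ := isCompact_univ.exists_bound_of_continuousOn (f := f) hf.continuousOn
    exact ⟨max M 1, by positivity, fun z => (hM z (mem_univ z)).trans (le_max_left _ _)⟩
  obtain ⟨ρ, hρ, hρ1, hρ2, hρ3⟩ : ∃ ρ > 0, ρ < 1 ∧ ρ ^ 2 ≤ r / M ∧ ρ ^ 2 / (1 - ρ ^ 2) * M < r := by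
    have h1 : ∀ᶠ ρ : ℝ in 𝓝[>] 0, ρ < 1 ∧ ρ ^ 2 < r / M ∧ ρ ^ 2 / (1 - ρ ^ 2) * M < r := by
      refine Filter.Eventually.filter_mono nhdsWithin_le_nhds ?_
      refine (eventually_lt_nhds one_pos).and (Eventually.and ?_ ?_)
      · exact ContinuousAt.eventually_lt (by fun_prop) continuousAt_const (by simp; positivity)
      · refine ContinuousAt.eventually_lt (ContinuousAt.mul (ContinuousAt.div (by fun_prop) (by fun_prop) (by simp)) continuousAt_const) continuousAt_const (by simpa using hr)
    obtain ⟨ρ, ⟨h2, h3, h4⟩, h5⟩ := (h1.and self_mem_nhdsWithin).exists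
    exact ⟨ρ, h5, h2, h3.le, h4⟩
  obtain ⟨a, ha1, ha2⟩ := ex_claim2 (m := m) hvc vf_self (fun z => vf_zero) hmc (fun z => vf_ne) hΨ hΨe hΨx hρ
  obtain ⟨han, l1, hl1, hl1e, hl1f⟩ := ha1
  obtain ⟨-, l2, hl2, hl2e, hl2f⟩ := ha2
  rw [dist_zero_right] at han
  have ha2n : ‖a ^ 2‖ < ρ ^ 2 := by
    rw [norm_pow]; exact pow_lt_pow_left₀ han (norm_nonneg _) (by norm_num)
  have hρ21 : ρ ^ 2 < 1 := by nlinarith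
  have hre1 : 0 < (1 - a ^ 2).re := by
    have h1 := Complex.abs_re_le_norm (a ^ 2)
    have h2 := abs_le.1 h1
    rw [Complex.sub_re, Complex.one_re]; linarith [h2.2]
  have hne1 : 1 - a ^ 2 ≠ 0 := fun h => by rw [h] at hre1; simp at hre1
  have hn1 : 1 - ρ ^ 2 ≤ ‖1 - a ^ 2‖ := by
    have := norm_sub_norm_le (1:ℂ) (a ^ 2); rw [norm_one] at this; linarith
  set q : ℂ := f x / (1 - a ^ 2) with hq
  have hqz : ∀ z, (f z - q) / f z = (v z ^ 2 - a ^ 2) / (1 - a ^ 2) := fun z => by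
    rw [hvsq, hq]
    have := hf0 z
    field_simp; ring
  refine ⟨q, ?_, fun z => l1 z + l2 z + Complex.log (1 - a ^ 2)⁻¹ + η z, ?_, ?_, ?_⟩
  · have : q - f x = a ^ 2 / (1 - a ^ 2) * f x := by rw [hq]; field_simp; ring
    rw [dist_eq_norm, this, norm_mul, norm_div]
    refine lt_of_le_of_lt ?_ hρ3
    have h1 : (0:ℝ) < 1 - ρ ^ 2 := by linarith
    gcongr
    exact hM x
  · fun_prop
  · intro z
    have e1 := hl1e z
    have e2 := hl2e z
    rw [one_mul] at e1 e2
    have e3 : f z - q = f z * ((v z ^ 2 - a ^ 2) / (1 - a ^ 2)) := by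
      rw [← hqz, mul_div_cancel₀ _ (hf0 z)]
    rw [e3, Complex.exp_add, Complex.exp_add, Complex.exp_add, ← e1, ← e2, hη1,
      Complex.exp_log (inv_ne_zero hne1), mul_one, div_eq_mul_inv]
    ring
  · intro z hz
    have hfx : f z - f x ≠ 0 := fun h => by rw [dist_eq_norm, h, norm_zero] at hz; linarith
    have hvf : ρ ≤ ‖v z‖ := by
      have h1 : ρ ^ 2 ≤ ‖v z‖ ^ 2 := by
        rw [← norm_pow, hvsq, norm_div]
        refine hρ2.trans ?_
        rw [dist_eq_norm] at hz
        have := norm_pos_iff.2 (hf0 z)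
        gcongr
        exact hM z
      exact le_of_sq_le_sq h1 (norm_nonneg _)
    have hv0 : v z ≠ 0 := fun h => by rw [h, norm_zero] at hvf; linarith
    have f1 := hl1f z (by rwa [dist_zero_right])
    have f2 := hl2f z (by rwa [dist_zero_right])
    rw [sub_zero] at f1 f2
    have r1 : 0 < ((v z - a) / v z).re := by
      have := re_pos_sub (z := v z) (a := a) (c := 0) (by rw [dist_zero_right, dist_zero_right]; linarith)
      rwa [sub_zero] at this
    have r2 : 0 < ((v z - -a) / v z).re := by
      have := re_pos_sub (z := v z) (a := -a) (c := 0) (by rw [dist_zero_right, dist_zero_right, norm_neg]; linarith)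
      rwa [sub_zero] at this
    have e4 : (v z - a) / v z * ((v z - -a) / v z) = (v z ^ 2 - a ^ 2) / v z ^ 2 := by
      field_simp; ring
    have r3 : 0 < ((v z - a) / v z * ((v z - -a) / v z)).re := by
      rw [e4]
      have := re_pos_sub (z := v z ^ 2) (a := a ^ 2) (c := 0) (by
        rw [dist_zero_right, dist_zero_right, norm_pow (v z)]
        refine ha2n.trans_le ?_
        gcongr)
      rwa [sub_zero] at this
    have r4 : 0 < ((1 - a ^ 2)⁻¹).re := by
      rw [Complex.inv_re]
      exact div_pos hre1 (Complex.normSq_pos.2 hne1)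
    beta_reduce
    rw [f1, f2]
    have e5 : (f z - q) / (f z - f x) = (v z - a) / v z * ((v z - -a) / v z) * (1 - a ^ 2)⁻¹ := by
      have h1 : (f z - q) / (f z - f x) = ((f z - q) / f z) / ((f z - f x) / f z) := by
        have := hf0 z; field_simp
      rw [h1, hqz, ← hvsq, e4]
      field_simp
    rw [e5, log_mul_re r3 r4, log_mul_re r1 r2]
    simp only [hm]; ring

variable {G : Isot X}
variable (G) in
/-- an end of the domain `D`, accessible at all times -/
structure End extends G.PreEnd where
  ne : ∀ t r, 0 < r → (toPreEnd.W t r).Nonempty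

lemma PreEnd.lam_all (e : G.PreEnd) (hn : G.Nice) {s : unitInterval} {p : ℂ} (hp : p ∈ G.D s)
    (h : Lam e.x (G.g s) p (e.μ s)) (t : unitInterval) : Lam e.x (G.g t) 0 (e.μ t) := by
  obtain ⟨γ, hγ⟩ := (hn.D_path s).joinedIn p hp 0 (zero_mem_D s)
  have h1 : Lam e.x (G.g s) 0 (e.μ s) := by
    have := e.lam_transport hn (τ := fun _ => s) continuous_const (γ := γ) γ.continuous hγ
      (by simpa using h)
    simpa using this
  have hpc : PathConnectedSpace unitInterval := isPathConnected_iff_pathConnectedSpace.1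
    ((convex_Icc (0:ℝ) 1).isPathConnected ⟨0, by simp⟩)
  have hj : Joined s t := PathConnectedSpace.joined s t
  obtain ⟨τ⟩ := hj
  have := e.lam_transport hn (τ := τ) τ.continuous (γ := fun _ => 0) continuous_const
    (fun s => zero_mem_D _) (by simpa using h1)
  simpa using this

lemma Nice.exists_end (hn : G.Nice) [hX : ConnectedSpace X] [Nontrivial X] {s : unitInterval} {p : ℂ}
    (hp : p ∈ G.D s) {x : X}
    (hx : ∀ z, dist p (G.g s x) ≤ dist p (G.g s z)) :
    ∃ e : G.End, e.x = x ∧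
      ∀ c ∈ Ioc (0:ℝ) 1, ∀ r, c * dist p (G.g s x) < r → G.g s x + c * (p - G.g s x) ∈ e.W s r := by
  obtain ⟨e, rfl, hL, hseg⟩ := hn.landing hp hx
  refine ⟨⟨e, fun t r hr => ?_⟩, rfl, hseg⟩
  exact ex_W (G.cont_t t) (G.inj t) (hn.ne0 t) (e.cont_t t) (fun z hz => e.eq t z hz) (e.lam_all hn hp hL t) hr

end Isot
end IsoExt
end

section
open Set Metric Topology Filter
set_option linter.unusedSectionVars false
namespace IsoExt

lemma preconn_thickening {Z : Set ℂ} (hZ : IsPreconnected Z) (δ : ℝ) : IsPreconnected (thickening δ Z) := by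
  refine isPreconnected_of_forall_pair fun x hx y hy => ?_
  obtain ⟨z1, hz1, h1⟩ := mem_thickening_iff.1 hx
  obtain ⟨z2, hz2, h2⟩ := mem_thickening_iff.1 hy
  have hδ : 0 < δ := dist_nonneg.trans_lt h1
  have hb : ∀ z : ℂ, IsPreconnected (ball z δ) := fun z => (convex_ball z δ).isPreconnected
  refine ⟨(ball z1 δ ∪ Z) ∪ ball z2 δ, ?_, Or.inl (Or.inl h1), Or.inr h2, ?_⟩
  · refine union_subset (union_subset ?_ (self_subset_thickening hδ Z)) ?_
    · intro w hw; exact mem_thickening_iff.2 ⟨z1, hz1, hw⟩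
    · intro w hw; exact mem_thickening_iff.2 ⟨z2, hz2, hw⟩
  · exact ((hb z1).union z1 (mem_ball_self hδ) hz1 hZ).union z2 (Or.inr hz2) (mem_ball_self hδ) (hb z2)

lemma koebe_log_compact {U Z : Set ℂ} (hU : IsOpen U) (hUb : Bornology.IsBounded U) (hUne : U.Nonempty)
    (hZ : IsCompact Z)
    (hZc : IsPreconnected Z) (hdis : Disjoint U Z) (hfr : frontier U ⊆ Z)
    (hrel : ∀ q ∈ U, ∀ q' ∈ U, LogRel Z (fun w => w - q) (fun w => w - q'))
    {f : ℂ → ℂ} (hfc : ContinuousOn f U) (hinj : InjOn f U) (hop : ∀ V ⊆ U, IsOpen V → IsOpen (f '' V))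
    {a : ℂ} (ha : a ∉ f '' U) {K : Set ℂ} (hK : IsCompact K) (hKU : K ⊆ U) :
    LogRel K (fun z => f z - a) (fun _ => 1) := by
  by_contra hna
  have hfK : ContinuousOn f K := hfc.mono hKU
  have hfKc : IsCompact (f '' K) := hK.image_of_continuousOn hfK
  set V : Set ℂ := {b | b ∉ f '' K ∧ ¬ LogRel K (fun z => f z - b) (fun _ => 1)} with hV
  have hloc : ∀ b, b ∉ f '' K → ∃ δ > 0, ∀ b' ∈ ball b δ, b' ∉ f '' K ∧
      (LogRel K (fun z => f z - b') (fun _ => 1) ↔ LogRel K (fun z => f z - b) (fun _ => 1)) := by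
    intro b hb
    obtain ⟨δ, hδ, hball⟩ := Metric.mem_nhds_iff.1 (hfKc.isClosed.isOpen_compl.mem_nhds hb)
    refine ⟨δ, hδ, fun b' hb' => ⟨hball hb', ?_⟩⟩
    have := logRel_nhds (p := b) (q := b') hfK (fun w hw => by
      by_contra hcon
      push Not at hcon
      exact hball (a := f w) (by rw [mem_ball, dist_comm]; exact hcon.trans_lt hb') (mem_image_of_mem f hw))
    exact ⟨fun h => this.symm.trans h, fun h => this.trans h⟩
  have hVo : IsOpen V := by
    rw [Metric.isOpen_iff]
    intro b hb
    obtain ⟨δ, hδ, h⟩ := hloc b hb.1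
    exact ⟨δ, hδ, fun b' hb' => ⟨(h b' hb').1, fun h' => hb.2 ((h b' hb').2.1 h')⟩⟩
  have hVK : IsClosed (V ∪ f '' K) := by
    rw [← isOpen_compl_iff, Metric.isOpen_iff]
    intro b hb
    rw [mem_compl_iff, mem_union, not_or] at hb
    obtain ⟨δ, hδ, h⟩ := hloc b hb.2
    refine ⟨δ, hδ, fun b' hb' => ?_⟩
    rw [mem_compl_iff, mem_union, not_or]
    refine ⟨fun h' => ?_, (h b' hb').1⟩
    exact hb.1 ⟨hb.2, fun h'' => h'.2 ((h b' hb').2.2 h'')⟩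
  have hVb : Bornology.IsBounded V := by
    obtain ⟨M, hM⟩ := hfKc.isBounded.exists_norm_le
    refine (isBounded_iff_forall_norm_le).2 ⟨M, fun b hb => ?_⟩
    by_contra hcon
    push Not at hcon
    exact hb.2 (logRel_far hfK fun w hw => (hM _ (mem_image_of_mem f hw)).trans_lt hcon)
  have haV : a ∈ V := ⟨fun h => ha (image_mono hKU h), hna⟩
  have hfU : IsOpen (f '' U) := hop U le_rfl hU
  set Gs : Set ℂ := U ∩ f ⁻¹' V with hGs
  set G' : Set ℂ := U ∩ f ⁻¹' (V ∪ f '' K)ᶜ with hG'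
  have hGo : IsOpen Gs := hfc.isOpen_inter_preimage hU hVo
  have hG'o : IsOpen G' := hfc.isOpen_inter_preimage hU hVK.isOpen_compl
  have hGG' : Disjoint Gs G' := by
    rw [Set.disjoint_left]; rintro z ⟨_, h1⟩ ⟨_, h2⟩; exact h2 (Or.inl h1)
  have hclU : closure U ⊆ U ∪ Z := by
    intro z hz
    by_cases h : z ∈ U
    · exact Or.inl h
    · exact Or.inr (hfr ⟨hz, by rwa [hU.interior_eq]⟩)
  -- image of the part mapped into `f '' K`
  set K1 : Set ℂ := U ∩ f ⁻¹' (f '' K) with hK1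
  have hcov : ∀ z ∈ U, z ∈ Gs ∨ z ∈ G' ∨ z ∈ K1 := by
    intro z hz
    by_cases h1 : f z ∈ V
    · exact Or.inl ⟨hz, h1⟩
    · by_cases h2 : f z ∈ f '' K
      · exact Or.inr (Or.inr ⟨hz, h2⟩)
      · exact Or.inr (Or.inl ⟨hz, fun h => h.elim h1 h2⟩)
  have hKZ : Disjoint K Z := hdis.mono_left hKU
  obtain ⟨δ, hδ, hδd⟩ := hKZ.exists_thickenings hK hZ.isClosed
  have hTK : Disjoint K (thickening δ Z) := hδd.mono_left (self_subset_thickening hδ K)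
  by_cases h1 : ∃ q ∈ Gs, q ∈ thickening δ Z
  swap
  · -- `Gs` stays away from `Z`
    push Not at h1
    have hV2 : IsOpen (V \ f '' U) := by
      rw [Metric.isOpen_iff]
      intro b hb
      by_contra hcon
      push Not at hcon
      have hbV := hb.1
      have : b ∈ closure (f '' Gs) := by
        rw [Metric.mem_closure_iff]
        intro ε hε
        obtain ⟨ε', hε', hbV'⟩ := Metric.isOpen_iff.1 hVo b hbV
        obtain ⟨c, hc, hc2⟩ := not_subset.1 (hcon (min ε ε') (lt_min hε hε'))
        have hcV := hbV' (ball_subset_ball (min_le_right _ _) hc)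
        have hcU : c ∈ f '' U := by by_contra h; exact hc2 ⟨hcV, h⟩
        obtain ⟨z, hz, rfl⟩ := hcU
        refine ⟨f z, mem_image_of_mem f ⟨hz, hcV⟩, ?_⟩
        rw [dist_comm]; exact (mem_ball.1 hc).trans_le (min_le_left _ _)
      have hcl : closure Gs ⊆ U := by
        intro z hz
        rcases hclU (closure_mono inter_subset_left hz) with h | h
        · exact h
        · exfalso
          obtain ⟨y, hy, hyd⟩ := Metric.mem_closure_iff.1 hz δ hδ
          exact h1 y hy (mem_thickening_iff.2 ⟨z, h, by rwa [dist_comm]⟩)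
      have hcc : IsCompact (f '' closure Gs) :=
        ((hUb.subset inter_subset_left).isCompact_closure).image_of_continuousOn (hfc.mono hcl)
      have := closure_minimal (image_mono subset_closure) hcc.isClosed this
      exact hb.2 (image_mono hcl this)
    -- then `V \ f '' U` has boundary inside the open set `f '' U`
    have hcl2 : IsClosed (V \ f '' U) := by
      have : V \ f '' U = (V ∪ f '' K) \ f '' U := by
        ext b; constructor
        · rintro ⟨h, h'⟩; exact ⟨Or.inl h, h'⟩
        · rintro ⟨h | h, h'⟩
          · exact ⟨h, h'⟩
          · exact absurd (image_mono hKU h) h'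
      rw [this]; exact hVK.sdiff hfU
    have huniv := IsClopen.eq_univ ⟨hcl2, hV2⟩ ⟨a, haV, ha⟩
    have := hVb.subset (sdiff_subset : V \ f '' U ⊆ V)
    rw [huniv] at this
    exact NormedSpace.unbounded_univ ℝ ℂ this
  by_cases h2 : ∃ q' ∈ G', q' ∈ thickening δ Z
  swap
  · push Not at h2
    have hcl : closure G' ⊆ U := by
      intro z hz
      rcases hclU (closure_mono inter_subset_left hz) with h | h
      · exact h
      · exfalso
        obtain ⟨y, hy, hyd⟩ := Metric.mem_closure_iff.1 hz δ hδ
        exact h2 y hy (mem_thickening_iff.2 ⟨z, h, by rwa [dist_comm]⟩)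
    have hcc : IsCompact (f '' closure G') :=
      ((hUb.subset inter_subset_left).isCompact_closure).image_of_continuousOn (hfc.mono hcl)
    have e1 : V ∪ f '' U = (V ∪ f '' K) ∪ f '' closure G' := by
      ext b; constructor
      · rintro (h | ⟨z, hz, rfl⟩)
        · exact Or.inl (Or.inl h)
        · rcases hcov z hz with h | h | h
          · exact Or.inl (Or.inl h.2)
          · exact Or.inr (mem_image_of_mem f (subset_closure h))
          · exact Or.inl (Or.inr h.2)
      · rintro ((h | h) | h)
        · exact Or.inl h
        · exact Or.inr (image_mono hKU h)
        · exact Or.inr (image_mono hcl h)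
    have hcl3 : IsClosed (V ∪ f '' U) := by rw [e1]; exact hVK.union hcc.isClosed
    have huniv := IsClopen.eq_univ ⟨hcl3, hVo.union hfU⟩ ⟨a, Or.inl haV⟩
    have hbd : Bornology.IsBounded (V ∪ f '' U) := by
      rw [e1]; exact (hVb.union hfKc.isBounded).union hcc.isBounded
    rw [huniv] at hbd
    exact NormedSpace.unbounded_univ ℝ ℂ hbd
  obtain ⟨q, hqG, hqT⟩ := h1
  obtain ⟨q', hqG', hqT'⟩ := h2
  have hK1K : K1 ⊆ K := by
    rintro z ⟨hz, y, hy, hyz⟩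
    rwa [← hinj (hKU hy) hz hyz]
  have hr1 : LogRel K (fun w => w - q) (fun w => w - q') :=
    logRel_of_preconnected hK continuousOn_id (preconn_thickening hZc δ)
      (fun w hw => Set.disjoint_left.1 hTK hw) hqT' hqT
  have hr2 := hr1.union (hrel q hqG.1 q' hqG'.1) hK.isClosed hZ.isClosed hKZ
  refine eilenberg (V := Gs) (hUb.subset inter_subset_left) (K := K ∪ Z) ?_ hqG
    (fun h => Set.disjoint_left.1 hGG' h hqG') ?_ hr2
  · intro z hz
    rcases hclU (closure_mono inter_subset_left hz.1) with h | h
    · rcases hcov z h with h' | h' | h'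
      · exact absurd h' (by have := hz.2; rwa [hGo.interior_eq] at this)
      · exfalso
        obtain ⟨y, hy1, hy2⟩ := mem_closure_iff.1 hz.1 G' hG'o h'
        exact Set.disjoint_left.1 hGG' hy2 hy1
      · exact Or.inl (hK1K h')
    · exact Or.inr h
  · rintro (h | h)
    · exact hqG'.2 (Or.inr (mem_image_of_mem f h))
    · exact Set.disjoint_left.1 hdis hqG'.1 h
end IsoExt
end

section
open Set Metric Topology Filter
set_option linter.unusedSectionVars false
namespace IsoExt

lemma log_patch {U : Set ℂ} (hU : IsOpen U) (hUc : IsPathConnected U) {F : ℂ → ℂ}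
    (h : ∀ K ⊆ U, IsCompact K → LogRel K F (fun _ => 1)) :
    ∃ L : ℂ → ℂ, ContinuousOn L U ∧ ∀ z ∈ U, Complex.exp (L z) = F z := by
  obtain ⟨o, ho, hpath⟩ := hUc
  have hF0 : F o ≠ 0 := by
    obtain ⟨l, -, hl⟩ := h {o} (by simpa using ho) isCompact_singleton
    rw [hl o rfl]; simp
  have hnorm : ∀ K ⊆ U, IsCompact K → o ∈ K → ∃ l : ℂ → ℂ, ContinuousOn l K ∧
      (∀ z ∈ K, Complex.exp (l z) = F z) ∧ l o = Complex.log (F o) := by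
    intro K hKU hK hoK
    obtain ⟨l, hl, hle⟩ := h K hKU hK
    have e1 : Complex.exp (l o) = F o := by rw [hle o hoK, one_mul]
    refine ⟨fun z => l z + (Complex.log (F o) - l o), hl.add continuousOn_const, fun z hz => ?_, by ring⟩
    rw [Complex.exp_add, Complex.exp_sub, Complex.exp_log hF0, e1, div_self hF0, mul_one, hle z hz, one_mul]
  have hC : ∀ q ∈ U, ∃ C ⊆ U, IsCompact C ∧ IsPreconnected C ∧ o ∈ C ∧ q ∈ C := by
    intro q hq
    obtain ⟨γ, hγ⟩ := hpath hq
    refine ⟨range γ, range_subset_iff.2 hγ, isCompact_range γ.continuous, isPreconnected_range γ.continuous,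
      ⟨0, γ.source⟩, ⟨1, γ.target⟩⟩
  choose! C hCU hCc hCp hCo hCq using hC
  have hl : ∀ q ∈ U, ∃ l : ℂ → ℂ, ContinuousOn l (C q) ∧
      (∀ z ∈ C q, Complex.exp (l z) = F z) ∧ l o = Complex.log (F o) := fun q hq =>
    hnorm _ (hCU q hq) (hCc q hq) (hCo q hq)
  choose! l hlc hle hlo using hl
  have key : ∀ K ⊆ U, IsCompact K → IsPreconnected K → o ∈ K → ∀ l' : ℂ → ℂ, ContinuousOn l' K →
      (∀ z ∈ K, Complex.exp (l' z) = F z) → l' o = Complex.log (F o) → ∀ q ∈ K, l q q = l' q := by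
    intro K hKU hK hKp hoK l' hl' hl'e hl'o q hq
    have hqU := hKU hq
    obtain ⟨l2, hl2, hl2e, hl2o⟩ := hnorm (K ∪ C q) (union_subset hKU (hCU q hqU)) (hK.union (hCc q hqU))
      (Or.inl hoK)
    have e1 : l2 q = l' q := log_unique' hKp (hl2.mono subset_union_left) hl'
      (fun w hw => by rw [hl2e w (Or.inl hw), hl'e w hw]) hoK hq (by rw [hl2o, hl'o])
    have e2 : l2 q = l q q := log_unique' (hCp q hqU) (hl2.mono subset_union_right) (hlc q hqU)
      (fun w hw => by rw [hl2e w (Or.inr hw), hle q hqU w hw]) (hCo q hqU) (hCq q hqU) (by rw [hl2o, hlo q hqU])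
    rw [← e2, e1]
  refine ⟨fun q => l q q, fun q hq => ContinuousAt.continuousWithinAt ?_, fun q hq => hle q hq q (hCq q hq)⟩
  obtain ⟨ε, hε, hεU⟩ := Metric.nhds_basis_closedBall.mem_iff.1 (hU.mem_nhds hq)
  have hsub : C q ∪ closedBall q ε ⊆ U := union_subset (hCU q hq) hεU
  have hcp : IsCompact (C q ∪ closedBall q ε) := (hCc q hq).union (isCompact_closedBall q ε)
  obtain ⟨l2, hl2, hl2e, hl2o⟩ := hnorm _ hsub hcp (Or.inl (hCo q hq))
  have hk := key _ hsub hcp ((hCp q hq).union q (hCq q hq) (mem_closedBall_self hε.le)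
    (convex_closedBall q ε).isPreconnected) (Or.inl (hCo q hq)) l2 hl2 hl2e hl2o
  have hn : closedBall q ε ∈ 𝓝 q := closedBall_mem_nhds q hε
  refine (hl2.continuousAt (mem_of_superset hn subset_union_right)).congr ?_
  filter_upwards [hn] with z hz using (hk z (Or.inr hz)).symm

lemma log_diff {U : Set ℂ} (hU : IsOpen U) {F L : ℂ → ℂ} (hF : DifferentiableOn ℂ F U)
    (hL : ContinuousOn L U) (hLF : ∀ z ∈ U, Complex.exp (L z) = F z) : DifferentiableOn ℂ L U := by
  intro q hq
  have hqn := hU.mem_nhds hq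
  have hc := hL.continuousAt hqn
  have hFq : F q ≠ 0 := by rw [← hLF q hq]; exact Complex.exp_ne_zero _
  have h1 : ∀ᶠ z in 𝓝 q, L z = L q + Complex.log (F z / F q) := by
    have h2 : ∀ᶠ z in 𝓝 q, ‖L z - L q‖ < 1 := by
      have := Metric.tendsto_nhds.1 hc 1 one_pos
      filter_upwards [this] with z hz
      rwa [dist_eq_norm] at hz
    filter_upwards [h2, hqn] with z hz hzU
    have h3 := Complex.abs_im_le_norm (L z - L q)
    have h4 := abs_le.1 h3
    rw [← hLF z hzU, ← hLF q hq, ← Complex.exp_sub, Complex.log_exp]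
    · ring
    · linarith [h4.1, Real.pi_gt_three]
    · linarith [h4.2, Real.pi_gt_three]
  have h5 : DifferentiableAt ℂ (fun z => L q + Complex.log (F z / F q)) q := by
    refine (differentiableAt_const _).add (DifferentiableAt.clog ?_ ?_)
    · exact (hF.differentiableAt hqn).div_const _
    · rw [div_self hFq]; simp
  exact (h5.congr_of_eventuallyEq h1).differentiableWithinAt

/-- the analytic form of simple connectivity used for the Riemann map -/
def LogProp (U : Set ℂ) : Prop := ∀ f : ℂ → ℂ, DifferentiableOn ℂ f U → InjOn f U → ∀ a, a ∉ f '' U →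
  ∃ L : ℂ → ℂ, DifferentiableOn ℂ L U ∧ ∀ z ∈ U, Complex.exp (L z) = f z - a

lemma open_map_of_inj {U : Set ℂ} (hU : IsOpen U) {f : ℂ → ℂ} (hf : DifferentiableOn ℂ f U) (hinj : InjOn f U)
    {V : Set ℂ} (hVU : V ⊆ U) (hV : IsOpen V) : IsOpen (f '' V) := by
  rw [isOpen_iff_mem_nhds]
  rintro _ ⟨z, hz, rfl⟩
  have ha : AnalyticAt ℂ f z := hf.analyticAt (hU.mem_nhds (hVU hz))
  rcases ha.eventually_constant_or_nhds_le_map_nhds with h | h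
  · exfalso
    have h1 : ∀ᶠ w in 𝓝 z, w ∈ U ∧ f w = f z := (hU.eventually_mem (hVU hz)).and h
    have h2 : ∀ᶠ w in 𝓝[≠] z, w ≠ z ∧ (w ∈ U ∧ f w = f z) :=
      (eventually_mem_nhdsWithin (s := {z}ᶜ)).and (h1.filter_mono nhdsWithin_le_nhds)
    obtain ⟨w, hw1, hw2, hw3⟩ := h2.exists
    exact hw1 (hinj hw2 (hVU hz) hw3)
  · exact h (image_mem_map (hV.mem_nhds hz))

namespace Isot
variable {X : Type*} [MetricSpace X] [CompactSpace X] {G : Isot X}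

lemma Nice.logProp (hn : G.Nice) [PreconnectedSpace X] (t : unitInterval) : LogProp (G.D t) := by
  intro f hf hinj a ha
  have hU := hn.D_open t
  have hrel : ∀ q ∈ G.D t, ∀ q' ∈ G.D t, LogRel (range (G.g t)) (fun w => w - q) (fun w => w - q') := by
    rintro q ⟨l, hl, hle⟩ q' ⟨l', hl', hle'⟩
    obtain ⟨M, hM, hMe⟩ := G.extend t (hl.sub hl')
    refine ⟨M, hM.continuousOn, ?_⟩
    rintro _ ⟨z, rfl⟩
    beta_reduce
    rw [hMe, hle z, hle' z, Pi.sub_apply, Complex.exp_sub]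
    field_simp
  obtain ⟨L, hL, hLe⟩ := log_patch hU (hn.D_path t) (F := fun z => f z - a) (fun K hKU hK =>
    koebe_log_compact hU (hn.D_bounded t) ⟨0, zero_mem_D t⟩ (G.isCompact_range t)
      (isPreconnected_range (G.cont_t t)) (Set.disjoint_left.2 fun q hq => hn.D_notMem hq)
      (hn.D_frontier t) hrel hf.continuousOn hinj
      (fun V hVU hV => open_map_of_inj hU hf hinj hVU hV) ha hK hKU)
  exact ⟨L, log_diff hU (hf.sub (differentiableOn_const a)) hL hLe, hLe⟩
end Isot
end IsoExt
end

section
open Set Metric Topology Filter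
set_option linter.unusedSectionVars false
namespace IsoExt

lemma montel {ι : Type*} (𝒰 : Ultrafilter ι) {U : Set ℂ} {f : ι → ℂ → ℂ} {M : ℝ}
    (h : ∀ z ∈ U, ∃ r > 0, ∀ᶠ i in (𝒰 : Filter ι), DifferentiableOn ℂ (f i) (ball z r) ∧ ∀ w ∈ ball z r, ‖f i w‖ ≤ M)
    (hU : IsOpen U) :
    ∃ F : ℂ → ℂ, DifferentiableOn ℂ F U ∧ (∀ z ∈ U, ‖F z‖ ≤ M) ∧
      (∀ z ∈ U, Tendsto (fun i => f i z) 𝒰 (𝓝 (F z))) ∧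
      ∀ z ∈ U, ∃ r > 0, (∀ᶠ i in (𝒰 : Filter ι), DifferentiableOn ℂ (f i) (ball z r)) ∧
        TendstoUniformlyOn f F 𝒰 (ball z r) := by
  have hpt : ∀ z ∈ U, ∃ y, ‖y‖ ≤ M ∧ Tendsto (fun i => f i z) 𝒰 (𝓝 y) := by
    intro z hz
    obtain ⟨r, hr, hi⟩ := h z hz
    have h1 : closedBall (0:ℂ) M ∈ (𝒰.map (fun i => f i z)) := by
      rw [Ultrafilter.mem_map]
      filter_upwards [hi] with i hi
      simpa using hi.2 z (mem_ball_self hr)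
    obtain ⟨y, hy, hle⟩ := (isCompact_closedBall (0:ℂ) M).ultrafilter_le_nhds (𝒰.map fun i => f i z)
      (le_principal_iff.2 h1)
    exact ⟨y, by simpa using hy, hle⟩
  choose! F hFM hF using hpt
  have key : ∀ z ∈ U, ∃ r > 0, (∀ᶠ i in (𝒰 : Filter ι), DifferentiableOn ℂ (f i) (ball z r)) ∧
        TendstoUniformlyOn f F 𝒰 (ball z r) := by
    intro z hz
    obtain ⟨r0, hr0, hi0⟩ := h z hz
    obtain ⟨r1, hr1, hr1U⟩ := Metric.isOpen_iff.1 hU z hz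
    set r := min r0 r1 with hrdef
    have hr : 0 < r := lt_min hr0 hr1
    have hbU : ball z r ⊆ U := (ball_subset_ball (min_le_right _ _)).trans hr1U
    have hM : 0 ≤ M := (norm_nonneg _).trans (hFM z hz)
    have hi : ∀ᶠ i in (𝒰 : Filter ι), DifferentiableOn ℂ (f i) (ball z r) ∧ ∀ w ∈ ball z r, ‖f i w‖ ≤ M := by
      filter_upwards [hi0] with i hi
      have := ball_subset_ball (x := z) (min_le_left r0 r1)
      exact ⟨hi.1.mono this, fun w hw => hi.2 w (this hw)⟩
    set C := 2 * M / (r/2) with hC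
    have hC0 : 0 ≤ C := by positivity
    have hlip : ∀ᶠ i in (𝒰 : Filter ι), ∀ w ∈ closedBall z (r/5), ∀ w' ∈ closedBall z (r/5), dist (f i w) (f i w') ≤ C * dist w w' := by
      filter_upwards [hi] with i hi w hw w' hw'
      rw [mem_closedBall] at hw hw'
      have hsub : ball w' (r/2) ⊆ ball z r := ball_subset_ball' (by linarith)
      refine Complex.dist_le_div_mul_dist_of_mapsTo_ball (hi.1.mono hsub) (fun u hu => ?_) ?_
      · rw [mem_closedBall, dist_eq_norm]
        refine (norm_sub_le _ _).trans ?_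
        have := hi.2 u (hsub hu)
        have := hi.2 w' (hsub (mem_ball_self (by linarith)))
        linarith
      · rw [mem_ball]
        have := dist_triangle_right w w' z
        linarith
    have hcU : closedBall z (r/5) ⊆ U := (closedBall_subset_ball (by linarith)).trans hbU
    have hlipF : ∀ w ∈ closedBall z (r/5), ∀ w' ∈ closedBall z (r/5), dist (F w) (F w') ≤ C * dist w w' := by
      intro w hw w' hw'
      refine le_of_tendsto ((hF w (hcU hw)).dist (hF w' (hcU hw'))) ?_
      filter_upwards [hlip] with i hi using hi w hw w' hw'
    have hsm : ball z (r/5) ⊆ closedBall z (r/5) := ball_subset_closedBall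
    refine ⟨r/5, by positivity, ?_, ?_⟩
    · filter_upwards [hi] with i hi using hi.1.mono (ball_subset_ball (by linarith))
    · rw [Metric.tendstoUniformlyOn_iff]
      intro ε hε
      set δ := ε / (3 * (C+1)) with hδd
      have hδ : 0 < δ := by positivity
      have hCδ : C * δ < ε/3 := by
        rw [hδd, mul_div_assoc', div_lt_div_iff₀ (by positivity) (by positivity)]
        nlinarith
      obtain ⟨N, hN, hNf, hcov⟩ := (isCompact_closedBall z (r/5)).finite_cover_balls hδ
      have hev : ∀ᶠ i in (𝒰 : Filter ι), ∀ n ∈ N, dist (f i n) (F n) < ε/3 := by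
        rw [Filter.eventually_all_finite hNf]
        intro n hn
        exact Metric.tendsto_nhds.1 (hF n (hcU (hN hn))) (ε/3) (by positivity)
      filter_upwards [hev, hlip] with i h1 h2 w hw
      obtain ⟨n, hn, hwn⟩ := mem_iUnion₂.1 (hcov (hsm hw))
      rw [mem_ball] at hwn
      have a1 := h1 n hn
      have a2 := h2 w (hsm hw) n (hN hn)
      have a3 := hlipF w (hsm hw) n (hN hn)
      have a4 : C * dist w n ≤ C * δ := by gcongr
      have a5 := dist_triangle4 (F w) (F n) (f i n) (f i w)
      rw [dist_comm (F n), dist_comm (f i n) (f i w)] at a5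
      linarith
  refine ⟨F, fun z hz => ?_, hFM, hF, key⟩
  obtain ⟨r, hr, hd, hu⟩ := key z hz
  have := hu.tendstoLocallyUniformlyOn.differentiableOn hd isOpen_ball
  exact (this.differentiableAt (ball_mem_nhds z hr)).differentiableWithinAt

lemma tendsto_deriv_of_unif {ι : Type*} {φ : Filter ι} [φ.NeBot] {f : ι → ℂ → ℂ} {F : ℂ → ℂ} {z : ℂ} {r : ℝ} (hr : 0 < r)
    (hd : ∀ᶠ i in φ, DifferentiableOn ℂ (f i) (ball z r)) (hu : TendstoUniformlyOn f F φ (ball z r)) :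
    Tendsto (fun i => deriv (f i) z) φ (𝓝 (deriv F z)) :=
  (hu.tendstoLocallyUniformlyOn.deriv hd isOpen_ball).tendsto_at (mem_ball_self hr)

lemma hurwitz_zero {ι : Type*} {φ : Filter ι} [φ.NeBot] {f : ι → ℂ → ℂ} {F : ℂ → ℂ} {b : ℂ} {r : ℝ} (hr : 0 < r)
    (hd : ∀ᶠ i in φ, DifferentiableOn ℂ (f i) (ball b r)) (hu : TendstoUniformlyOn f F φ (ball b r))
    (h0 : ∀ᶠ i in φ, ∀ w ∈ ball b r, f i w ≠ 0) (hb : F b = 0) : ∀ᶠ w in 𝓝 b, F w = 0 := by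
  have hF := hu.tendstoLocallyUniformlyOn.differentiableOn hd isOpen_ball
  have hFa : AnalyticAt ℂ F b := hF.analyticAt (ball_mem_nhds b hr)
  rcases hFa.eventually_eq_zero_or_eventually_ne_zero with h | h
  · exact h
  exfalso
  rw [eventually_nhdsWithin_iff, Metric.eventually_nhds_iff_ball] at h
  obtain ⟨s, hs, hne⟩ := h
  set ρ := min r s / 2 with hρd
  have hm : 0 < min r s := lt_min hr hs
  have hρ : 0 < ρ := by positivity
  have hρm : ρ < min r s := by rw [hρd]; linarith
  have hρr : ρ < r := hρm.trans_le (min_le_left _ _)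
  have hρs : ρ < s := hρm.trans_le (min_le_right _ _)
  have hsph : sphere b ρ ⊆ ball b r := sphere_subset_ball hρr
  obtain ⟨w0, hw0, hmin⟩ := (isCompact_sphere b ρ).exists_isMinOn (NormedSpace.sphere_nonempty.2 hρ.le)
    (hF.continuousOn.norm.mono hsph)
  have hm0 : 0 < ‖F w0‖ := norm_pos_iff.2 (hne w0 (sphere_subset_ball hρs hw0) (ne_of_mem_sphere hw0 hρ.ne'))
  set m := ‖F w0‖
  obtain ⟨i, h1, h2, h3⟩ := (hd.and (h0.and (Metric.tendstoUniformlyOn_iff.1 hu (m/3) (by positivity)))).exists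
  have hcl : closedBall b ρ ⊆ ball b r := closedBall_subset_ball hρr
  have hdc : DiffContOnCl ℂ (fun w => (f i w)⁻¹) (ball b ρ) := by
    apply DifferentiableOn.diffContOnCl
    rw [closure_ball b hρ.ne']
    exact (h1.mono hcl).inv fun w hw => h2 w (hcl hw)
  have hle := Complex.norm_le_of_forall_mem_frontier_norm_le isBounded_ball hdc (C := (2*m/3)⁻¹) (fun w hw => by
    rw [frontier_ball b hρ.ne'] at hw
    rw [norm_inv]
    refine inv_anti₀ (by positivity) ?_
    have e1 : m ≤ ‖F w‖ := hmin hw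
    have e2 := h3 w (hsph hw)
    rw [dist_eq_norm] at e2
    have e3 := norm_sub_norm_le (F w) (f i w)
    linarith) (subset_closure (mem_ball_self hρ))
  rw [norm_inv] at hle
  have e4 := h3 b (mem_ball_self hr)
  rw [hb, dist_zero_left] at e4
  have e5 : 0 < ‖f i b‖ := norm_pos_iff.2 (h2 b (mem_ball_self hr))
  have := (inv_le_inv₀ e5 (by positivity)).1 hle
  linarith

lemma hurwitz_inj {ι : Type*} {φ : Filter ι} [φ.NeBot] {f : ι → ℂ → ℂ} {F : ℂ → ℂ} {U : Set ℂ} (hU : IsOpen U)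
    (hUc : IsPreconnected U)
    (hu : ∀ z ∈ U, ∃ r > 0, (∀ᶠ i in φ, DifferentiableOn ℂ (f i) (ball z r)) ∧
        TendstoUniformlyOn f F φ (ball z r))
    (hinj : ∀ a ∈ U, ∀ b ∈ U, ∃ r > 0, ∀ᶠ i in φ, InjOn (f i) (ball a r ∪ ball b r)) :
    InjOn F U ∨ ∃ c, ∀ z ∈ U, F z = c := by
  by_contra hcon
  push Not at hcon
  obtain ⟨h1, h2⟩ := hcon
  simp only [InjOn, not_forall] at h1
  obtain ⟨a, ha, b, hb, hab, hne⟩ := h1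
  have hFd : DifferentiableOn ℂ F U := by
    intro z hz
    obtain ⟨r, hr, hd, hu⟩ := hu z hz
    have := hu.tendstoLocallyUniformlyOn.differentiableOn hd isOpen_ball
    exact (this.differentiableAt (ball_mem_nhds z hr)).differentiableWithinAt
  obtain ⟨ra, hra, -, hua⟩ := hu a ha
  obtain ⟨rb, hrb, hdb, hub⟩ := hu b hb
  obtain ⟨r0, hr0, hi⟩ := hinj a ha b hb
  have hd0 : 0 < dist a b := dist_pos.2 hne
  set r := min (min rb r0) (dist a b) with hr
  have hr0' : 0 < r := lt_min (lt_min hrb hr0) hd0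
  have hrb' : r ≤ rb := (min_le_left _ _).trans (min_le_left _ _)
  have hr0'' : r ≤ r0 := (min_le_left _ _).trans (min_le_right _ _)
  have ht : Tendsto (fun i => f i a) φ (𝓝 (F a)) := hua.tendsto_at (mem_ball_self hra)
  have hz := hurwitz_zero (f := fun i w => f i w - f i a) (F := fun w => F w - F a) (φ := φ) hr0'
    (by
      filter_upwards [hdb] with i hi
      exact (hi.mono (ball_subset_ball hrb')).sub (differentiableOn_const _))
    (by
      rw [Metric.tendstoUniformlyOn_iff]
      intro ε hε
      filter_upwards [Metric.tendstoUniformlyOn_iff.1 hub (ε/2) (by positivity),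
        Metric.tendsto_nhds.1 ht (ε/2) (by positivity)] with i h1 h2 w hw
      have := h1 w (ball_subset_ball hrb' hw)
      have h3 := dist_sub_sub_le (F w) (F a) (f i w) (f i a)
      rw [dist_comm (F a)] at h3
      linarith)
    (by
      filter_upwards [hi] with i hi w hw h0
      have := hi (Or.inr (ball_subset_ball hr0'' hw)) (Or.inl (mem_ball_self hr0)) (sub_eq_zero.1 h0)
      rw [this, mem_ball] at hw
      exact absurd hw (not_lt.2 (min_le_right _ _)))
    (by rw [hab, sub_self])
  obtain ⟨z, hz1, hz2⟩ := h2 (F a)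
  have := (hFd.analyticOnNhd hU).eqOn_of_preconnected_of_eventuallyEq (g := fun _ => F a) analyticOnNhd_const hUc hb
    (by filter_upwards [hz] with w hw using sub_eq_zero.1 hw)
  exact hz2 (this hz1)
end IsoExt
end

section
open Set Metric Topology Filter ComplexConjugate
set_option linter.unusedSectionVars false
namespace IsoExt

/-- disk automorphism -/
noncomputable def mob (c w : ℂ) : ℂ := (w - c) / (1 - conj c * w)

lemma mob_identity (c w : ℂ) : ‖1 - conj c * w‖^2 - ‖w - c‖^2 = (1 - ‖w‖^2) * (1 - ‖c‖^2) := by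
  simp only [Complex.sq_norm, Complex.normSq_apply]
  simp
  ring

lemma mob_re {c w : ℂ} (hc : ‖c‖ < 1) (hw : ‖w‖ < 1) : 0 < (1 - conj c * w).re := by
  have h : ‖conj c * w‖ < 1 := by
    rw [norm_mul, RCLike.norm_conj]
    nlinarith [norm_nonneg c, norm_nonneg w]
  have := Complex.re_le_norm (conj c * w)
  rw [Complex.sub_re, Complex.one_re]; linarith

lemma mob_den {c w : ℂ} (hc : ‖c‖ < 1) (hw : ‖w‖ < 1) : 1 - conj c * w ≠ 0 := by
  intro h; have := mob_re hc hw; rw [h] at this; simp at this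

lemma mob_norm {c w : ℂ} (hc : ‖c‖ < 1) (hw : ‖w‖ < 1) : ‖mob c w‖ < 1 := by
  rw [mob, norm_div, div_lt_one (norm_pos_iff.2 (mob_den hc hw))]
  have h := mob_identity c w
  have h2 : 0 < (1 - ‖w‖^2) * (1 - ‖c‖^2) := by
    apply mul_pos <;> nlinarith [norm_nonneg c, norm_nonneg w]
  refine lt_of_pow_lt_pow_left₀ 2 (norm_nonneg _) (by linarith)

lemma mob_inj {c w v : ℂ} (hc : ‖c‖ < 1) (hw : ‖w‖ < 1) (hv : ‖v‖ < 1) (h : mob c w = mob c v) : w = v := by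
  rw [mob, mob, div_eq_div_iff (mob_den hc hw) (mob_den hc hv)] at h
  have h1 : (w - v) * (1 - conj c * c) = 0 := by linear_combination h
  have := mob_den hc hc
  rcases mul_eq_zero.1 h1 with h | h
  · exact sub_eq_zero.1 h
  · exact absurd h this

lemma mob_zero_left (w : ℂ) : mob w 0 = -w := by simp [mob]
lemma mob_self (w : ℂ) : mob w w = 0 := by simp [mob]

lemma mob_hasDerivAt {c w : ℂ} (hc : ‖c‖ < 1) (hw : ‖w‖ < 1) :
    HasDerivAt (mob c) ((1 - conj c * c) / (1 - conj c * w)^2) w := by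
  have h1 : HasDerivAt (fun w : ℂ => w - c) 1 w := (hasDerivAt_id w).sub_const c
  have h2 : HasDerivAt (fun w : ℂ => 1 - conj c * w) (-(conj c)) w := by
    simpa using ((hasDerivAt_id w).const_mul (conj c)).const_sub 1
  refine HasDerivAt.congr_deriv (f := mob c) (h1.div h2 (mob_den hc hw)) ?_
  congr 1
  ring

/-- competitor family -/
structure Comp (U : Set ℂ) (f : ℂ → ℂ) : Prop where
  diff : DifferentiableOn ℂ f U
  inj : InjOn f U
  zero : f 0 = 0
  lt : ∀ z ∈ U, ‖f z‖ < 1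

lemma koebe_step {U : Set ℂ} (hU : IsOpen U) (h0 : (0:ℂ) ∈ U) (hL : LogProp U) {f : ℂ → ℂ} (hf : Comp U f)
    (hd : deriv f 0 ≠ 0) {a : ℂ} (ha : ‖a‖ < 1) (haf : a ∉ f '' U) :
    ∃ f2, Comp U f2 ∧ ‖deriv f 0‖ < ‖deriv f2 0‖ := by
  obtain ⟨L, hLd, hLe⟩ := hL f hf.diff hf.inj a haf
  have hre : ∀ z ∈ U, 0 < (1 - conj a * f z).re := fun z hz => mob_re ha (hf.lt z hz)
  have hne : ∀ z ∈ U, 1 - conj a * f z ≠ 0 := fun z hz => mob_den ha (hf.lt z hz)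
  set g : ℂ → ℂ := fun z => Complex.exp ((L z - Complex.log (1 - conj a * f z)) / 2) with hg
  have hgd : DifferentiableOn ℂ g U := by
    refine DifferentiableOn.cexp (DifferentiableOn.div_const (hLd.sub (DifferentiableOn.clog ?_ ?_)) 2)
    · exact (differentiableOn_const _).sub (hf.diff.const_mul _)
    · intro z hz; exact Or.inl (hre z hz)
  have hgs : ∀ z ∈ U, g z * g z = mob a (f z) := by
    intro z hz
    rw [hg]; beta_reduce
    rw [← Complex.exp_add, add_halves, Complex.exp_sub, hLe z hz, Complex.exp_log (hne z hz), mob]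
  have hglt : ∀ z ∈ U, ‖g z‖ < 1 := by
    intro z hz
    have h1 := mob_norm ha (hf.lt z hz)
    rw [← hgs z hz, norm_mul] at h1
    nlinarith [norm_nonneg (g z)]
  have hgi : InjOn g U := by
    intro z hz w hw h
    refine hf.inj hz hw (mob_inj ha (hf.lt z hz) (hf.lt w hw) ?_)
    rw [← hgs z hz, ← hgs w hw, h]
  set b := g 0 with hb
  have hb1 : ‖b‖ < 1 := hglt 0 h0
  have hb0 : b ≠ 0 := Complex.exp_ne_zero _
  have hbb : b * b = -a := by rw [hb, hgs 0 h0, hf.zero, mob_zero_left]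
  have hUn := hU.mem_nhds h0
  refine ⟨fun z => mob b (g z), ⟨?_, ?_, mob_self b, fun z hz => mob_norm hb1 (hglt z hz)⟩, ?_⟩
  · intro z hz
    exact ((mob_hasDerivAt hb1 (hglt z hz)).differentiableAt.comp z (hgd.differentiableAt (hU.mem_nhds hz))).differentiableWithinAt
  · intro z hz w hw h
    exact hgi hz hw (mob_inj hb1 (hglt z hz) (hglt w hw) h)
  · have hgD : HasDerivAt g (deriv g 0) 0 := (hgd.differentiableAt hUn).hasDerivAt
    have hfD : HasDerivAt f (deriv f 0) 0 := (hf.diff.differentiableAt hUn).hasDerivAt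
    have e1 : HasDerivAt (fun z => mob b (g z)) ((1 - conj b * b) / (1 - conj b * b)^2 * deriv g 0) 0 :=
      (mob_hasDerivAt hb1 (hglt 0 h0)).comp 0 hgD
    have e2 : HasDerivAt (fun z => mob a (f z)) ((1 - conj a * a) / (1 - conj a * f 0)^2 * deriv f 0) 0 :=
      (mob_hasDerivAt ha (hf.lt 0 h0)).comp 0 hfD
    have e3 : HasDerivAt (fun z => mob a (f z)) (deriv g 0 * b + b * deriv g 0) 0 := by
      refine (hgD.mul hgD).congr_of_eventuallyEq ?_
      filter_upwards [hUn] with z hz using (hgs z hz).symm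
    have e4 := e2.unique e3
    rw [hf.zero, mul_zero, sub_zero, one_pow, div_one] at e4
    rw [e1.deriv]
    have hbd := mob_den hb1 hb1
    have e5 : (1 - conj b * b) / (1 - conj b * b)^2 * deriv g 0 = deriv g 0 / (1 - conj b * b) := by
      field_simp
    rw [e5]
    have haa : conj a * a = (conj b * b)*(conj b * b) := by
      have : a = -(b*b) := by rw [hbb]; ring
      rw [this]; simp; ring
    have e6 : deriv f 0 = (2 * b / (1 + conj b * b)) * (deriv g 0 / (1 - conj b * b)) := by
      have h1 : (1 + conj b * b) ≠ 0 := by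
        rw [mul_comm, Complex.mul_conj]
        have : (0:ℝ) < 1 + Complex.normSq b := by linarith [Complex.normSq_nonneg b]
        exact_mod_cast this.ne'
      rw [haa] at e4
      rw [div_mul_div_comm, eq_div_iff (mul_ne_zero h1 hbd)]
      linear_combination e4
    have e7 : ‖2 * b / (1 + conj b * b)‖ < 1 := by
      have h1 : (1 + conj b * b) = ((1 + ‖b‖^2 : ℝ) : ℂ) := by
        rw [mul_comm, Complex.mul_conj, Complex.normSq_eq_norm_sq]; push_cast; ring
      rw [h1, norm_div, norm_mul, Complex.norm_real, Real.norm_of_nonneg (by positivity), div_lt_one (by positivity)]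
      simp only [Complex.norm_ofNat]
      nlinarith [sq_pos_of_pos (sub_pos.2 hb1)]
    have e8 : deriv g 0 / (1 - conj b * b) ≠ 0 := by
      intro h; rw [h, mul_zero] at e6; exact hd e6
    calc ‖deriv f 0‖ = ‖2 * b / (1 + conj b * b)‖ * ‖deriv g 0 / (1 - conj b * b)‖ := by rw [← norm_mul, ← e6]
      _ < 1 * _ := by gcongr
      _ = _ := one_mul _

theorem riemann_map {U : Set ℂ} (hU : IsOpen U) (hUc : IsPreconnected U) (hb : Bornology.IsBounded U)
    (h0 : (0:ℂ) ∈ U) (hL : LogProp U) :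
    ∃ ψ, Comp U ψ ∧ ψ '' U = ball 0 1 ∧ 0 < (deriv ψ 0).re ∧ (deriv ψ 0).im = 0 := by
  obtain ⟨R, hR0, hR⟩ := hb.subset_ball_lt 0 0
  obtain ⟨δ, hδ, hδU⟩ := Metric.isOpen_iff.1 hU 0 h0
  set S := {s : ℝ | ∃ f, Comp U f ∧ s = ‖deriv f 0‖} with hS
  have hbd : ∀ f, Comp U f → ‖deriv f 0‖ ≤ 1/δ := by
    intro f hf
    refine Complex.norm_deriv_le_div_of_mapsTo_ball (hf.diff.mono hδU) ?_ hδ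
    intro z hz
    rw [hf.zero, mem_closedBall, dist_zero_right]; exact (hf.lt z (hδU hz)).le
  have hSb : BddAbove S := ⟨1/δ, by rintro _ ⟨f, hf, rfl⟩; exact hbd f hf⟩
  have hc0 : Comp U (fun z => z / R) := by
    refine ⟨differentiableOn_id.div_const _, ?_, by simp, ?_⟩
    · intro z _ w _ h
      have : (R:ℂ) ≠ 0 := by exact_mod_cast hR0.ne'
      exact (div_left_inj' this).1 h
    · intro z hz
      have := hR hz
      rw [mem_ball_zero_iff] at this
      rw [norm_div, Complex.norm_real, Real.norm_of_nonneg hR0.le, div_lt_one hR0]; exact this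
  have hs1 : 1/R ∈ S := ⟨_, hc0, by
    rw [deriv_div_const, deriv_id'']; simp [abs_of_pos hR0]⟩
  set s := sSup S
  have hs0 : 0 < s := lt_of_lt_of_le (by positivity) (le_csSup hSb hs1)
  have hseq : ∀ n : ℕ, ∃ f, Comp U f ∧ s - 1/((n:ℝ)+1) < ‖deriv f 0‖ := by
    intro n
    obtain ⟨_, ⟨f, hf, rfl⟩, h⟩ := exists_lt_of_lt_csSup ⟨_, hs1⟩ (show s - 1/((n:ℝ)+1) < s by
      have : 0 < 1/((n:ℝ)+1) := by positivity
      linarith)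
    exact ⟨f, hf, h⟩
  choose f hf hfs using hseq
  have hUball : ∀ z ∈ U, ∃ r > 0, ball z r ⊆ U := Metric.isOpen_iff.1 hU
  obtain ⟨F, hFd, hFM, hFt, hFu⟩ := montel (Filter.hyperfilter ℕ) (f := f) (M := 1) (fun z hz => by
    obtain ⟨r, hr, hrU⟩ := hUball z hz
    exact ⟨r, hr, Eventually.of_forall fun i => ⟨(hf i).diff.mono hrU, fun w hw => ((hf i).lt w (hrU hw)).le⟩⟩) hU
  have hFder : ‖deriv F 0‖ = s := by
    obtain ⟨r, hr, hd, hu⟩ := hFu 0 h0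
    have h1 := (tendsto_deriv_of_unif hr hd hu).norm
    have h2 : Tendsto (fun n => ‖deriv (f n) 0‖) atTop (𝓝 s) := by
      refine tendsto_of_tendsto_of_tendsto_of_le_of_le (g := fun n : ℕ => s - 1/((n:ℝ)+1)) (h := fun _ => s) ?_
        tendsto_const_nhds (fun n => (hfs n).le) (fun n => le_csSup hSb ⟨_, hf n, rfl⟩)
      simpa using tendsto_one_div_add_atTop_nhds_zero_nat.const_sub s
    exact tendsto_nhds_unique h1 (h2.mono_left (by
      have := Nat.hyperfilter_le_atTop
      exact this))
  have hFi : InjOn F U := by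
    rcases hurwitz_inj hU hUc hFu (fun a ha b hb => by
      obtain ⟨r, hr, hrU⟩ := hUball a ha
      obtain ⟨r', hr', hrU'⟩ := hUball b hb
      exact ⟨min r r', lt_min hr hr', Eventually.of_forall fun i => (hf i).inj.mono
        (union_subset ((ball_subset_ball (min_le_left _ _)).trans hrU)
          ((ball_subset_ball (min_le_right _ _)).trans hrU'))⟩) with h | ⟨c, hc⟩
    · exact h
    · exfalso
      have : deriv F 0 = 0 := by
        have h1 : F =ᶠ[𝓝 0] fun _ => c := by filter_upwards [hU.mem_nhds h0] with z hz using hc z hz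
        rw [h1.deriv_eq]; simp
      rw [this, norm_zero] at hFder; linarith
  have hF0 : F 0 = 0 := by
    refine tendsto_nhds_unique (hFt 0 h0) ?_
    simp only [(hf _).zero]; exact tendsto_const_nhds
  have hFc : Comp U F := by
    refine ⟨hFd, hFi, hF0, fun z hz => ?_⟩
    have h1 : F '' U ⊆ interior (closedBall 0 1) := by
      refine interior_maximal ?_ (open_map_of_inj hU hFd hFi subset_rfl hU)
      rintro _ ⟨w, hw, rfl⟩
      simpa using hFM w hw
    rw [interior_closedBall _ one_ne_zero] at h1
    simpa using h1 ⟨z, hz, rfl⟩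
  have hder0 : deriv F 0 ≠ 0 := by rw [← norm_pos_iff, hFder]; exact hs0
  have himg : F '' U = ball 0 1 := by
    refine Subset.antisymm ?_ ?_
    · rintro _ ⟨w, hw, rfl⟩; simpa using hFc.lt w hw
    · intro a ha
      by_contra hna
      obtain ⟨f2, hf2, hlt⟩ := koebe_step hU h0 hL hFc hder0 (by simpa using ha) hna
      rw [hFder] at hlt
      exact absurd hlt (not_lt.2 (le_csSup hSb ⟨f2, hf2, rfl⟩))
  -- rotate
  set u : ℂ := (s:ℂ) / deriv F 0 with hu
  have hu1 : ‖u‖ = 1 := by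
    rw [hu, norm_div, hFder, Complex.norm_real, Real.norm_of_nonneg hs0.le, div_self hs0.ne']
  have hu0 : u ≠ 0 := by rw [← norm_pos_iff, hu1]; exact one_pos
  have hdu : deriv (fun z => u * F z) 0 = s := by
    rw [deriv_const_mul _ (hFd.differentiableAt (hU.mem_nhds h0)), hu, div_mul_cancel₀ _ hder0]
  refine ⟨fun z => u * F z, ⟨hFd.const_mul u, ?_, by simp [hF0], fun z hz => ?_⟩, ?_, ?_, ?_⟩
  · intro z hz w hw h
    exact hFi hz hw (mul_left_cancel₀ hu0 h)
  · rw [norm_mul, hu1, one_mul]; exact hFc.lt z hz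
  · ext w
    constructor
    · rintro ⟨z, hz, rfl⟩
      simp [hu1, hFc.lt z hz]
    · intro hw
      have : w / u ∈ F '' U := by
        rw [himg]
        simpa [hu1] using hw
      obtain ⟨z, hz, hzw⟩ := this
      exact ⟨z, hz, by beta_reduce; rw [hzw, mul_div_cancel₀ _ hu0]⟩
  · rw [hdu]; simpa using hs0
  · rw [hdu]; simp
end IsoExt
end

section
open Set Metric Topology Filter ComplexConjugate MeasureTheory
set_option linter.unusedSectionVars false
namespace IsoExt

lemma det_smul_one (w : ℂ) : (w • (1 : ℂ →L[ℝ] ℂ)).det = ‖w‖^2 := by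
  have h : ((w • (1 : ℂ →L[ℝ] ℂ)) : ℂ →ₗ[ℝ] ℂ) = (w • (1 : ℂ →ₗ[ℂ] ℂ)).restrictScalars ℝ := by
    ext <;> simp
  have h2 : (w • (1 : ℂ →L[ℝ] ℂ)).det = LinearMap.det ((w • (1 : ℂ →L[ℝ] ℂ)) : ℂ →ₗ[ℝ] ℂ) := rfl
  rw [h2, h, LinearMap.det_restrictScalars, Algebra.norm_complex_apply, LinearMap.det_smul]
  simp [Complex.normSq_eq_norm_sq]

lemma area_formula {Ω : Set ℂ} (hΩ : IsOpen Ω) {F : ℂ → ℂ} (hF : DifferentiableOn ℂ F Ω) (hi : InjOn F Ω) :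
    ∫⁻ z, Ω.indicator (fun z => ENNReal.ofReal (‖deriv F z‖^2)) z = volume (F '' Ω) := by
  rw [lintegral_indicator hΩ.measurableSet]
  rw [← lintegral_abs_det_fderiv_eq_addHaar_image volume hΩ.measurableSet
    (f' := fun z => deriv F z • (1 : ℂ →L[ℝ] ℂ)) (fun z hz =>
      ((hF.differentiableAt (hΩ.mem_nhds hz)).hasDerivAt.complexToReal_fderiv).hasFDerivWithinAt) hi]
  refine lintegral_congr fun z => ?_
  rw [det_smul_one, abs_of_nonneg (by positivity)]

/-- length of the image of the circle -/
noncomputable def clen (Ω : Set ℂ) (F : ℂ → ℂ) (c : ℂ) (ρ : ℝ) : ENNReal :=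
  ∫⁻ θ in Ioo (-Real.pi) Real.pi, Ω.indicator (fun z => ENNReal.ofReal (ρ * ‖deriv F z‖)) (circleMap c ρ θ)

lemma wolff {Ω : Set ℂ} (hΩ : IsOpen Ω) {F : ℂ → ℂ} (hF : DifferentiableOn ℂ F Ω) (hi : InjOn F Ω)
    {A : ℝ} (hA : volume (F '' Ω) ≤ ENNReal.ofReal A) (c : ℂ) {r R Λ : ℝ} (hr : 0 < r) (hrR : r < R) (hΛ : 0 < Λ)
    (hN : 2 * Real.pi * A < Λ^2 * Real.log (R / r)) :
    ∃ ρ ∈ Ioo r R, clen Ω F c ρ ≤ ENNReal.ofReal Λ := by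
  by_contra hcon
  push Not at hcon
  have hpi := Real.pi_pos
  set k := Ω.indicator (fun z => ENNReal.ofReal (‖deriv F z‖^2)) with hk
  have hkm : Measurable k :=
    Measurable.indicator (((measurable_deriv F).norm.pow_const 2).ennreal_ofReal) hΩ.measurableSet
  have h1 : ∫⁻ z, k z = ∫⁻ ρ in Ioi (0:ℝ), ∫⁻ θ in Ioo (-Real.pi) Real.pi,
      ENNReal.ofReal ρ * k (circleMap c ρ θ) := by
    rw [← lintegral_add_left_eq_self k c, ← Complex.lintegral_comp_polarCoord_symm, polarCoord_target,
      Measure.volume_eq_prod, setLIntegral_prod]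
    · refine lintegral_congr fun ρ => lintegral_congr fun θ => ?_
      rw [Complex.polarCoord_symm_apply, smul_eq_mul, circleMap, Complex.exp_mul_I, Complex.ofReal_cos, Complex.ofReal_sin]
    · apply Measurable.aemeasurable
      refine Measurable.mul (by fun_prop) (hkm.comp ?_)
      have hm : Measurable (fun p : ℝ × ℝ => Complex.polarCoord.symm p) := by
        rw [show (fun p : ℝ × ℝ => Complex.polarCoord.symm p) = _ from funext Complex.polarCoord_symm_apply]
        fun_prop
      exact hm.const_add c
  have hcl : ∀ ρ ∈ Ioo r R, ENNReal.ofReal (Λ^2/(2*Real.pi) * ρ⁻¹) ≤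
      ∫⁻ θ in Ioo (-Real.pi) Real.pi, ENNReal.ofReal ρ * k (circleMap c ρ θ) := by
    intro ρ hρ
    have hρ0 : 0 < ρ := hr.trans hρ.1
    have hl := hcon ρ hρ
    set m := Λ/(2*Real.pi) with hm
    have hm0 : 0 < m := by positivity
    have h2 : ENNReal.ofReal (2*m) * clen Ω F c ρ ≤
        ENNReal.ofReal ρ * (∫⁻ θ in Ioo (-Real.pi) Real.pi, ENNReal.ofReal ρ * k (circleMap c ρ θ)) +
          ENNReal.ofReal (m^2) * ENNReal.ofReal (2*Real.pi) := by
      have hvol : (ENNReal.ofReal (2*Real.pi)) = volume (Ioo (-Real.pi) Real.pi) := by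
        rw [Real.volume_Ioo]; congr 1; ring
      have hmk : Measurable fun θ : ℝ => k (circleMap c ρ θ) := hkm.comp (continuous_circleMap c ρ).measurable
      rw [hvol, ← setLIntegral_const, ← lintegral_const_mul _ (hmk.const_mul _), ← lintegral_add_right _ measurable_const, clen,
        ← lintegral_const_mul']
      · refine lintegral_mono fun θ => ?_
        by_cases hz : circleMap c ρ θ ∈ Ω
        · simp only [hk, indicator_of_mem hz]
          rw [← ENNReal.ofReal_mul hρ0.le, ← ENNReal.ofReal_mul hρ0.le, ← ENNReal.ofReal_mul (by positivity),
            ← ENNReal.ofReal_add (by positivity) (by positivity)]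
          apply ENNReal.ofReal_le_ofReal
          nlinarith [sq_nonneg (ρ * ‖deriv F (circleMap c ρ θ)‖ - m)]
        · simp only [indicator_of_notMem hz]; simp
      · exact ENNReal.ofReal_ne_top
    set a := ∫⁻ θ in Ioo (-Real.pi) Real.pi, ENNReal.ofReal ρ * k (circleMap c ρ θ) with ha
    by_cases hat : a = ⊤
    · rw [hat]; exact le_top
    rw [← ENNReal.ofReal_toReal hat]
    apply ENNReal.ofReal_le_ofReal
    have h3 : ENNReal.ofReal (2*m) * ENNReal.ofReal Λ ≤ ENNReal.ofReal (2*m) * clen Ω F c ρ := by gcongr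
    have h4 := h3.trans h2
    rw [← ENNReal.ofReal_toReal hat, ← ENNReal.ofReal_mul (by positivity), ← ENNReal.ofReal_mul (by positivity),
      ← ENNReal.ofReal_mul (by positivity), ← ENNReal.ofReal_add (by positivity) (by positivity),
      ENNReal.ofReal_le_ofReal_iff (by positivity)] at h4
    have e1 : m * (2*Real.pi) = Λ := by rw [hm]; field_simp
    have e2 : Λ^2/(2*Real.pi) = m * Λ := by rw [hm]; field_simp
    rw [e2, ← div_eq_mul_inv, div_le_iff₀ hρ0]
    have e3 : m^2 * (2*Real.pi) = m * Λ := by rw [← e1]; ring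
    linarith
  have h5 : ENNReal.ofReal (Λ^2/(2*Real.pi) * Real.log (R/r)) ≤ ENNReal.ofReal A := by
    calc ENNReal.ofReal (Λ^2/(2*Real.pi) * Real.log (R/r))
        = ∫⁻ ρ in Ioo r R, ENNReal.ofReal (Λ^2/(2*Real.pi) * ρ⁻¹) := by
          rw [← integral_inv_of_pos hr (hr.trans hrR), intervalIntegral.integral_of_le hrR.le,
            integral_Ioc_eq_integral_Ioo, ← integral_const_mul, ofReal_integral_eq_lintegral_ofReal]
          · have : IntegrableOn (fun x : ℝ => x⁻¹) (Icc r R) := by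
              apply ContinuousOn.integrableOn_Icc
              refine continuousOn_inv₀.mono fun x hx => ?_
              exact (lt_of_lt_of_le hr hx.1).ne'
            exact (this.mono_set Ioo_subset_Icc_self).const_mul _
          · filter_upwards [ae_restrict_mem measurableSet_Ioo] with x hx
            have : 0 < x := hr.trans hx.1
            simp only [Pi.zero_apply]; positivity
      _ ≤ ∫⁻ ρ in Ioo r R, ∫⁻ θ in Ioo (-Real.pi) Real.pi, ENNReal.ofReal ρ * k (circleMap c ρ θ) :=
          setLIntegral_mono' measurableSet_Ioo hcl
      _ ≤ ∫⁻ ρ in Ioi (0:ℝ), ∫⁻ θ in Ioo (-Real.pi) Real.pi, ENNReal.ofReal ρ * k (circleMap c ρ θ) :=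
          lintegral_mono_set fun x hx => hr.trans hx.1
      _ = volume (F '' Ω) := by rw [← h1, area_formula hΩ hF hi]
      _ ≤ _ := hA
  have hlog : 0 < Real.log (R/r) := Real.log_pos (by rw [lt_div_iff₀ hr]; linarith)
  have hA0 : 0 < A := by
    by_contra hA0
    rw [ENNReal.ofReal_eq_zero.2 (not_lt.1 hA0), nonpos_iff_eq_zero, ENNReal.ofReal_eq_zero] at h5
    have : 0 < Λ^2/(2*Real.pi) * Real.log (R/r) := by positivity
    linarith
  rw [ENNReal.ofReal_le_ofReal_iff hA0.le, div_mul_eq_mul_div, div_le_iff₀ (by positivity)] at h5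
  linarith

/-- existence of a scale -/
lemma wolff_scale (A : ℝ) {R Λ : ℝ} (hR : 0 < R) (hΛ : 0 < Λ) :
    ∃ r, 0 < r ∧ r < R ∧ 2 * Real.pi * A < Λ^2 * Real.log (R / r) := by
  set N := (2 * Real.pi * |A| + 1)/Λ^2 with hN
  have hN0 : 0 < N := by have := Real.pi_pos; positivity
  refine ⟨R * Real.exp (-N), by positivity, ?_, ?_⟩
  · have : Real.exp (-N) < 1 := by rw [Real.exp_lt_one_iff]; linarith
    nlinarith
  · have e : R / (R * Real.exp (-N)) = Real.exp N := by
      rw [Real.exp_neg]; field_simp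
    rw [e, Real.log_exp, hN, mul_div_cancel₀ _ (by positivity)]
    have := mul_le_mul_of_nonneg_left (le_abs_self A) (by positivity : 0 ≤ 2 * Real.pi)
    linarith

/-- image measure of a Lipschitz functional along the circle -/
lemma arc_image {Ω : Set ℂ} (hΩ : IsOpen Ω) {F : ℂ → ℂ} (hF : DifferentiableOn ℂ F Ω) {c : ℂ} {ρ : ℝ} (hρ : 0 < ρ)
    {E : Set ℂ} (hE : IsOpen E) {u : ℂ → ℝ} {K : ℝ} (hK : 0 ≤ K)
    (hu : ∀ w ∈ E, ∃ u' : ℂ →L[ℝ] ℝ, HasFDerivAt u u' w ∧ ‖u'‖ ≤ K) :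
    volume ((fun θ => u (F (circleMap c ρ θ))) '' {θ ∈ Ioo (-Real.pi) Real.pi | circleMap c ρ θ ∈ Ω ∧ F (circleMap c ρ θ) ∈ E})
      ≤ ENNReal.ofReal K * clen Ω F c ρ := by
  set S := {θ ∈ Ioo (-Real.pi) Real.pi | circleMap c ρ θ ∈ Ω ∧ F (circleMap c ρ θ) ∈ E} with hS
  have hO : IsOpen (Ω ∩ F ⁻¹' E) := hF.continuousOn.isOpen_inter_preimage hΩ hE
  have hSm : MeasurableSet S :=
    measurableSet_Ioo.inter ((hO.preimage (continuous_circleMap c ρ)).measurableSet)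
  choose! u' hu' hK' using hu
  have hd : ∀ θ ∈ S, HasDerivAt (fun θ => u (F (circleMap c ρ θ)))
      (u' (F (circleMap c ρ θ)) (deriv F (circleMap c ρ θ) * (circleMap 0 ρ θ * Complex.I))) θ := by
    intro θ hθ
    have h1 : HasDerivAt (fun θ => F (circleMap c ρ θ)) (deriv F (circleMap c ρ θ) * (circleMap 0 ρ θ * Complex.I)) θ :=
      ((hF.differentiableAt (hΩ.mem_nhds hθ.2.1)).hasDerivAt.scomp θ (hasDerivAt_circleMap c ρ θ)).congr_deriv (by
        rw [smul_eq_mul, mul_comm])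
    exact (hu' _ hθ.2.2).comp_hasDerivAt θ h1
  refine (addHaar_image_le_lintegral_abs_det_fderiv volume hSm (fun θ hθ => (hd θ hθ).hasFDerivAt.hasFDerivWithinAt)).trans ?_
  rw [clen, ← lintegral_const_mul' _ _ ENNReal.ofReal_ne_top]
  refine (setLIntegral_mono' hSm ?_).trans (lintegral_mono_set (fun θ hθ => hθ.1))
  intro θ hθ
  simp only [indicator_of_mem hθ.2.1]
  rw [← ENNReal.ofReal_mul hK]
  apply ENNReal.ofReal_le_ofReal
  have hdet : ∀ y : ℝ, (ContinuousLinearMap.toSpanSingleton ℝ y : ℝ →L[ℝ] ℝ).det = y := by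
    intro y; simp
  rw [hdet, ← Real.norm_eq_abs]
  refine (ContinuousLinearMap.le_opNorm _ _).trans ?_
  refine mul_le_mul (hK' _ hθ.2.2) ?_ (norm_nonneg _) hK
  simp [abs_of_pos hρ]
  linarith
end IsoExt
end

section
open Set Metric Topology Filter ComplexConjugate MeasureTheory
set_option linter.unusedSectionVars false
namespace IsoExt

/-- a pair of mutually inverse conformal maps between U and the disk -/
structure Conf (U : Set ℂ) (ψ φ : ℂ → ℂ) : Prop where
  isOpen : IsOpen U
  dψ : DifferentiableOn ℂ ψ U
  dφ : DifferentiableOn ℂ φ (ball 0 1)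
  mψ : ∀ z ∈ U, ‖ψ z‖ < 1
  mφ : ∀ w, ‖w‖ < 1 → φ w ∈ U
  left : ∀ z ∈ U, φ (ψ z) = z
  right : ∀ w, ‖w‖ < 1 → ψ (φ w) = w

lemma conf_of {U : Set ℂ} (hU : IsOpen U) {ψ : ℂ → ℂ} (hd : DifferentiableOn ℂ ψ U) (hi : InjOn ψ U)
    (him : ψ '' U = ball 0 1) : ∃ φ, Conf U ψ φ := by
  classical
  set φ := Function.invFunOn ψ U with hφ
  have hm : ∀ w, ‖w‖ < 1 → φ w ∈ U ∧ ψ (φ w) = w := by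
    intro w hw
    have : ∃ a ∈ U, ψ a = w := by
      have : w ∈ ψ '' U := by rw [him]; simpa using hw
      exact this
    exact ⟨Function.invFunOn_mem this, Function.invFunOn_eq this⟩
  have hlt : ∀ z ∈ U, ‖ψ z‖ < 1 := by
    intro z hz
    have : ψ z ∈ ψ '' U := ⟨z, hz, rfl⟩
    rw [him] at this; simpa using this
  have hl : ∀ z ∈ U, φ (ψ z) = z := fun z hz => hi (hm _ (hlt z hz)).1 hz (hm _ (hlt z hz)).2
  have hcont : ∀ w, ‖w‖ < 1 → ContinuousAt φ w := by
    intro w hw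
    rw [ContinuousAt, tendsto_def]
    intro s hs
    obtain ⟨t, hts, hto, hwt⟩ := _root_.mem_nhds_iff.1 hs
    have hV : IsOpen (t ∩ U) := hto.inter hU
    have h1 := open_map_of_inj hU hd hi inter_subset_right hV
    refine mem_of_superset (h1.mem_nhds ⟨φ w, ⟨hwt, (hm w hw).1⟩, (hm w hw).2⟩) ?_
    rintro _ ⟨q, hq, rfl⟩
    rw [mem_preimage, hl q hq.2]; exact hts hq.1
  have hgood : ∀ w, ‖w‖ < 1 → deriv ψ (φ w) ≠ 0 → DifferentiableAt ℂ φ w := by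
    intro w hw hne
    refine (HasDerivAt.of_local_left_inverse (hcont w hw)
      (hd.differentiableAt (hU.mem_nhds (hm w hw).1)).hasDerivAt hne ?_).differentiableAt
    have : ball (0:ℂ) 1 ∈ 𝓝 w := isOpen_ball.mem_nhds (by simpa using hw)
    filter_upwards [this] with v hv using (hm v (by simpa using hv)).2
  refine ⟨φ, hU, hd, ?_, hlt, fun w hw => (hm w hw).1, hl, fun w hw => (hm w hw).2⟩
  intro w hw
  have hw1 : ‖w‖ < 1 := by simpa using hw
  refine DifferentiableAt.differentiableWithinAt ?_
  have hq := (hm w hw1).1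
  have ha : AnalyticAt ℂ (deriv ψ) (φ w) := (hd.analyticAt (hU.mem_nhds hq)).deriv
  rcases ha.eventually_eq_zero_or_eventually_ne_zero with h | h
  · exfalso
    obtain ⟨ε, hε, hεU⟩ := Metric.eventually_nhds_iff_ball.1 (h.and (hU.mem_nhds hq))
    have hc : ∀ z ∈ ball (φ w) ε, ψ z = ψ (φ w) := fun z hz =>
      isOpen_ball.is_const_of_deriv_eq_zero (convex_ball _ _).isPreconnected
        (hd.mono fun y hy => (hεU y hy).2) (fun y hy => (hεU y hy).1) hz (mem_ball_self hε)
    have hz : φ w + (ε/2 : ℝ) ∈ ball (φ w) ε := by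
      simp [abs_of_pos hε]; linarith
    have := hi (hεU _ hz).2 hq (hc _ hz)
    have h3 : ((ε/2 : ℝ) : ℂ) = 0 := by linear_combination this
    rw [Complex.ofReal_eq_zero] at h3
    linarith
  · refine (Complex.analyticAt_of_differentiable_on_punctured_nhds_of_continuousAt ?_ (hcont w hw1)).differentiableAt
    rw [eventually_nhdsWithin_iff] at h ⊢
    have h1 := (hcont w hw1).eventually h
    have h2 : ball (0:ℂ) 1 ∈ 𝓝 w := isOpen_ball.mem_nhds hw
    filter_upwards [h1, h2] with v hv hv2 hvw
    have hv1 : ‖v‖ < 1 := by simpa using hv2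
    refine hgood v hv1 (hv ?_)
    intro heq
    apply hvw
    have := congrArg ψ (show φ v = φ w from heq)
    rwa [(hm v hv1).2, (hm w hw1).2] at this

lemma mob_inv {c w : ℂ} (hc : ‖c‖ < 1) (hw : ‖w‖ < 1) : mob (-c) (mob c w) = w := by
  have h1 := mob_den hc hw
  have h2 := mob_den hc hc
  rw [mob, mob, map_neg]
  have h3 : (1 - -conj c * ((w - c) / (1 - conj c * w))) = (1 - conj c * c) / (1 - conj c * w) := by
    field_simp; ring
  have h4 : (w - c) / (1 - conj c * w) - -c = w * (1 - conj c * c) / (1 - conj c * w) := by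
    rw [sub_neg_eq_add, div_add' _ _ _ h1]; congr 1; ring
  rw [h3, h4, div_div_div_cancel_right₀ h1, mul_div_assoc, div_self h2, mul_one]

lemma mob_diff {c : ℂ} (hc : ‖c‖ < 1) : DifferentiableOn ℂ (mob c) (ball 0 1) := fun w hw =>
  (mob_hasDerivAt hc (by simpa using hw)).differentiableAt.differentiableWithinAt

namespace Conf
variable {U : Set ℂ} {ψ φ : ℂ → ℂ}

lemma injψ (h : Conf U ψ φ) : InjOn ψ U := fun z hz w hw e => by rw [← h.left z hz, e, h.left w hw]
lemma injφ (h : Conf U ψ φ) : InjOn φ (ball 0 1) := fun z hz w hw e => by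
  rw [← h.right z (by simpa using hz), e, h.right w (by simpa using hw)]

lemma comp_mob (h : Conf U ψ φ) {c : ℂ} (hc : ‖c‖ < 1) :
    Conf U (fun z => mob c (ψ z)) (fun w => φ (mob (-c) w)) := by
  have hc' : ‖-c‖ < 1 := by rwa [norm_neg]
  refine ⟨h.isOpen, ?_, ?_, fun z hz => mob_norm hc (h.mψ z hz), fun w hw => h.mφ _ (mob_norm hc' hw), ?_, ?_⟩
  · exact (mob_diff hc).comp h.dψ fun z hz => by simpa using h.mψ z hz
  · exact h.dφ.comp (mob_diff hc') fun w hw => by simpa using mob_norm hc' (by simpa using hw)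
  · intro z hz
    beta_reduce
    rw [mob_inv hc (h.mψ z hz), h.left z hz]
  · intro w hw
    beta_reduce
    have := mob_inv hc' hw
    rw [neg_neg] at this
    rw [h.right _ (mob_norm hc' hw), this]

lemma proper (h : Conf U ψ φ) {s : ℝ} (hs : s < 1) : IsCompact {z ∈ U | ‖ψ z‖ ≤ s} := by
  have : {z ∈ U | ‖ψ z‖ ≤ s} = φ '' closedBall 0 s := by
    ext z
    constructor
    · rintro ⟨h1, h2⟩
      exact ⟨ψ z, by simpa using h2, h.left z h1⟩
    · rintro ⟨w, hw, rfl⟩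
      have hw' : ‖w‖ ≤ s := by simpa using hw
      exact ⟨h.mφ w (hw'.trans_lt hs), by rw [h.right w (hw'.trans_lt hs)]; exact hw'⟩
  rw [this]
  exact (isCompact_closedBall _ _).image_of_continuousOn (h.dφ.continuousOn.mono (closedBall_subset_ball hs))

open Classical in
/-- norm of ψ extended by 1 -/
noncomputable def nx (U : Set ℂ) (ψ : ℂ → ℂ) (z : ℂ) : ℝ := if z ∈ U then ‖ψ z‖ else 1

lemma nx_cont (h : Conf U ψ φ) : Continuous (nx U ψ) := by
  rw [continuous_iff_continuousAt]
  intro z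
  by_cases hz : z ∈ U
  · refine ((h.dψ.continuousOn.continuousAt (h.isOpen.mem_nhds hz)).norm).congr ?_
    filter_upwards [h.isOpen.mem_nhds hz] with w hw
    rw [nx, if_pos hw]
  · rw [ContinuousAt, Metric.tendsto_nhds]
    intro ε hε
    have hK := (h.proper (s := 1 - ε) (by linarith)).isClosed.isOpen_compl.mem_nhds (x := z) (fun h' => hz h'.1)
    filter_upwards [hK] with w hw
    have hzz : nx U ψ z = 1 := by rw [nx, if_neg hz]
    rw [hzz, nx]
    split_ifs with hwU
    · have h1 : ¬ (‖ψ w‖ ≤ 1 - ε) := fun h' => hw ⟨hwU, h'⟩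
      have h2 := h.mψ w hwU
      rw [Real.dist_eq, abs_lt]; constructor <;> linarith
    · simpa using hε

end Conf

lemma arc_lip {Ω : Set ℂ} (hΩ : IsOpen Ω) {F : ℂ → ℂ} (hF : DifferentiableOn ℂ F Ω) {c : ℂ} {ρ : ℝ} (hρ : 0 < ρ)
    {E : Set ℂ} (hE : IsOpen E) {u : ℂ → ℝ} {K : NNReal} (hu : ∀ w ∈ E, DifferentiableAt ℝ u w)
    (hL : LipschitzOnWith K u E) {a b Λ : ℝ} (hΛ : 0 ≤ Λ) (hlen : clen Ω F c ρ ≤ ENNReal.ofReal Λ)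
    (hcov : ∀ y ∈ Ioo a b, ∃ z ∈ sphere c ρ, z ∈ Ω ∧ F z ∈ E ∧ u (F z) = y) : b - a ≤ K * Λ := by
  have h1 := arc_image hΩ hF (c := c) hρ hE (u := u) (K := K) K.2 (fun w hw =>
    ⟨_, (hu w hw).hasFDerivAt, (hu w hw).hasFDerivAt.le_of_lipschitzOn (hE.mem_nhds hw) hL⟩)
  set S := {θ ∈ Ioo (-Real.pi) Real.pi | circleMap c ρ θ ∈ Ω ∧ F (circleMap c ρ θ) ∈ E} with hS
  have h2 : Ioo a b ⊆ ((fun θ => u (F (circleMap c ρ θ))) '' S) ∪ {u (F (circleMap c ρ Real.pi))} := by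
    intro y hy
    obtain ⟨z, hz, hz1, hz2, hz3⟩ := hcov y hy
    have hzc : z = circleMap c ρ (Complex.arg (z - c)) := by
      rw [circleMap, mem_sphere, dist_eq_norm] at *
      rw [← hz, Complex.norm_mul_exp_arg_mul_I]; ring
    by_cases hp : Complex.arg (z - c) = Real.pi
    · right
      rw [hp] at hzc
      rw [mem_singleton_iff, ← hzc, hz3]
    · left
      have ha := Complex.arg_mem_Ioc (z - c)
      exact ⟨Complex.arg (z - c), ⟨⟨ha.1, lt_of_le_of_ne ha.2 hp⟩, by rw [← hzc]; exact hz1, by rw [← hzc]; exact hz2⟩,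
        by beta_reduce; rw [← hzc, hz3]⟩
  have h3 := (measure_mono (μ := MeasureTheory.volume) h2).trans (measure_union_le _ _)
  rw [Real.volume_singleton, add_zero, Real.volume_Ioo] at h3
  have h4 : ENNReal.ofReal K * clen Ω F c ρ ≤ ENNReal.ofReal (K * Λ) := by
    rw [ENNReal.ofReal_mul K.coe_nonneg]; gcongr
  have h5 := (h3.trans h1).trans h4
  rwa [ENNReal.ofReal_le_ofReal_iff (by positivity)] at h5

lemma isOpen_half : IsOpen {w : ℂ | 1/2 < ‖w‖} := isOpen_lt continuous_const continuous_norm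

lemma half_ne {w : ℂ} (hw : w ∈ {w : ℂ | 1/2 < ‖w‖}) : w ≠ 0 := by
  rintro rfl
  rw [mem_ofPred_eq, norm_zero] at hw; linarith

lemma lip_dir {w v : ℂ} (hw : 1/2 < ‖w‖) (hv : 1/2 < ‖v‖) : ‖w / ‖w‖ - v / ‖v‖‖ ≤ 4 * ‖w - v‖ := by
  have hw0 : (‖w‖:ℂ) ≠ 0 := by exact_mod_cast (by linarith : (‖w‖:ℝ) ≠ 0)
  have hv0 : (‖v‖:ℂ) ≠ 0 := by exact_mod_cast (by linarith : (‖v‖:ℝ) ≠ 0)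
  have e : w / ‖w‖ - v / ‖v‖ = ((w - v) + (v/‖v‖) * ((‖v‖ - ‖w‖ : ℝ) : ℂ)) / ‖w‖ := by
    push_cast; field_simp; ring
  have hn : ‖v / (‖v‖:ℂ)‖ = 1 := by
    rw [norm_div, Complex.norm_real, norm_norm, div_self (by linarith)]
  rw [e, norm_div, Complex.norm_real, norm_norm, div_le_iff₀ (by linarith)]
  refine (norm_add_le _ _).trans ?_
  rw [norm_mul, hn, one_mul, Complex.norm_real, Real.norm_eq_abs]
  have h1 := abs_norm_sub_norm_le v w
  rw [norm_sub_rev] at h1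
  nlinarith [norm_nonneg (w - v)]

namespace Conf
variable {U : Set ℂ} {ψ φ : ℂ → ℂ}

lemma cap_norm (h : Conf U ψ φ) {c : ℂ} {ρ Λ : ℝ} (hρ : 0 < ρ) (hcirc : ∃ z ∈ sphere c ρ, z ∉ U) (hΛ : 0 ≤ Λ)
    (hΛ2 : Λ < 1/2) (hlen : clen U ψ c ρ ≤ ENNReal.ofReal Λ) {z1 : ℂ} (hz1 : z1 ∈ sphere c ρ) (hz1U : z1 ∈ U) :
    1 - Λ ≤ ‖ψ z1‖ := by
  obtain ⟨z0, hz0, hz0U⟩ := hcirc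
  have hconn : IsPreconnected (sphere c ρ) := isPreconnected_sphere (by rw [Complex.rank_real_complex]; norm_num) _ _
  have hivt := hconn.intermediate_value hz1 hz0 h.nx_cont.continuousOn
  have e1 : nx U ψ z1 = ‖ψ z1‖ := by rw [nx, if_pos hz1U]
  have e0 : nx U ψ z0 = 1 := by rw [nx, if_neg hz0U]
  rw [e1, e0] at hivt
  have := arc_lip h.isOpen h.dψ (c := c) hρ isOpen_half (u := fun w => ‖w‖) (K := 1)
    (fun w hw => differentiableAt_id.norm ℝ (half_ne hw))
    (LipschitzWith.lipschitzOnWith lipschitzWith_one_norm) (a := max (1/2) ‖ψ z1‖) (b := 1) hΛ hlen (by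
      intro y hy
      obtain ⟨z, hz, hzy⟩ := hivt ⟨(le_max_right _ _).trans hy.1.le, hy.2.le⟩
      have hzU : z ∈ U := by
        by_contra hzU
        rw [nx, if_neg hzU] at hzy
        linarith [hy.2]
      rw [nx, if_pos hzU] at hzy
      refine ⟨z, hz, hzU, ?_, hzy⟩
      rw [mem_ofPred_eq, hzy]
      exact (le_max_left _ _).trans_lt hy.1)
  simp only [NNReal.coe_one, one_mul] at this
  rcases max_choice (1/2) ‖ψ z1‖ with h' | h' <;> rw [h'] at this <;> linarith

lemma cap_ang (h : Conf U ψ φ) {c : ℂ} {ρ Λ : ℝ} (hρ : 0 < ρ) (hcirc : ∃ z ∈ sphere c ρ, z ∉ U) (hΛ : 0 ≤ Λ)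
    (hΛ2 : Λ < 1/2) (hlen : clen U ψ c ρ ≤ ENNReal.ofReal Λ) {e : ℂ} (he : ‖e‖ = 1) {β : ℝ}
    (hcov : ∀ y ∈ Ioo (1 - β) 1, ∃ z ∈ sphere c ρ, z ∈ U ∧ (conj e * (ψ z / ‖ψ z‖)).re = y) : β ≤ 4 * Λ := by
  have := arc_lip h.isOpen h.dψ (c := c) hρ isOpen_half (u := fun w => (conj e * (w / ‖w‖)).re) (K := 4)
    (fun w hw => by
      have h1 : DifferentiableAt ℝ (fun w : ℂ => ‖w‖⁻¹) w :=
        (differentiableAt_id.norm ℝ (half_ne hw)).fun_inv (by simpa using half_ne hw)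
      have h2 : DifferentiableAt ℝ (fun w : ℂ => conj e * (w / (‖w‖ : ℂ))) w := by
        have h3 : (fun w : ℂ => conj e * (w / (‖w‖ : ℂ))) = fun w : ℂ => conj e * ((‖w‖⁻¹ : ℝ) • w) := by
          funext w
          rw [Complex.real_smul, Complex.ofReal_inv]; ring
        rw [h3]
        exact (h1.smul differentiableAt_id).const_mul _
      exact Complex.reCLM.differentiableAt.comp w h2)
    (LipschitzOnWith.of_dist_le_mul fun w hw v hv => by
      rw [Real.dist_eq, ← Complex.sub_re, ← mul_sub, dist_eq_norm]
      refine (Complex.abs_re_le_norm _).trans ?_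
      rw [norm_mul, RCLike.norm_conj, he, one_mul]
      exact lip_dir hw hv) (a := 1 - β) (b := 1) hΛ hlen (by
      intro y hy
      obtain ⟨z, hz, hzU, hzy⟩ := hcov y hy
      refine ⟨z, hz, hzU, ?_, hzy⟩
      have := h.cap_norm hρ hcirc hΛ hΛ2 hlen hz hzU
      rw [mem_ofPred_eq]; linarith)
  have h4 : ((4:NNReal):ℝ) = 4 := rfl
  rw [h4] at this
  linarith

/-- the radial segment from base point o to q crosses the circle -/
lemma hit (h : Conf U ψ φ) {o : ℂ} (ho : o ∈ U) (ho0 : ψ o = 0) {c : ℂ} {ρ : ℝ} (hco : ρ < dist o c) {w : ℂ} (hw : ‖w‖ < 1)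
    (hq : dist (φ w) c < ρ) : ∃ s ∈ Ioo (0:ℝ) 1, φ (s * w) ∈ sphere c ρ := by
  have hn : ∀ s ∈ Icc (0:ℝ) 1, ‖(s:ℂ) * w‖ < 1 := by
    intro s hs
    rw [norm_mul, Complex.norm_real, Real.norm_of_nonneg hs.1]
    nlinarith [hs.2, norm_nonneg w]
  have hc : ContinuousOn (fun s : ℝ => dist (φ (s * w)) c) (Icc 0 1) := by
    refine continuous_dist.comp_continuousOn ((h.dφ.continuousOn.comp (by fun_prop) fun s hs => ?_).prodMk continuousOn_const)
    simpa using hn s hs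
  have hφ0 : φ 0 = o := by rw [← ho0, h.left o ho]
  obtain ⟨s, hs, hs1⟩ := intermediate_value_Icc' zero_le_one hc (show ρ ∈ _ by
    constructor
    · simpa using hq.le
    · simpa [hφ0] using hco.le)
  refine ⟨s, ⟨lt_of_le_of_ne hs.1 ?_, lt_of_le_of_ne hs.2 ?_⟩, hs1⟩
  · rintro rfl
    simp [hφ0] at hs1; linarith
  · rintro rfl
    simp at hs1; linarith

lemma cap (h : Conf U ψ φ) {o : ℂ} (ho : o ∈ U) (ho0 : ψ o = 0) {c : ℂ} {ρ Λ : ℝ} (hρ : 0 < ρ) (hco : ρ < dist o c)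
    (hcirc : ∃ z ∈ sphere c ρ, z ∉ U) (hΛ : 0 < Λ)
    (hΛ2 : Λ < 1/2) (hlen : clen U ψ c ρ ≤ ENNReal.ofReal Λ) {W : Set ℂ} (hWU : W ⊆ U) (hWb : W ⊆ ball c ρ)
    (hW : IsPreconnected W) {q q' : ℂ} (hq : q ∈ W) (hq' : q' ∈ W) :
    1 - Λ ≤ ‖ψ q‖ ∧ ‖ψ q - ψ q'‖ ≤ 2 * Λ + √(8 * Λ) := by
  have hhit : ∀ q ∈ W, ∃ z ∈ sphere c ρ, z ∈ U ∧ ∃ s ∈ Ioo (0:ℝ) 1, ψ z = s * ψ q := by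
    intro q hq
    have hw := h.mψ q (hWU hq)
    obtain ⟨s, hs, hs1⟩ := h.hit ho ho0 hco hw (by rw [h.left q (hWU hq)]; exact hWb hq)
    have hn : ‖(s:ℂ) * ψ q‖ < 1 := by
      rw [norm_mul, Complex.norm_real, Real.norm_of_nonneg hs.1.le]
      nlinarith [hs.2, norm_nonneg (ψ q)]
    exact ⟨_, hs1, h.mφ _ hn, s, hs, h.right _ hn⟩
  have hnorm : ∀ q ∈ W, 1 - Λ ≤ ‖ψ q‖ := by
    intro q hq
    obtain ⟨z, hz, hzU, s, hs, e⟩ := hhit q hq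
    have h1 := h.cap_norm hρ hcirc hΛ.le hΛ2 hlen hz hzU
    rw [e, norm_mul, Complex.norm_real, Real.norm_of_nonneg hs.1.le] at h1
    nlinarith [hs.2, norm_nonneg (ψ q)]
  refine ⟨hnorm q hq, ?_⟩
  have hne : ∀ q ∈ W, (‖ψ q‖:ℂ) ≠ 0 := by
    intro q hq
    have := hnorm q hq
    exact_mod_cast (by linarith : ‖ψ q‖ ≠ 0)
  have hu1 : ∀ q ∈ W, ‖ψ q / (‖ψ q‖:ℂ)‖ = 1 := by
    intro q hq
    have := hnorm q hq
    rw [norm_div, Complex.norm_real, norm_norm, div_self (by linarith)]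
  set e := ψ q / (‖ψ q‖:ℂ) with he
  set f : ℂ → ℝ := fun q => (conj e * (ψ q / ‖ψ q‖)).re with hf
  have hfc : ContinuousOn f W := by
    have hψ : ContinuousOn ψ W := h.dψ.continuousOn.mono hWU
    refine Complex.continuous_re.comp_continuousOn (continuousOn_const.mul (hψ.div ?_ hne))
    exact Complex.continuous_ofReal.comp_continuousOn hψ.norm
  have hfq : f q = 1 := by
    have : conj e * e = 1 := by
      rw [mul_comm, Complex.mul_conj, Complex.normSq_eq_norm_sq, hu1 q hq]; simp
    rw [hf]; beta_reduce; rw [← he, this]; simp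
  have hivt := hW.intermediate_value hq' hq hfc
  rw [hfq] at hivt
  have hβ := h.cap_ang hρ hcirc hΛ.le hΛ2 hlen (hu1 q hq) (β := 1 - f q') (by
    intro y hy
    obtain ⟨q1, hq1, hy1⟩ := hivt ⟨by linarith [hy.1], hy.2.le⟩
    obtain ⟨z, hz, hzU, s, hs, e1⟩ := hhit q1 hq1
    refine ⟨z, hz, hzU, ?_⟩
    rw [← hy1, hf]; beta_reduce
    have hs0 : (s:ℂ) ≠ 0 := by exact_mod_cast hs.1.ne'
    rw [e1, norm_mul, Complex.norm_real, Real.norm_of_nonneg hs.1.le, Complex.ofReal_mul, mul_div_mul_left _ _ hs0])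
  set e' := ψ q' / (‖ψ q'‖:ℂ) with he'
  have hd : ‖e - e'‖ ≤ √(8 * Λ) := by
    apply Real.le_sqrt_of_sq_le
    have h1 : ‖e - e'‖^2 = ‖e‖^2 + ‖e'‖^2 - 2 * (conj e * e').re := by
      simp only [Complex.sq_norm, Complex.normSq_apply]; simp; ring
    rw [h1, hu1 q hq, hu1 q' hq']
    have : f q' = (conj e * e').re := rfl
    rw [← this]; linarith
  have hr : ∀ q ∈ W, ‖ψ q - ψ q / (‖ψ q‖:ℂ)‖ ≤ Λ := by
    intro q hq
    have e1 : ψ q - ψ q / (‖ψ q‖:ℂ) = (ψ q / (‖ψ q‖:ℂ)) * ((‖ψ q‖ - 1 : ℝ):ℂ) := by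
      have := hne q hq
      push_cast; field_simp
    rw [e1, norm_mul, hu1 q hq, one_mul, Complex.norm_real, Real.norm_eq_abs, abs_le]
    have h1 := hnorm q hq
    have h2 := h.mψ q (hWU hq)
    constructor <;> linarith
  have a1 := hr q hq
  have a2 := hr q' hq'
  rw [norm_sub_rev] at a2
  have e2 : ψ q - ψ q' = (ψ q - e) + (e - e') + (e' - ψ q') := by ring
  rw [e2]
  refine (norm_add₃_le).trans ?_
  linarith

/-- uniform scale for caps -/
lemma cap_scale {η R : ℝ} (hη : 0 < η) (hR : 0 < R) : ∃ r, 0 < r ∧ r < R ∧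
    ∀ (U : Set ℂ) (ψ φ : ℂ → ℂ), Conf U ψ φ → ∀ o ∈ U, ψ o = 0 → ∀ c, R ≤ dist o c →
      (∀ ρ > 0, ∃ z ∈ sphere c ρ, z ∉ U) → ∀ W ⊆ U, W ⊆ ball c r → IsPreconnected W → ∀ q ∈ W, ∀ q' ∈ W,
        1 - η ≤ ‖ψ q‖ ∧ ‖ψ q - ψ q'‖ ≤ η := by
  obtain ⟨Λ, hΛ, hΛ2, hΛη, hΛη2⟩ : ∃ Λ : ℝ, 0 < Λ ∧ Λ < 1/2 ∧ Λ ≤ η ∧ 2 * Λ + √(8 * Λ) ≤ η := by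
    refine ⟨min (1/4) (min (η/4) (η^2/32)), by positivity, (min_le_left _ _).trans_lt (by norm_num), ?_, ?_⟩
    · exact (min_le_right _ _).trans ((min_le_left _ _).trans (by linarith))
    · set Λ := min (1/4:ℝ) (min (η/4) (η^2/32))
      have h1 : Λ ≤ η/4 := (min_le_right _ _).trans (min_le_left _ _)
      have h2 : Λ ≤ η^2/32 := (min_le_right _ _).trans (min_le_right _ _)
      have h3 : √(8 * Λ) ≤ η/2 := by
        apply Real.sqrt_le_iff.2 ⟨by linarith, by nlinarith⟩
      linarith
  obtain ⟨r, hr, hrR, hN⟩ := wolff_scale Real.pi hR hΛ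
  refine ⟨r, hr, hrR, fun U ψ φ h o ho ho0 c hoc hcirc W hWU hWb hW q hq q' hq' => ?_⟩
  have hA : volume (ψ '' U) ≤ ENNReal.ofReal Real.pi := by
    have h1 : ψ '' U ⊆ ball 0 1 := by
      rintro _ ⟨z, hz, rfl⟩; simpa using h.mψ z hz
    refine (measure_mono h1).trans ?_
    rw [Complex.volume_ball]
    simp [ENNReal.ofReal, NNReal.pi, Real.toNNReal_of_nonneg Real.pi_pos.le]
    exact le_rfl
  obtain ⟨ρ, hρ, hlen⟩ := wolff h.isOpen h.dψ h.injψ hA c hr hrR hΛ hN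
  have hρ0 := hr.trans hρ.1
  have := h.cap ho ho0 hρ0 (hρ.2.trans_le hoc) (hcirc ρ hρ0) hΛ hΛ2 hlen hWU
    (hWb.trans (ball_subset_ball hρ.1.le)) hW hq hq'
  exact ⟨by linarith [this.1], this.2.trans hΛη2⟩
end Conf
end IsoExt
end

section
open Set Metric Topology Filter ComplexConjugate MeasureTheory
set_option linter.unusedSectionVars false
namespace IsoExt

lemma Conf.unique {U : Set ℂ} {ψ φ ψ' φ' : ℂ → ℂ} (h : Conf U ψ φ) (h' : Conf U ψ' φ') (h0 : (0:ℂ) ∈ U) (hz : ψ 0 = 0)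
    (hz' : ψ' 0 = 0) (hr : 0 < (deriv ψ 0).re) (hi : (deriv ψ 0).im = 0) (hr' : 0 ≤ (deriv ψ' 0).re)
    (hi' : (deriv ψ' 0).im = 0) : (∀ z ∈ U, ψ' z = ψ z) ∧ ∀ w, ‖w‖ < 1 → φ' w = φ w := by
  have key : ∀ z ∈ U, ψ' z = ψ z := by
    have hs : ∀ (a b a' b' : ℂ → ℂ), Conf U a b → Conf U a' b' → a 0 = 0 → a' 0 = 0 →
        DifferentiableOn ℂ (a' ∘ b) (ball 0 1) ∧ MapsTo (a' ∘ b) (ball 0 1) (closedBall 0 1) ∧ (a' ∘ b) 0 = 0 := by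
      intro a b a' b' h h' h1 h2
      refine ⟨h'.dψ.comp h.dφ fun w hw => h.mφ w (by simpa using hw), fun w hw => ?_, ?_⟩
      · simpa using (h'.mψ _ (h.mφ w (by simpa using hw))).le
      · have : b 0 = 0 := by
          have := h.left 0 h0
          rwa [h1] at this
        simp [this, h2]
    obtain ⟨a1, a2, a3⟩ := hs ψ φ ψ' φ' h h' hz hz'
    obtain ⟨b1, b2, b3⟩ := hs ψ' φ' ψ φ h' h hz' hz
    have hhalf : ‖(1/2 : ℂ)‖ < 1 := by norm_num
    have e1 : ‖ψ' (φ (1/2))‖ ≤ ‖(1/2:ℂ)‖ := Complex.norm_le_norm_of_mapsTo_ball a1 a2 a3 hhalf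
    have hm := h.mφ _ hhalf
    have e2 : ‖ψ (φ' (ψ' (φ (1/2))))‖ ≤ ‖ψ' (φ (1/2))‖ :=
      Complex.norm_le_norm_of_mapsTo_ball b1 b2 b3 (h'.mψ _ hm)
    rw [h'.left _ hm, h.right _ hhalf] at e2
    have e3 : ‖ψ' (φ (1/2))‖ = ‖(1/2:ℂ)‖ := le_antisymm e1 e2
    have hds : dslope (ψ' ∘ φ) 0 (1/2) = 2 * ψ' (φ (1/2)) := by
      rw [dslope_of_ne _ (by norm_num), slope_def_module, a3]
      simp
    have aff := Complex.affine_of_mapsTo_ball_of_norm_dslope_eq_div a1 (R₂ := 1) (by rwa [a3])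
      (z₀ := 1/2) (by simpa using hhalf) (by rw [hds, norm_mul, e3]; norm_num)
    rw [hds, a3] at aff
    set C := 2 * ψ' (φ (1/2)) with hC
    have hCn : ‖C‖ = 1 := by rw [hC, norm_mul, e3]; norm_num
    have hall : ∀ z ∈ U, ψ' z = C * ψ z := by
      intro z hzU
      have := aff (show ψ z ∈ ball 0 1 by simpa using h.mψ z hzU)
      simp only [Function.comp, h.left z hzU] at this
      rw [this, smul_eq_mul]; ring
    have hder : deriv ψ' 0 = C * deriv ψ 0 := by
      have he : ψ' =ᶠ[𝓝 0] fun z => C * ψ z := by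
        filter_upwards [h.isOpen.mem_nhds h0] with z hz using hall z hz
      rw [he.deriv_eq, deriv_const_mul]
      exact h.dψ.differentiableAt (h.isOpen.mem_nhds h0)
    have hre := congr_arg Complex.re hder
    have him := congr_arg Complex.im hder
    rw [Complex.mul_re, hi, mul_zero, sub_zero] at hre
    rw [Complex.mul_im, hi, mul_zero, zero_add, hi'] at him
    have hCi : C.im = 0 := by
      rcases mul_eq_zero.1 him.symm with h | h
      · exact h
      · linarith
    have hCr : 0 ≤ C.re := by
      by_contra hc
      push Not at hc
      nlinarith
    have hC1 : C = 1 := by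
      have hCe : C = (C.re : ℂ) := by apply Complex.ext <;> simp [hCi]
      rw [hCe, Complex.norm_real, Real.norm_of_nonneg hCr] at hCn
      rw [hCe, hCn]; simp
    intro z hz; rw [hall z hz, hC1, one_mul]
  refine ⟨key, fun w hw => ?_⟩
  have := h.mφ w hw
  rw [← h'.left _ this, key _ this, h.right w hw]

lemma unif_tendsto {ι : Type*} {𝒰 : Filter ι} {f : ι → ℂ → ℂ} {F : ℂ → ℂ} {z : ℂ} {r : ℝ} (hr : 0 < r)
    (hu : TendstoUniformlyOn f F 𝒰 (ball z r)) (hF : ContinuousAt F z) {Q : ι → ℂ} (hQ : Tendsto Q 𝒰 (𝓝 z)) :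
    Tendsto (fun i => f i (Q i)) 𝒰 (𝓝 (F z)) := by
  rw [Metric.tendsto_nhds]
  intro ε hε
  rw [Metric.tendstoUniformlyOn_iff] at hu
  filter_upwards [hu (ε/2) (half_pos hε), hQ (ball_mem_nhds z hr),
    Metric.tendsto_nhds.1 (hF.tendsto.comp hQ) (ε/2) (half_pos hε)] with i h1 h2 h3
  have h4 := h1 (Q i) h2
  simp only [Function.comp] at h3
  calc dist (f i (Q i)) (F z) ≤ dist (f i (Q i)) (F (Q i)) + dist (F (Q i)) (F z) := dist_triangle _ _ _
    _ < ε := by rw [dist_comm (f i (Q i))]; linarith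

namespace Isot
variable {X : Type*} [MetricSpace X] [CompactSpace X] {G : Isot X}

lemma Nice.no_ray (hn : G.Nice) {t : unitInterval} {q c : ℂ} (hq : q ∈ G.D t)
    (h : ∀ z, dist (G.g t z) c < dist q c) (hne : q ≠ c) : False := by
  set C : Set ℂ := (fun s : ℝ => c + s * (q - c)) '' Ici 1 with hC
  have hCp : IsPreconnected C := isPreconnected_Ici.image _ (by fun_prop)
  have hd : ∀ s : ℝ, dist (c + s * (q - c)) c = |s| * dist q c := by
    intro s
    rw [dist_eq_norm, add_sub_cancel_left, norm_mul, Complex.norm_real, Real.norm_eq_abs, dist_eq_norm]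
  have hsub := hn.D_max hCp (t := t) (by
    rw [Set.disjoint_left]
    rintro _ ⟨s, hs, rfl⟩ ⟨z, hz⟩
    have h1 := h z
    rw [hz, hd, abs_of_nonneg (by linarith [mem_Ici.1 hs])] at h1
    nlinarith [mem_Ici.1 hs, dist_nonneg (x := q) (y := c)]) (p := q) ⟨1, by simp, by simp⟩ hq
  obtain ⟨M, hM⟩ := (hn.D_bounded t).subset_ball c
  have hdp : 0 < dist q c := dist_pos.2 hne
  have h2 := hM (hsub ⟨max 1 (M / dist q c), by simp, rfl⟩)
  rw [mem_ball, hd, abs_of_nonneg (by positivity)] at h2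
  have h3 : M / dist q c * dist q c ≤ max 1 (M / dist q c) * dist q c := by
    gcongr; exact le_max_right _ _
  rw [div_mul_cancel₀ _ hdp.ne'] at h3
  linarith

lemma Nice.circ (hn : G.Nice) [PreconnectedSpace X] (t : unitInterval) (x : X) {ρ : ℝ} (hρ : 0 < ρ) :
    ∃ z ∈ sphere (G.g t x) ρ, z ∉ G.D t := by
  by_contra hcon
  push Not at hcon
  have hb : ∀ z, dist (G.g t z) (G.g t x) < ρ := by
    intro z
    by_contra hz
    push Not at hz
    have hc : Continuous fun z => dist (G.g t z) (G.g t x) := (G.cont_t t).dist continuous_const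
    obtain ⟨y, hy⟩ := mem_range_of_exists_le_of_exists_ge hc ⟨x, by simpa using hρ.le⟩ ⟨z, hz⟩
    exact hn.D_notMem (hcon _ hy) ⟨y, rfl⟩
  have hs : G.g t x + (ρ : ℂ) ∈ sphere (G.g t x) ρ := by simp [abs_of_pos hρ]
  refine hn.no_ray (c := G.g t x) (hcon _ hs) (fun z => ?_) (fun h => hρ.ne' (by simpa using h))
  rw [mem_sphere.1 hs]; exact hb z

lemma Nice.exists_lower [Nonempty X] (hn : G.Nice) : ∃ R > 0, ∀ t z, R ≤ ‖G.g t z‖ := by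
  obtain ⟨p, -, hp⟩ := isCompact_univ.exists_isMinOn (univ_nonempty (α := unitInterval × X))
    (G.cont.norm).continuousOn
  exact ⟨_, norm_pos_iff.2 (hn.ne0 p.1 p.2), fun t z => hp (mem_univ (t, z))⟩

lemma exists_upper (G : Isot X) : ∃ M, ∀ t z, ‖G.g t z‖ ≤ M := by
  obtain ⟨M, hM⟩ := (_root_.isCompact_range G.cont).isBounded.exists_norm_le
  exact ⟨M, fun t z => hM _ ⟨(t, z), rfl⟩⟩

lemma Nice.exists_D_bound (hn : G.Nice) : ∃ M, ∀ t, ∀ q ∈ G.D t, ‖q‖ ≤ M := by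
  obtain ⟨M, hM⟩ := G.exists_upper
  refine ⟨max M 0, fun t q hq => ?_⟩
  by_contra hcon
  push Not at hcon
  refine hn.no_ray (c := 0) hq (fun z => ?_) ?_
  · rw [dist_zero_right, dist_zero_right]
    exact ((hM t z).trans (le_max_left _ _)).trans_lt hcon
  · rintro rfl
    simp at hcon

variable (G) in
structure RM where
  ψ : unitInterval → ℂ → ℂ
  φ : unitInterval → ℂ → ℂ
  conf : ∀ t, Conf (G.D t) (ψ t) (φ t)
  zero : ∀ t, ψ t 0 = 0
  re : ∀ t, 0 < (deriv (ψ t) 0).re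
  im : ∀ t, (deriv (ψ t) 0).im = 0

lemma Nice.exists_RM (hn : G.Nice) [PreconnectedSpace X] : Nonempty G.RM := by
  have h : ∀ t, ∃ ψ φ, Conf (G.D t) ψ φ ∧ ψ 0 = 0 ∧ 0 < (deriv ψ 0).re ∧ (deriv ψ 0).im = 0 := by
    intro t
    obtain ⟨ψ, h1, h2, h3, h4⟩ := riemann_map (hn.D_open t) (hn.D_preconn t) (hn.D_bounded t) (zero_mem_D t) (hn.logProp t)
    obtain ⟨φ, hφ⟩ := conf_of (hn.D_open t) h1.diff h1.inj h2
    exact ⟨ψ, φ, hφ, h1.zero, h3, h4⟩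
  choose ψ φ h1 h2 h3 h4 using h
  exact ⟨⟨ψ, φ, h1, h2, h3, h4⟩⟩

namespace RM
variable (A : G.RM)

lemma φ_zero (t : unitInterval) : A.φ t 0 = 0 := by
  have := (A.conf t).left 0 (zero_mem_D t)
  rwa [A.zero] at this

lemma proper (hn : G.Nice) [ConnectedSpace X] {s : ℝ} (hs : s < 1) :
    ∃ δ > 0, ∀ t, ∀ q ∈ G.D t, ‖A.ψ t q‖ ≤ s → ∀ z, δ ≤ dist q (G.g t z) := by
  obtain ⟨R, hR, hRg⟩ := hn.exists_lower
  obtain ⟨r, hr, -, h⟩ := Conf.cap_scale (η := (1 - s)/2) (by linarith) hR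
  refine ⟨r, hr, fun t q hq hqs z => ?_⟩
  by_contra hcon
  push Not at hcon
  have := (h _ _ _ (A.conf t) 0 (zero_mem_D t) (A.zero t) (G.g t z) (by rw [dist_zero_left]; exact hRg t z)
    (fun ρ hρ => hn.circ t z hρ) {q} (by simpa using hq) (by simpa using hcon) isPreconnected_singleton q rfl q rfl).1
  linarith

lemma kernel (hn : G.Nice) [ConnectedSpace X] {ι : Type*} (𝒰 : Ultrafilter ι) {τ : ι → unitInterval} {t0 : unitInterval}
    (hτ : Tendsto τ 𝒰 (𝓝 t0)) :
    (∀ (Q : ι → ℂ) (q0 : ℂ), q0 ∈ G.D t0 → Tendsto Q 𝒰 (𝓝 q0) → Tendsto (fun i => A.ψ (τ i) (Q i)) 𝒰 (𝓝 (A.ψ t0 q0))) ∧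
    (∀ (Q : ι → ℂ) (q0 : ℂ), ‖q0‖ < 1 → Tendsto Q 𝒰 (𝓝 q0) → Tendsto (fun i => A.φ (τ i) (Q i)) 𝒰 (𝓝 (A.φ t0 q0))) := by
  obtain ⟨M, hM⟩ := hn.exists_D_bound
  have hsub : ∀ z ∈ G.D t0, ∃ r > 0, ∀ᶠ i in (𝒰 : Filter ι), ball z r ⊆ G.D (τ i) := by
    intro z hz
    have h1 := hn.D_joint t0 (hn.D_notMem hz)
    rw [nhds_prod_eq, Filter.eventually_prod_iff] at h1
    obtain ⟨p, hp, p', hp', h2⟩ := h1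
    obtain ⟨r, hr, hr'⟩ := Metric.eventually_nhds_iff_ball.1 hp'
    refine ⟨r, hr, ?_⟩
    filter_upwards [hτ hp] with i hi q hq
    exact (h2 hi (hr' q hq)).2 hz
  obtain ⟨Ψ, Ψd, Ψb, Ψt, Ψu⟩ := montel 𝒰 (U := G.D t0) (f := fun i => A.ψ (τ i)) (M := 1) (fun z hz => by
    obtain ⟨r, hr, h⟩ := hsub z hz
    refine ⟨r, hr, ?_⟩
    filter_upwards [h] with i hi
    exact ⟨(A.conf _).dψ.mono hi, fun w hw => ((A.conf _).mψ w (hi hw)).le⟩) (hn.D_open t0)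
  obtain ⟨Φ, Φd, Φb, Φt, Φu⟩ := montel 𝒰 (U := ball 0 1) (f := fun i => A.φ (τ i)) (M := M) (fun z hz => by
    obtain ⟨r, hr, h⟩ := Metric.isOpen_iff.1 isOpen_ball z hz
    refine ⟨r, hr, Eventually.of_forall fun i => ?_⟩
    exact ⟨(A.conf _).dφ.mono h, fun w hw => hM _ _ ((A.conf _).mφ w (by simpa using h hw))⟩) isOpen_ball
  have Φc : ∀ w, ‖w‖ < 1 → ContinuousAt Φ w := fun w hw =>
    (Φd.differentiableAt (isOpen_ball.mem_nhds (by simpa using hw))).continuousAt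
  have Ψc : ∀ w ∈ G.D t0, ContinuousAt Ψ w := fun w hw =>
    (Ψd.differentiableAt ((hn.D_open t0).mem_nhds hw)).continuousAt
  have Φ0 : Φ 0 = 0 := by
    have h1 := Φt 0 (by simp)
    simp only [A.φ_zero] at h1
    exact (tendsto_nhds_unique h1 tendsto_const_nhds)
  have Φnot : ∀ w, ‖w‖ < 1 → Φ w ∉ range (G.g t0) := by
    rintro w hw ⟨z, hz⟩
    obtain ⟨δ, hδ, h⟩ := A.proper hn hw
    have h1 : Tendsto (fun i => dist (A.φ (τ i) w) (G.g (τ i) z)) 𝒰 (𝓝 (dist (Φ w) (G.g t0 z))) := by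
      refine (Φt w (by simpa using hw)).dist ?_
      have : Continuous fun t => G.g t z := G.cont.comp (Continuous.prodMk_left z)
      exact (this.tendsto t0).comp hτ
    have h2 := ge_of_tendsto' h1 (b := δ) fun i => h _ _ ((A.conf _).mφ w hw) (by rw [(A.conf _).right w hw]) z
    rw [hz, dist_self] at h2; linarith
  have ΦD : ∀ w, ‖w‖ < 1 → Φ w ∈ G.D t0 := by
    have hp : IsPreconnected (Φ '' ball 0 1) := (convex_ball _ _).isPreconnected.image _ Φd.continuousOn
    have := hn.D_max hp (t := t0) (by
      rw [Set.disjoint_left]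
      rintro _ ⟨w, hw, rfl⟩
      exact Φnot w (by simpa using hw)) (p := 0) ⟨0, by simp, Φ0⟩ (zero_mem_D t0)
    exact fun w hw => this ⟨w, by simpa using hw, rfl⟩
  have ΨΦ : ∀ w, ‖w‖ < 1 → Ψ (Φ w) = w := by
    intro w hw
    obtain ⟨r, hr, -, hu⟩ := Ψu _ (ΦD w hw)
    have h1 := unif_tendsto hr hu (Ψc _ (ΦD w hw)) (Φt w (by simpa using hw))
    simp only [(A.conf _).right w hw] at h1
    exact (tendsto_nhds_unique h1 tendsto_const_nhds)
  have Ψ0 : Ψ 0 = 0 := by have := ΨΦ 0 (by simp); rwa [Φ0] at this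
  have Ψi : InjOn Ψ (G.D t0) := by
    rcases hurwitz_inj (hn.D_open t0) (hn.D_preconn t0) Ψu (fun a ha b hb => by
      obtain ⟨r1, hr1, h1⟩ := hsub a ha
      obtain ⟨r2, hr2, h2⟩ := hsub b hb
      refine ⟨min r1 r2, lt_min hr1 hr2, ?_⟩
      filter_upwards [h1, h2] with i h1 h2
      exact (A.conf _).injψ.mono (union_subset ((ball_subset_ball (min_le_left _ _)).trans h1)
        ((ball_subset_ball (min_le_right _ _)).trans h2))) with h | ⟨c, hc⟩
    · exact h
    · exfalso
      have h1 := ΨΦ (1/2) (by norm_num)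
      have h2 := ΨΦ 0 (by norm_num)
      rw [hc _ (ΦD _ (by norm_num))] at h1 h2
      rw [h1] at h2; norm_num at h2
  have Ψlt : ∀ z ∈ G.D t0, ‖Ψ z‖ < 1 := by
    intro z hz
    have h1 : Ψ '' G.D t0 ⊆ interior (closedBall 0 1) := by
      refine interior_maximal ?_ (open_map_of_inj (hn.D_open t0) Ψd Ψi subset_rfl (hn.D_open t0))
      rintro _ ⟨w, hw, rfl⟩
      simpa using Ψb w hw
    rw [interior_closedBall _ one_ne_zero] at h1
    simpa using h1 ⟨z, hz, rfl⟩
  have hc : Conf (G.D t0) Ψ Φ := ⟨hn.D_open t0, Ψd, Φd, Ψlt, ΦD, fun z hz =>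
    Ψi (ΦD _ (Ψlt z hz)) hz (ΨΦ _ (Ψlt z hz)), ΨΦ⟩
  have hder : Tendsto (fun i => deriv (A.ψ (τ i)) 0) 𝒰 (𝓝 (deriv Ψ 0)) := by
    obtain ⟨r, hr, hd, hu⟩ := Ψu 0 (zero_mem_D t0)
    exact tendsto_deriv_of_unif hr hd hu
  have hu := (A.conf t0).unique hc (zero_mem_D t0) (A.zero t0) Ψ0 (A.re t0) (A.im t0)
    (ge_of_tendsto' ((Complex.continuous_re.tendsto _).comp hder) fun i => (A.re _).le)
    (by
      have h1 := (Complex.continuous_im.tendsto _).comp hder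
      have h2 : (Complex.im ∘ fun i => deriv (A.ψ (τ i)) 0) = fun _ => 0 := by funext i; exact A.im _
      rw [h2] at h1
      exact (tendsto_nhds_unique h1 tendsto_const_nhds))
  constructor
  · intro Q q0 hq hQ
    obtain ⟨r, hr, -, h⟩ := Ψu q0 hq
    rw [← hu.1 q0 hq]
    exact unif_tendsto hr h (Ψc _ hq) hQ
  · intro Q q0 hq hQ
    obtain ⟨r, hr, -, h⟩ := Φu q0 (by simpa using hq)
    rw [← hu.2 q0 hq]
    exact unif_tendsto hr h (Φc _ hq) hQ

lemma ψ_cont (hn : G.Nice) [ConnectedSpace X] {t0 : unitInterval} {q0 : ℂ} (hq : q0 ∈ G.D t0) :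
    ContinuousAt (fun p : unitInterval × ℂ => A.ψ p.1 p.2) (t0, q0) := by
  rw [ContinuousAt, tendsto_iff_ultrafilter]
  intro 𝒰 h𝒰
  exact (A.kernel hn 𝒰 (τ := Prod.fst) ((continuous_fst.tendsto (t0, q0)).comp h𝒰)).1 Prod.snd q0 hq
    ((continuous_snd.tendsto (t0, q0)).comp h𝒰)

lemma φ_cont (hn : G.Nice) [ConnectedSpace X] {t0 : unitInterval} {q0 : ℂ} (hq : ‖q0‖ < 1) :
    ContinuousAt (fun p : unitInterval × ℂ => A.φ p.1 p.2) (t0, q0) := by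
  rw [ContinuousAt, tendsto_iff_ultrafilter]
  intro 𝒰 h𝒰
  exact (A.kernel hn 𝒰 (τ := Prod.fst) ((continuous_fst.tendsto (t0, q0)).comp h𝒰)).2 Prod.snd q0 hq
    ((continuous_snd.tendsto (t0, q0)).comp h𝒰)
end RM
end Isot
end IsoExt
end

section
open Set Metric Topology Filter ComplexConjugate MeasureTheory
set_option linter.unusedSectionVars false
namespace IsoExt

namespace Isot
variable {X : Type*} [MetricSpace X] [CompactSpace X] {G : Isot X}

namespace RM
variable (A : G.RM)

lemma cap (hn : G.Nice) [ConnectedSpace X] {η : ℝ} (hη : 0 < η) :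
    ∃ r > 0, ∀ t (x : X), ∀ W ⊆ G.D t, W ⊆ ball (G.g t x) r → IsPreconnected W → ∀ q ∈ W, ∀ q' ∈ W,
      1 - η ≤ ‖A.ψ t q‖ ∧ ‖A.ψ t q - A.ψ t q'‖ ≤ η := by
  obtain ⟨R, hR, hRg⟩ := hn.exists_lower
  obtain ⟨r, hr, -, h⟩ := Conf.cap_scale hη hR
  refine ⟨r, hr, fun t x W hWD hWb hW => ?_⟩
  exact h _ _ _ (A.conf t) 0 (zero_mem_D t) (A.zero t) (G.g t x) (by rw [dist_zero_left]; exact hRg t x)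
    (fun ρ hρ => hn.circ t x hρ) W hWD hWb hW

lemma exists_bd (hn : G.Nice) [ConnectedSpace X] (e : G.End) (t : unitInterval) :
    ∃ ζ : ℂ, ‖ζ‖ = 1 ∧ ∀ η > 0, ∀ r0 > 0, (∀ q ∈ e.W t r0, ∀ q' ∈ e.W t r0, ‖A.ψ t q - A.ψ t q'‖ ≤ η) →
      ∀ q ∈ e.W t r0, ‖A.ψ t q - ζ‖ ≤ η := by
  have hpos : ∀ n : ℕ, (0:ℝ) < 1 / (n + 1) := fun n => by positivity
  choose Q hQ using fun n : ℕ => e.ne t _ (hpos n)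
  have hlim : Tendsto (fun n : ℕ => (1:ℝ) / (n + 1)) (hyperfilter ℕ) (𝓝 0) :=
    tendsto_one_div_add_atTop_nhds_zero_nat.mono_left (by rw [← Nat.cofinite_eq_atTop]; exact hyperfilter_le_cofinite)
  have hQr : ∀ r > 0, ∀ᶠ n in (hyperfilter ℕ : Filter ℕ), Q n ∈ e.W t r := by
    intro r hr
    filter_upwards [hlim.eventually (gt_mem_nhds hr)] with n hn'
    exact W_mono_self (hpos n) hn'.le (hQ n)
  obtain ⟨ζ, -, hζ⟩ := (isCompact_closedBall (0:ℂ) 1).ultrafilter_le_nhds ((hyperfilter ℕ).map fun n => A.ψ t (Q n)) (by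
    rw [le_principal_iff, Ultrafilter.mem_coe, Ultrafilter.mem_map]
    refine Filter.univ_mem' fun n => ?_
    simpa using ((A.conf t).mψ _ (W_subset_D (hQ n))).le)
  have hζ : Tendsto (fun n => A.ψ t (Q n)) (hyperfilter ℕ) (𝓝 ζ) := hζ
  refine ⟨ζ, ?_, fun η hη r0 hr0 h q hq => ?_⟩
  · refine le_antisymm (le_of_tendsto' hζ.norm fun n => ((A.conf t).mψ _ (W_subset_D (hQ n))).le) ?_
    refine le_of_forall_pos_sub_le fun η hη => ?_
    obtain ⟨r, hr, hc⟩ := A.cap hn hη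
    refine ge_of_tendsto hζ.norm ?_
    filter_upwards [hQr r hr] with n hq
    exact (hc t e.x _ W_subset_D W_subset_ball (hn.W_preconn _ _ _ _) _ hq _ hq).1
  · have h1 : Tendsto (fun n => ‖A.ψ t q - A.ψ t (Q n)‖) (hyperfilter ℕ) (𝓝 ‖A.ψ t q - ζ‖) :=
      (tendsto_const_nhds.sub hζ).norm
    refine le_of_tendsto h1 ?_
    filter_upwards [hQr r0 hr0] with n hq'
    exact h q hq _ hq'

open Classical in
/-- boundary value of an end -/
noncomputable def bd (A : G.RM) (e : G.End) (t : unitInterval) : ℂ :=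
  if h : ∃ ζ : ℂ, ‖ζ‖ = 1 ∧ ∀ η > 0, ∀ r0 > 0, (∀ q ∈ e.W t r0, ∀ q' ∈ e.W t r0, ‖A.ψ t q - A.ψ t q'‖ ≤ η) →
      ∀ q ∈ e.W t r0, ‖A.ψ t q - ζ‖ ≤ η then h.choose else 0

lemma bd_spec (hn : G.Nice) [ConnectedSpace X] (e : G.End) (t : unitInterval) :
    ‖A.bd e t‖ = 1 ∧ ∀ η > 0, ∀ r0 > 0, (∀ q ∈ e.W t r0, ∀ q' ∈ e.W t r0, ‖A.ψ t q - A.ψ t q'‖ ≤ η) →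
      ∀ q ∈ e.W t r0, ‖A.ψ t q - A.bd e t‖ ≤ η := by
  rw [bd, dif_pos (A.exists_bd hn e t)]
  exact (A.exists_bd hn e t).choose_spec

lemma bd_unif (hn : G.Nice) [ConnectedSpace X] {η : ℝ} (hη : 0 < η) :
    ∃ r0 > 0, ∀ (e : G.End) t, ∀ q ∈ e.W t r0, ‖A.ψ t q - A.bd e t‖ ≤ η := by
  obtain ⟨r, hr, hc⟩ := A.cap hn hη
  exact ⟨r, hr, fun e t => (A.bd_spec hn e t).2 η hη r hr fun q hq q' hq' =>
    (hc t e.x _ W_subset_D W_subset_ball (hn.W_preconn _ _ _ _) q hq q' hq').2⟩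

lemma bd_cont (hn : G.Nice) [ConnectedSpace X] (e : G.End) : Continuous (A.bd e) := by
  rw [continuous_iff_continuousAt]
  intro t0
  rw [ContinuousAt, Metric.tendsto_nhds]
  intro ε hε
  obtain ⟨r, hr, h⟩ := A.bd_unif hn (η := ε/4) (by linarith)
  obtain ⟨q, hq⟩ := e.ne t0 r hr
  have hc : ContinuousAt (fun t => A.ψ t q) t0 :=
    (A.ψ_cont hn (W_subset_D hq)).comp (f := fun t : unitInterval => (t, q)) (Continuous.prodMk_left q).continuousAt
  filter_upwards [e.toPreEnd.W_time hn hr hq, Metric.tendsto_nhds.1 hc (ε/4) (by linarith)] with t h1 h2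
  have h3 := h e t q h1
  have h4 := h e t0 q hq
  rw [← dist_eq_norm] at h3 h4
  rw [dist_comm] at h3
  linarith [dist_triangle4 (A.bd e t) (A.ψ t q) (A.ψ t0 q) (A.bd e t0)]

lemma near (hn : G.Nice) [ConnectedSpace X] (t : unitInterval) {δ : ℝ} (hδ : 0 < δ) :
    ∃ s < 1, ∀ w, s < ‖w‖ → ‖w‖ < 1 → ∃ x, (∀ z, dist (A.φ t w) (G.g t x) ≤ dist (A.φ t w) (G.g t z)) ∧
      dist (A.φ t w) (G.g t x) < δ := by
  set K : Set ℂ := closure (G.D t) ∩ ⋂ z, {q | δ ≤ dist q (G.g t z)} with hK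
  have hKD : K ⊆ G.D t := by
    rintro q ⟨h1, h2⟩
    by_contra hq
    have : q ∈ frontier (G.D t) := by rw [(hn.D_open t).frontier_eq]; exact ⟨h1, hq⟩
    obtain ⟨z, hz⟩ := hn.D_frontier t this
    have := mem_iInter.1 h2 z
    rw [mem_ofPred_eq, hz, dist_self] at this
    linarith
  have hKc : IsCompact K := by
    refine Metric.isCompact_of_isClosed_isBounded (isClosed_closure.inter (isClosed_iInter fun z => ?_))
      ((hn.D_bounded t).subset hKD)
    exact isClosed_le continuous_const (continuous_id.dist continuous_const)
  have hs : ∃ s < 1, ∀ q ∈ K, ‖A.ψ t q‖ ≤ s := by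
    rcases K.eq_empty_or_nonempty with h | h
    · exact ⟨0, one_pos, by simp [h]⟩
    · obtain ⟨q, hq, hm⟩ := hKc.exists_isMaxOn h (((A.conf t).dψ.continuousOn.mono hKD).norm)
      exact ⟨_, (A.conf t).mψ q (hKD hq), fun q' hq' => hm hq'⟩
  obtain ⟨s, hs1, hs⟩ := hs
  refine ⟨s, hs1, fun w hw hw1 => ?_⟩
  obtain ⟨x, -, hx⟩ := isCompact_univ.exists_isMinOn (univ_nonempty (α := X))
    (f := fun z => dist (A.φ t w) (G.g t z)) (continuous_const.dist (G.cont_t t)).continuousOn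
  have hx' : ∀ z, dist (A.φ t w) (G.g t x) ≤ dist (A.φ t w) (G.g t z) := fun z => hx (mem_univ z)
  refine ⟨x, hx', ?_⟩
  by_contra hcon
  push Not at hcon
  have := hs (A.φ t w) ⟨subset_closure ((A.conf t).mφ w hw1), mem_iInter.2 fun z => hcon.trans (hx' z)⟩
  rw [(A.conf t).right w hw1] at this
  linarith

lemma end_near (hn : G.Nice) [ConnectedSpace X] [Nontrivial X] (t : unitInterval) {η : ℝ} (hη : 0 < η) :
    ∃ s < 1, ∀ w, s < ‖w‖ → ‖w‖ < 1 → ∃ e : G.End, ‖w - A.bd e t‖ ≤ η ∧ dist (A.φ t w) (G.g t e.x) < η ∧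
      ∀ c ∈ Ioc (0:ℝ) 1, ∀ r, c * dist (A.φ t w) (G.g t e.x) < r →
        G.g t e.x + c * (A.φ t w - G.g t e.x) ∈ e.W t r := by
  obtain ⟨r, hr, hb⟩ := A.bd_unif hn hη
  obtain ⟨s, hs, h⟩ := A.near hn t (δ := min r η) (by positivity)
  refine ⟨s, hs, fun w hw hw1 => ?_⟩
  obtain ⟨x, hx, hxd⟩ := h w hw hw1
  obtain ⟨e, rfl, he⟩ := hn.exists_end ((A.conf t).mφ w hw1) hx
  refine ⟨e, ?_, hxd.trans_le (min_le_right _ _), he⟩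
  have h1 := he 1 (by simp) r (by rw [one_mul]; exact hxd.trans_le (min_le_left _ _))
  have h2 := hb e t _ h1
  simpa [(A.conf t).right w hw1] using h2

lemma bd_dense (hn : G.Nice) [ConnectedSpace X] [Nontrivial X] (t : unitInterval) {ζ : ℂ} (hζ : ‖ζ‖ = 1) {ε : ℝ} (hε : 0 < ε) :
    ∃ e : G.End, ‖A.bd e t - ζ‖ < ε := by
  obtain ⟨s, hs, h⟩ := A.end_near hn t (η := ε/4) (by linarith)
  obtain ⟨s', h1, h2⟩ := exists_between (show max s (max (1 - ε/4) 0) < 1 by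
    refine max_lt hs (max_lt (by linarith) one_pos))
  have hs1 : s < s' := (le_max_left _ _).trans_lt h1
  have hs2 : 1 - ε/4 < s' := ((le_max_left _ _).trans (le_max_right _ _)).trans_lt h1
  have hs3 : 0 < s' := ((le_max_right _ _).trans (le_max_right _ _)).trans_lt h1
  have hnw : ‖(s':ℂ) * ζ‖ = s' := by rw [norm_mul, hζ, mul_one, Complex.norm_real, Real.norm_of_nonneg hs3.le]
  obtain ⟨e, he, -⟩ := h ((s':ℂ) * ζ) (by rwa [hnw]) (by rwa [hnw])
  refine ⟨e, ?_⟩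
  have h3 : ‖(s':ℂ) * ζ - ζ‖ < ε/4 := by
    rw [show (s':ℂ) * ζ - ζ = ((s' - 1 : ℝ) : ℂ) * ζ by push_cast; ring, norm_mul, hζ, mul_one, Complex.norm_real,
      Real.norm_eq_abs, abs_of_nonpos (by linarith)]
    linarith
  rw [← dist_eq_norm] at *
  rw [dist_comm] at he
  linarith [dist_triangle (A.bd e t) ((s':ℂ) * ζ) ζ]

end RM
end Isot
end IsoExt
end

section
open Set Metric Topology Filter ComplexConjugate MeasureTheory
set_option linter.unusedSectionVars false
namespace IsoExt

lemma arc_preconn {ζ : ℂ} (hζ : ‖ζ‖ = 1) {ρ : ℝ} (hρ : 0 < ρ) : IsPreconnected (sphere ζ ρ ∩ ball (0:ℂ) 1) := by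
  have hζ0 : ζ ≠ 0 := by rintro rfl; simp at hζ
  have hnorm : ∀ u : ℂ, ‖u‖ = 1 → (‖ζ * (1 - ρ * u)‖ < 1 ↔ ρ / 2 < u.re) := by
    intro u hu
    rw [norm_mul, hζ, one_mul]
    have h1 : ‖1 - (ρ:ℂ) * u‖ ^ 2 = 1 - 2 * ρ * u.re + ρ ^ 2 := by
      have hu2 : u.re ^ 2 + u.im ^ 2 = 1 := by
        have := Complex.sq_norm u
        rw [hu, Complex.normSq_apply] at this; nlinarith
      rw [Complex.sq_norm, Complex.normSq_apply]
      simp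
      linear_combination ρ ^ 2 * hu2
    rw [← sq_lt_one_iff₀ (norm_nonneg _), h1]
    constructor
    · intro h
      have : ρ * (ρ / 2) < ρ * u.re := by nlinarith
      exact lt_of_mul_lt_mul_left this hρ.le
    · intro h; nlinarith
  have him : sphere ζ ρ ∩ ball (0:ℂ) 1 = (fun θ : ℝ => ζ * (1 - ρ * Complex.exp (θ * Complex.I))) ''
      {θ | θ ∈ Ioo (-Real.arccos (ρ / 2)) (Real.arccos (ρ / 2))} := by
    ext w
    constructor
    · rintro ⟨h1, h2⟩
      set u := (1 - w / ζ) / ρ with hu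
      have hw : w = ζ * (1 - ρ * u) := by
        have : (ρ:ℂ) ≠ 0 := by exact_mod_cast hρ.ne'
        rw [hu]; field_simp; ring
      have hun : ‖u‖ = 1 := by
        rw [mem_sphere, dist_eq_norm, hw, show ζ * (1 - ρ * u) - ζ = -(ζ * (ρ * u)) by ring, norm_neg, norm_mul, hζ, one_mul,
          norm_mul, Complex.norm_real, Real.norm_of_nonneg hρ.le] at h1
        have : ρ * (‖u‖ - 1) = 0 := by linarith
        rcases mul_eq_zero.1 this with h | h <;> linarith
      have hre : ρ / 2 < u.re := by
        rw [← hnorm u hun, ← hw]; simpa using h2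
      have he : Complex.exp (Complex.arg u * Complex.I) = u := by
        have := Complex.norm_mul_exp_arg_mul_I u
        rwa [hun, Complex.ofReal_one, one_mul] at this
      refine ⟨Complex.arg u, ?_, by beta_reduce; rw [he, ← hw]⟩
      have hcos : Real.cos |Complex.arg u| = u.re := by
        rw [Real.cos_abs]
        have := congr_arg Complex.re he
        rwa [Complex.exp_ofReal_mul_I_re] at this
      have h3 : Real.arccos (Real.cos |Complex.arg u|) = |Complex.arg u| :=
        Real.arccos_cos (abs_nonneg _) (Complex.abs_arg_le_pi u)
      have h4 : |Complex.arg u| < Real.arccos (ρ/2) := by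
        rw [← h3, hcos]
        have hle : u.re ≤ 1 := by rw [← hun]; exact Complex.re_le_norm u
        exact Real.strictAntiOn_arccos ⟨by linarith, by linarith⟩ ⟨by linarith, hle⟩ hre
      exact abs_lt.1 h4
    · rintro ⟨θ, hθ, rfl⟩
      have hun : ‖Complex.exp (θ * Complex.I)‖ = 1 := Complex.norm_exp_ofReal_mul_I θ
      have hθ' : |θ| < Real.arccos (ρ/2) := abs_lt.2 hθ
      constructor
      · rw [mem_sphere, dist_eq_norm, show ∀ u : ℂ, ζ * (1 - ρ * u) - ζ = -(ζ * (ρ * u)) by intro u; ring, norm_neg, norm_mul,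
          hζ, one_mul, norm_mul, hun, Complex.norm_real, Real.norm_of_nonneg hρ.le, mul_one]
      · rw [mem_ball, dist_zero_right, hnorm _ hun, Complex.exp_ofReal_mul_I_re, ← Real.cos_abs]
        have h5 : Real.arccos (ρ/2) ≤ Real.pi := Real.arccos_le_pi _
        have h6 : 0 < Real.arccos (ρ/2) := (abs_nonneg θ).trans_lt hθ'
        have h7 : ρ/2 < 1 := Real.arccos_pos.1 h6
        rw [← Real.cos_arccos (x := ρ/2) (by linarith) h7.le]
        exact Real.cos_lt_cos_of_nonneg_of_le_pi (abs_nonneg _) h5 hθ'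
  rw [him]
  exact isPreconnected_Ioo.image _ (by fun_prop)

lemma Conf.short_arc {U : Set ℂ} {ψ φ : ℂ → ℂ} (h : Conf U ψ φ) (hb : Bornology.IsBounded U) {ζ : ℂ} (hζ : ‖ζ‖ = 1) {Λ R : ℝ}
    (hΛ : 0 < Λ) (hR : 0 < R) : ∃ ρ ∈ Ioo 0 R, ∀ w ∈ sphere ζ ρ ∩ ball (0:ℂ) 1, ∀ w' ∈ sphere ζ ρ ∩ ball (0:ℂ) 1,
      ‖φ w - φ w'‖ ≤ Λ := by
  have him : φ '' ball 0 1 ⊆ U := by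
    rintro _ ⟨w, hw, rfl⟩; exact h.mφ w (by simpa using hw)
  have hfin : volume (φ '' ball 0 1) ≠ ⊤ := ((measure_mono him).trans_lt hb.measure_lt_top).ne
  obtain ⟨r, hr, hrR, hN⟩ := wolff_scale (volume (φ '' ball 0 1)).toReal hR hΛ
  obtain ⟨ρ, hρ, hlen⟩ := wolff isOpen_ball h.dφ h.injφ (by rw [ENNReal.ofReal_toReal hfin]) ζ hr hrR hΛ hN
  have hρ0 := hr.trans hρ.1
  refine ⟨ρ, ⟨hρ0, hρ.2⟩, fun w hw w' hw' => ?_⟩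
  set b := φ w
  set b' := φ w'
  by_cases hbb : b - b' = 0
  · rw [hbb, norm_zero]; exact hΛ.le
  set L := ‖b - b'‖ with hL
  have hL0 : 0 < L := norm_pos_iff.2 hbb
  set e := (b - b') / L with he
  have hen : ‖e‖ = 1 := by rw [he, norm_div, Complex.norm_real, Real.norm_of_nonneg hL0.le, div_self hL0.ne']
  set u : ℂ → ℝ := fun y => (conj e * (y - b')).re with hu
  have hub : u b = L := by
    have : conj e * (b - b') = (L:ℂ) := by
      have h1 : b - b' = e * L := by
        have hLc : (L:ℂ) ≠ 0 := by exact_mod_cast hL0.ne'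
        rw [he, div_mul_cancel₀ _ hLc]
      rw [h1, ← mul_assoc, Complex.conj_mul', hen]; simp
    rw [hu]; simp only; rw [this]; simp
  have hub' : u b' = 0 := by rw [hu]; simp
  have huc : Continuous u := by rw [hu]; fun_prop
  have hcov : ∀ y ∈ Ioo 0 L, ∃ z ∈ sphere ζ ρ, z ∈ ball (0:ℂ) 1 ∧ φ z ∈ (univ : Set ℂ) ∧ u (φ z) = y := by
    intro y hy
    have hc : ContinuousOn (fun z => u (φ z)) (sphere ζ ρ ∩ ball (0:ℂ) 1) :=
      huc.comp_continuousOn (h.dφ.continuousOn.mono inter_subset_right)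
    obtain ⟨z, hz, hzy⟩ := (arc_preconn hζ hρ0).intermediate_value hw' hw hc (show y ∈ _ from
      ⟨by change u b' ≤ y; rw [hub']; exact hy.1.le, by change y ≤ u b; rw [hub]; exact hy.2.le⟩)
    exact ⟨z, hz.1, hz.2, trivial, hzy⟩
  have := arc_lip isOpen_ball h.dφ (c := ζ) hρ0 isOpen_univ (u := u) (K := 1) (fun y _ => by
      have h2 : DifferentiableAt ℝ (fun y : ℂ => conj e * (y - b')) y := by fun_prop
      exact Complex.reCLM.differentiableAt.comp y h2)
    (LipschitzOnWith.of_dist_le_mul fun y _ v _ => by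
      rw [Real.dist_eq, hu]
      simp only
      rw [← Complex.sub_re, ← mul_sub, sub_sub_sub_cancel_right, dist_eq_norm]
      refine (Complex.abs_re_le_norm _).trans ?_
      rw [norm_mul, RCLike.norm_conj, hen]; simp) (a := 0) (b := L) hΛ.le hlen hcov
  simpa using this

namespace Isot
variable {X : Type*} [MetricSpace X] [CompactSpace X] {G : Isot X}

lemma End.exp_diff {e e' : G.End} (hn : G.Nice) (hx : e.x = e'.x) (t : unitInterval) {z : X} (hz : z ≠ e.x) :
    Complex.exp (e.μ t z - e'.μ t z) = 1 := by
  have h1 := e.eq t z hz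
  have h2 := e'.eq t z (by rwa [← hx])
  rw [← hx, ← h1] at h2
  have h3 := mul_left_cancel₀ (hn.ne0 t z) h2
  rw [Complex.exp_sub, h3, div_self (Complex.exp_ne_zero _)]

end Isot
end IsoExt
end

section
open Set Metric Topology Filter ComplexConjugate
set_option linter.unusedSectionVars false
namespace IsoExt
namespace Isot
variable {X : Type*} [MetricSpace X] [CompactSpace X] {G : Isot X}

lemma Nice.W_common (hn : G.Nice) [PreconnectedSpace X] {t : unitInterval} {c : ℂ} {R : ℝ} {μ ν : X → ℂ} {q : ℂ}
    (h1 : q ∈ G.W t c R μ) (h2 : q ∈ G.W t c R ν) :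
    ∃ k : ℂ, Complex.exp k = 1 ∧ ∀ z, R ≤ dist (G.g t z) c → μ z - ν z = k := by
  obtain ⟨_, l, hl, he, hf⟩ := h1
  obtain ⟨_, l', hl', he', hf'⟩ := h2
  have hexp : ∀ z, Complex.exp (l z) = Complex.exp (l' z) := fun z =>
    mul_left_cancel₀ (hn.ne0 t z) ((he z).symm.trans (he' z))
  rcases isEmpty_or_nonempty X with h | ⟨⟨z0⟩⟩
  · exact ⟨0, by simp, fun z => (h.false z).elim⟩
  refine ⟨l z0 - l' z0, by rw [Complex.exp_sub, hexp, div_self (Complex.exp_ne_zero _)], fun z hz => ?_⟩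
  rw [log_unique isPreconnected_univ hl.continuousOn hl'.continuousOn (fun z _ => hexp z) (mem_univ z0) (mem_univ z),
    hf z hz, hf' z hz]
  ring

lemma W_const {t : unitInterval} {c : ℂ} {R : ℝ} {μ ν : X → ℂ} {k : ℂ} (hk : Complex.exp k = 1)
    (h : ∀ z, R ≤ dist (G.g t z) c → μ z - ν z = k) : G.W t c R μ ⊆ G.W t c R ν := by
  rintro q ⟨hq, l, hl, he, hf⟩
  refine ⟨hq, fun z => l z - k, hl.sub continuous_const, fun z => ?_, fun z hz => ?_⟩
  · rw [Complex.exp_sub, hk, div_one]; exact he z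
  · beta_reduce
    rw [hf z hz, ← h z hz]; ring

namespace RM
variable (A : G.RM)

lemma bd_of_eq (hn : G.Nice) [ConnectedSpace X] {e e' : G.End} {t : unitInterval} (hx : e.x = e'.x) {k : ℂ} (hk : Complex.exp k = 1)
    (h : ∀ z, z ≠ e.x → e.μ t z - e'.μ t z = k) : A.bd e t = A.bd e' t := by
  by_contra hne
  have hd : 0 < dist (A.bd e t) (A.bd e' t) := dist_pos.2 hne
  obtain ⟨r, hr, hb⟩ := A.bd_unif hn (η := dist (A.bd e t) (A.bd e' t) / 3) (by linarith)
  obtain ⟨q, hq⟩ := e.ne t r hr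
  have hq' : q ∈ e'.W t r := by
    change q ∈ G.W t (G.g t e'.x) r (e'.μ t)
    rw [← hx]
    refine W_const hk (fun z hz => h z ?_) hq
    rintro rfl; rw [dist_self] at hz; linarith
  have h1 := hb e t q hq
  have h2 := hb e' t q hq'
  rw [← dist_eq_norm] at h1 h2
  linarith [dist_triangle_left (A.bd e t) (A.bd e' t) (A.ψ t q)]

lemma meet (hn : G.Nice) [ConnectedSpace X] (e : G.End) (t : unitInterval) {r : ℝ} (hr : 0 < r) :
    ∃ R > 0, ∀ ρ ∈ Ioo 0 R, ∃ q ∈ e.W t r, A.ψ t q ∈ sphere (A.bd e t) ρ ∩ ball (0:ℂ) 1 := by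
  obtain ⟨q0, hq0⟩ := e.ne t r hr
  have hin : ∀ q ∈ e.W t r, ‖A.ψ t q‖ < 1 := fun q hq => (A.conf t).mψ q (W_subset_D hq)
  have hb1 := (A.bd_spec hn e t).1
  refine ⟨dist (A.ψ t q0) (A.bd e t), dist_pos.2 fun h => ?_, fun ρ hρ => ?_⟩
  · have := hin q0 hq0; rw [h, hb1] at this; linarith
  obtain ⟨r0, hr0, hb⟩ := A.bd_unif hn (η := ρ/2) (by linarith [hρ.1])
  obtain ⟨q1, hq1⟩ := e.ne t (min r r0) (lt_min hr hr0)
  have hq1r : q1 ∈ e.W t r := W_mono_self (lt_min hr hr0) (min_le_left _ _) hq1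
  have hq1' := hb e t q1 (W_mono_self (lt_min hr hr0) (min_le_right _ _) hq1)
  have hc : ContinuousOn (fun q => dist (A.ψ t q) (A.bd e t)) (e.W t r) :=
    continuous_dist.comp_continuousOn
      (((A.conf t).dψ.continuousOn.mono W_subset_D).prodMk continuousOn_const)
  obtain ⟨q, hq, hqρ⟩ := (hn.W_preconn _ _ _ _).intermediate_value hq1r hq0 hc (show ρ ∈ _ from
    ⟨by rw [dist_eq_norm]; linarith [hρ.1], hρ.2.le⟩)
  exact ⟨q, hq, hqρ, by simpa using hin q hq⟩

lemma eq_of_bd (hn : G.Nice) [ConnectedSpace X] {e e' : G.End} {t : unitInterval} (h : A.bd e t = A.bd e' t) :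
    e.x = e'.x ∧ ∃ k : ℂ, Complex.exp k = 1 ∧ ∀ z, z ≠ e.x → e.μ t z - e'.μ t z = k := by
  have key : ∀ r > 0, ∃ q, q ∈ e.W t (2*r) ∧ q ∈ e'.W t (2*r) := by
    intro r hr
    obtain ⟨R, hR, hm⟩ := A.meet hn e t hr
    obtain ⟨R', hR', hm'⟩ := A.meet hn e' t hr
    obtain ⟨ρ, hρ, hs⟩ := (A.conf t).short_arc (hn.D_bounded t) (A.bd_spec hn e t).1 (Λ := r/2) (by linarith) (lt_min hR hR')
    obtain ⟨q, hq, hqs⟩ := hm ρ ⟨hρ.1, hρ.2.trans_le (min_le_left _ _)⟩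
    obtain ⟨q', hq', hqs'⟩ := hm' ρ ⟨hρ.1, hρ.2.trans_le (min_le_right _ _)⟩
    rw [← h] at hqs'
    set C := A.φ t '' (sphere (A.bd e t) ρ ∩ ball (0:ℂ) 1) with hC
    have hCp : IsPreconnected C := (arc_preconn (A.bd_spec hn e t).1 hρ.1).image _
      ((A.conf t).dφ.continuousOn.mono inter_subset_right)
    have hCD : Disjoint C (range (G.g t)) := by
      rw [disjoint_left]
      rintro _ ⟨w, hw, rfl⟩ ⟨z, hz⟩
      exact hn.D_notMem ((A.conf t).mφ w (by simpa using hw.2)) ⟨z, hz⟩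
    have hqC : ∀ q, q ∈ G.D t → A.ψ t q ∈ sphere (A.bd e t) ρ ∩ ball (0:ℂ) 1 → q ∈ C := fun q hq h =>
      ⟨_, h, (A.conf t).left q hq⟩
    have hdiam : ∀ a ∈ C, ∀ b ∈ C, dist a b ≤ r/2 := by
      rintro _ ⟨a, ha, rfl⟩ _ ⟨b, hb, rfl⟩
      rw [dist_eq_norm]; exact hs a ha b hb
    have hqc := hqC q (W_subset_D hq) hqs
    have hqc' := hqC q' (W_subset_D hq') hqs'
    refine ⟨q, W_mono_self hr (by linarith) hq, ?_⟩
    refine hn.W_max hCp hCD ?_ hqc' (W_mono_self hr (by linarith) hq') hqc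
    intro a ha
    have h1 := hdiam a ha q' hqc'
    have h2 : dist q' (G.g t e'.x) < r := W_subset_ball hq'
    rw [mem_ball]
    linarith [dist_triangle a q' (G.g t e'.x)]
  have hx : e.x = e'.x := by
    apply G.inj t
    by_contra hne
    have hd : 0 < dist (G.g t e.x) (G.g t e'.x) := dist_pos.2 hne
    obtain ⟨q, hq, hq'⟩ := key (dist (G.g t e.x) (G.g t e'.x) / 4) (by linarith)
    have h1 := W_subset_ball hq
    have h2 := W_subset_ball hq'
    rw [mem_ball] at h1 h2
    linarith [dist_triangle_left (G.g t e.x) (G.g t e'.x) q]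
  refine ⟨hx, ?_⟩
  have key2 : ∀ r > 0, ∃ k : ℂ, Complex.exp k = 1 ∧ ∀ z, r ≤ dist (G.g t z) (G.g t e.x) → e.μ t z - e'.μ t z = k := by
    intro r hr
    obtain ⟨q, hq, hq'⟩ := key (r/2) (by linarith)
    rw [show 2 * (r/2) = r by ring] at hq hq'
    refine hn.W_common hq ?_
    rw [hx]; exact hq'
  by_cases hex : ∃ z0, z0 ≠ e.x
  · obtain ⟨z0, hz0⟩ := hex
    have hpos : ∀ z, z ≠ e.x → 0 < dist (G.g t z) (G.g t e.x) := fun z hz => dist_pos.2 fun h => hz (G.inj t h)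
    refine ⟨e.μ t z0 - e'.μ t z0, End.exp_diff hn hx t hz0, fun z hz => ?_⟩
    obtain ⟨k, hk, hk'⟩ := key2 (min (dist (G.g t z) (G.g t e.x)) (dist (G.g t z0) (G.g t e.x))) (lt_min (hpos z hz) (hpos z0 hz0))
    rw [hk' z (min_le_left _ _), hk' z0 (min_le_right _ _)]
  · push Not at hex
    exact ⟨0, by simp, fun z hz => (hz (hex z)).elim⟩

lemma bd_eq_time (hn : G.Nice) [ConnectedSpace X] {e e' : G.End} {t s : unitInterval} (h : A.bd e t = A.bd e' t) :
    A.bd e s = A.bd e' s := by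
  obtain ⟨hx, k, hk, hz⟩ := A.eq_of_bd hn h
  refine A.bd_of_eq hn hx hk fun z hzx => ?_
  rw [← hz z hzx]
  have hzx' : z ≠ e'.x := by rwa [← hx]
  have c1 : Continuous fun t => e.μ t z := continuous_iff_continuousAt.2 fun t =>
    (e.contAt (t := t) hzx).comp (f := fun t : unitInterval => (t, z)) (by fun_prop)
  have c2 : Continuous fun t => e'.μ t z := continuous_iff_continuousAt.2 fun t =>
    (e'.contAt (t := t) hzx').comp (f := fun t : unitInterval => (t, z)) (by fun_prop)
  refine log_unique isPreconnected_univ c1.continuousOn c2.continuousOn (fun u _ => ?_) (mem_univ s) (mem_univ t)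
  have := End.exp_diff hn hx u hzx
  rw [Complex.exp_sub] at this
  exact (div_eq_one_iff_eq (Complex.exp_ne_zero _)).1 this
end RM
end Isot
end IsoExt
end

section
open Set Metric Topology Filter ComplexConjugate
set_option linter.unusedSectionVars false
namespace IsoExt

section mono
variable {E : Type*} {r : E → unitInterval → ℝ}

/-- the monotone transfer function -/
noncomputable def mf (r : E → unitInterval → ℝ) (s t : unitInterval) (y : ℝ) : ℝ := sSup ((fun e => r e t) '' {e | r e s < y})

/-- hypotheses of the monotone transfer -/
structure MHyp (r : E → unitInterval → ℝ) : Prop where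
  cont : ∀ e, Continuous (r e)
  dense : ∀ t a b, a < b → ∃ e, a < r e t ∧ r e t < b
  eqt : ∀ e e' t s, r e t = r e' t → r e s = r e' s

namespace MHyp
lemma order (h : MHyp r) {e e' : E} {t : unitInterval} (hlt : r e t < r e' t) (s : unitInterval) : r e s < r e' s := by
  by_contra hcon
  obtain ⟨u, hu⟩ := mem_range_of_exists_le_of_exists_ge ((h.cont e').sub (h.cont e)) (c := 0)
    ⟨s, by simpa using hcon⟩ ⟨t, by simpa using hlt.le⟩
  have := h.eqt e' e u t (by simpa [sub_eq_zero] using hu)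
  linarith

lemma lt_mf (h : MHyp r) {e : E} {s t : unitInterval} {y : ℝ} (hy : r e s < y) : r e t < mf r s t y := by
  obtain ⟨e', h1, h2⟩ := h.dense s _ _ hy
  obtain ⟨e2, h3, _⟩ := h.dense s y (y+1) (by linarith)
  refine (h.order h1 t).trans_le (le_csSup ⟨r e2 t, ?_⟩ ⟨e', h2, rfl⟩)
  rintro _ ⟨e3, h4, rfl⟩
  exact (h.order (show r e3 s < r e2 s from lt_trans h4 h3) t).le

lemma mf_le (h : MHyp r) {e : E} {s t : unitInterval} {y : ℝ} (hy : y ≤ r e s) : mf r s t y ≤ r e t := by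
  obtain ⟨e1, _, h1⟩ := h.dense s (y-1) y (by linarith)
  refine csSup_le ⟨_, e1, h1, rfl⟩ ?_
  rintro _ ⟨e3, h4, rfl⟩
  exact (h.order (show r e3 s < r e s from lt_of_lt_of_le h4 hy) t).le

lemma lt_iff (h : MHyp r) {e : E} {s t : unitInterval} {y : ℝ} : r e t < mf r s t y ↔ r e s < y :=
  ⟨fun h1 => by by_contra h2; exact absurd (h.mf_le (t := t) (not_lt.1 h2)) (not_le.2 h1), h.lt_mf⟩

lemma mf_lt (h : MHyp r) {e : E} {s t : unitInterval} {y : ℝ} (hy : y < r e s) : mf r s t y < r e t := by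
  obtain ⟨e', h1, h2⟩ := h.dense s _ _ hy
  exact (h.mf_le h1.le).trans_lt (h.order h2 t)

lemma eq_of (h : MHyp r) {a b : ℝ} {t : unitInterval} (hab : ∀ e, r e t < a ↔ r e t < b) : a = b := by
  by_contra hne
  rcases lt_or_gt_of_ne hne with hlt | hlt
  · obtain ⟨e, h1, h2⟩ := h.dense t _ _ hlt
    exact absurd ((hab e).2 h2) (not_lt.2 h1.le)
  · obtain ⟨e, h1, h2⟩ := h.dense t _ _ hlt
    exact absurd ((hab e).1 h2) (not_lt.2 h1.le)

lemma mf_r (h : MHyp r) (e : E) (s t : unitInterval) : mf r s t (r e s) = r e t :=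
  h.eq_of (t := t) fun e' => by
    rw [h.lt_iff]; exact ⟨fun h1 => h.order h1 t, fun h1 => h.order h1 s⟩

lemma lt_iff' (h : MHyp r) {e : E} {s t : unitInterval} {y : ℝ} : mf r s t y < r e t ↔ y < r e s := by
  refine ⟨fun h1 => ?_, h.mf_lt⟩
  by_contra h2
  rcases (not_lt.1 h2).lt_or_eq with h3 | h3
  · exact absurd (h.lt_mf (t := t) h3) (not_lt.2 h1.le)
  · rw [← h3, h.mf_r] at h1; exact lt_irrefl _ h1

lemma mf_mf (h : MHyp r) (s t : unitInterval) (y : ℝ) : mf r t s (mf r s t y) = y :=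
  h.eq_of (t := s) fun e' => by rw [h.lt_iff, h.lt_iff]

lemma mf_self (h : MHyp r) (t : unitInterval) (y : ℝ) : mf r t t y = y := h.eq_of (t := t) fun e' => by rw [h.lt_iff]

lemma mf_mono (h : MHyp r) {s t : unitInterval} {y y' : ℝ} (hy : y < y') : mf r s t y < mf r s t y' := by
  obtain ⟨e, h1, h2⟩ := h.dense s _ _ hy
  exact (h.mf_lt h1).trans (h.lt_mf h2)

lemma mf_cont (h : MHyp r) (s : unitInterval) : Continuous fun p : unitInterval × ℝ => mf r s p.1 p.2 := by
  rw [continuous_iff_continuousAt]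
  rintro ⟨t0, y0⟩
  rw [ContinuousAt, tendsto_order]
  constructor
  · intro a ha
    obtain ⟨e, h1, h2⟩ := h.dense t0 _ _ ha
    have c1 : ∀ᶠ p : unitInterval × ℝ in 𝓝 (t0, y0), a < r e p.1 :=
      ((h.cont e).comp continuous_fst).continuousAt.eventually (lt_mem_nhds h1)
    have c2 : ∀ᶠ p : unitInterval × ℝ in 𝓝 (t0, y0), r e s < p.2 :=
      continuous_snd.continuousAt.eventually (lt_mem_nhds (h.lt_iff.1 h2))
    filter_upwards [c1, c2] with p h3 h4 using h3.trans (h.lt_mf h4)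
  · intro a ha
    obtain ⟨e, h1, h2⟩ := h.dense t0 _ _ ha
    have c1 : ∀ᶠ p : unitInterval × ℝ in 𝓝 (t0, y0), r e p.1 < a :=
      ((h.cont e).comp continuous_fst).continuousAt.eventually (gt_mem_nhds h2)
    have c2 : ∀ᶠ p : unitInterval × ℝ in 𝓝 (t0, y0), p.2 < r e s :=
      continuous_snd.continuousAt.eventually (gt_mem_nhds (h.lt_iff'.1 h1))
    filter_upwards [c1, c2] with p h3 h4 using (h.mf_lt h4).trans h3
end MHyp
end mono

/-- transfer on the half plane -/
noncomputable def hf (f : ℝ → ℝ) (w : ℂ) : ℂ :=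
  ⟨(f (w.re - w.im) + f (w.re + w.im)) / 2, (f (w.re + w.im) - f (w.re - w.im)) / 2⟩

lemma hf_hf {f g : ℝ → ℝ} (h : ∀ y, g (f y) = y) (w : ℂ) : hf g (hf f w) = w := by
  have h1 : (hf f w).re - (hf f w).im = f (w.re - w.im) := by simp only [hf]; ring
  have h2 : (hf f w).re + (hf f w).im = f (w.re + w.im) := by simp only [hf]; ring
  apply Complex.ext
  · change (g _ + g _) / 2 = _
    rw [h1, h2, h, h]; ring
  · change (g _ - g _) / 2 = _
    rw [h1, h2, h, h]; ring

/-- Cayley transform disk to half plane -/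
noncomputable def cay (v : ℂ) : ℂ := Complex.I * (1 + v) / (1 - v)
/-- inverse Cayley transform -/
noncomputable def icay (w : ℂ) : ℂ := (w - Complex.I) / (w + Complex.I)

lemma cay_im {v : ℂ} : (cay v).im = (1 - ‖v‖^2) / ‖1 - v‖^2 := by
  rw [cay, Complex.div_im, ← Complex.normSq_eq_norm_sq, ← Complex.normSq_eq_norm_sq]
  by_cases h : Complex.normSq (1 - v) = 0
  · rw [h]; simp
  field_simp
  rw [Complex.normSq_apply]
  simp
  ring

lemma icay_cay {v : ℂ} (hv : v ≠ 1) : icay (cay v) = v := by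
  have : 1 - v ≠ 0 := sub_ne_zero.2 hv.symm
  rw [icay, cay]
  have h1 : Complex.I * (1 + v) / (1 - v) - Complex.I = 2 * Complex.I * v / (1 - v) := by field_simp; ring
  have h2 : Complex.I * (1 + v) / (1 - v) + Complex.I = 2 * Complex.I / (1 - v) := by field_simp; ring
  rw [h1, h2]; field_simp

lemma cay_icay {w : ℂ} (hw : w + Complex.I ≠ 0) : cay (icay w) = w := by
  rw [icay, cay]
  have h1 : 1 + (w - Complex.I) / (w + Complex.I) = 2 * w / (w + Complex.I) := by field_simp; ring
  have h2 : 1 - (w - Complex.I) / (w + Complex.I) = 2 * Complex.I / (w + Complex.I) := by field_simp; ring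
  rw [h1, h2]; field_simp

lemma add_I_ne {w : ℂ} (hw : 0 ≤ w.im) : w + Complex.I ≠ 0 := by
  intro h; have := congr_arg Complex.im h; simp at this; linarith

lemma icay_norm {w : ℂ} (hw : 0 < w.im) : ‖icay w‖ < 1 := by
  rw [icay, norm_div, div_lt_one (norm_pos_iff.2 (add_I_ne hw.le))]
  rw [← sq_lt_sq₀ (norm_nonneg _) (norm_nonneg _), ← Complex.normSq_eq_norm_sq, ← Complex.normSq_eq_norm_sq,
    Complex.normSq_apply, Complex.normSq_apply]
  simp; nlinarith

lemma icay_norm_real (r : ℝ) : ‖icay r‖ = 1 := by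
  have h0 : (r:ℂ) + Complex.I ≠ 0 := add_I_ne (by simp)
  rw [icay, norm_div, div_eq_one_iff_eq (norm_ne_zero_iff.2 h0),
    ← sq_eq_sq₀ (norm_nonneg _) (norm_nonneg _), ← Complex.normSq_eq_norm_sq, ← Complex.normSq_eq_norm_sq,
    Complex.normSq_apply, Complex.normSq_apply]
  simp

lemma icay_ne_one {w : ℂ} (hw : w + Complex.I ≠ 0) : icay w ≠ 1 := by
  intro h
  rw [icay, div_eq_one_iff_eq hw] at h
  have := congr_arg Complex.im h; simp at this; linarith

lemma icay_re (v : ℝ) : (icay v).re = (v^2 - 1) / (v^2 + 1) := by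
  rw [icay, Complex.div_re, Complex.normSq_apply]; simp
  rw [← add_div]; congr 1 <;> ring

lemma icay_im (v : ℝ) : (icay v).im = - (2 * v) / (v^2 + 1) := by
  rw [icay, Complex.div_im, Complex.normSq_apply]; simp
  rw [← sub_div]; congr 1 <;> ring

/-- the mobius map in half plane coordinates -/
lemma mob_cay {π w0 w : ℂ} (hπ : ‖π‖ = 1) (hw0 : ‖w0‖ < 1) (hw : ‖w‖ = 1) (hne : w ≠ π) :
    conj π * (1 - conj (conj π * w0)) / (1 - conj π * w0) * mob w0 w
      = icay (((cay (conj π * w)).re - (cay (conj π * w0)).re) / (cay (conj π * w0)).im : ℝ) := by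
  have hππ : conj π * π = 1 := by rw [Complex.conj_mul', hπ]; simp
  have hπ0 : π ≠ 0 := by rintro rfl; simp at hπ
  set v := conj π * w with hv
  set v0 := conj π * w0 with hv0
  have hvn : ‖v‖ = 1 := by rw [hv, norm_mul, RCLike.norm_conj, hπ, hw, one_mul]
  have hv0n : ‖v0‖ < 1 := by rw [hv0, norm_mul, RCLike.norm_conj, hπ, one_mul]; exact hw0
  have hwv : w = π * v := by rw [hv, ← mul_assoc, mul_comm π, hππ, one_mul]
  have hwv0 : w0 = π * v0 := by rw [hv0, ← mul_assoc, mul_comm π, hππ, one_mul]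
  have hv1 : v ≠ 1 := by rintro h; rw [h, mul_one] at hwv; exact hne hwv
  have hv01 : v0 ≠ 1 := by rintro h; rw [h] at hv0n; simp at hv0n
  have n1 : 1 - v ≠ 0 := sub_ne_zero.2 hv1.symm
  have n2 : 1 - v0 ≠ 0 := sub_ne_zero.2 hv01.symm
  have n3 : 1 - conj v0 ≠ 0 := by
    intro h; apply n2; have := congr_arg conj h; simpa using this
  have n4 : 1 - conj v0 * v ≠ 0 := by
    intro h
    have : ‖conj v0 * v‖ = 1 := by rw [← sub_eq_zero.1 h]; simp
    rw [norm_mul, RCLike.norm_conj, hvn, mul_one] at this; linarith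
  have hm : mob w0 w = π * ((v - v0) / (1 - conj v0 * v)) := by
    rw [mob, hwv, hwv0, map_mul, show conj π * conj v0 * (π * v) = (conj π * π) * (conj v0 * v) by ring, hππ, one_mul]
    ring
  set h := cay v with hh
  set h0 := cay v0 with hh0
  have him : h.im = 0 := by rw [hh, cay_im, hvn]; simp
  have him0 : 0 < h0.im := by
    rw [hh0, cay_im]
    have : 0 < ‖1 - v0‖ := norm_pos_iff.2 n2
    have : ‖v0‖^2 < 1 := by nlinarith [norm_nonneg v0]
    positivity
  have hR : icay ((h.re - h0.re) / h0.im : ℝ) = (h - h0) / (h - conj h0) := by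
    have e1 : h = h.re := by apply Complex.ext <;> simp [him]
    have hI : (h0.im : ℂ) ≠ 0 := by exact_mod_cast him0.ne'
    have e2 : h - h0 = h0.im * (((h.re - h0.re) / h0.im : ℝ) - Complex.I) := by
      rw [e1]; push_cast; rw [mul_sub, mul_div_cancel₀ _ hI]
      apply Complex.ext <;> simp
    have e3 : h - conj h0 = h0.im * (((h.re - h0.re) / h0.im : ℝ) + Complex.I) := by
      rw [e1]; push_cast; rw [mul_add, mul_div_cancel₀ _ hI]
      apply Complex.ext <;> simp
    rw [e2, e3, icay, mul_div_mul_left _ _ hI]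
  rw [hR, hm]
  have a1 : h - h0 = 2 * Complex.I * (v - v0) / ((1 - v) * (1 - v0)) := by
    rw [hh, hh0, cay, cay]; field_simp; ring
  have a2 : h - conj h0 = 2 * Complex.I * (1 - conj v0 * v) / ((1 - v) * (1 - conj v0)) := by
    rw [hh, hh0, cay, cay]; simp only [map_div₀, map_mul, map_add, map_sub, map_one, Complex.conj_I]; field_simp; ring
  rw [a1, a2, show ∀ a b c : ℂ, conj π * a / b * (π * c) = (conj π * π) * (a / b * c) by intros; ring, hππ, one_mul]
  field_simp
end IsoExt
end

section
open Set Metric Topology Filter ComplexConjugate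
set_option linter.unusedSectionVars false
namespace IsoExt
namespace Isot
variable {X : Type*} [MetricSpace X] [CompactSpace X] {G : Isot X}
namespace RM
variable (A : G.RM) (e0 : G.End)

/-- boundary coordinate -/
noncomputable def br (e : G.End) (t : unitInterval) : ℝ := (cay (conj (A.bd e0 t) * A.bd e t)).re

lemma cay_contAt {v : ℂ} (h : v ≠ 1) : ContinuousAt cay v := by
  unfold cay
  exact ContinuousAt.div (by fun_prop) (by fun_prop) (sub_ne_zero.2 h.symm)

lemma conj_unit {π : ℂ} (hπ : ‖π‖ = 1) : π * conj π = 1 := by rw [Complex.mul_conj', hπ]; simp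

lemma conj_mul_ne {π b : ℂ} (hπ : ‖π‖ = 1) (h : b ≠ π) : conj π * b ≠ 1 := by
  intro h1
  apply h
  have := congr_arg (fun x => π * x) h1
  simp only [← mul_assoc, conj_unit hπ] at this
  simpa using this

lemma cay_unit {v : ℂ} (h : ‖v‖ = 1) : cay v = ((cay v).re : ℂ) := by
  have him : (cay v).im = 0 := by rw [cay_im, h]; simp
  apply Complex.ext <;> simp [him]

lemma mhyp (hn : G.Nice) [ConnectedSpace X] [Nontrivial X] :
    MHyp (fun (e : {e : G.End // A.bd e 0 ≠ A.bd e0 0}) t => A.br e0 e.1 t) := by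
  have hπ : ∀ t, ‖A.bd e0 t‖ = 1 := fun t => (A.bd_spec hn e0 t).1
  have hb : ∀ e t, ‖A.bd e t‖ = 1 := fun e t => (A.bd_spec hn e t).1
  have hne : ∀ (e : {e : G.End // A.bd e 0 ≠ A.bd e0 0}) t, A.bd e.1 t ≠ A.bd e0 t := fun e t h =>
    e.2 (A.bd_eq_time hn h)
  refine ⟨fun e => ?_, fun t a b hab => ?_, fun e e' t s h => ?_⟩
  · rw [continuous_iff_continuousAt]
    intro t
    refine Complex.continuous_re.continuousAt.comp ?_
    refine ContinuousAt.comp (f := fun t => conj (A.bd e0 t) * A.bd e.1 t) (g := cay) (cay_contAt (conj_mul_ne (hπ t) (hne e t))) ?_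
    exact ((Complex.continuous_conj.comp (A.bd_cont hn e0)).mul (A.bd_cont hn e.1)).continuousAt
  · set π := A.bd e0 t with hpi
    set r0 := (a + b) / 2 with hr0
    set u := icay r0 with hu
    have hI : (r0:ℂ) + Complex.I ≠ 0 := add_I_ne (by simp)
    have hun : ‖u‖ = 1 := icay_norm_real r0
    have hu1 : u ≠ 1 := icay_ne_one hI
    have hcu : conj π * (π * u) = u := by rw [← mul_assoc, mul_comm _ π, conj_unit (hπ t), one_mul]
    have hc : ContinuousAt (fun w => (cay (conj π * w)).re) (π * u) := by
      refine Complex.continuous_re.continuousAt.comp ?_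
      refine ContinuousAt.comp (f := fun w => conj π * w) (g := cay) ?_ (by fun_prop)
      rw [hcu]; exact cay_contAt hu1
    have hval : (cay (conj π * (π * u))).re = r0 := by rw [hcu, hu, cay_icay hI]; simp
    have hne' : π * u ≠ π := by
      intro h
      apply hu1
      have hπ0 : π ≠ 0 := by intro h0; have := hπ t; rw [← hpi, h0] at this; simp at this
      exact mul_left_cancel₀ hπ0 (by rw [h, mul_one])
    have ev : ∀ᶠ w in 𝓝 (π * u), (cay (conj π * w)).re ∈ Ioo a b ∧ w ≠ π :=
      (hc.eventually (Ioo_mem_nhds (by beta_reduce; rw [hval, hr0]; linarith) (by beta_reduce; rw [hval, hr0]; linarith))).and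
        (isOpen_ne.mem_nhds hne')
    obtain ⟨ε, hε, hball⟩ := Metric.eventually_nhds_iff.1 ev
    obtain ⟨e, he⟩ := A.bd_dense hn t (ζ := π * u) (by rw [norm_mul, hun, mul_one]; exact hπ t) hε
    obtain ⟨h1, h2⟩ := hball (y := A.bd e t) (by rw [dist_eq_norm]; exact he)
    exact ⟨⟨e, fun h => h2 (A.bd_eq_time hn h)⟩, h1⟩
  · have h1 : ∀ e : {e : G.End // A.bd e 0 ≠ A.bd e0 0}, A.bd e.1 t = A.bd e0 t * icay (A.br e0 e.1 t) := by
      intro e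
      have : icay (A.br e0 e.1 t) = conj (A.bd e0 t) * A.bd e.1 t := by
        rw [br, ← cay_unit (by rw [norm_mul, RCLike.norm_conj, hπ, hb, one_mul]), icay_cay (conj_mul_ne (hπ t) (hne e t))]
      rw [this, ← mul_assoc, conj_unit (hπ t), one_mul]
    have h2 : A.bd e.1 t = A.bd e'.1 t := by
      rw [h1 e, h1 e']
      beta_reduce at h
      rw [h]
    simp only [br, A.bd_eq_time hn (s := s) h2]

/-- half plane coordinate -/
noncomputable def hX (t : unitInterval) (q : ℂ) : ℂ := cay (conj (A.bd e0 t) * A.ψ t q)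
/-- inverse of the half plane coordinate -/
noncomputable def hY (t : unitInterval) (w : ℂ) : ℂ := A.φ t (A.bd e0 t * icay w)

variable {A e0}
lemma hX_pre (hn : G.Nice) [ConnectedSpace X] {t : unitInterval} {q : ℂ} (hq : q ∈ G.D t) :
    ‖conj (A.bd e0 t) * A.ψ t q‖ < 1 := by
  rw [norm_mul, RCLike.norm_conj, (A.bd_spec hn e0 t).1, one_mul]; exact (A.conf t).mψ q hq

lemma hX_im (hn : G.Nice) [ConnectedSpace X] {t : unitInterval} {q : ℂ} (hq : q ∈ G.D t) : 0 < (A.hX e0 t q).im := by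
  have h := hX_pre (A := A) (e0 := e0) hn hq
  rw [hX, cay_im]
  have n2 : 1 - conj (A.bd e0 t) * A.ψ t q ≠ 0 := by
    intro h0; rw [← sub_eq_zero.1 h0] at h; simp at h
  have : 0 < ‖1 - conj (A.bd e0 t) * A.ψ t q‖ := norm_pos_iff.2 n2
  have : ‖conj (A.bd e0 t) * A.ψ t q‖^2 < 1 := by nlinarith [norm_nonneg (conj (A.bd e0 t) * A.ψ t q)]
  have : 0 < 1 - ‖conj (A.bd e0 t) * A.ψ t q‖^2 := by linarith
  positivity

lemma hY_pre (hn : G.Nice) [ConnectedSpace X] {t : unitInterval} {w : ℂ} (hw : 0 < w.im) : ‖A.bd e0 t * icay w‖ < 1 := by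
  rw [norm_mul, (A.bd_spec hn e0 t).1, one_mul]; exact icay_norm hw

lemma hY_mem (hn : G.Nice) [ConnectedSpace X] {t : unitInterval} {w : ℂ} (hw : 0 < w.im) : A.hY e0 t w ∈ G.D t :=
  (A.conf t).mφ _ (hY_pre hn hw)

lemma hY_hX (hn : G.Nice) [ConnectedSpace X] {t : unitInterval} {q : ℂ} (hq : q ∈ G.D t) : A.hY e0 t (A.hX e0 t q) = q := by
  have h := hX_pre (A := A) (e0 := e0) hn hq
  rw [hY, hX, icay_cay (by intro h0; rw [h0] at h; simp at h), ← mul_assoc, conj_unit (A.bd_spec hn e0 t).1, one_mul]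
  exact (A.conf t).left q hq

lemma hX_hY (hn : G.Nice) [ConnectedSpace X] {t : unitInterval} {w : ℂ} (hw : 0 < w.im) : A.hX e0 t (A.hY e0 t w) = w := by
  rw [hY, hX, (A.conf t).right _ (hY_pre hn hw), ← mul_assoc, mul_comm _ (A.bd e0 t), conj_unit (A.bd_spec hn e0 t).1, one_mul,
    cay_icay (add_I_ne hw.le)]

lemma hX_cont (hn : G.Nice) [ConnectedSpace X] (t : unitInterval) : ContinuousOn (A.hX e0 t) (G.D t) := by
  intro q hq
  have h := hX_pre (A := A) (e0 := e0) hn hq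
  refine ContinuousWithinAt.comp (f := fun q => conj (A.bd e0 t) * A.ψ t q) (g := cay) (t := univ)
    (cay_contAt (by intro h0; rw [h0] at h; simp at h)).continuousWithinAt ?_ (mapsTo_univ _ _)
  exact continuousWithinAt_const.mul ((A.conf t).dψ.continuousOn q hq)

lemma hY_cont (hn : G.Nice) [ConnectedSpace X] {t : unitInterval} {w : ℂ} (hw : 0 < w.im) :
    ContinuousAt (fun p : unitInterval × ℂ => A.hY e0 p.1 p.2) (t, w) := by
  have c1 : ContinuousAt (fun p : unitInterval × ℂ => A.bd e0 p.1 * icay p.2) (t, w) := by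
    refine ((A.bd_cont hn e0).comp continuous_fst).continuousAt.mul ?_
    unfold icay
    exact ContinuousAt.div (by fun_prop) (by fun_prop) (add_I_ne hw.le)
  exact ContinuousAt.comp (f := fun p : unitInterval × ℂ => (p.1, A.bd e0 p.1 * icay p.2))
    (g := fun p : unitInterval × ℂ => A.φ p.1 p.2) (x := (t, w))
    (A.φ_cont hn (hY_pre hn hw)) (continuousAt_fst.prodMk c1)

lemma exists_HD (A : G.RM) (hn : G.Nice) [ConnectedSpace X] [Nontrivial X] :
    ∃ H : unitInterval → ℂ → ℂ, (∀ t, BijOn (H t) (G.D 0) (G.D t)) ∧ (∀ q ∈ G.D 0, H 0 q = q) ∧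
      ContinuousOn (fun p : unitInterval × ℂ => H p.1 p.2) (univ ×ˢ G.D 0) ∧
      ∀ t, ∀ p ∈ G.D 0, ∃ k k' : ℂ, ‖k‖ = 1 ∧ ‖k'‖ = 1 ∧ ∀ e : G.End,
        ((k * mob (A.ψ 0 p) (A.bd e 0)).re < 0 → (k' * mob (A.ψ t (H t p)) (A.bd e t)).re < 0) ∧
        (0 < (k * mob (A.ψ 0 p) (A.bd e 0)).re → (k * mob (A.ψ 0 p) (A.bd e 0)).im < 0 →
          0 < (k' * mob (A.ψ t (H t p)) (A.bd e t)).re ∧ (k' * mob (A.ψ t (H t p)) (A.bd e t)).im < 0) ∧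
        (0 < (k * mob (A.ψ 0 p) (A.bd e 0)).re → 0 < (k * mob (A.ψ 0 p) (A.bd e 0)).im →
          0 < (k' * mob (A.ψ t (H t p)) (A.bd e t)).re ∧ 0 < (k' * mob (A.ψ t (H t p)) (A.bd e t)).im) := by
  obtain ⟨e0, -⟩ := A.bd_dense hn 0 (ζ := 1) (by simp) one_pos
  have hM := A.mhyp e0 hn
  set r := (fun (e : {e : G.End // A.bd e 0 ≠ A.bd e0 0}) t => A.br e0 e.1 t) with hr
  have him : ∀ s t {w : ℂ}, 0 < w.im → 0 < (hf (mf r s t) w).im := by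
    intro s t w hw
    have := hM.mf_mono (s := s) (t := t) (show w.re - w.im < w.re + w.im by linarith)
    change 0 < (mf r s t _ - mf r s t _) / 2
    linarith
  set H : unitInterval → unitInterval → ℂ → ℂ := fun s t q => A.hY e0 t (hf (mf r s t) (A.hX e0 s q)) with hH
  have hmem : ∀ s t, ∀ q ∈ G.D s, H s t q ∈ G.D t := fun s t q hq => hY_mem hn (him s t (hX_im hn hq))
  have hinv : ∀ s t, ∀ q ∈ G.D s, H t s (H s t q) = q := by
    intro s t q hq
    simp only [hH]
    rw [hX_hY hn (him s t (hX_im hn hq)), hf_hf (hM.mf_mf s t), hY_hX hn hq]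
  refine ⟨fun t => H 0 t, fun t => ⟨fun q hq => hmem 0 t q hq, fun q hq q' hq' h => ?_, fun q hq => ?_⟩, fun q hq => ?_, ?_, ?_⟩
  · rw [← hinv 0 t q hq, ← hinv 0 t q' hq']; exact congrArg _ h
  · exact ⟨H t 0 q, hmem t 0 q hq, hinv t 0 q hq⟩
  · have : ∀ w, hf (mf r 0 0) w = w := by
      intro w
      apply Complex.ext <;> simp [hf, hM.mf_self]
    simp only [hH, this]
    exact hY_hX hn hq
  · rintro ⟨t, q⟩ ⟨-, hq⟩
    have c1 : ContinuousWithinAt (fun p : unitInterval × ℂ => A.hX e0 0 p.2) (univ ×ˢ G.D 0) (t, q) :=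
      ContinuousWithinAt.comp (f := Prod.snd) (g := A.hX e0 0) (t := G.D 0) (hX_cont hn 0 q hq) continuousWithinAt_snd (fun p hp => hp.2)
    have c2 : Continuous fun p : unitInterval × ℂ => hf (mf r 0 p.1) p.2 := by
      have c3 : Continuous fun p : unitInterval × ℂ => mf r 0 p.1 (p.2.re - p.2.im) :=
        (hM.mf_cont 0).comp (f := fun p : unitInterval × ℂ => (p.1, p.2.re - p.2.im)) (by fun_prop)
      have c4 : Continuous fun p : unitInterval × ℂ => mf r 0 p.1 (p.2.re + p.2.im) :=
        (hM.mf_cont 0).comp (f := fun p : unitInterval × ℂ => (p.1, p.2.re + p.2.im)) (by fun_prop)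
      have : (fun p : unitInterval × ℂ => hf (mf r 0 p.1) p.2) = fun p : unitInterval × ℂ =>
          (((mf r 0 p.1 (p.2.re - p.2.im) + mf r 0 p.1 (p.2.re + p.2.im)) / 2 : ℝ) : ℂ) +
          (((mf r 0 p.1 (p.2.re + p.2.im) - mf r 0 p.1 (p.2.re - p.2.im)) / 2 : ℝ) : ℂ) * Complex.I := by
        funext p
        apply Complex.ext <;> simp [hf]
      rw [this]
      fun_prop
    have c5 : ContinuousWithinAt (fun p : unitInterval × ℂ => (p.1, hf (mf r 0 p.1) (A.hX e0 0 p.2))) (univ ×ˢ G.D 0) (t, q) :=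
      continuousWithinAt_fst.prodMk (c2.continuousAt.comp_continuousWithinAt (f := fun p : unitInterval × ℂ => (p.1, A.hX e0 0 p.2))
        (x := (t, q)) (continuousWithinAt_fst.prodMk c1))
    exact (hY_cont hn (him 0 t (hX_im hn hq))).comp_continuousWithinAt (f := fun p : unitInterval × ℂ => (p.1, hf (mf r 0 p.1) (A.hX e0 0 p.2)))
      (x := (t, q)) c5
  · intro t p hp
    have hp' := hmem 0 t p hp
    have hXH : A.hX e0 t (H 0 t p) = hf (mf r 0 t) (A.hX e0 0 p) := hX_hY hn (him 0 t (hX_im hn hp))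
    have key : ∀ s, ∀ q ∈ G.D s, ∃ k : ℂ, ‖k‖ = 1 ∧ (∀ e, A.bd e s = A.bd e0 s → k * mob (A.ψ s q) (A.bd e s) = 1) ∧
        ∀ e, A.bd e s ≠ A.bd e0 s → k * mob (A.ψ s q) (A.bd e s) =
          icay ((A.br e0 e s - (A.hX e0 s q).re) / (A.hX e0 s q).im : ℝ) := by
      intro s q hq
      have hπ := (A.bd_spec hn e0 s).1
      have hw0 := (A.conf s).mψ q hq
      set π := A.bd e0 s with hpi
      set w0 := A.ψ s q with hw0d
      have hv0 := hX_pre (A := A) (e0 := e0) hn hq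
      rw [← hpi, ← hw0d] at hv0
      set v0 := conj π * w0 with hv0d
      have n2 : 1 - v0 ≠ 0 := by intro h0; rw [← sub_eq_zero.1 h0] at hv0; simp at hv0
      have n3 : 1 - conj v0 ≠ 0 := by intro h; apply n2; have := congr_arg conj h; simpa using this
      refine ⟨conj π * (1 - conj v0) / (1 - v0), ?_, fun e he => ?_, fun e he => ?_⟩
      · rw [norm_div, norm_mul, RCLike.norm_conj, hπ, one_mul, ← Complex.norm_conj (1 - conj v0)]
        simp only [map_sub, map_one, Complex.conj_conj]
        exact div_self (norm_ne_zero_iff.2 n2)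
      · rw [he, mob]
        have e1 : 1 - conj w0 * π = 1 - conj v0 := by rw [hv0d]; simp; ring
        have e2 : π - w0 = π * (1 - v0) := by
          rw [hv0d, mul_sub, ← mul_assoc, conj_unit hπ]; ring
        rw [e1, e2]
        rw [show conj π * (1 - conj v0) / (1 - v0) * (π * (1 - v0) / (1 - conj v0)) =
          (π * conj π) * (((1 - conj v0) / (1 - conj v0)) * ((1 - v0) / (1 - v0))) by ring, div_self n2, div_self n3, conj_unit hπ]
        ring
      · exact mob_cay hπ hw0 (A.bd_spec hn e s).1 he
    obtain ⟨k, hk, hk1, hk2⟩ := key 0 p hp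
    obtain ⟨k', hk', hk1', hk2'⟩ := key t _ hp'
    refine ⟨k, k', hk, hk', fun e => ?_⟩
    by_cases he : A.bd e 0 = A.bd e0 0
    · rw [hk1 e he]
      refine ⟨fun h => ?_, fun _ h => ?_, fun _ h => ?_⟩ <;> norm_num at h
    have he' : A.bd e t ≠ A.bd e0 t := fun h => he (A.bd_eq_time hn h)
    rw [hk2 e he, hk2' e he', hXH, icay_re, icay_im, icay_re, icay_im]
    have hy := hX_im (A := A) (e0 := e0) hn hp
    have hy' := him 0 t hy
    have l1 : A.br e0 e t < mf r 0 t ((A.hX e0 0 p).re + (A.hX e0 0 p).im) ↔ A.br e0 e 0 < (A.hX e0 0 p).re + (A.hX e0 0 p).im :=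
      hM.lt_iff (e := ⟨e, he⟩)
    have l2 : A.br e0 e t < mf r 0 t ((A.hX e0 0 p).re - (A.hX e0 0 p).im) ↔ A.br e0 e 0 < (A.hX e0 0 p).re - (A.hX e0 0 p).im :=
      hM.lt_iff (e := ⟨e, he⟩)
    have l3 : mf r 0 t ((A.hX e0 0 p).re + (A.hX e0 0 p).im) < A.br e0 e t ↔ (A.hX e0 0 p).re + (A.hX e0 0 p).im < A.br e0 e 0 :=
      hM.lt_iff' (e := ⟨e, he⟩)
    have l4 : mf r 0 t ((A.hX e0 0 p).re - (A.hX e0 0 p).im) < A.br e0 e t ↔ (A.hX e0 0 p).re - (A.hX e0 0 p).im < A.br e0 e 0 :=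
      hM.lt_iff' (e := ⟨e, he⟩)
    set x := (A.hX e0 0 p).re
    set y := (A.hX e0 0 p).im
    set h' := hf (mf r 0 t) (A.hX e0 0 p) with hh'
    have m1 : h'.re + h'.im = mf r 0 t (x + y) := by simp only [hh', hf]; ring
    have m2 : h'.re - h'.im = mf r 0 t (x - y) := by simp only [hh', hf]; ring
    rw [← m1] at l1 l3
    rw [← m2] at l2 l4
    set b := A.br e0 e 0
    set b' := A.br e0 e t
    have pos : ∀ a : ℝ, 0 < a^2 + 1 := fun a => by positivity
    rw [div_lt_iff₀ (pos _), div_lt_iff₀ (pos _), div_lt_iff₀ (pos _), div_lt_iff₀ (pos _), lt_div_iff₀ (pos _),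
      lt_div_iff₀ (pos _), lt_div_iff₀ (pos _), lt_div_iff₀ (pos _)]
    simp only [zero_mul]
    have v1 : b - x = y * ((b - x) / y) := by field_simp
    have v2 : b' - h'.re = h'.im * ((b' - h'.re) / h'.im) := by field_simp
    set v := (b - x) / y
    set v' := (b' - h'.re) / h'.im
    have k1 : b < x + y ↔ v < 1 := ⟨fun h => by by_contra hc; nlinarith, fun h => by nlinarith⟩
    have k2 : b < x - y ↔ v < -1 := ⟨fun h => by by_contra hc; nlinarith, fun h => by nlinarith⟩
    have k3 : x + y < b ↔ 1 < v := ⟨fun h => by by_contra hc; nlinarith, fun h => by nlinarith⟩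
    have k4 : x - y < b ↔ -1 < v := ⟨fun h => by by_contra hc; nlinarith, fun h => by nlinarith⟩
    have k1' : b' < h'.re + h'.im ↔ v' < 1 := ⟨fun h => by by_contra hc; nlinarith, fun h => by nlinarith⟩
    have k2' : b' < h'.re - h'.im ↔ v' < -1 := ⟨fun h => by by_contra hc; nlinarith, fun h => by nlinarith⟩
    have k3' : h'.re + h'.im < b' ↔ 1 < v' := ⟨fun h => by by_contra hc; nlinarith, fun h => by nlinarith⟩
    have k4' : h'.re - h'.im < b' ↔ -1 < v' := ⟨fun h => by by_contra hc; nlinarith, fun h => by nlinarith⟩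
    rw [k1, k1'] at l1
    rw [k2, k2'] at l2
    rw [k3, k3'] at l3
    rw [k4, k4'] at l4
    refine ⟨fun h => ?_, fun h1 h2 => ?_, fun h1 h2 => ?_⟩
    · have a1 := l1.2 (by nlinarith)
      have a2 := l4.2 (by nlinarith)
      nlinarith
    · have a1 := l3.2 (by nlinarith)
      constructor <;> nlinarith
    · have a1 := l2.2 (by nlinarith)
      constructor <;> nlinarith
end RM
end Isot
end IsoExt
end

section
open Set Metric Topology Filter ComplexConjugate MeasureTheory
set_option linter.unusedSectionVars false
namespace IsoExt

lemma Conf.ray {R : ℝ} (hR : 0 < R) : ∃ δ, 0 < δ ∧ δ < R ∧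
    ∀ (U : Set ℂ) (ψ φ : ℂ → ℂ), Conf U ψ φ → ∀ o ∈ U, ψ o = 0 → ∀ c, dist o c < δ →
      (∀ ρ > 0, ∃ z ∈ sphere c ρ, z ∉ U) → ∀ ζ : ℂ, ‖ζ‖ = 1 → ∃ ζ' : ℂ, ‖ζ'‖ = 1 ∧ ‖ζ' - ζ‖ ≤ 1/8 ∧
        ∀ s ∈ Ico (0:ℝ) 1, φ (s * ζ') ∈ ball c R := by
  obtain ⟨r, hr, hrR, hN⟩ := wolff_scale Real.pi hR (Λ := 1/1000) (by norm_num)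
  refine ⟨r, hr, hrR, fun U ψ φ h o ho ho0 c hoc hcirc ζ hζ => ?_⟩
  have hA : volume (ψ '' U) ≤ ENNReal.ofReal Real.pi := by
    refine (measure_mono (μ := volume) (t := ball (0:ℂ) 1) ?_).trans ?_
    · rintro _ ⟨z, hz, rfl⟩; simpa using h.mψ z hz
    · rw [Complex.volume_ball]; simp [NNReal.pi, ENNReal.ofReal, Real.toNNReal_of_nonneg Real.pi_pos.le]; exact le_rfl
  obtain ⟨ρ, hρ, hlen⟩ := wolff h.isOpen h.dψ h.injψ hA c hr hrR (by norm_num) hN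
  have hρ0 := hr.trans hρ.1
  have hang := fun hcov => h.cap_ang hρ0 (hcirc ρ hρ0) (by norm_num) (by norm_num) hlen hζ (β := 1/128) hcov
  have : ∃ y ∈ Ioo (1 - 1/128 : ℝ) 1, ∀ z ∈ sphere c ρ, z ∈ U → (conj ζ * (ψ z / ‖ψ z‖)).re ≠ y := by
    by_contra hcon
    push Not at hcon
    have := hang hcon
    norm_num at this
  obtain ⟨y, hy, hyz⟩ := this
  set u : ℂ := ⟨y, √(1 - y^2)⟩ with hu
  have hy1 : 0 ≤ 1 - y^2 := by nlinarith [hy.1, hy.2]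
  have hun : ‖u‖ = 1 := by
    rw [← sq_eq_sq₀ (norm_nonneg _) zero_le_one, ← Complex.normSq_eq_norm_sq, Complex.normSq_apply, hu]
    simp only; rw [Real.mul_self_sqrt hy1]; ring
  refine ⟨ζ * u, by rw [norm_mul, hζ, hun, one_mul], ?_, ?_⟩
  · have h1 : ‖ζ * u - ζ‖ = ‖u - 1‖ := by
      rw [show ζ * u - ζ = ζ * (u - 1) by ring, norm_mul, hζ, one_mul]
    rw [h1, ← sq_le_sq₀ (norm_nonneg _) (by norm_num), ← Complex.normSq_eq_norm_sq, Complex.normSq_apply, hu]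
    simp only [Complex.sub_re, Complex.sub_im, Complex.one_re, Complex.one_im, sub_zero]
    rw [Real.mul_self_sqrt hy1]; nlinarith [hy.1]
  · have hlt : ∀ s ∈ Ico (0:ℝ) 1, ‖(s:ℂ) * (ζ * u)‖ = s := by
      intro s hs
      rw [norm_mul, norm_mul, hζ, hun, Complex.norm_real, Real.norm_of_nonneg hs.1]; ring
    have hmiss : ∀ s ∈ Ico (0:ℝ) 1, φ (s * (ζ * u)) ∉ sphere c ρ := by
      intro s hs hsp
      have hlt' : ‖(s:ℂ) * (ζ * u)‖ < 1 := by rw [hlt s hs]; exact hs.2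
      rcases hs.1.eq_or_lt with h0 | h0
      · rw [← h0] at hsp
        have hφ0 : φ 0 = o := by rw [← ho0, h.left o ho]
        rw [Complex.ofReal_zero, zero_mul, hφ0, mem_sphere] at hsp
        linarith [hρ.1]
      · refine hyz _ hsp (h.mφ _ hlt') ?_
        rw [h.right _ hlt', hlt s hs, mul_div_cancel_left₀ _ (by exact_mod_cast h0.ne'), ← mul_assoc, Complex.conj_mul', hζ, hu]
        simp
    intro s hs
    have hc : ContinuousOn (fun s : ℝ => dist (φ (s * (ζ * u))) c) (Ico 0 1) := by
      refine continuous_dist.comp_continuousOn ((h.dφ.continuousOn.comp (by fun_prop) fun s hs => ?_).prodMk continuousOn_const)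
      rw [mem_ball, dist_zero_right, hlt s hs]; exact hs.2
    have hρs : dist (φ (s * (ζ * u))) c < ρ := by
      by_contra hcon
      have hφ0 : φ 0 = o := by rw [← ho0, h.left o ho]
      obtain ⟨s', hs', hs2⟩ := isPreconnected_Ico.intermediate_value (a := 0) (by simp) hs hc (show ρ ∈ _ from
        ⟨by beta_reduce; rw [Complex.ofReal_zero, zero_mul, hφ0]; linarith [hρ.1], not_lt.1 hcon⟩)
      exact hmiss s' hs' hs2
    exact hρs.trans hρ.2

lemma mob_unit {c w : ℂ} (hc : ‖c‖ < 1) (hw : ‖w‖ = 1) : ‖mob c w‖ = 1 := by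
  have h := mob_identity c w
  rw [hw] at h
  have hd : 1 - conj c * w ≠ 0 := by
    intro h0
    have : ‖conj c * w‖ = 1 := by rw [← sub_eq_zero.1 h0]; simp
    rw [norm_mul, RCLike.norm_conj, hw, mul_one] at this; linarith
  rw [mob, norm_div, div_eq_one_iff_eq (norm_ne_zero_iff.2 hd), ← sq_eq_sq₀ (norm_nonneg _) (norm_nonneg _)]
  linarith

lemma mob_lip {c : ℂ} (hc : ‖c‖ < 1) : ∃ K > 0, ∀ a b : ℂ, ‖a‖ ≤ 1 → ‖b‖ ≤ 1 → ‖mob c a - mob c b‖ ≤ K * ‖a - b‖ := by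
  have hd : ∀ a : ℂ, ‖a‖ ≤ 1 → 1 - ‖c‖ ≤ ‖1 - conj c * a‖ := by
    intro a ha
    have h1 := norm_sub_norm_le (1:ℂ) (conj c * a)
    rw [norm_mul, RCLike.norm_conj, norm_one] at h1
    nlinarith [norm_nonneg c, norm_nonneg a]
  have hp : 0 < 1 - ‖c‖ := by linarith
  refine ⟨2 / (1 - ‖c‖)^2, by positivity, fun a b ha hb => ?_⟩
  have na : 1 - conj c * a ≠ 0 := norm_pos_iff.1 (hp.trans_le (hd a ha))
  have nb : 1 - conj c * b ≠ 0 := norm_pos_iff.1 (hp.trans_le (hd b hb))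
  have e : mob c a - mob c b = (1 - conj c * c) * (a - b) / ((1 - conj c * a) * (1 - conj c * b)) := by
    rw [mob, mob, div_sub_div _ _ na nb]; congr 1; ring
  rw [e, norm_div, norm_mul, norm_mul, div_mul_eq_mul_div]
  refine div_le_div₀ (by positivity) ?_ (by positivity) ?_
  · gcongr
    refine (norm_sub_le _ _).trans ?_
    rw [norm_one, norm_mul, RCLike.norm_conj]; nlinarith [norm_nonneg c]
  · rw [sq]; exact mul_le_mul (hd a ha) (hd b hb) hp.le (norm_nonneg _)

namespace Isot
variable {X : Type*} [MetricSpace X] [CompactSpace X]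

lemma RM.reach {R : ℝ} (hR : 0 < R) [ConnectedSpace X] [Nontrivial X] : ∃ δ > 0, ∀ (G : Isot X) (A : G.RM), G.Nice →
    ∀ p ∈ G.D 0, ∀ z0, dist p (G.g 0 z0) < δ → ∀ ζ : ℂ, ‖ζ‖ = 1 → ∃ e : G.End, ‖mob (A.ψ 0 p) (A.bd e 0) - ζ‖ ≤ 1/4 ∧
      ∃ C : Set ℂ, IsPreconnected C ∧ p ∈ C ∧ C ⊆ G.D 0 ∧ C ⊆ ball (G.g 0 z0) R ∧ ∀ r > 0, (C ∩ e.W 0 r).Nonempty := by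
  obtain ⟨δ, hδ, -, hray⟩ := Conf.ray (R := R/2) (by linarith)
  refine ⟨δ, hδ, fun G A hn p hp z0 hpz ζ hζ => ?_⟩
  set w0 := A.ψ 0 p with hw0
  have hw0n : ‖w0‖ < 1 := (A.conf 0).mψ p hp
  have hw0n' : ‖-w0‖ < 1 := by rwa [norm_neg]
  have hconf := (A.conf 0).comp_mob hw0n
  obtain ⟨ζ', hζ', hζζ, hin⟩ := hray _ _ _ hconf p hp (mob_self w0) _ hpz (fun ρ hρ => hn.circ 0 z0 hρ) ζ hζ
  obtain ⟨K, hK, hlip⟩ := mob_lip hw0n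
  obtain ⟨s, hs, hend⟩ := A.end_near hn 0 (η := min (R/2) (1/(16*K))) (by positivity)
  have hlim : ContinuousAt (fun τ : ℝ => ‖mob (-w0) (τ * ζ')‖) 1 := by
    have hd : 1 - conj (-w0) * ((1:ℝ) * ζ') ≠ 0 := by
      intro h0
      have : ‖conj (-w0) * ((1:ℝ) * ζ')‖ = 1 := by rw [← sub_eq_zero.1 h0]; simp
      rw [norm_mul, RCLike.norm_conj, Complex.ofReal_one, one_mul, hζ', mul_one] at this; linarith
    have c1 : ContinuousAt (fun τ : ℝ => (τ:ℂ) * ζ' - -w0) 1 := by fun_prop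
    have c2 : ContinuousAt (fun τ : ℝ => 1 - conj (-w0) * ((τ:ℂ) * ζ')) 1 := by fun_prop
    exact (c1.div c2 hd).norm
  have hev : ∀ᶠ τ : ℝ in 𝓝[<] 1, s < ‖mob (-w0) (τ * ζ')‖ ∧ 15/16 < τ ∧ τ < 1 := by
    have h1 : ∀ᶠ τ : ℝ in 𝓝 1, s < ‖mob (-w0) (τ * ζ')‖ := by
      refine hlim.eventually (lt_mem_nhds ?_)
      beta_reduce
      rw [Complex.ofReal_one, one_mul, mob_unit hw0n' hζ']; exact hs
    filter_upwards [h1.filter_mono nhdsWithin_le_nhds, (lt_mem_nhds (show (15/16:ℝ) < 1 by norm_num)).filter_mono nhdsWithin_le_nhds,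
      self_mem_nhdsWithin] with τ a b c using ⟨a, b, c⟩
  obtain ⟨τ, hτs, hτ, hτ1⟩ := hev.exists
  set w := mob (-w0) (τ * ζ') with hw
  have hτn : ‖(τ:ℂ) * ζ'‖ = τ := by rw [norm_mul, hζ', mul_one, Complex.norm_real, Real.norm_of_nonneg (by linarith)]
  have hwn : ‖w‖ < 1 := mob_norm hw0n' (by rw [hτn]; exact hτ1)
  obtain ⟨e, he1, he2, he3⟩ := hend w hτs hwn
  have hmw : mob w0 w = τ * ζ' := by
    have := mob_inv (c := -w0) hw0n' (w := τ * ζ') (by rw [hτn]; exact hτ1)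
    rwa [neg_neg] at this
  refine ⟨e, ?_, ?_⟩
  · have h1 := hlip (A.bd e 0) w (A.bd_spec hn e 0).1.le hwn.le
    rw [hmw] at h1
    have h2 : ‖A.bd e 0 - w‖ ≤ 1/(16*K) := by rw [norm_sub_rev]; exact he1.trans (min_le_right _ _)
    have h3 : K * ‖A.bd e 0 - w‖ ≤ 1/16 := by
      calc _ ≤ K * (1/(16*K)) := by gcongr
        _ = 1/16 := by field_simp
    have h4 : ‖(τ:ℂ) * ζ' - ζ'‖ ≤ 1/16 := by
      rw [show (τ:ℂ) * ζ' - ζ' = ((τ - 1 : ℝ):ℂ) * ζ' by push_cast; ring, norm_mul, hζ', mul_one, Complex.norm_real, Real.norm_eq_abs,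
        abs_of_neg (by linarith)]
      linarith
    have : mob w0 (A.bd e 0) - ζ = (mob w0 (A.bd e 0) - τ * ζ') + ((τ:ℂ) * ζ' - ζ') + (ζ' - ζ) := by ring
    rw [this]
    refine (norm_add₃_le).trans ?_
    linarith
  · set x := G.g 0 e.x with hx
    set C1 := (fun σ : ℝ => A.φ 0 (mob (-w0) (σ * ζ'))) '' Icc 0 τ with hC1
    set C2 := (fun c : ℝ => x + c * (A.φ 0 w - x)) '' Ioc 0 1 with hC2
    have hσ : ∀ σ ∈ Icc 0 τ, ‖(σ:ℂ) * ζ'‖ < 1 := by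
      intro σ hσ
      rw [norm_mul, hζ', mul_one, Complex.norm_real, Real.norm_of_nonneg hσ.1]
      exact hσ.2.trans_lt hτ1
    have p1 : IsPreconnected C1 := isPreconnected_Icc.image _
      (hconf.dφ.continuousOn.comp (f := fun σ : ℝ => (σ:ℂ) * ζ') (by fun_prop) fun σ h => by simpa using hσ σ h)
    have p2 : IsPreconnected C2 := isPreconnected_Ioc.image _ (by fun_prop)
    have m1 : A.φ 0 w ∈ C1 := ⟨τ, ⟨by linarith, le_rfl⟩, rfl⟩
    have m2 : A.φ 0 w ∈ C2 := ⟨1, by simp, by simp⟩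
    have hwb : dist (A.φ 0 w) (G.g 0 z0) < R/2 := hin τ ⟨by linarith, hτ1⟩
    have hxd : dist (A.φ 0 w) x < R/2 := he2.trans_le (min_le_left _ _)
    refine ⟨C1 ∪ C2, IsPreconnected.union _ m1 m2 p1 p2, Or.inl ⟨0, ⟨le_rfl, by linarith⟩, ?_⟩, ?_, ?_, ?_⟩
    · beta_reduce
      rw [Complex.ofReal_zero, zero_mul, mob_zero_left, neg_neg, hw0, (A.conf 0).left p hp]
    · rintro _ (⟨σ, h, rfl⟩ | ⟨c, hc, rfl⟩)
      · exact hconf.mφ _ (hσ σ h)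
      · exact W_subset_D (he3 c hc _ (lt_add_one _))
    · rintro _ (⟨σ, h, rfl⟩ | ⟨c, hc, rfl⟩)
      · exact ball_subset_ball (by linarith) (hin σ ⟨h.1, h.2.trans_lt hτ1⟩)
      · have h1 : dist (x + c * (A.φ 0 w - x)) (A.φ 0 w) ≤ dist (A.φ 0 w) x := by
          rw [dist_eq_norm, dist_eq_norm, show x + c * (A.φ 0 w - x) - A.φ 0 w = ((c - 1 : ℝ):ℂ) * (A.φ 0 w - x) by push_cast; ring, norm_mul,
            Complex.norm_real, Real.norm_eq_abs]
          have : |c - 1| ≤ 1 := abs_le.2 ⟨by linarith [hc.1], by linarith [hc.2]⟩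
          exact mul_le_of_le_one_left (norm_nonneg _) this
        rw [mem_ball]
        linarith [dist_triangle (x + c * (A.φ 0 w - x)) (A.φ 0 w) (G.g 0 z0)]
    · intro r hr
      have hd : 0 ≤ dist (A.φ 0 w) x := dist_nonneg
      set c := min 1 (r / (2 * (dist (A.φ 0 w) x + 1))) with hc
      have hc0 : 0 < c := by positivity
      have hc1 : c ≤ 1 := min_le_left _ _
      refine ⟨_, Or.inr ⟨c, ⟨hc0, hc1⟩, rfl⟩, he3 c ⟨hc0, hc1⟩ r ?_⟩
      have h1 : c * (2 * (dist (A.φ 0 w) x + 1)) ≤ r := by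
        rw [← le_div_iff₀ (by positivity)]; exact min_le_right _ _
      nlinarith
end Isot
end IsoExt
end

section
open Set Metric Topology Filter ComplexConjugate MeasureTheory
set_option linter.unusedSectionVars false
namespace IsoExt
namespace Isot
variable {X : Type*} [MetricSpace X] [CompactSpace X] 

/-- the extension on one complementary domain -/
structure HDm {G : Isot X} (A : G.RM) (H : unitInterval → ℂ → ℂ) : Prop where
  bij : ∀ t, BijOn (H t) (G.D 0) (G.D t)
  id : ∀ q ∈ G.D 0, H 0 q = q
  cont : ContinuousOn (fun p : unitInterval × ℂ => H p.1 p.2) (univ ×ˢ G.D 0)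
  ord : ∀ t, ∀ p ∈ G.D 0, ∃ k k' : ℂ, ‖k‖ = 1 ∧ ‖k'‖ = 1 ∧ ∀ e : G.End,
        ((k * mob (A.ψ 0 p) (A.bd e 0)).re < 0 → (k' * mob (A.ψ t (H t p)) (A.bd e t)).re < 0) ∧
        (0 < (k * mob (A.ψ 0 p) (A.bd e 0)).re → (k * mob (A.ψ 0 p) (A.bd e 0)).im < 0 →
          0 < (k' * mob (A.ψ t (H t p)) (A.bd e t)).re ∧ (k' * mob (A.ψ t (H t p)) (A.bd e t)).im < 0) ∧
        (0 < (k * mob (A.ψ 0 p) (A.bd e 0)).re → 0 < (k * mob (A.ψ 0 p) (A.bd e 0)).im →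
          0 < (k' * mob (A.ψ t (H t p)) (A.bd e t)).re ∧ 0 < (k' * mob (A.ψ t (H t p)) (A.bd e t)).im)

lemma exists_HDm {G : Isot X} (A : G.RM) (hn : G.Nice) [ConnectedSpace X] [Nontrivial X] : ∃ H, HDm A H := by
  obtain ⟨H, h1, h2, h3, h4⟩ := A.exists_HD hn
  exact ⟨H, h1, h2, h3, h4⟩

/-- moduli -/
structure Mod (G : Isot X) (R0 R1 δ0 : ℝ) : Prop where
  far : ∀ t z z0, R1 ≤ dist (G.g t z) (G.g t z0) → ∀ s, R0 ≤ dist (G.g s z) (G.g s z0)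
  near : ∀ x z0, dist (G.g 0 x) (G.g 0 z0) < δ0 → ∀ s, dist (G.g s x) (G.g s z0) < min R0 R1 / 2

lemma mob_bd_close {G : Isot X} (A : G.RM) (hn : G.Nice) [ConnectedSpace X] {t : unitInterval} {e e' : G.End} {w : ℂ} (hw : ‖w‖ < 1)
    {η r0 : ℝ} (hr0 : 0 < r0) (h : ∀ q ∈ e.W t r0, ∀ q' ∈ e'.W t r0, ‖mob w (A.ψ t q) - mob w (A.ψ t q')‖ ≤ η) :
    ‖mob w (A.bd e t) - mob w (A.bd e' t)‖ ≤ η := by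
  obtain ⟨K, hK, hlip⟩ := mob_lip hw
  refine le_of_forall_pos_le_add fun ε hε => ?_
  obtain ⟨r, hr, hb⟩ := A.bd_unif hn (η := ε/(2*K)) (by positivity)
  have key : ∀ e : G.End, ∃ q ∈ e.W t r0, ‖mob w (A.bd e t) - mob w (A.ψ t q)‖ ≤ ε/2 := by
    intro e
    obtain ⟨q, hq⟩ := e.ne t (min r0 r) (lt_min hr0 hr)
    have hq1 := W_mono_self (lt_min hr0 hr) (min_le_left _ _) hq
    have h1 := hb e t q (W_mono_self (lt_min hr0 hr) (min_le_right _ _) hq)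
    refine ⟨q, hq1, (hlip _ _ (A.bd_spec hn e t).1.le ((A.conf t).mψ q (W_subset_D hq)).le).trans ?_⟩
    rw [norm_sub_rev]
    calc _ ≤ K * (ε/(2*K)) := by gcongr
      _ = ε/2 := by field_simp
  obtain ⟨q, hq, h1⟩ := key e
  obtain ⟨q', hq', h2⟩ := key e'
  have h3 := h q hq q' hq'
  rw [norm_sub_rev] at h2
  have : mob w (A.bd e t) - mob w (A.bd e' t) = (mob w (A.bd e t) - mob w (A.ψ t q)) + (mob w (A.ψ t q) - mob w (A.ψ t q'))
    + (mob w (A.ψ t q') - mob w (A.bd e' t)) := by ring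
  rw [this]
  refine norm_add₃_le.trans ?_
  linarith

section compare
variable {G : Isot X} {R0 R1 δ0 : ℝ} {z0 : X}

/-- relative logarithm seen from z0 -/
noncomputable def relN (z0 : X) (e : G.End) (s : unitInterval) (z : X) : ℂ :=
  e.μ s z - Complex.log ((G.g s z - G.g s e.x) / (G.g s z - G.g s z0))

lemma relN_sub (hM : G.Mod R0 R1 δ0) (e : G.End) (hx : dist (G.g 0 e.x) (G.g 0 z0) < δ0) (s : unitInterval) {R r : ℝ}
    (hr : 0 < r) (hR : min R0 R1 ≤ R) (hrR : r ≤ R/2) : e.W s r ⊆ G.W s (G.g s z0) R (relN z0 e s) := by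
  have h1 := hM.near _ _ hx s
  refine W_mono hr (by linarith) fun z hz => ?_
  simp only [relN]; ring

lemma relN_exp (hn : G.Nice) (e : G.End) (s : unitInterval) {z : X} (hz : dist (G.g s e.x) (G.g s z0) < dist (G.g s z) (G.g s z0)) :
    Complex.exp (relN z0 e s z) = (G.g s z - G.g s z0) / G.g s z := by
  have hzx : z ≠ e.x := by rintro rfl; exact lt_irrefl _ hz
  have n1 : G.g s z - G.g s e.x ≠ 0 := sub_ne_zero.2 fun h => hzx (G.inj s h)
  have n2 : G.g s z - G.g s z0 ≠ 0 := by
    rw [← norm_pos_iff, ← dist_eq_norm]; exact dist_nonneg.trans_lt hz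
  have n3 := hn.ne0 s z
  have h := e.eq s z hzx
  rw [relN, Complex.exp_sub, Complex.exp_log (div_ne_zero n1 n2)]
  have h' : Complex.exp (e.μ s z) = (G.g s z - G.g s e.x) / G.g s z := by rw [← h]; field_simp
  rw [h']; field_simp

lemma relN_cont (e : G.End) {z : X} (hz : ∀ s, dist (G.g s e.x) (G.g s z0) < dist (G.g s z) (G.g s z0)) :
    Continuous fun s => relN z0 e s z := by
  have hzx : z ≠ e.x := by rintro rfl; exact lt_irrefl _ (hz 0)
  have c1 : Continuous fun t => e.μ t z := continuous_iff_continuousAt.2 fun t =>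
    (e.contAt (t := t) hzx).comp (f := fun t : unitInterval => (t, z)) (by fun_prop)
  have cg : ∀ y, Continuous fun s => G.g s y := fun y => G.cont.comp (Continuous.prodMk_left y)
  refine c1.sub (Continuous.clog ?_ fun s => Or.inl (re_pos_sub (hz s)))
  refine ((cg z).sub (cg e.x)).div ((cg z).sub (cg z0)) fun s => ?_
  rw [← norm_pos_iff, ← dist_eq_norm]; exact dist_nonneg.trans_lt (hz s)

lemma compare (hn : G.Nice) [ConnectedSpace X] (hM : G.Mod R0 R1 δ0) (hR0 : 0 < R0) (hR1 : 0 < R1) {R : ℝ} (hRδ : R < δ0) (hRR : R ≤ R0)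
    {p : ℂ} {e e' : G.End} (he : ∃ C : Set ℂ, IsPreconnected C ∧ p ∈ C ∧ C ⊆ G.D 0 ∧ C ⊆ ball (G.g 0 z0) R ∧ ∀ r > 0, (C ∩ e.W 0 r).Nonempty)
    (he' : ∃ C : Set ℂ, IsPreconnected C ∧ p ∈ C ∧ C ⊆ G.D 0 ∧ C ⊆ ball (G.g 0 z0) R ∧ ∀ r > 0, (C ∩ e'.W 0 r).Nonempty)
    (t : unitInterval) : ∃ W : Set ℂ, W ⊆ G.D t ∧ W ⊆ ball (G.g t z0) R1 ∧ IsPreconnected W ∧ ∃ r > 0, e.W t r ⊆ W ∧ e'.W t r ⊆ W := by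
  have key : ∀ e : G.End, (∃ C : Set ℂ, IsPreconnected C ∧ p ∈ C ∧ C ⊆ G.D 0 ∧ C ⊆ ball (G.g 0 z0) R ∧ ∀ r > 0, (C ∩ e.W 0 r).Nonempty) →
      dist (G.g 0 e.x) (G.g 0 z0) < δ0 ∧ p ∈ G.W 0 (G.g 0 z0) R0 (relN z0 e 0) := by
    rintro e ⟨C, hC, hpC, hCD, hCb, hCW⟩
    have hx : dist (G.g 0 e.x) (G.g 0 z0) < δ0 := by
      refine lt_of_le_of_lt (le_of_forall_pos_le_add fun r hr => ?_) hRδ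
      obtain ⟨q, hq, hqW⟩ := hCW r hr
      have h1 := hCb hq
      have h2 := W_subset_ball hqW
      rw [mem_ball] at h1 h2
      linarith [dist_triangle_left (G.g 0 e.x) (G.g 0 z0) q]
    refine ⟨hx, ?_⟩
    obtain ⟨q, hq, hqW⟩ := hCW (R0/2) (by linarith)
    refine hn.W_max hC ?_ (hCb.trans (ball_subset_ball hRR)) hq (relN_sub hM e hx 0 (by linarith) (min_le_left _ _) le_rfl hqW) hpC
    rw [disjoint_left]
    exact fun q hq => hn.D_notMem (hCD hq)
  obtain ⟨hx, hp⟩ := key e he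
  obtain ⟨hx', hp'⟩ := key e' he'
  obtain ⟨k, hk, hkz⟩ := hn.W_common hp hp'
  have hfar : ∀ z, R1 ≤ dist (G.g t z) (G.g t z0) → relN z0 e t z - relN z0 e' t z = k := by
    intro z hz
    have h1 := hM.far t z z0 hz
    have hd : ∀ e : G.End, dist (G.g 0 e.x) (G.g 0 z0) < δ0 → ∀ s, dist (G.g s e.x) (G.g s z0) < dist (G.g s z) (G.g s z0) := by
      intro e hx s
      have h2 := hM.near _ _ hx s
      have h3 := h1 s
      have h4 := min_le_left R0 R1
      linarith
    rw [← hkz z (h1 0)]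
    refine log_unique isPreconnected_univ (relN_cont e (hd e hx)).continuousOn (relN_cont e' (hd e' hx')).continuousOn
      (fun s _ => ?_) (mem_univ _) (mem_univ _)
    rw [relN_exp hn e s (hd e hx s), relN_exp hn e' s (hd e' hx' s)]
  refine ⟨G.W t (G.g t z0) R1 (relN z0 e' t), W_subset_D, W_subset_ball, hn.W_preconn _ _ _ _, R1/2, by linarith, ?_, ?_⟩
  · exact (relN_sub hM e hx t (by linarith) (min_le_right _ _) le_rfl).trans (W_const hk hfar)
  · exact relN_sub hM e' hx' t (by linarith) (min_le_right _ _) le_rfl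
end compare

lemma control [ConnectedSpace X] [Nontrivial X] {ε : ℝ} (hε : 0 < ε) : ∃ R1 > 0, ∀ R0 > 0, ∀ δ0 > 0, ∃ δ > 0,
    ∀ (G : Isot X) (A : G.RM) (H : unitInterval → ℂ → ℂ), G.Nice → HDm A H → G.Mod R0 R1 δ0 → ∀ p ∈ G.D 0, ∀ z0,
      dist p (G.g 0 z0) < δ → ∀ t, dist (H t p) (G.g t z0) < ε := by
  obtain ⟨R1, hR1, -, hcap⟩ := Conf.cap_scale (η := 1/4) (by norm_num) hε
  refine ⟨R1, hR1, fun R0 hR0 δ0 hδ0 => ?_⟩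
  obtain ⟨δ, hδ, hreach⟩ := RM.reach (X := X) (R := min (δ0/2) R0) (by positivity)
  refine ⟨δ, hδ, fun G A H hn hH hM p hp z0 hpz t => ?_⟩
  by_contra hcon
  have hcon := not_lt.1 hcon
  obtain ⟨k, k', hk, hk', hord⟩ := hH.ord t p hp
  have hk0 : k ≠ 0 := by rintro rfl; simp at hk
  have hr := hreach G A hn p hp z0 hpz
  have hHp := (hH.bij t).mapsTo hp
  set o := A.ψ t (H t p) with ho
  have hon : ‖o‖ < 1 := (A.conf t).mψ _ hHp
  have hget : ∀ c : ℂ, ‖c‖ = 1 → ∃ e : G.End, ‖k * mob (A.ψ 0 p) (A.bd e 0) - c‖ ≤ 1/4 ∧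
      ∃ C : Set ℂ, IsPreconnected C ∧ p ∈ C ∧ C ⊆ G.D 0 ∧ C ⊆ ball (G.g 0 z0) (min (δ0/2) R0) ∧ ∀ r > 0, (C ∩ e.W 0 r).Nonempty := by
    intro c hc
    obtain ⟨e, h1, h2⟩ := hr (k⁻¹ * c) (by rw [norm_mul, norm_inv, hk, hc]; simp)
    refine ⟨e, ?_, h2⟩
    have : k * mob (A.ψ 0 p) (A.bd e 0) - c = k * (mob (A.ψ 0 p) (A.bd e 0) - k⁻¹ * c) := by
      rw [mul_sub, ← mul_assoc, mul_inv_cancel₀ hk0, one_mul]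
    rw [this, norm_mul, hk, one_mul]; exact h1
  have hclose : ∀ e e' : G.End, (∃ C : Set ℂ, IsPreconnected C ∧ p ∈ C ∧ C ⊆ G.D 0 ∧ C ⊆ ball (G.g 0 z0) (min (δ0/2) R0) ∧ ∀ r > 0, (C ∩ e.W 0 r).Nonempty) →
      (∃ C : Set ℂ, IsPreconnected C ∧ p ∈ C ∧ C ⊆ G.D 0 ∧ C ⊆ ball (G.g 0 z0) (min (δ0/2) R0) ∧ ∀ r > 0, (C ∩ e'.W 0 r).Nonempty) →
      ‖k' * mob o (A.bd e t) - k' * mob o (A.bd e' t)‖ ≤ 1/4 := by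
    intro e e' he he'
    obtain ⟨W, hWD, hWb, hW, r, hr, h1, h2⟩ := compare hn hM hR0 hR1 ((min_le_left _ _).trans_lt (by linarith)) (min_le_right _ _) he he' t
    rw [← mul_sub, norm_mul, hk', one_mul]
    refine mob_bd_close A hn hon hr fun q hq q' hq' => ?_
    exact (hcap _ _ _ ((A.conf t).comp_mob hon) (H t p) hHp (mob_self o) (G.g t z0) hcon (fun ρ hρ => hn.circ t z0 hρ) W hWD hWb hW
      q (h1 hq) q' (h2 hq')).2
  have hreim : ∀ {a b : ℂ} {η : ℝ}, ‖a - b‖ ≤ η → |a.re - b.re| ≤ η ∧ |a.im - b.im| ≤ η := by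
    intro a b η h
    exact ⟨by rw [← Complex.sub_re]; exact (Complex.abs_re_le_norm _).trans h, by rw [← Complex.sub_im]; exact (Complex.abs_im_le_norm _).trans h⟩
  have hunit : ∀ a b : ℝ, a^2 + b^2 = 1 → ‖(⟨a, b⟩ : ℂ)‖ = 1 := by
    intro a b h
    rw [← sq_eq_sq₀ (norm_nonneg _) zero_le_one, ← Complex.normSq_eq_norm_sq, Complex.normSq_apply]
    simp only; linarith
  obtain ⟨e1, a1, b1⟩ := hget ⟨-1, 0⟩ (hunit _ _ (by norm_num))
  obtain ⟨e2, a2, b2⟩ := hget ⟨3/5, -4/5⟩ (hunit _ _ (by norm_num))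
  obtain ⟨e3, a3, b3⟩ := hget ⟨3/5, 4/5⟩ (hunit _ _ (by norm_num))
  have r1 := abs_le.1 (hreim a1).1
  have r2 := abs_le.1 (hreim a2).1
  have i2 := abs_le.1 (hreim a2).2
  have r3 := abs_le.1 (hreim a3).1
  have i3 := abs_le.1 (hreim a3).2
  have o1 := (hord e1).1 (by linarith [r1.2])
  have o2 := (hord e2).2.1 (by linarith [r2.1]) (by linarith [i2.2])
  have o3 := (hord e3).2.2 (by linarith [r3.1]) (by linarith [i3.1])
  have c12 := abs_le.1 (hreim (hclose e1 e2 b1 b2)).1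
  have c23 := abs_le.1 (hreim (hclose e2 e3 b2 b3)).2
  have hun : ∀ e : G.End, (k' * mob o (A.bd e t)).re^2 + (k' * mob o (A.bd e t)).im^2 = 1 := by
    intro e
    have : ‖k' * mob o (A.bd e t)‖ = 1 := by rw [norm_mul, hk', mob_unit hon (A.bd_spec hn e t).1, one_mul]
    rw [← sq_eq_sq₀ (norm_nonneg _) zero_le_one, ← Complex.normSq_eq_norm_sq, Complex.normSq_apply] at this
    linarith
  have u2 := hun e2
  have x2 : (k' * mob o (A.bd e2 t)).re < 1/4 := by linarith [c12.1]
  have y2 : -1/4 < (k' * mob o (A.bd e2 t)).im := by linarith [c23.1]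
  nlinarith [o2.1, o2.2]
end Isot
end IsoExt
end

section
open Set Metric Topology Filter
set_option linter.unusedSectionVars false
namespace IsoExt
namespace Isot
variable {X : Type*} [MetricSpace X] [CompactSpace X]

lemma exists_Mod (G : Isot X) {R1 : ℝ} (hR1 : 0 < R1) : ∃ R0 > 0, ∃ δ0 > 0, G.Mod R0 R1 δ0 := by
  have hg := G.cont
  have c1 : IsClosed {p : (unitInterval × unitInterval) × (X × X) |
      R1 ≤ dist (G.g p.1.1 p.2.1) (G.g p.1.1 p.2.2)} := by
    refine isClosed_le continuous_const (Continuous.dist ?_ ?_)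
    · exact hg.comp (by fun_prop : Continuous fun p : (unitInterval × unitInterval) × (X × X) => (p.1.1, p.2.1))
    · exact hg.comp (by fun_prop : Continuous fun p : (unitInterval × unitInterval) × (X × X) => (p.1.1, p.2.2))
  obtain ⟨R0, hR0, h0⟩ := c1.isCompact.exists_forall_le' (a := (0:ℝ))
    (f := fun p => dist (G.g p.1.2 p.2.1) (G.g p.1.2 p.2.2)) (by
      refine Continuous.continuousOn (Continuous.dist ?_ ?_)
      · exact hg.comp (by fun_prop : Continuous fun p : (unitInterval × unitInterval) × (X × X) => (p.1.2, p.2.1))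
      · exact hg.comp (by fun_prop : Continuous fun p : (unitInterval × unitInterval) × (X × X) => (p.1.2, p.2.2)))
    (by
      rintro ⟨⟨t, s⟩, z, z0⟩ h
      simp only [mem_ofPred_eq] at h ⊢
      refine dist_pos.2 fun hh => ?_
      rw [G.inj s hh, dist_self] at h; linarith)
  have c2 : IsClosed {p : unitInterval × (X × X) |
      min R0 R1 / 2 ≤ dist (G.g p.1 p.2.1) (G.g p.1 p.2.2)} := by
    refine isClosed_le continuous_const (Continuous.dist ?_ ?_)
    · exact hg.comp (by fun_prop : Continuous fun p : (unitInterval) × (X × X) => (p.1, p.2.1))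
    · exact hg.comp (by fun_prop : Continuous fun p : (unitInterval) × (X × X) => (p.1, p.2.2))
  have he : 0 < min R0 R1 / 2 := by positivity
  obtain ⟨δ0, hδ0, h1⟩ := c2.isCompact.exists_forall_le' (a := (0:ℝ))
    (f := fun p => dist (G.g 0 p.2.1) (G.g 0 p.2.2)) (by
      refine Continuous.continuousOn (Continuous.dist ?_ ?_)
      · exact (G.cont_t 0).comp (by fun_prop)
      · exact (G.cont_t 0).comp (by fun_prop))
    (by
      rintro ⟨s, z, z0⟩ h
      simp only [mem_ofPred_eq] at h ⊢
      refine dist_pos.2 fun hh => ?_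
      rw [G.inj 0 hh, dist_self] at h; linarith)
  refine ⟨R0, hR0, δ0, hδ0, ⟨fun t z z0 h s => h0 ((t, s), (z, z0)) h, fun x z0 h s => ?_⟩⟩
  by_contra hc
  exact absurd (h1 (s, (x, z0)) (not_lt.1 hc)) (not_le.2 h)

lemma Mod.shift {G : Isot X} {R0 R1 δ0 : ℝ} (h : G.Mod R0 R1 δ0) (P : unitInterval → ℂ) (hP : Continuous P) :
    (G.shift P hP).Mod R0 R1 δ0 := by
  constructor
  · intro t z z0 h1 s
    simp only [Isot.shift, dist_sub_right] at h1 ⊢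
    exact h.far t z z0 h1 s
  · intro x z0 h1 s
    simp only [Isot.shift, dist_sub_right] at h1 ⊢
    exact h.near x z0 h1 s

/-- points in bounded complementary domains at time zero -/
def Good (G : Isot X) (b : ℂ) : Prop := b ∉ range (G.g 0) ∧ ¬ LogRel univ (fun z => G.g 0 z - b) (fun _ => 1)

/-- the reference function of a point -/
def kap (G : Isot X) (b : ℂ) : X → ℂ := fun z => G.g 0 z - b

lemma Good.kap_ne {G : Isot X} {b : ℂ} (hb : b ∉ range (G.g 0)) (z : X) : G.kap b z ≠ 0 :=
  fun h => hb ⟨z, sub_eq_zero.1 h⟩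

lemma kap_cont (G : Isot X) (b : ℂ) : Continuous (G.kap b) := (G.cont_t 0).sub continuous_const

lemma mem_U_kap (G : Isot X) (b : ℂ) : b ∈ G.U (G.kap b) 0 := LogRel.refl

lemma good_data (G : Isot X) [ConnectedSpace X] [Nontrivial X] {b : ℂ} (hb : G.Good b) :
    ∃ (P : unitInterval → ℂ) (hP : Continuous P) (A : (G.shift P hP).RM) (H : unitInterval → ℂ → ℂ),
      (G.shift P hP).Nice ∧ HDm A H ∧ ∀ t, ∀ q, q ∈ (G.shift P hP).D t ↔ q + P t ∈ G.U (G.kap b) t := by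
  obtain ⟨P, hP, hPU⟩ := G.exists_base (G.kap_cont b) (Good.kap_ne hb.1) hb.2 (s := 0) ⟨b, G.mem_U_kap b⟩
  have hn : (G.shift P hP).Nice := by
    constructor
    · intro t z h
      exact G.U_notMem (Good.kap_ne hb.1) (hPU t) ⟨z, sub_eq_zero.1 h⟩
    · intro h
      exact hb.2 ((LogRel.symm (hPU 0)).trans h)
  obtain ⟨A⟩ := hn.exists_RM
  obtain ⟨H, hH⟩ := exists_HDm A hn
  refine ⟨P, hP, A, H, hn, hH, fun t q => ?_⟩
  rw [hn.D_eq, shift_U]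
  have h0 : LogRel univ ((G.shift P hP).g 0) (G.kap b) := hPU 0
  exact ⟨fun h => LogRel.trans h h0, fun h => LogRel.trans h h0.symm⟩

lemma comps (G : Isot X) [ConnectedSpace X] [Nontrivial X] : ∃ H : ℂ → unitInterval → ℂ → ℂ,
    (∀ b, G.Good b → (∀ t, BijOn (H b t) (G.U (G.kap b) 0) (G.U (G.kap b) t)) ∧
      (∀ q ∈ G.U (G.kap b) 0, H b 0 q = q) ∧
      ContinuousOn (fun p : unitInterval × ℂ => H b p.1 p.2) (univ ×ˢ G.U (G.kap b) 0)) ∧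
    ∀ ε > 0, ∃ δ > 0, ∀ b, G.Good b → ∀ p ∈ G.U (G.kap b) 0, ∀ z0, dist p (G.g 0 z0) < δ →
      ∀ t, dist (H b t p) (G.g t z0) < ε := by
  classical
  choose! P hP A H hn hH hD using fun b (hb : G.Good b) => G.good_data hb
  refine ⟨fun b t q => H b t (q - P b 0) + P b t, ?_, ?_⟩
  · intro b hb
    beta_reduce
    refine ⟨fun t => ⟨?_, ?_, ?_⟩, ?_, ?_⟩
    · intro q hq
      rw [← hD b hb]
      exact ((hH b hb).bij t).mapsTo ((hD b hb 0 (q - P b 0)).2 (by simpa using hq))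
    · intro q hq q' hq' h
      have := ((hH b hb).bij t).injOn ((hD b hb 0 (q - P b 0)).2 (by simpa using hq))
        ((hD b hb 0 (q' - P b 0)).2 (by simpa using hq')) (by simpa using h)
      simpa using this
    · intro q hq
      obtain ⟨x, hx, hxq⟩ := ((hH b hb).bij t).surjOn ((hD b hb t (q - P b t)).2 (by simpa using hq))
      exact ⟨x + P b 0, (hD b hb 0 x).1 hx, by simp [hxq]⟩
    · intro q hq
      rw [(hH b hb).id _ ((hD b hb 0 (q - P b 0)).2 (by simpa using hq))]; ring
    · refine ContinuousOn.add ?_ ((hP b hb).comp continuous_fst).continuousOn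
      refine (hH b hb).cont.comp (f := fun p : unitInterval × ℂ => (p.1, p.2 - P b 0))
        (Continuous.continuousOn (by fun_prop)) ?_
      rintro ⟨t, q⟩ ⟨-, hq⟩
      exact ⟨trivial, (hD b hb 0 (q - P b 0)).2 (by simpa using hq)⟩
  · intro ε hε
    obtain ⟨R1, hR1, h⟩ := control (X := X) hε
    obtain ⟨R0, hR0, δ0, hδ0, hM⟩ := G.exists_Mod hR1
    obtain ⟨δ, hδ, h⟩ := h R0 hR0 δ0 hδ0
    refine ⟨δ, hδ, fun b hb p hp z0 hd t => ?_⟩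
    beta_reduce
    have := h _ _ _ (hn b hb) (hH b hb) (hM.shift _ _) (p - P b 0) ((hD b hb 0 _).2 (by simpa using hp)) z0
      (by simpa [Isot.shift] using hd) t
    rw [dist_eq_norm] at this ⊢
    convert this using 2
    simp only [Isot.shift]; ring

end Isot
end IsoExt
end

section
open Set Metric Topology Filter
set_option linter.unusedSectionVars false
namespace IsoExt
namespace Isot
variable {X : Type*} [MetricSpace X] [CompactSpace X]

lemma near_unif (G : Isot X) {ε : ℝ} (hε : 0 < ε) : ∃ δ > 0, ∀ x z0, dist (G.g 0 x) (G.g 0 z0) < δ →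
    ∀ s, dist (G.g s x) (G.g s z0) < ε := by
  obtain ⟨R0, -, δ0, hδ0, h⟩ := G.exists_Mod hε
  refine ⟨δ0, hδ0, fun x z0 hx s => (h.near x z0 hx s).trans_le ?_⟩
  have := min_le_right R0 ε
  linarith

variable {G : Isot X}
/-- gluing on the closure of one domain -/
lemma Nice.closure_ext (hn : G.Nice) [ConnectedSpace X] [Nontrivial X] : ∃ H : unitInterval → ℂ → ℂ,
    (∀ t, BijOn (H t) (G.D 0) (G.D t)) ∧ (∀ q ∈ G.D 0, H 0 q = q) ∧ (∀ t x, H t (G.g 0 x) = G.g t x) ∧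
    ContinuousOn (fun p : unitInterval × ℂ => H p.1 p.2) (univ ×ˢ (G.D 0 ∪ range (G.g 0))) := by
  classical
  obtain ⟨A⟩ := hn.exists_RM
  obtain ⟨H, hH⟩ := exists_HDm A hn
  let K : unitInterval → ℂ → ℂ := fun t q => if h : ∃ x, G.g 0 x = q then G.g t h.choose else H t q
  have hKr : ∀ t x, K t (G.g 0 x) = G.g t x := by
    intro t x
    have h : ∃ x', G.g 0 x' = G.g 0 x := ⟨x, rfl⟩
    simp only [K, h, dite_true]
    rw [G.inj 0 h.choose_spec]
  have hKD : ∀ t, ∀ q ∈ G.D 0, K t q = H t q := by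
    intro t q hq
    have h : ¬ ∃ x', G.g 0 x' = q := hn.D_notMem hq
    simp only [K, h, dite_false]
  refine ⟨K, fun t => (hH.bij t).congr fun q hq => (hKD t q hq).symm, fun q hq => ?_, hKr, ?_⟩
  · rw [hKD 0 q hq, hH.id q hq]
  rintro ⟨t0, q0⟩ ⟨-, hq0 | ⟨z0, rfl⟩⟩
  · refine ContinuousAt.continuousWithinAt ?_
    have ho : (univ : Set unitInterval) ×ˢ G.D 0 ∈ 𝓝 (t0, q0) :=
      (isOpen_univ.prod (hn.D_open 0)).mem_nhds ⟨trivial, hq0⟩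
    refine (hH.cont.continuousAt ho).congr ?_
    filter_upwards [ho] with p hp
    exact (hKD p.1 p.2 hp.2).symm
  · rw [ContinuousWithinAt, Metric.tendsto_nhds]
    intro ε hε
    obtain ⟨R1, hR1, h⟩ := control (X := X) (half_pos hε)
    obtain ⟨R0, hR0, δ0, hδ0, hM⟩ := G.exists_Mod hR1
    obtain ⟨δ, hδ, h⟩ := h R0 hR0 δ0 hδ0
    obtain ⟨δ', hδ', h'⟩ := G.near_unif (half_pos hε)
    have e1 : ∀ᶠ p : unitInterval × ℂ in 𝓝[univ ×ˢ (G.D 0 ∪ range (G.g 0))] (t0, G.g 0 z0),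
        ∀ z, dist (G.g p.1 z) (G.g t0 z) < ε / 2 :=
      ((continuous_fst.tendsto (t0, G.g 0 z0)).eventually (G.time_unif t0 (half_pos hε))).filter_mono nhdsWithin_le_nhds
    have e2 : ∀ᶠ p : unitInterval × ℂ in 𝓝[univ ×ˢ (G.D 0 ∪ range (G.g 0))] (t0, G.g 0 z0),
        dist p.2 (G.g 0 z0) < min δ δ' :=
      ((continuous_snd.tendsto (t0, G.g 0 z0)).eventually (Metric.ball_mem_nhds _ (by positivity))).filter_mono nhdsWithin_le_nhds
    filter_upwards [e1, e2, self_mem_nhdsWithin] with p h1 h2 h3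
    rw [hKr]
    obtain ⟨t, q⟩ := p
    obtain ⟨-, hq | ⟨x, hx⟩⟩ := h3
    · have a1 := h G A H hn hH hM q hq z0 (h2.trans_le (min_le_left _ _)) t
      have a2 := h1 z0
      simp only [] at *
      rw [hKD t q hq]
      linarith [dist_triangle (H t q) (G.g t z0) (G.g t0 z0)]
    · simp only [] at *
      subst hx
      have a1 := h' x z0 (h2.trans_le (min_le_right _ _)) t
      have a2 := h1 z0
      rw [hKr]
      linarith [dist_triangle (G.g t x) (G.g t z0) (G.g t0 z0)]

lemma Nice.compact_closure (hn : G.Nice) (t : unitInterval) : IsCompact (G.D t ∪ range (G.g t)) := by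
  refine Metric.isCompact_of_isClosed_isBounded ?_ ((hn.D_bounded t).union (G.isCompact_range t).isBounded)
  have : G.D t ∪ range (G.g t) = closure (G.D t) ∪ range (G.g t) := by
    rw [closure_eq_self_union_frontier, union_assoc, union_eq_right.2 (hn.D_frontier t)]
  rw [this]
  exact isClosed_closure.union (G.isCompact_range t).isClosed

end Isot
end IsoExt
end

section
open Set Metric Topology Filter
set_option linter.unusedSectionVars false
namespace IsoExt

lemma quad_ne {v w : ℂ} (h : v ^ 2 + 1 = 2 * v * w) : v ≠ 0 := by
  rintro rfl; simp at h

lemma quad_inv {v w : ℂ} (h : v ^ 2 + 1 = 2 * v * w) : (v⁻¹) ^ 2 + 1 = 2 * v⁻¹ * w := by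
  have hv := quad_ne h
  field_simp; linear_combination h

lemma quad_norm {v w : ℂ} (h : v ^ 2 + 1 = 2 * v * w) : ‖v‖ ≤ 2 * ‖w‖ + 1 := by
  by_contra hc
  have hc := not_le.1 hc
  have h1 : v ^ 2 = 2 * v * w - 1 := by linear_combination h
  have h2 : ‖v‖ ^ 2 ≤ 2 * ‖v‖ * ‖w‖ + 1 := by
    rw [← norm_pow, h1]
    refine (norm_sub_le _ _).trans ?_
    simp
  nlinarith [norm_nonneg v, norm_nonneg w]

lemma quad_exists (w : ℂ) : ∃ v : ℂ, v ^ 2 + 1 = 2 * v * w := by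
  obtain ⟨d, hd⟩ := IsAlgClosed.exists_pow_nat_eq (w ^ 2 - 1) (n := 2) (by norm_num)
  exact ⟨w + d, by linear_combination hd⟩

lemma quad_two {v v' w : ℂ} (h : v ^ 2 + 1 = 2 * v * w) (h' : v' ^ 2 + 1 = 2 * v' * w) :
    v' = v ∨ v' = v⁻¹ := by
  have hv := quad_ne h
  have hv' := quad_ne h'
  have : (v' - v) * (v' * v - 1) = 0 := by linear_combination v * h' - v' * h
  rcases mul_eq_zero.1 this with h1 | h1
  · exact Or.inl (sub_eq_zero.1 h1)
  · exact Or.inr (eq_inv_of_mul_eq_one_left (sub_eq_zero.1 h1))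

lemma quad_w {v w w' : ℂ} (h : v ^ 2 + 1 = 2 * v * w) (h' : v ^ 2 + 1 = 2 * v * w') : w = w' := by
  have hv := quad_ne h
  have : 2 * v * w = 2 * v * w' := h.symm.trans h'
  exact mul_left_cancel₀ (by simpa using hv) this

lemma quad_one {v : ℂ} (h : v ^ 2 + 1 = 2 * v * 1) : v = 1 := by
  have : (v - 1) ^ 2 = 0 := by linear_combination h
  exact sub_eq_zero.1 (pow_eq_zero_iff (by norm_num) |>.1 this)

lemma quad_neg_one {v : ℂ} (h : v ^ 2 + 1 = 2 * v * (-1)) : v = -1 := by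
  have : (v + 1) ^ 2 = 0 := by linear_combination h
  exact eq_neg_of_add_eq_zero_left (pow_eq_zero_iff (by norm_num) |>.1 this)

namespace Isot
variable {X : Type*} [MetricSpace X] [CompactSpace X] (G : Isot X)

/-- the branched double cover -/
abbrev JX : Type _ := {p : X × ℂ // p.2 ^ 2 + 1 = 2 * p.2 * G.g 0 p.1}

instance : CompactSpace G.JX := by
  refine (isCompact_iff_compactSpace (s := {p : X × ℂ | p.2 ^ 2 + 1 = 2 * p.2 * G.g 0 p.1})).1 ?_
  obtain ⟨M, hM⟩ := G.exists_bound 0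
  refine IsCompact.of_isClosed_subset (isCompact_univ.prod (isCompact_closedBall (0:ℂ) (2 * M + 1))) ?_ ?_
  · have := G.cont_t 0
    exact isClosed_eq (by fun_prop) (by fun_prop)
  · rintro ⟨x, v⟩ h
    refine ⟨trivial, ?_⟩
    rw [mem_closedBall_zero_iff]
    have := quad_norm h
    have := hM x
    simp only [] at *
    linarith

/-- the deck transformation -/
noncomputable def sig (p : G.JX) : G.JX := ⟨(p.1.1, p.1.2⁻¹), quad_inv p.2⟩

lemma sig_cont : Continuous G.sig := by
  refine Continuous.subtype_mk (Continuous.prodMk (by fun_prop) ?_) _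
  exact Continuous.inv₀ (by fun_prop) fun p => quad_ne p.2

lemma sig_sig (p : G.JX) : G.sig (G.sig p) = p := by
  apply Subtype.ext; simp [sig]

/-- projection -/
def prX (p : G.JX) : X := p.1.1

lemma prX_cont : Continuous G.prX := by unfold prX; fun_prop

lemma prX_surj : Function.Surjective G.prX := fun x => by
  obtain ⟨v, hv⟩ := quad_exists (G.g 0 x)
  exact ⟨⟨(x, v), hv⟩, rfl⟩

lemma fib {p q : G.JX} (h : G.prX q = G.prX p) : q = p ∨ q = G.sig p := by
  obtain ⟨⟨x, v⟩, hp⟩ := p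
  obtain ⟨⟨y, w⟩, hq⟩ := q
  simp only [prX] at h
  subst h
  rcases quad_two hp hq with h | h
  · left; simp only [] at h; subst h; rfl
  · right; simp only [] at h; subst h; rfl

lemma prX_closed : IsClosedMap G.prX := G.prX_cont.isClosedMap

lemma prX_open : IsOpenMap G.prX := by
  intro A hA
  have : G.prX '' A = (G.prX '' (Aᶜ ∩ G.sig ⁻¹' Aᶜ))ᶜ := by
    ext x
    constructor
    · rintro ⟨p, hp, rfl⟩ ⟨q, ⟨hq1, hq2⟩, hq⟩
      rcases G.fib hq with rfl | rfl
      · exact hq1 hp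
      · apply hq2; rw [sig_sig]; exact hp
    · intro h
      by_contra hc
      obtain ⟨p, rfl⟩ := G.prX_surj x
      refine h ⟨p, ⟨fun hp => hc ⟨p, hp, rfl⟩, fun hp => hc ⟨_, hp, rfl⟩⟩, rfl⟩
  rw [this, isOpen_compl_iff]
  exact G.prX_closed _ (hA.isClosed_compl.inter (hA.isClosed_compl.preimage G.sig_cont))

/-- a symmetric function descends -/
lemma descend {m : G.JX → ℂ} (hm : Continuous m) (hs : ∀ p, m (G.sig p) = m p) :
    ∃ n : X → ℂ, Continuous n ∧ ∀ p, n (G.prX p) = m p := by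
  have hq := G.prX_closed.isQuotientMap G.prX_cont G.prX_surj
  choose s hs' using G.prX_surj
  have h : ∀ p, m (s (G.prX p)) = m p := by
    intro p
    rcases G.fib (hs' (G.prX p)) with h | h
    · rw [h]
    · rw [h, hs]
  refine ⟨fun x => m (s x), ?_, h⟩
  rw [hq.continuous_iff]
  convert hm using 1
  ext p; exact h p

/-- normalization: two marked points at -1 and 1 -/
structure Norm (a b : X) : Prop where
  ha : ∀ t, G.g t a = -1
  hb : ∀ t, G.g t b = 1

variable {G} {a b : X}

/-- point over b -/
def Norm.pb (N : G.Norm a b) : G.JX := ⟨(b, 1), by rw [N.hb]; norm_num⟩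
/-- point over a -/
def Norm.pa (N : G.Norm a b) : G.JX := ⟨(a, -1), by rw [N.ha]; norm_num⟩

lemma Norm.preconn (N : G.Norm a b) [PreconnectedSpace X] : PreconnectedSpace G.JX := by
  have key : ∀ s : Set G.JX, IsClopen s → s.Nonempty → N.pb ∈ s := by
    intro s hs hne
    have : IsClopen (G.prX '' s) := ⟨G.prX_closed _ hs.1, G.prX_open _ hs.2⟩
    have h := this.eq_univ (hne.image _)
    obtain ⟨p, hp, hpb⟩ : b ∈ G.prX '' s := by rw [h]; trivial
    convert hp
    rcases G.fib (p := N.pb) (q := p) hpb with h | h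
    · exact h.symm
    · rw [h]; apply Subtype.ext; simp [sig, Norm.pb]
  rw [preconnectedSpace_iff_clopen]
  intro s hs
  by_contra hc
  push Not at hc
  exact key sᶜ hs.compl (nonempty_compl.2 hc.2) (key s hs hc.1)

lemma Norm.conn (N : G.Norm a b) [PreconnectedSpace X] : ConnectedSpace G.JX :=
  { N.preconn with toNonempty := ⟨N.pb⟩ }

lemma Norm.ne (N : G.Norm a b) : a ≠ b := by
  rintro rfl
  have := (N.ha 0).symm.trans (N.hb 0)
  norm_num at this

lemma Norm.nontriv (N : G.Norm a b) : Nontrivial G.JX :=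
  ⟨N.pa, N.pb, fun h => N.ne (congr_arg (fun p : G.JX => p.1.1) h)⟩

end Isot
end IsoExt
end

section
open Set Metric Topology Filter
set_option linter.unusedSectionVars false
namespace IsoExt

lemma quad_of_root {w r : ℂ} (hw1 : w + 1 ≠ 0) (hr : r ^ 2 = (w - 1) / (w + 1)) :
    r ≠ 1 ∧ r ≠ -1 ∧ ((1 + r) / (1 - r)) ^ 2 + 1 = 2 * ((1 + r) / (1 - r)) * w := by
  have h : r ^ 2 * (w + 1) = w - 1 := by rw [hr]; field_simp
  have h1 : r ≠ 1 := by
    rintro rfl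
    have : (2:ℂ) = 0 := by linear_combination h
    norm_num at this
  have h2 : r ≠ -1 := by
    rintro rfl
    have : (2:ℂ) = 0 := by linear_combination h
    norm_num at this
  refine ⟨h1, h2, ?_⟩
  have h3 : 1 - r ≠ 0 := sub_ne_zero.2 h1.symm
  field_simp
  linear_combination 2 * h

lemma quad_root_zero {v w : ℂ} (h : v ^ 2 + 1 = 2 * v * w) (hw1 : w + 1 ≠ 0) :
    v + 1 ≠ 0 ∧ ((v - 1) / (v + 1)) ^ 2 = (w - 1) / (w + 1) := by
  have h1 : v + 1 ≠ 0 := by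
    intro h0
    have hv : v = -1 := by linear_combination h0
    subst hv
    apply hw1; linear_combination h / 2
  refine ⟨h1, ?_⟩
  field_simp
  linear_combination 2 * h

namespace Isot
variable {X : Type*} [MetricSpace X] [CompactSpace X] {G : Isot X} {a b : X}

lemma Norm.ne_b (N : G.Norm a b) {x : X} (hx : x ≠ b) (t) : G.g t x - 1 ≠ 0 := fun h =>
  hx (G.inj t ((sub_eq_zero.1 h).trans (N.hb t).symm))

lemma Norm.ne_a (N : G.Norm a b) {x : X} (hx : x ≠ a) (t) : G.g t x + 1 ≠ 0 := fun h =>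
  hx (G.inj t ((eq_neg_of_add_eq_zero_left h).trans (N.ha t).symm))

/-- unbranched part -/
abbrev JA (a b : X) : Type _ := {x : X // x ≠ a ∧ x ≠ b}

/-- the lifted family -/
lemma Norm.exists_lift (N : G.Norm a b) : ∃ k : unitInterval → G.JX → ℂ,
    Continuous (fun p : unitInterval × G.JX => k p.1 p.2) ∧
    (∀ t p, k t p ^ 2 + 1 = 2 * k t p * G.g t (G.prX p)) ∧ (∀ t p, k t (G.sig p) = (k t p)⁻¹) ∧
    (∀ p, k 0 p = p.1.2) ∧ (∀ t, Function.Injective (k t)) := by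
  classical
  have hgc := G.cont
  have c1 : Continuous fun y : unitInterval × JA a b => G.g y.1 y.2.1 :=
    hgc.comp (by fun_prop : Continuous fun y : unitInterval × JA a b => (y.1, y.2.1))
  have c0 : Continuous fun y : unitInterval × JA a b => G.g 0 y.2.1 := (G.cont_t 0).comp (by fun_prop)
  have n1 : ∀ (t) (y : JA a b), G.g t y.1 - 1 ≠ 0 := fun t y => N.ne_b y.2.2 t
  have n2 : ∀ (t) (y : JA a b), G.g t y.1 + 1 ≠ 0 := fun t y => N.ne_a y.2.1 t
  obtain ⟨L, hL, hLe, hL0⟩ := exp_lift_homotopy (A := JA a b)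
    (fun y => ((G.g y.1 y.2.1 - 1) / (G.g y.1 y.2.1 + 1)) / ((G.g 0 y.2.1 - 1) / (G.g 0 y.2.1 + 1)))
    (by
      refine Continuous.div ?_ ?_ fun y => div_ne_zero (n1 _ _) (n2 _ _)
      · exact Continuous.div (by fun_prop) (by fun_prop) fun y => n2 _ _
      · exact Continuous.div (by fun_prop) (by fun_prop) fun y => n2 _ _)
    (fun y => div_ne_zero (div_ne_zero (n1 _ _) (n2 _ _)) (div_ne_zero (n1 _ _) (n2 _ _)))
    (fun _ => 0) continuous_const (fun y => by
      simp only [Complex.exp_zero]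
      exact (div_self (div_ne_zero (n1 _ _) (n2 _ _))).symm)
  let r : unitInterval → (p : G.JX) → (h : G.prX p ≠ a ∧ G.prX p ≠ b) → ℂ := fun t p h =>
    (p.1.2 - 1) / (p.1.2 + 1) * Complex.exp (L (t, ⟨G.prX p, h⟩) / 2)
  have hr : ∀ t p h, r t p h ^ 2 = (G.g t (G.prX p) - 1) / (G.g t (G.prX p) + 1) := by
    intro t p h
    simp only [r]
    rw [mul_pow, ← Complex.exp_nat_mul]
    have e := hLe (t, ⟨G.prX p, h⟩)
    have h0 := n1 0 ⟨G.prX p, h⟩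
    have h0' := n2 0 ⟨G.prX p, h⟩
    rw [(quad_root_zero p.2 h0').2]
    push_cast
    rw [mul_div_cancel₀ _ (by norm_num : (2:ℂ) ≠ 0), e]
    exact mul_div_cancel₀ _ (div_ne_zero h0 h0')
  let k : unitInterval → G.JX → ℂ := fun t p =>
    if h : G.prX p ≠ a ∧ G.prX p ≠ b then (1 + r t p h) / (1 - r t p h) else p.1.2
  have hk1 : ∀ t p (h : G.prX p ≠ a ∧ G.prX p ≠ b), k t p = (1 + r t p h) / (1 - r t p h) := by
    intro t p h; exact dif_pos h
  have hk2 : ∀ t p (h : ¬ (G.prX p ≠ a ∧ G.prX p ≠ b)), k t p = p.1.2 := by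
    intro t p h; exact dif_neg h
  have cases : ∀ p, ¬ (G.prX p ≠ a ∧ G.prX p ≠ b) → (G.prX p = a ∧ p.1.2 = -1) ∨ (G.prX p = b ∧ p.1.2 = 1) := by
    intro p h
    have hp := p.2
    by_cases h1 : G.prX p = a
    · left; refine ⟨h1, quad_neg_one ?_⟩
      rw [hp]; change 2 * p.1.2 * G.g 0 (G.prX p) = _
      rw [h1, N.ha]
    · right
      have h2 : G.prX p = b := by by_contra h2; exact h ⟨h1, h2⟩
      refine ⟨h2, quad_one ?_⟩
      rw [hp]; change 2 * p.1.2 * G.g 0 (G.prX p) = _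
      rw [h2, N.hb]
  have hq : ∀ t p, k t p ^ 2 + 1 = 2 * k t p * G.g t (G.prX p) := by
    intro t p
    by_cases h : G.prX p ≠ a ∧ G.prX p ≠ b
    · rw [hk1 t p h]
      exact (quad_of_root (n2 t ⟨_, h⟩) (hr t p h)).2.2
    · rw [hk2 t p h]
      rcases cases p h with ⟨h1, h2⟩ | ⟨h1, h2⟩
      · rw [h1, h2, N.ha]; norm_num
      · rw [h1, h2, N.hb]; norm_num
  refine ⟨k, ?_, hq, ?_, ?_, ?_⟩
  · have hcg : Continuous fun y : unitInterval × G.JX => G.g y.1 (G.prX y.2) :=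
      hgc.comp (continuous_fst.prodMk (G.prX_cont.comp continuous_snd))
    rw [continuous_iff_continuousAt]
    rintro ⟨t0, p0⟩
    by_cases h0 : G.prX p0 ≠ a ∧ G.prX p0 ≠ b
    · have ho : IsOpen {y : unitInterval × G.JX | G.prX y.2 ≠ a ∧ G.prX y.2 ≠ b} := by
        have c := G.prX_cont
        exact (isOpen_ne_fun (by fun_prop) (by fun_prop)).inter (isOpen_ne_fun (by fun_prop) (by fun_prop))
      refine ContinuousOn.continuousAt (s := {y : unitInterval × G.JX | G.prX y.2 ≠ a ∧ G.prX y.2 ≠ b}) ?_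
        (ho.mem_nhds h0)
      rw [continuousOn_iff_continuous_restrict]
      have cr : Continuous fun y : {y : unitInterval × G.JX | G.prX y.2 ≠ a ∧ G.prX y.2 ≠ b} =>
          r y.1.1 y.1.2 y.2 := by
        refine Continuous.mul (Continuous.div (by fun_prop) (by fun_prop) fun y => ?_) ?_
        · exact (quad_root_zero y.1.2.2 (n2 0 ⟨_, y.2⟩)).1
        · refine Complex.continuous_exp.comp (Continuous.div_const (hL.comp ?_) _)
          refine Continuous.prodMk (by fun_prop) (Continuous.subtype_mk ?_ _)
          exact G.prX_cont.comp (by fun_prop)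
      have ce : (({y : unitInterval × G.JX | G.prX y.2 ≠ a ∧ G.prX y.2 ≠ b}).domRestrict
          fun y : unitInterval × G.JX => k y.1 y.2) = fun y => (1 + r y.1.1 y.1.2 y.2) / (1 - r y.1.1 y.1.2 y.2) := by
        ext y; exact hk1 y.1.1 y.1.2 y.2
      rw [ce]
      refine Continuous.div (by fun_prop) (by fun_prop) fun y => ?_
      exact sub_ne_zero.2 (quad_of_root (n2 y.1.1 ⟨_, y.2⟩) (hr y.1.1 y.1.2 y.2)).1.symm
    · have gen : ∀ c : ℂ, (c = 1 ∨ c = -1) → k t0 p0 = c → G.g t0 (G.prX p0) = c →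
          ContinuousAt (fun y : unitInterval × G.JX => k y.1 y.2) (t0, p0) := by
        intro c hc hkc hgc'
        rw [ContinuousAt, tendsto_iff_norm_sub_tendsto_zero]
        have e1 : ∀ y : unitInterval × G.JX, ‖k y.1 y.2 - c‖ ≤
            Real.sqrt (2 * (2 * ‖G.g y.1 (G.prX y.2)‖ + 1) * ‖G.g y.1 (G.prX y.2) - c‖) := by
          intro y
          apply Real.le_sqrt_of_sq_le
          have e := hq y.1 y.2
          have e2 : (k y.1 y.2 - c) ^ 2 = 2 * k y.1 y.2 * (G.g y.1 (G.prX y.2) - c) := by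
            have : c ^ 2 = 1 := by rcases hc with rfl | rfl <;> norm_num
            linear_combination e + this
          rw [← norm_pow, e2, norm_mul, norm_mul]
          have := quad_norm e
          simp only [RCLike.norm_ofNat]
          gcongr
        simp only [hkc]
        refine squeeze_zero (fun _ => norm_nonneg _) e1 ?_
        have : Continuous fun y : unitInterval × G.JX =>
            Real.sqrt (2 * (2 * ‖G.g y.1 (G.prX y.2)‖ + 1) * ‖G.g y.1 (G.prX y.2) - c‖) := by fun_prop
        have := this.tendsto (t0, p0)
        simpa [hgc'] using this
      rcases cases p0 h0 with ⟨h1, h2⟩ | ⟨h1, h2⟩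
      · exact gen (-1) (Or.inr rfl) (by rw [hk2 _ _ h0, h2]) (by rw [h1, N.ha])
      · exact gen 1 (Or.inl rfl) (by rw [hk2 _ _ h0, h2]) (by rw [h1, N.hb])
  · intro t p
    by_cases h : G.prX p ≠ a ∧ G.prX p ≠ b
    · have h' : G.prX (G.sig p) ≠ a ∧ G.prX (G.sig p) ≠ b := h
      rw [hk1 t p h, hk1 t (G.sig p) h', inv_div]
      have e : r t (G.sig p) h' = - r t p h := by
        simp only [r]
        change (p.1.2⁻¹ - 1) / (p.1.2⁻¹ + 1) * Complex.exp (L (t, ⟨G.prX p, h⟩) / 2) = _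
        have hv := quad_ne p.2
        have hv1 := (quad_root_zero p.2 (n2 0 ⟨_, h⟩)).1
        have hv2 : (1:ℂ) + p.1.2 ≠ 0 := by rwa [add_comm]
        have : (p.1.2⁻¹ - 1) / (p.1.2⁻¹ + 1) = - ((p.1.2 - 1) / (p.1.2 + 1)) := by
          field_simp; ring
        rw [this, neg_mul]
      rw [e, sub_neg_eq_add, ← sub_eq_add_neg]
    · have h' : ¬ (G.prX (G.sig p) ≠ a ∧ G.prX (G.sig p) ≠ b) := h
      rw [hk2 t p h, hk2 t (G.sig p) h']; rfl
  · intro p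
    by_cases h : G.prX p ≠ a ∧ G.prX p ≠ b
    · rw [hk1 0 p h]
      simp only [r]
      rw [hL0]
      have hv1 := (quad_root_zero p.2 (n2 0 ⟨_, h⟩)).1
      simp only [zero_div, Complex.exp_zero, mul_one]
      have e1 : 1 + (p.1.2 - 1) / (p.1.2 + 1) = 2 * p.1.2 / (p.1.2 + 1) := by field_simp; ring
      have e2 : 1 - (p.1.2 - 1) / (p.1.2 + 1) = 2 / (p.1.2 + 1) := by field_simp; ring
      rw [e1, e2]; field_simp
    · exact hk2 0 p h
  · intro t p p' hpp
    have hx : G.prX p' = G.prX p := by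
      have e := hq t p
      have e' := hq t p'
      rw [← hpp] at e'
      exact G.inj t (quad_w e' e)
    by_cases h : G.prX p ≠ a ∧ G.prX p ≠ b
    · have h' : G.prX p' ≠ a ∧ G.prX p' ≠ b := by rw [hx]; exact h
      rw [hk1 t p h, hk1 t p' h'] at hpp
      have d1 := sub_ne_zero.2 (quad_of_root (n2 t ⟨_, h⟩) (hr t p h)).1.symm
      have d2 := sub_ne_zero.2 (quad_of_root (n2 t ⟨_, h'⟩) (hr t p' h')).1.symm
      rw [div_eq_div_iff d1 d2] at hpp
      have hrr : r t p h = r t p' h' := by linear_combination hpp / 2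
      simp only [r] at hrr
      have hsub : (⟨G.prX p', h'⟩ : JA a b) = ⟨G.prX p, h⟩ := Subtype.ext hx
      rw [hsub] at hrr
      have hrr := mul_right_cancel₀ (Complex.exp_ne_zero _) hrr
      have u1 := (quad_root_zero p.2 (n2 0 ⟨_, h⟩)).1
      have u2 := (quad_root_zero p'.2 (n2 0 ⟨_, h'⟩)).1
      rw [div_eq_div_iff u1 u2] at hrr
      have : p.1.2 = p'.1.2 := by linear_combination hrr / 2
      exact Subtype.ext (Prod.ext hx.symm this)
    · have h' : ¬ (G.prX p' ≠ a ∧ G.prX p' ≠ b) := by rw [hx]; exact h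
      rw [hk2 t p h, hk2 t p' h'] at hpp
      exact Subtype.ext (Prod.ext hx.symm hpp)

end Isot
end IsoExt
end

section
open Set Metric Topology Filter
set_option linter.unusedSectionVars false
namespace IsoExt

namespace Isot
variable {X : Type*} [MetricSpace X] [CompactSpace X] {G : Isot X} {a b : X}

/-- an isotopy of the double cover lifting `G` -/
structure Lift (G : Isot X) (K : Isot G.JX) : Prop where
  quad : ∀ t p, K.g t p ^ 2 + 1 = 2 * K.g t p * G.g t (G.prX p)
  sig : ∀ t p, K.g t (G.sig p) = (K.g t p)⁻¹
  zero : ∀ p, K.g 0 p = p.1.2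

lemma Norm.exists_Lift (N : G.Norm a b) : ∃ K : Isot G.JX, G.Lift K := by
  obtain ⟨k, h1, h2, h3, h4, h5⟩ := N.exists_lift
  exact ⟨⟨k, h1, h5⟩, h2, h3, h4⟩

variable {K : Isot G.JX}

lemma Lift.nice (hK : G.Lift K) (N : G.Norm a b) [PreconnectedSpace X] : K.Nice := by
  haveI := N.preconn
  refine ⟨fun t p => quad_ne (hK.quad t p), ?_⟩
  rintro ⟨l, hl, h⟩
  rw [continuousOn_univ] at hl
  have h : ∀ p, Complex.exp (l p) = p.1.2 := fun p => by
    rw [← hK.zero, h p trivial, one_mul]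
  have := log_unique (S := (univ : Set G.JX)) isPreconnected_univ (l := l) (l' := fun p => - l (G.sig p))
    hl.continuousOn (hl.comp G.sig_cont).neg.continuousOn
    (fun p _ => by
      rw [Complex.exp_neg, h, h]
      simp [Isot.sig]) (mem_univ N.pb) (mem_univ N.pa)
  have e1 : G.sig N.pb = N.pb := Subtype.ext (by simp [Isot.sig, Norm.pb])
  have e2 : G.sig N.pa = N.pa := Subtype.ext (by simp [Isot.sig, Norm.pa, inv_neg])
  rw [e1, e2] at this
  have h3 : l N.pb = l N.pa := by linear_combination this / 2
  have h4 := h N.pb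
  rw [h3, h] at h4
  simp [Norm.pb, Norm.pa] at h4
  norm_num at h4

lemma logRel_const {α : Type*} [TopologicalSpace α] {S : Set α} {c : ℂ} (hc : c ≠ 0) :
    LogRel S (fun _ => c) (fun _ => 1) :=
  ⟨fun _ => Complex.log c, continuousOn_const, fun w _ => by rw [Complex.exp_log hc, one_mul]⟩

lemma Lift.range (hK : G.Lift K) {t : unitInterval} {q c : ℂ} (hq : q ^ 2 + 1 = 2 * q * c) :
    q ∈ range (K.g t) ↔ c ∈ range (G.g t) := by
  constructor
  · rintro ⟨p, rfl⟩
    exact ⟨G.prX p, quad_w (hK.quad t p) hq⟩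
  · rintro ⟨x, rfl⟩
    obtain ⟨p, rfl⟩ := G.prX_surj x
    rcases quad_two (hK.quad t p) hq with h | h
    · exact ⟨p, h.symm⟩
    · exact ⟨G.sig p, by rw [hK.sig, h]⟩

/-- the domain of the origin maps into the unbounded domain -/
lemma Lift.maps (hK : G.Lift K) {t : unitInterval} {q c : ℂ} (hqD : q ∈ K.D t)
    (hq : q ^ 2 + 1 = 2 * q * c) : c ∈ G.U (fun _ => 1) t := by
  obtain ⟨l, hl, h⟩ := hqD
  obtain ⟨n, hn, hnp⟩ := G.descend (m := fun p => l p + l (G.sig p)) (hl.add (hl.comp G.sig_cont))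
    (fun p => by rw [G.sig_sig]; ring)
  have hq0 := quad_ne hq
  have h0 : -(2 * q)⁻¹ ≠ 0 := by simpa using hq0
  refine LogRel.trans (g := fun _ => -(2 * q)⁻¹) ⟨n, hn.continuousOn, fun x _ => ?_⟩ (logRel_const h0)
  obtain ⟨p, rfl⟩ := G.prX_surj x
  rw [hnp, Complex.exp_add]
  have e1 := h p
  have e2 := h (G.sig p)
  rw [hK.sig] at e2
  have hu := quad_ne (hK.quad t p)
  have hu2 := hK.quad t p
  beta_reduce
  generalize K.g t p = u at *
  generalize G.g t (G.prX p) = w at *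
  have e1' : Complex.exp (l p) = 1 - q / u := by
    field_simp; linear_combination -e1
  have e2' : Complex.exp (l (G.sig p)) = 1 - q * u := by
    have : u * (u⁻¹ - q) = u * (u⁻¹ * Complex.exp (l (G.sig p))) := by rw [e2]
    field_simp at this; linear_combination -this
  rw [e1', e2']
  field_simp
  linear_combination (-q) * hu2 + u * hq

lemma Lift.inj (hK : G.Lift K) (hn : K.Nice) {t : unitInterval} {q q' c : ℂ} (hqD : q ∈ K.D t) (hqD' : q' ∈ K.D t)
    (hq : q ^ 2 + 1 = 2 * q * c) (hq' : q' ^ 2 + 1 = 2 * q' * c) : q' = q := by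
  rcases quad_two hq hq' with h | h
  · exact h
  subst h
  exfalso
  obtain ⟨l, hl, h⟩ := hqD
  obtain ⟨l', hl', h'⟩ := hqD'
  have hq0 := quad_ne hq
  have : LogRel univ (K.g t) (fun _ => -q⁻¹) := by
    refine ⟨fun p => l (G.sig p) - l' p, ((hl.comp G.sig_cont).sub hl').continuousOn, fun p _ => ?_⟩
    have e1 := h' p
    have e2 := h (G.sig p)
    rw [hK.sig] at e2
    rw [Complex.exp_sub]
    have hu := quad_ne (hK.quad t p)
    generalize K.g t p = u at *
    have e2' : Complex.exp (l (G.sig p)) = 1 - q * u := by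
      have : u * (u⁻¹ - q) = u * (u⁻¹ * Complex.exp (l (G.sig p))) := by rw [e2]
      field_simp at this; linear_combination -this
    have e3 := Complex.exp_ne_zero (l' p)
    rw [e2']
    rw [mul_div_assoc', eq_div_iff e3, ← e1]
    field_simp; ring
  exact hn.bdd ((hn.rel t).symm.trans (this.trans (logRel_const (by simpa using hq0))))

lemma Lift.surj (hK : G.Lift K) (N : G.Norm a b) (hn : K.Nice) {t : unitInterval} {c : ℂ} (hc : c ∈ G.U (fun _ => 1) t) :
    ∃ q ∈ K.D t, q ^ 2 + 1 = 2 * q * c := by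
  by_contra hcon
  set W : Set ℂ := {c | ∃ q ∈ K.D t, q ^ 2 + 1 = 2 * q * c} with hW
  set O : Set ℂ := (W ∪ Set.range (G.g t))ᶜ with hO
  have h1 : ∀ z : X, (1:ℂ) ≠ 0 := fun _ => one_ne_zero
  obtain ⟨ε, hε, hball⟩ := Metric.isOpen_iff.1 (hn.D_open t) 0 (zero_mem_D t)
  have hbig : ∀ c : ℂ, 1 / ε < ‖c‖ → c ∈ W := by
    intro c hc
    obtain ⟨q, hq⟩ := quad_exists c
    have hle : ∀ q : ℂ, q ^ 2 + 1 = 2 * q * c → ‖q‖ ≤ 1 → c ∈ W := by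
      intro q hq hq1
      refine ⟨q, hball ?_, hq⟩
      rw [mem_ball_zero_iff]
      have : 2 * ‖q‖ * ‖c‖ ≤ 2 := by
        have e : ‖q ^ 2 + 1‖ = 2 * ‖q‖ * ‖c‖ := by rw [hq]; simp
        rw [← e]
        refine (norm_add_le _ _).trans ?_
        rw [norm_pow, norm_one]
        nlinarith [norm_nonneg q]
      rw [div_lt_iff₀ hε] at hc
      by_contra hh
      nlinarith [norm_nonneg c, not_lt.1 hh]
    rcases le_total ‖q‖ 1 with h | h
    · exact hle q hq h
    · refine hle q⁻¹ (quad_inv hq) ?_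
      rw [norm_inv]; exact inv_le_one_of_one_le₀ h
  have hWo : IsOpen W := by
    rw [isOpen_iff_mem_nhds]
    rintro y ⟨q, hqD, hq⟩
    have hq0 := quad_ne hq
    have hqr := hn.D_notMem hqD
    have hq1 : q ≠ 1 := by
      rintro rfl
      refine hqr ((hK.range hq).2 ⟨b, ?_⟩)
      rw [N.hb]; linear_combination hq / 2
    have hq2 : q ≠ -1 := by
      rintro rfl
      refine hqr ((hK.range hq).2 ⟨a, ?_⟩)
      rw [N.ha]; linear_combination -hq / 2
    have hd : HasStrictDerivAt (fun q : ℂ => (q + q⁻¹) / 2) ((1 + -(q ^ 2)⁻¹) / 2) q :=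
      ((hasStrictDerivAt_id q).add (hasStrictDerivAt_inv hq0)).div_const 2
    have hd0 : (1 + -(q ^ 2)⁻¹) / 2 ≠ 0 := by
      intro h0
      have h2 : q ^ 2 = 1 := by
        field_simp at h0; linear_combination h0
      rcases mul_self_eq_one_iff.1 ((sq q).symm.trans h2) with h | h
      · exact hq1 h
      · exact hq2 h
    have hy : y = (q + q⁻¹) / 2 := by field_simp; linear_combination -hq
    rw [hy, ← hd.map_nhds_eq hd0]
    refine mem_of_superset (image_mem_map (inter_mem ((hn.D_open t).mem_nhds hqD) (isOpen_ne.mem_nhds hq0))) ?_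
    rintro _ ⟨q', ⟨hq'D, hq'0⟩, rfl⟩
    refine ⟨q', hq'D, ?_⟩
    have : q' ≠ 0 := hq'0
    field_simp
  have hcl : IsClosed (W ∪ Set.range (G.g t)) := by
    have hc := hn.compact_closure t
    haveI := isCompact_iff_compactSpace.1 hc
    have e : W ∪ Set.range (G.g t) = Prod.snd '' {y : (K.D t ∪ Set.range (K.g t) : Set ℂ) × ℂ | (y.1 : ℂ) ^ 2 + 1 = 2 * y.1 * y.2} := by
      ext c
      constructor
      · rintro (⟨q, hqD, hq⟩ | hc)
        · exact ⟨(⟨q, Or.inl hqD⟩, c), hq, rfl⟩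
        · obtain ⟨q, hq⟩ := quad_exists c
          exact ⟨(⟨q, Or.inr ((hK.range hq).2 hc)⟩, c), hq, rfl⟩
      · rintro ⟨⟨⟨q, hqD | hqr⟩, c⟩, hq, rfl⟩
        · exact Or.inl ⟨q, hqD, hq⟩
        · exact Or.inr ((hK.range hq).1 hqr)
    rw [e]
    exact isClosedMap_snd_of_compactSpace _ (isClosed_eq (by fun_prop) (by fun_prop))
  have hcO : c ∈ O := by
    rintro (h | h)
    · exact hcon h
    · exact G.U_notMem h1 hc h
  obtain ⟨M, hM⟩ := G.exists_bound t
  obtain ⟨y, hy⟩ : ∃ y : ℂ, max (1 / ε) M < ‖y‖ := by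
    refine ⟨((|max (1/ε) M| + 1 : ℝ) : ℂ), ?_⟩
    rw [Complex.norm_real, Real.norm_eq_abs]
    have := le_abs_self (max (1/ε) M)
    have := le_abs_self (|max (1/ε) M| + 1)
    linarith
  have hyW := hbig y ((le_max_left _ _).trans_lt hy)
  have hyU : y ∈ G.U (fun _ => 1) t := by
    obtain ⟨q, hqD, hq⟩ := hyW
    exact hK.maps hqD hq
  refine eilenberg (V := O) (K := Set.range (G.g t)) ?_ ?_ hcO (q := y) (fun h => h (Or.inl hyW)) (G.U_notMem h1 hyU)
    (G.U_logRel t hc hyU)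
  · refine (isBounded_iff_forall_norm_le).2 ⟨1 / ε, fun c hc => ?_⟩
    by_contra h
    exact hc (Or.inl (hbig c (not_le.1 h)))
  · intro y hy
    rw [hO, frontier_compl] at hy
    have := hcl.frontier_subset hy
    rcases this with h | h
    · exact absurd (interior_mono (subset_union_left) (hWo.interior_eq.symm ▸ h)) hy.2
    · exact h

end Isot
end IsoExt
end

section
open Set Metric Topology Filter
set_option linter.unusedSectionVars false
namespace IsoExt

lemma tendsto_infty_of_norm {α : Type*} {l : Filter α} {f : α → ℂ} (h : Tendsto (fun x => ‖f x‖) l atTop) :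
    Tendsto (fun x => (f x : OnePoint ℂ)) l (𝓝 OnePoint.infty) := by
  have h1 : Tendsto f l (Filter.coclosedCompact ℂ) := by
    rw [Filter.coclosedCompact_eq_cocompact, ← Metric.cobounded_eq_cocompact]
    exact tendsto_norm_atTop_iff_cobounded.1 h
  exact OnePoint.tendsto_coe_infty.comp h1

/-- Joukowski map to the sphere -/
noncomputable def jou (q : ℂ) : OnePoint ℂ := if q = 0 then OnePoint.infty else (((q + q⁻¹) / 2 : ℂ) : OnePoint ℂ)

lemma jou_zero : jou 0 = OnePoint.infty := by simp [jou]

lemma jou_of {q c : ℂ} (h : q ^ 2 + 1 = 2 * q * c) : jou q = (c : OnePoint ℂ) := by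
  have h0 := quad_ne h
  rw [jou, if_neg h0]
  congr 1
  field_simp; linear_combination h

lemma jou_eq {q c : ℂ} (h : jou q = (c : OnePoint ℂ)) : q ^ 2 + 1 = 2 * q * c := by
  unfold jou at h
  split_ifs at h with h0
  · exact absurd h (OnePoint.infty_ne_coe c)
  · rw [← OnePoint.coe_injective h]; field_simp

lemma jou_eq_infty {q : ℂ} (h : jou q = OnePoint.infty) : q = 0 := by
  unfold jou at h
  split_ifs at h with h0
  · exact h0
  · exact absurd h (OnePoint.coe_ne_infty _)

lemma jou_cont : Continuous jou := by
  rw [continuous_iff_continuousAt]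
  intro q
  by_cases hq : q = 0
  · subst hq
    rw [continuousAt_iff_punctured_nhds, jou_zero]
    have : Tendsto (fun q : ℂ => (((q + q⁻¹) / 2 : ℂ) : OnePoint ℂ)) (𝓝[≠] 0) (𝓝 OnePoint.infty) := by
      apply tendsto_infty_of_norm
      have h1 : Tendsto (fun q : ℂ => ‖q⁻¹‖) (𝓝[≠] 0) atTop :=
        tendsto_norm_atTop_iff_cobounded.2 Filter.tendsto_inv₀_nhdsNE_zero
      have h2 : Tendsto (fun q : ℂ => -‖q‖) (𝓝[≠] 0) (𝓝 (-‖(0:ℂ)‖)) :=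
        (continuous_norm.neg.tendsto 0).mono_left nhdsWithin_le_nhds
      have h3 := (h1.atTop_add h2).atTop_div_const (by norm_num : (0:ℝ) < 2)
      refine tendsto_atTop_mono (fun q => ?_) h3
      rw [norm_div, RCLike.norm_ofNat]
      have : ‖q⁻¹‖ ≤ ‖q + q⁻¹‖ + ‖q‖ := by
        have := norm_sub_le (q + q⁻¹) q
        simpa using this
      gcongr
      linarith
    refine this.congr' ?_
    filter_upwards [self_mem_nhdsWithin] with q hq
    have hq : q ≠ 0 := hq
    rw [jou, if_neg hq]
  · have h1 : ContinuousAt (fun q : ℂ => (((q + q⁻¹) / 2 : ℂ) : OnePoint ℂ)) q := by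
      refine OnePoint.continuous_coe.continuousAt.comp' ?_
      exact (continuousAt_id.add (continuousAt_inv₀ hq)).div_const 2
    refine h1.congr ?_
    filter_upwards [isOpen_ne.mem_nhds hq] with q' hq'
    have hq' : q' ≠ 0 := hq'
    rw [jou, if_neg hq']

namespace Isot
variable {X : Type*} [MetricSpace X] [CompactSpace X] {G : Isot X} {a b : X}

/-- the unbounded domain on the sphere -/
def Vs (G : Isot X) (t : unitInterval) : Set (OnePoint ℂ) := insert OnePoint.infty ((↑) '' G.U (fun _ => 1) t)

/-- the extension over the unbounded domain -/
structure UExt (G : Isot X) (H : unitInterval → OnePoint ℂ → OnePoint ℂ) : Prop where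
  bij : ∀ t, BijOn (H t) (G.Vs 0) (G.Vs t)
  id : ∀ c ∈ G.Vs 0, H 0 c = c
  ext : ∀ t x, H t (G.g 0 x) = G.g t x
  cont : ContinuousOn (fun p : unitInterval × OnePoint ℂ => H p.1 p.2)
    (univ ×ˢ (G.Vs 0 ∪ (↑) '' range (G.g 0)))

variable {K : Isot G.JX}
lemma Lift.jou_bij (hK : G.Lift K) (N : G.Norm a b) (hn : K.Nice) (t : unitInterval) :
    BijOn jou (K.D t) (G.Vs t) := by
  refine ⟨fun q hq => ?_, fun q hq q' hq' h => ?_, fun c hc => ?_⟩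
  · by_cases h0 : q = 0
    · subst h0; rw [jou_zero]; exact Or.inl rfl
    · have e : q ^ 2 + 1 = 2 * q * ((q + q⁻¹) / 2) := by field_simp
      rw [jou_of e]
      exact Or.inr ⟨_, hK.maps hq e, rfl⟩
  · by_cases h0 : q = 0
    · subst h0; rw [jou_zero] at h; exact (jou_eq_infty h.symm).symm
    · have e : q ^ 2 + 1 = 2 * q * ((q + q⁻¹) / 2) := by field_simp
      rw [jou_of e] at h
      exact hK.inj hn hq' hq (jou_eq h.symm) e
  · rcases hc with rfl | ⟨c, hc, rfl⟩
    · exact ⟨0, zero_mem_D t, jou_zero⟩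
    · obtain ⟨q, hq, e⟩ := hK.surj N hn hc
      exact ⟨q, hq, jou_of e⟩

lemma Vs_disj (t : unitInterval) {c : OnePoint ℂ} (hc : c ∈ G.Vs t) : c ∉ ((↑) : ℂ → OnePoint ℂ) '' range (G.g t) := by
  rintro ⟨w, hw, rfl⟩
  rcases hc with h | ⟨c, hc, h⟩
  · exact OnePoint.coe_ne_infty w h
  · rw [OnePoint.coe_injective h] at hc
    exact G.U_notMem (fun _ => one_ne_zero) hc hw

lemma Norm.exists_UExt (N : G.Norm a b) [PreconnectedSpace X] : ∃ H, G.UExt H := by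
  obtain ⟨K, hK⟩ := N.exists_Lift
  have hn := hK.nice N
  haveI := N.conn
  haveI := N.nontriv
  obtain ⟨H, hb, hid, hg, hc⟩ := hn.closure_ext
  set C : Set ℂ := K.D 0 ∪ range (K.g 0) with hC
  have hjr : ∀ t p, jou (K.g t p) = (G.g t (G.prX p) : OnePoint ℂ) := fun t p => jou_of (hK.quad t p)
  have himg : ∀ c : OnePoint ℂ, c ∈ G.Vs 0 ∪ (↑) '' range (G.g 0) ↔ ∃ q ∈ C, jou q = c := by
    intro c
    constructor
    · rintro (hc | ⟨_, ⟨x, rfl⟩, rfl⟩)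
      · obtain ⟨q, hq, h⟩ := (hK.jou_bij N hn 0).surjOn hc
        exact ⟨q, Or.inl hq, h⟩
      · obtain ⟨p, rfl⟩ := G.prX_surj x
        exact ⟨_, Or.inr ⟨p, rfl⟩, hjr 0 p⟩
    · rintro ⟨q, hq | ⟨p, rfl⟩, rfl⟩
      · exact Or.inl ((hK.jou_bij N hn 0).mapsTo hq)
      · rw [hjr]; exact Or.inr ⟨_, ⟨_, rfl⟩, rfl⟩
  choose! ψ hψ using fun c => (himg c).1
  have fibc : ∀ q ∈ C, ∀ t, jou (H t (ψ (jou q))) = jou (H t q) := by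
    intro q hq t
    obtain ⟨h1, h2⟩ := hψ (jou q) ((himg _).2 ⟨q, hq, rfl⟩)
    generalize ψ (jou q) = q' at *
    rcases hq with hq | ⟨p, rfl⟩
    · have hv := (hK.jou_bij N hn 0).mapsTo hq
      rcases h1 with h1 | ⟨p, rfl⟩
      · rw [(hK.jou_bij N hn 0).injOn h1 hq h2]
      · exfalso
        rw [← h2, hjr] at hv
        exact Vs_disj 0 hv ⟨_, ⟨_, rfl⟩, rfl⟩
    · rcases h1 with h1 | ⟨p', rfl⟩
      · exfalso
        have hv := (hK.jou_bij N hn 0).mapsTo h1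
        rw [h2, hjr] at hv
        exact Vs_disj 0 hv ⟨_, ⟨_, rfl⟩, rfl⟩
      · rw [hjr, hjr] at h2
        have := G.inj 0 (OnePoint.coe_injective h2)
        rw [hg, hg, hjr, hjr, this]
  have hψD : ∀ c ∈ G.Vs 0, ψ c ∈ K.D 0 ∧ jou (ψ c) = c := by
    intro c hcV
    obtain ⟨h1, h2⟩ := hψ c (Or.inl hcV)
    refine ⟨?_, h2⟩
    rcases h1 with h1 | ⟨p, hp⟩
    · exact h1
    · exfalso
      rw [← h2, ← hp, hjr] at hcV
      exact Vs_disj 0 hcV ⟨_, ⟨_, rfl⟩, rfl⟩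
  refine ⟨fun t c => jou (H t (ψ c)), ⟨fun t => ?_, fun c hc => ?_, fun t x => ?_, ?_⟩⟩
  · refine ((hK.jou_bij N hn t).comp (hb t)).comp ⟨fun c hc => (hψD c hc).1, fun c hc c' hc' h => ?_, fun q hq => ?_⟩
    · rw [← (hψD c hc).2, ← (hψD c' hc').2, h]
    · have hv := (hK.jou_bij N hn 0).mapsTo hq
      exact ⟨jou q, hv, (hK.jou_bij N hn 0).injOn (hψD _ hv).1 hq (hψD _ hv).2⟩
  · beta_reduce
    rw [hid _ (hψD c hc).1, (hψD c hc).2]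
  · obtain ⟨p, rfl⟩ := G.prX_surj x
    beta_reduce
    rw [← hjr, fibc _ (Or.inr ⟨p, rfl⟩), hg, hjr]
  · rw [continuousOn_iff_continuous_restrict]
    have hCc : IsCompact C := hn.compact_closure 0
    haveI := isCompact_iff_compactSpace.1 hCc
    let Q : unitInterval × C → ((univ : Set unitInterval) ×ˢ (G.Vs 0 ∪ (↑) '' range (G.g 0)) : Set (unitInterval × OnePoint ℂ)) :=
      fun y => ⟨(y.1, jou y.2), trivial, (himg _).2 ⟨y.2, y.2.2, rfl⟩⟩
    have hQc : Continuous Q := Continuous.subtype_mk (Continuous.prodMk continuous_fst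
      (jou_cont.comp (continuous_subtype_val.comp continuous_snd))) _
    have hQs : Function.Surjective Q := by
      rintro ⟨⟨t, c⟩, -, hc⟩
      obtain ⟨q, hq, h⟩ := (himg c).1 hc
      exact ⟨(t, ⟨q, hq⟩), Subtype.ext (Prod.ext rfl h)⟩
    have hQ := hQc.isClosedMap.isQuotientMap hQc hQs
    rw [hQ.continuous_iff]
    have : Continuous fun y : unitInterval × C => jou (H y.1 y.2) := by
      refine jou_cont.comp ?_
      exact hc.comp_continuous (f := fun y : unitInterval × C => (y.1, (y.2 : ℂ))) (by fun_prop) fun y => ⟨trivial, y.2.2⟩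
    convert this using 1
    ext y
    exact fibc y.2 y.2.2 y.1

end Isot
end IsoExt
end

section
open Set Metric Topology Filter
set_option linter.unusedSectionVars false
namespace IsoExt

/-- affine maps of the sphere -/
noncomputable def aff (m d : ℂ) : OnePoint ℂ → OnePoint ℂ := OnePoint.map (fun z => m + d * z)

@[simp] lemma aff_coe (m d z : ℂ) : aff m d (z : OnePoint ℂ) = ((m + d * z : ℂ) : OnePoint ℂ) := rfl
@[simp] lemma aff_infty (m d : ℂ) : aff m d OnePoint.infty = OnePoint.infty := rfl

lemma aff_inv {m d : ℂ} (hd : d ≠ 0) (c : OnePoint ℂ) : aff m d (aff (-m / d) d⁻¹ c) = c := by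
  induction c using OnePoint.rec with
  | infty => rfl
  | coe z => simp only [aff_coe]; congr 1; field_simp; ring

lemma inv_aff {m d : ℂ} (hd : d ≠ 0) (c : OnePoint ℂ) : aff (-m / d) d⁻¹ (aff m d c) = c := by
  induction c using OnePoint.rec with
  | infty => rfl
  | coe z => simp only [aff_coe]; congr 1; field_simp; ring

lemma aff_cont {T : Type*} [TopologicalSpace T] {m d : T → ℂ} (hm : Continuous m) (hd : Continuous d)
    (h0 : ∀ t, d t ≠ 0) : Continuous fun p : T × OnePoint ℂ => aff (m p.1) (d p.1) p.2 := by
  rw [continuous_iff_continuousAt]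
  rintro ⟨t0, c⟩
  induction c using OnePoint.rec with
  | coe z =>
    have he := (IsOpenEmbedding.id (X := T)).prodMap (OnePoint.isOpenEmbedding_coe (X := ℂ))
    have := he.continuousAt_iff (g := fun p : T × OnePoint ℂ => aff (m p.1) (d p.1) p.2) (x := (t0, z))
    refine this.1 ?_
    have : Continuous fun p : T × ℂ => ((m p.1 + d p.1 * p.2 : ℂ) : OnePoint ℂ) :=
      OnePoint.continuous_coe.comp (by fun_prop)
    exact this.continuousAt
  | infty =>
    rw [ContinuousAt, nhds_prod_eq, OnePoint.nhds_infty_eq, Filter.prod_sup, tendsto_sup]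
    simp only [aff_infty]
    constructor
    · rw [Filter.prod_map_right, tendsto_map'_iff]
      have : Tendsto (fun p : T × ℂ => ((m p.1 + d p.1 * p.2 : ℂ) : OnePoint ℂ))
          (𝓝 t0 ×ˢ coclosedCompact ℂ) (𝓝 OnePoint.infty) := by
        apply tendsto_infty_of_norm
        rw [Filter.coclosedCompact_eq_cocompact, ← Metric.cobounded_eq_cocompact]
        have h1 : Tendsto (fun p : T × ℂ => ‖d p.1‖) (𝓝 t0 ×ˢ Bornology.cobounded ℂ) (𝓝 ‖d t0‖) :=
          (hd.norm.tendsto t0).comp tendsto_fst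
        have h2 : Tendsto (fun p : T × ℂ => -‖m p.1‖) (𝓝 t0 ×ˢ Bornology.cobounded ℂ) (𝓝 (-‖m t0‖)) :=
          (hm.norm.neg.tendsto t0).comp tendsto_fst
        have h3 : Tendsto (fun p : T × ℂ => ‖p.2‖) (𝓝 t0 ×ˢ Bornology.cobounded ℂ) atTop :=
          tendsto_norm_cobounded_atTop.comp tendsto_snd
        refine tendsto_atTop_mono (fun p => ?_) ((h1.pos_mul_atTop (norm_pos_iff.2 (h0 t0)) h3).atTop_add h2)
        have := norm_sub_le (m p.1 + d p.1 * p.2) (m p.1)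
        rw [add_sub_cancel_left, norm_mul] at this
        linarith
      exact this
    · rw [Filter.prod_pure, tendsto_map'_iff]
      exact tendsto_const_nhds.congr fun _ => rfl

namespace Isot
variable {X : Type*} [MetricSpace X] [CompactSpace X] (G : Isot X)

lemma exists_UExt [PreconnectedSpace X] [Nontrivial X] : ∃ H, G.UExt H := by
  obtain ⟨a, b, hab⟩ := exists_pair_ne X
  have hgc := G.cont
  have ca : Continuous fun t => G.g t a := hgc.comp (by fun_prop : Continuous fun t : unitInterval => (t, a))
  have cb : Continuous fun t => G.g t b := hgc.comp (by fun_prop : Continuous fun t : unitInterval => (t, b))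
  obtain ⟨m, hm, hmd⟩ : ∃ m : unitInterval → ℂ, Continuous m ∧ ∀ t, m t = (G.g t a + G.g t b) / 2 := ⟨_, by fun_prop, fun _ => rfl⟩
  obtain ⟨d, hd, hdd⟩ : ∃ d : unitInterval → ℂ, Continuous d ∧ ∀ t, d t = (G.g t b - G.g t a) / 2 := ⟨_, by fun_prop, fun _ => rfl⟩
  have h0 : ∀ t, d t ≠ 0 := by
    intro t
    rw [hdd]
    have : G.g t b - G.g t a ≠ 0 := sub_ne_zero.2 fun h => hab (G.inj t h).symm
    simpa using this
  let G' : Isot X := ⟨fun t x => (G.g t x - m t) / d t,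
    (hgc.sub (hm.comp continuous_fst)).div (hd.comp continuous_fst) fun p => h0 p.1,
    fun t x y h => G.inj t (by
      have := h0 t
      simp only [] at h
      field_simp at h
      linear_combination h)⟩
  have hG' : ∀ t x, G.g t x = m t + d t * G'.g t x := by
    intro t x
    have := h0 t
    simp only [G']
    field_simp; ring
  have N : G'.Norm a b := by
    constructor
    · intro t; have := h0 t; simp only [G']; rw [div_eq_iff this, hmd, hdd]; ring
    · intro t; have := h0 t; simp only [G']; rw [div_eq_iff this, hmd, hdd]; ring
  obtain ⟨H, hH⟩ := N.exists_UExt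
  have hU : ∀ t q, q ∈ G'.U (fun _ => 1) t ↔ m t + d t * q ∈ G.U (fun _ => 1) t := by
    intro t q
    have e : ∀ x, G.g t x - (m t + d t * q) = d t * (G'.g t x - q) := by intro x; rw [hG']; ring
    constructor
    · rintro ⟨l, hl, h⟩
      refine LogRel.trans (g := fun _ => d t) ⟨l, hl, fun x hx => ?_⟩ (logRel_const (h0 t))
      have h1 := h x hx
      beta_reduce at h1 ⊢
      rw [e, h1, one_mul]
    · rintro ⟨l, hl, h⟩
      refine LogRel.trans (g := fun _ => (d t)⁻¹) ⟨l, hl, fun x hx => ?_⟩ (logRel_const (inv_ne_zero (h0 t)))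
      have h1 := h x hx
      beta_reduce at h1
      rw [e, one_mul] at h1
      beta_reduce
      rw [← h1, inv_mul_cancel_left₀ (h0 t)]
  have hV : ∀ t, BijOn (aff (m t) (d t)) (G'.Vs t) (G.Vs t) := by
    intro t
    refine ⟨?_, ?_, ?_⟩
    · rintro c (rfl | ⟨z, hz, rfl⟩)
      · exact Or.inl rfl
      · exact Or.inr ⟨_, (hU t z).1 hz, rfl⟩
    · intro c _ c' _ h
      rw [← inv_aff (m := m t) (h0 t) c, h, inv_aff (h0 t)]
    · rintro c (rfl | ⟨z, hz, rfl⟩)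
      · exact ⟨OnePoint.infty, Or.inl rfl, rfl⟩
      · have h1 := h0 t
        have e : m t + d t * ((z - m t) / d t) = z := by field_simp; ring
        exact ⟨_, Or.inr ⟨(z - m t) / d t, (hU t _).2 (by rw [e]; exact hz), rfl⟩, by rw [aff_coe, e]⟩
  have hV' : ∀ c ∈ G.Vs 0, aff (-m 0 / d 0) (d 0)⁻¹ c ∈ G'.Vs 0 := by
    intro c hc
    obtain ⟨c', hc', rfl⟩ := (hV 0).surjOn hc
    rwa [inv_aff (h0 0)]
  have hx : ∀ x, aff (-m 0 / d 0) (d 0)⁻¹ (G.g 0 x) = (G'.g 0 x : OnePoint ℂ) := by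
    intro x
    rw [hG', ← aff_coe, inv_aff (h0 0)]
  refine ⟨fun t c => aff (m t) (d t) (H t (aff (-m 0 / d 0) (d 0)⁻¹ c)), ⟨fun t => ?_, fun c hc => ?_, fun t x => ?_, ?_⟩⟩
  · refine ((hV t).comp (hH.bij t)).comp ⟨hV', ?_, ?_⟩
    · intro c _ c' _ h
      rw [← aff_inv (m := m 0) (h0 0) c, h, aff_inv (h0 0)]
    · intro c hc
      exact ⟨_, (hV 0).mapsTo hc, inv_aff (h0 0) c⟩
  · beta_reduce
    rw [hH.id _ (hV' c hc), aff_inv (h0 0)]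
  · beta_reduce
    rw [hx, hH.ext, hG', aff_coe]
  · have c1 := aff_cont hm hd h0
    have c2 : Continuous (aff (-m 0 / d 0) (d 0)⁻¹) :=
      (aff_cont (T := Unit) (m := fun _ => -m 0 / d 0) (d := fun _ => (d 0)⁻¹) continuous_const continuous_const
        (fun _ => inv_ne_zero (h0 0))).comp (by fun_prop : Continuous fun c => ((), c))
    have c3 : ContinuousOn (fun p : unitInterval × OnePoint ℂ => H p.1 (aff (-m 0 / d 0) (d 0)⁻¹ p.2))
        (univ ×ˢ (G.Vs 0 ∪ (↑) '' range (G.g 0))) := by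
      refine hH.cont.comp (f := fun p : unitInterval × OnePoint ℂ => (p.1, aff (-m 0 / d 0) (d 0)⁻¹ p.2))
        (Continuous.continuousOn (by fun_prop)) ?_
      rintro ⟨t, c⟩ ⟨-, hc | ⟨_, ⟨x, rfl⟩, rfl⟩⟩
      · exact ⟨trivial, Or.inl (hV' c hc)⟩
      · refine ⟨trivial, Or.inr ?_⟩
        change aff (-m 0 / d 0) (d 0)⁻¹ (G.g 0 x : OnePoint ℂ) ∈ ((↑) : ℂ → OnePoint ℂ) '' range (G'.g 0)
        rw [hx]; exact ⟨_, ⟨x, rfl⟩, rfl⟩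
    exact c1.comp_continuousOn (continuousOn_fst.prodMk c3)

end Isot
end IsoExt
end

section
open Set Metric Topology Filter
set_option linter.unusedSectionVars false
namespace IsoExt

lemma bij_of_pieces {α : Type*} {f : α → α} {S T : Set α} (h1 : BijOn f S T) (h2 : BijOn f Sᶜ Tᶜ) :
    Function.Bijective f := by
  constructor
  · intro x y h
    by_cases hx : x ∈ S <;> by_cases hy : y ∈ S
    · exact h1.injOn hx hy h
    · exact absurd (h ▸ h1.mapsTo hx) (h2.mapsTo hy)
    · exact absurd (h.symm ▸ h1.mapsTo hy) (h2.mapsTo hx)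
    · exact h2.injOn hx hy h
  · intro y
    by_cases hy : y ∈ T
    · obtain ⟨x, -, h⟩ := h1.surjOn hy; exact ⟨x, h⟩
    · obtain ⟨x, -, h⟩ := h2.surjOn hy; exact ⟨x, h⟩

namespace Isot
variable {X : Type*} [MetricSpace X] [CompactSpace X] (G : Isot X)

lemma exists_rep : ∃ rep : ℂ → ℂ, (∀ b, LogRel univ (G.kap (rep b)) (G.kap b)) ∧
    ∀ b b', LogRel univ (G.kap b) (G.kap b') → rep b = rep b' := by
  let s : Setoid ℂ := ⟨fun b b' => LogRel univ (G.kap b) (G.kap b'),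
    ⟨fun _ => LogRel.refl, fun h => h.symm, fun h h' => h.trans h'⟩⟩
  refine ⟨fun b => (Quotient.mk s b).out, fun b => Quotient.mk_out (s := s) b, fun b b' h => ?_⟩
  have : Quotient.mk s b = Quotient.mk s b' := Quotient.sound h
  beta_reduce
  rw [this]

/-- closed unbounded part -/
def Ss (t : unitInterval) : Set (OnePoint ℂ) := G.Vs t ∪ (↑) '' range (G.g t)

lemma coe_mem_Ss {t : unitInterval} {q : ℂ} : (q : OnePoint ℂ) ∈ G.Ss t ↔ q ∈ G.U (fun _ => 1) t ∨ q ∈ range (G.g t) := by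
  constructor
  · rintro ((h | ⟨c, hc, h⟩) | ⟨c, hc, h⟩)
    · exact absurd h (OnePoint.coe_ne_infty q)
    · rw [← OnePoint.coe_injective h]; exact Or.inl hc
    · rw [← OnePoint.coe_injective h]; exact Or.inr hc
  · rintro (h | h)
    · exact Or.inl (Or.inr ⟨q, h, rfl⟩)
    · exact Or.inr ⟨q, h, rfl⟩

lemma infty_mem_Ss (t : unitInterval) : OnePoint.infty ∈ G.Ss t := Or.inl (Or.inl rfl)

lemma good_iff {q : ℂ} : G.Good q ↔ (q : OnePoint ℂ) ∉ G.Ss 0 := by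
  rw [coe_mem_Ss, not_or, and_comm]; rfl

lemma Ss_nhds {c : OnePoint ℂ} (hc : c ∈ G.Vs 0) : G.Ss 0 ∈ 𝓝 c := by
  rcases hc with rfl | ⟨q, hq, rfl⟩
  · rw [OnePoint.nhds_infty_eq]
    refine mem_sup.2 ⟨?_, mem_pure.2 (G.infty_mem_Ss 0)⟩
    rw [mem_map, Filter.coclosedCompact_eq_cocompact, ← Metric.cobounded_eq_cocompact]
    obtain ⟨M, hM⟩ := G.exists_bound 0
    filter_upwards [tendsto_norm_cobounded_atTop.eventually (eventually_gt_atTop M)] with q hq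
    rw [mem_preimage, coe_mem_Ss]
    exact Or.inl (logRel_far (G.cont_t 0).continuousOn fun x _ => (hM x).trans_lt hq)
  · rw [OnePoint.nhds_coe_eq, mem_map]
    filter_upwards [(G.U_open (κ := fun _ => 1) (fun _ => one_ne_zero) 0).mem_nhds hq] with q' hq'
    rw [mem_preimage, coe_mem_Ss]; exact Or.inl hq'

lemma planar_nontrivial [ConnectedSpace X] [Nontrivial X] : ∃ H : unitInterval → OnePoint ℂ → OnePoint ℂ,
    Continuous (fun p : unitInterval × OnePoint ℂ => H p.1 p.2) ∧ (∀ t, Function.Bijective (H t)) ∧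
    (∀ c, H 0 c = c) ∧ ∀ t x, H t (G.g 0 x) = G.g t x := by
  classical
  obtain ⟨HU, hU⟩ := G.exists_UExt
  obtain ⟨HB, hB, hctl⟩ := G.comps
  obtain ⟨rep, hrep, hrep'⟩ := G.exists_rep
  have hgr : ∀ b, G.Good b → G.Good (rep b) := by
    rintro b ⟨h1, h2⟩
    constructor
    · rintro ⟨x, hx⟩
      obtain ⟨l, hl, h⟩ := hrep b
      have := h x trivial
      have e : G.kap (rep b) x = 0 := sub_eq_zero.2 hx
      rw [e] at this
      exact mul_ne_zero (Good.kap_ne h1 x) (Complex.exp_ne_zero _) this.symm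
    · intro h
      exact h2 ((hrep b).symm.trans h)
  have hmr : ∀ b, b ∈ G.U (G.kap (rep b)) 0 := fun b => (hrep b).symm
  have hUr : ∀ b, ∀ q ∈ G.U (G.kap (rep b)) 0, rep q = rep b := fun b q hq =>
    hrep' q b (LogRel.trans hq (hrep b))
  have hUg : ∀ b, G.Good b → ∀ q ∈ G.U (G.kap b) 0, G.Good q := by
    intro b hb q hq
    exact ⟨G.U_notMem (Good.kap_ne hb.1) hq, fun h => hb.2 ((LogRel.symm hq).trans h)⟩
  let H : unitInterval → OnePoint ℂ → OnePoint ℂ := fun t c =>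
    if c ∈ G.Ss 0 then HU t c else OnePoint.map (fun q => HB (rep q) t q) c
  have hH1 : ∀ t, ∀ c ∈ G.Ss 0, H t c = HU t c := fun t c hc => if_pos hc
  have hH2 : ∀ t q, G.Good q → H t q = (HB (rep q) t q : OnePoint ℂ) := fun t q hq =>
    if_neg (G.good_iff.1 hq)
  have hcoe : ∀ c, c ∉ G.Ss 0 → ∃ q, G.Good q ∧ (q : OnePoint ℂ) = c := by
    intro c hc
    induction c using OnePoint.rec with
    | infty => exact absurd (G.infty_mem_Ss 0) hc
    | coe q => exact ⟨q, G.good_iff.2 hc, rfl⟩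
  have hx0 : ∀ x, (G.g 0 x : OnePoint ℂ) ∈ G.Ss 0 := fun x => G.coe_mem_Ss.2 (Or.inr ⟨x, rfl⟩)
  refine ⟨H, ?_, fun t => ?_, fun c => ?_, fun t x => ?_⟩
  · rw [continuous_iff_continuousAt]
    rintro ⟨t0, c0⟩
    have he := (IsOpenEmbedding.id (X := unitInterval)).prodMap (OnePoint.isOpenEmbedding_coe (X := ℂ))
    by_cases hc0 : c0 ∈ G.Ss 0
    · rcases hc0 with hc0 | ⟨_, ⟨z0, rfl⟩, rfl⟩
      · have ho : (univ : Set unitInterval) ×ˢ G.Ss 0 ∈ 𝓝 (t0, c0) := prod_mem_nhds univ_mem (G.Ss_nhds hc0)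
        refine (hU.cont.continuousAt ho).congr ?_
        filter_upwards [ho] with p hp
        exact (hH1 p.1 p.2 hp.2).symm
      · rw [ContinuousAt]
        intro N hN
        have hval : H t0 (G.g 0 z0) = (G.g t0 z0 : OnePoint ℂ) := by rw [hH1 t0 _ (hx0 z0), hU.ext]
        simp only [hval] at hN
        have e1 : ∀ᶠ p : unitInterval × OnePoint ℂ in 𝓝 (t0, (G.g 0 z0 : OnePoint ℂ)),
            p.2 ∈ G.Ss 0 → H p.1 p.2 ∈ N := by
          have h := hU.cont (t0, (G.g 0 z0 : OnePoint ℂ)) ⟨trivial, hx0 z0⟩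
          have h := h.eventually (p := fun c => c ∈ N) (by beta_reduce; rw [hU.ext]; exact hN)
          rw [eventually_nhdsWithin_iff] at h
          filter_upwards [h] with p hp hp2
          rw [hH1 _ _ hp2]; exact hp ⟨trivial, hp2⟩
        have e2 : ∀ᶠ p : unitInterval × OnePoint ℂ in 𝓝 (t0, (G.g 0 z0 : OnePoint ℂ)),
            p.2 ∉ G.Ss 0 → H p.1 p.2 ∈ N := by
          have hm := he.map_nhds_eq (t0, G.g 0 z0)
          change map _ _ = 𝓝 (t0, (G.g 0 z0 : OnePoint ℂ)) at hm
          rw [← hm, eventually_map]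
          rw [OnePoint.nhds_coe_eq, mem_map] at hN
          obtain ⟨ε, hε, hball⟩ := Metric.mem_nhds_iff.1 hN
          obtain ⟨δ, hδ, hc⟩ := hctl (ε / 2) (half_pos hε)
          have f1 := (continuous_fst.tendsto (t0, G.g 0 z0)).eventually (G.time_unif t0 (half_pos hε))
          have f2 := (continuous_snd.tendsto (t0, G.g 0 z0)).eventually (Metric.ball_mem_nhds (G.g 0 z0) hδ)
          filter_upwards [f1, f2] with y h1 h2 h3
          obtain ⟨t, q⟩ := y
          have hq : G.Good q := G.good_iff.2 h3
          change H t (q : OnePoint ℂ) ∈ N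
          rw [hH2 t q hq]
          apply hball
          rw [mem_ball]
          have a1 := hc (rep q) (hgr q hq) q (hmr q) z0 h2 t
          have a2 := h1 z0
          linarith [dist_triangle (HB (rep q) t q) (G.g t z0) (G.g t0 z0)]
        rw [mem_map]
        filter_upwards [e1, e2] with p h1 h2
        by_cases h : p.2 ∈ G.Ss 0
        · exact h1 h
        · exact h2 h
    · obtain ⟨q0, hq0, rfl⟩ := hcoe c0 hc0
      have := he.continuousAt_iff (g := fun p : unitInterval × OnePoint ℂ => H p.1 p.2) (x := (t0, q0))
      refine this.1 ?_
      obtain ⟨-, -, h3⟩ := hB (rep q0) (hgr q0 hq0)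
      have ho : (univ : Set unitInterval) ×ˢ G.U (G.kap (rep q0)) 0 ∈ 𝓝 (t0, q0) :=
        (isOpen_univ.prod (G.U_open (Good.kap_ne (hgr q0 hq0).1) 0)).mem_nhds ⟨trivial, hmr q0⟩
      have h4 := OnePoint.continuous_coe.continuousAt.comp (h3.continuousAt ho)
      refine h4.congr ?_
      filter_upwards [ho] with y hy
      obtain ⟨t, q⟩ := y
      have hq := hUg _ (hgr q0 hq0) q hy.2
      change _ = H t (q : OnePoint ℂ)
      rw [hH2 t q hq, hUr q0 q hy.2]; rfl
  · refine bij_of_pieces (S := G.Ss 0) (T := G.Ss t) ?_ ?_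
    · refine BijOn.congr ?_ (fun c hc => (hH1 t c hc).symm)
      refine BijOn.union (hU.bij t) (f := HU t) ⟨?_, ?_, ?_⟩ ?_
      · rintro _ ⟨_, ⟨x, rfl⟩, rfl⟩
        rw [hU.ext]; exact ⟨_, ⟨x, rfl⟩, rfl⟩
      · rintro _ ⟨_, ⟨x, rfl⟩, rfl⟩ _ ⟨_, ⟨x', rfl⟩, rfl⟩ h
        rw [hU.ext, hU.ext] at h
        rw [G.inj t (OnePoint.coe_injective h)]
      · rintro _ ⟨_, ⟨x, rfl⟩, rfl⟩
        exact ⟨_, ⟨_, ⟨x, rfl⟩, rfl⟩, hU.ext t x⟩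
      · rintro c (hc | ⟨_, ⟨x, rfl⟩, rfl⟩) c' (hc' | ⟨_, ⟨x', rfl⟩, rfl⟩) h
        · exact (hU.bij t).injOn hc hc' h
        · exfalso
          rw [hU.ext] at h
          exact Vs_disj t ((hU.bij t).mapsTo hc) (h ▸ ⟨_, ⟨x', rfl⟩, rfl⟩)
        · exfalso
          rw [hU.ext] at h
          exact Vs_disj t ((hU.bij t).mapsTo hc') (h ▸ ⟨_, ⟨x, rfl⟩, rfl⟩)
        · rw [hU.ext, hU.ext] at h
          rw [G.inj t (OnePoint.coe_injective h)]
    · have hm : ∀ q, G.Good q → HB (rep q) t q ∈ G.U (G.kap (rep q)) t := fun q hq =>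
        ((hB _ (hgr q hq)).1 t).mapsTo (hmr q)
      refine ⟨fun c hc => ?_, fun c hc c' hc' h => ?_, fun c hc => ?_⟩
      · obtain ⟨q, hq, rfl⟩ := hcoe c hc
        rw [hH2 t q hq]
        rw [mem_compl_iff, coe_mem_Ss]
        have hr := hgr q hq
        rintro (h | h)
        · exact hr.2 ((LogRel.symm (hm q hq)).trans h)
        · exact G.U_notMem (Good.kap_ne hr.1) (hm q hq) h
      · obtain ⟨q, hq, rfl⟩ := hcoe c hc
        obtain ⟨q', hq', rfl⟩ := hcoe c' hc'
        rw [hH2 t q hq, hH2 t q' hq'] at h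
        have h := OnePoint.coe_injective h
        have h1 := hm q hq
        have h2 := hm q' hq'
        rw [← h] at h2
        have h3 : LogRel univ (G.kap (rep q)) (G.kap (rep q')) := (LogRel.symm h1).trans h2
        have h4 : rep q = rep q' := hrep' q q' ((hrep q).symm.trans (h3.trans (hrep q')))
        have h5 := hmr q'
        rw [← h4] at h5 h
        rw [((hB _ (hgr q hq)).1 t).injOn (hmr q) h5 h]
      · induction c using OnePoint.rec with
        | infty => exact absurd (G.infty_mem_Ss t) hc
        | coe w =>
          rw [mem_compl_iff, coe_mem_Ss, not_or] at hc
          obtain ⟨hc1, hc2⟩ := hc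
          obtain ⟨b, hb⟩ := G.U_nonempty (κ := fun z => G.g t z - w) ((G.cont_t t).sub continuous_const)
            (fun z h => hc2 ⟨z, sub_eq_zero.1 h⟩) hc1 (s := t) ⟨w, LogRel.refl⟩ 0
          have hgb : G.Good b := by
            refine ⟨G.U_notMem (fun z h => hc2 ⟨z, sub_eq_zero.1 h⟩) hb, fun h => hc1 ((LogRel.symm hb).trans h)⟩
          have hw : w ∈ G.U (G.kap (rep b)) t := (LogRel.symm hb).trans (hrep b).symm
          obtain ⟨q, hq, hqw⟩ := ((hB _ (hgr b hgb)).1 t).surjOn hw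
          have hqg := hUg _ (hgr b hgb) q hq
          refine ⟨q, G.good_iff.1 hqg, ?_⟩
          rw [hH2 t q hqg, hUr b q hq, hqw]
  · by_cases hc : c ∈ G.Ss 0
    · rw [hH1 0 c hc]
      rcases hc with hc | ⟨_, ⟨x, rfl⟩, rfl⟩
      · exact hU.id c hc
      · exact hU.ext 0 x
    · obtain ⟨q, hq, rfl⟩ := hcoe c hc
      rw [hH2 0 q hq, (hB _ (hgr q hq)).2.1 q (hmr q)]
  · rw [hH1 t _ (hx0 x), hU.ext]

end Isot
end IsoExt
end

section
open Set Metric Topology Filter ComplexConjugate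
set_option linter.unusedSectionVars false
namespace IsoExt

lemma Isot.planar {X : Type*} [MetricSpace X] [CompactSpace X] [ConnectedSpace X] (G : Isot X) :
    ∃ H : unitInterval → OnePoint ℂ → OnePoint ℂ,
      Continuous (fun p : unitInterval × OnePoint ℂ => H p.1 p.2) ∧ (∀ t, Function.Bijective (H t)) ∧
      (∀ c, H 0 c = c) ∧ ∀ t x, H t (G.g 0 x) = G.g t x := by
  rcases subsingleton_or_nontrivial X with hX | hX
  · obtain ⟨x0⟩ : Nonempty X := inferInstance
    have hc : Continuous fun t => G.g t x0 :=
      G.cont.comp (f := fun t : unitInterval => (t, x0)) (by fun_prop)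
    refine ⟨fun t => aff (G.g t x0 - G.g 0 x0) 1, ?_, fun t => ?_, fun c => ?_, fun t x => ?_⟩
    · exact aff_cont (m := fun t => G.g t x0 - G.g 0 x0) (d := fun _ => 1) (by fun_prop)
        continuous_const (fun _ => one_ne_zero)
    · exact Function.bijective_iff_has_inverse.2 ⟨_, inv_aff one_ne_zero, aff_inv one_ne_zero⟩
    · induction c using OnePoint.rec with
      | infty => simp
      | coe z => simp
    · rw [Subsingleton.elim x x0]; simp
  · exact G.planar_nontrivial

/-- inversion of the sphere -/
noncomputable def sinv (c : OnePoint ℂ) : OnePoint ℂ :=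
  OnePoint.rec ((0 : ℂ) : OnePoint ℂ) (fun z => if z = 0 then OnePoint.infty else ((z⁻¹ : ℂ) : OnePoint ℂ)) c

lemma sinv_infty : sinv OnePoint.infty = ((0 : ℂ) : OnePoint ℂ) := rfl
lemma sinv_zero : sinv ((0 : ℂ) : OnePoint ℂ) = OnePoint.infty := if_pos rfl
lemma sinv_coe {z : ℂ} (h : z ≠ 0) : sinv (z : OnePoint ℂ) = ((z⁻¹ : ℂ) : OnePoint ℂ) := if_neg h

lemma sinv_sinv (c : OnePoint ℂ) : sinv (sinv c) = c := by
  induction c using OnePoint.rec with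
  | infty => rw [sinv_infty, sinv_zero]
  | coe z =>
    by_cases h : z = 0
    · rw [h, sinv_zero, sinv_infty]
    · rw [sinv_coe h, sinv_coe (inv_ne_zero h), inv_inv]

lemma sinv_cont : Continuous sinv := by
  rw [continuous_iff_continuousAt]
  intro c
  induction c using OnePoint.rec with
  | infty =>
    rw [OnePoint.continuousAt_infty']
    rw [sinv_infty]
    have h1 : Tendsto (fun z : ℂ => ((z⁻¹ : ℂ) : OnePoint ℂ)) (coclosedCompact ℂ) (𝓝 ((0 : ℂ) : OnePoint ℂ)) := by
      refine (OnePoint.continuous_coe.tendsto 0).comp ?_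
      rw [coclosedCompact_eq_cocompact]
      exact tendsto_inv₀_cobounded.comp (by rw [Metric.cobounded_eq_cocompact]; exact tendsto_id)
    refine h1.congr' ?_
    rw [coclosedCompact_eq_cocompact]
    have : ({0} : Set ℂ)ᶜ ∈ cocompact ℂ := isCompact_singleton.compl_mem_cocompact
    filter_upwards [this] with z hz
    exact (sinv_coe hz).symm
  | coe z =>
    rw [OnePoint.continuousAt_coe]
    by_cases h : z = 0
    · subst h
      rw [continuousAt_iff_punctured_nhds]
      simp only [Function.comp, sinv_zero]
      have : Tendsto (fun z : ℂ => ((z⁻¹ : ℂ) : OnePoint ℂ)) (𝓝[≠] 0) (𝓝 OnePoint.infty) := by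
        refine tendsto_infty_of_norm ?_
        exact tendsto_norm_inv_nhdsNE_zero_atTop
      refine this.congr' ?_
      filter_upwards [self_mem_nhdsWithin] with z hz
      exact (sinv_coe hz).symm
    · have : ContinuousAt (fun z : ℂ => ((z⁻¹ : ℂ) : OnePoint ℂ)) z :=
        OnePoint.continuous_coe.continuousAt.comp (continuousAt_inv₀ h)
      refine this.congr ?_
      filter_upwards [isOpen_ne.mem_nhds h] with w hw
      exact (sinv_coe hw).symm

noncomputable def sinvHomeo : OnePoint ℂ ≃ₜ OnePoint ℂ where
  toFun := sinv
  invFun := sinv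
  left_inv := sinv_sinv
  right_inv := sinv_sinv
  continuous_toFun := sinv_cont
  continuous_invFun := sinv_cont

lemma aff_const_cont (m : ℂ) : Continuous (aff m 1) :=
  (aff_cont (T := Unit) (m := fun _ => m) (d := fun _ => 1) continuous_const continuous_const
    (fun _ => one_ne_zero)).comp (f := fun c => ((), c)) (by fun_prop)

lemma exists_to_infty (y : OnePoint ℂ) : ∃ φ : OnePoint ℂ ≃ₜ OnePoint ℂ, φ y = OnePoint.infty := by
  induction y using OnePoint.rec with
  | infty => exact ⟨Homeomorph.refl _, rfl⟩
  | coe z =>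
    have e : (- -z / 1 : ℂ) = z := by simp
    refine ⟨(Homeomorph.mk ⟨aff (-z) 1, aff z 1, fun c => ?_, fun c => ?_⟩ (aff_const_cont _)
      (aff_const_cont _)).trans sinvHomeo, ?_⟩
    · have := inv_aff (m := -z) (d := 1) one_ne_zero c
      rwa [e, inv_one] at this
    · have := aff_inv (m := -z) (d := 1) one_ne_zero c
      rwa [e, inv_one] at this
    · change sinv (aff (-z) 1 z) = _
      rw [aff_coe, one_mul, neg_add_cancel, sinv_zero]

/-- the sphere does not embed in the plane -/
lemma no_sphere_embed (k : OnePoint ℂ → ℂ) (hk : Continuous k) (hi : Function.Injective k) : False := by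
  let A : ℂ → OnePoint ℂ := fun x => sinv ((-conj x : ℂ) : OnePoint ℂ)
  have hA : Continuous A := sinv_cont.comp (OnePoint.continuous_coe.comp (by fun_prop))
  have hA1 : ∀ x : ℂ, x ≠ 0 → A x = (((-conj x)⁻¹ : ℂ) : OnePoint ℂ) := fun x hx =>
    sinv_coe (by simpa using hx)
  have hne : ∀ x : ℂ, k x - k (A x) ≠ 0 := by
    intro x h
    have h1 := hi (sub_eq_zero.1 h)
    by_cases hx : x = 0
    · subst hx
      have : A 0 = OnePoint.infty := by simp only [A, map_zero, neg_zero]; exact sinv_zero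
      rw [this] at h1
      exact OnePoint.coe_ne_infty _ h1
    · rw [hA1 x hx] at h1
      have h2 := OnePoint.coe_injective h1
      have h3 : x * conj x = -1 := by
        have : (-conj x) ≠ 0 := by simpa using hx
        have h4 : x * (-conj x) = 1 := by
          rw [← inv_mul_cancel₀ this, ← h2]
        linear_combination -h4
      rw [Complex.mul_conj] at h3
      have := congrArg Complex.re h3
      simp at this
      linarith [Complex.normSq_nonneg x]
  obtain ⟨L, hL, hLF⟩ := plane_log (F := fun x : ℂ => k x - k (A x))
    ((hk.comp OnePoint.continuous_coe).sub (hk.comp hA)) hne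
  let a : ℂ → ℂ := fun x => (-conj x)⁻¹
  have ha0 : ∀ x, x ≠ 0 → a x ≠ 0 := fun x hx => inv_ne_zero (by simpa using hx)
  have haa : ∀ x, a (a x) = x := fun x => by simp [a]
  have hac : ContinuousOn a {0}ᶜ := by
    refine ContinuousOn.inv₀ (by fun_prop) ?_
    intro x hx; simpa using hx
  have hpre : IsPreconnected ({0}ᶜ : Set ℂ) :=
    (isConnected_compl_singleton_of_one_lt_rank (by rw [Complex.rank_real_complex]; norm_num) 0).isPreconnected
  have hF : ∀ x, x ≠ 0 → Complex.exp (L (a x)) = - Complex.exp (L x) := by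
    intro x hx
    rw [hLF, hLF, hA1 x hx, hA1 _ (ha0 x hx)]
    change k (a x) - k (a (a x)) = -(k x - k (a x))
    rw [haa]; ring
  have key := log_unique hpre (l := fun x => L (a x)) (l' := fun x => L x + Real.pi * Complex.I)
    (hL.comp_continuousOn hac) (by fun_prop) (fun w hw => by
      beta_reduce
      rw [hF w hw, Complex.exp_add, Complex.exp_pi_mul_I]; ring)
    (a := 1) (b := a 1) one_ne_zero (ha0 1 one_ne_zero)
  beta_reduce at key
  rw [haa] at key
  have e1 : L (a 1) = L 1 := by linear_combination key / 2
  have e2 := hF 1 one_ne_zero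
  rw [e1] at e2
  have := Complex.exp_ne_zero (L 1)
  apply this
  linear_combination e2 / 2
end IsoExt
end

section
open Set Metric Topology Filter
set_option linter.unusedSectionVars false
namespace IsoExt

variable {X : Type*} [MetricSpace X] [CompactSpace X] [ConnectedSpace X]

lemma sphere_step (h : ℝ → X → OnePoint ℂ) (hc : Continuous fun p : ℝ × X => h p.1 p.2)
    (hi : ∀ t, Function.Injective (h t)) {a b : ℝ} (hab : a < b) (y : OnePoint ℂ)
    (hy : ∀ t ∈ Icc a b, ∀ x, h t x ≠ y) :
    ∃ K : ℝ → OnePoint ℂ → OnePoint ℂ, Continuous (fun p : ℝ × OnePoint ℂ => K p.1 p.2) ∧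
      (∀ t, Function.Bijective (K t)) ∧ (∀ t ≤ a, ∀ c, K t c = c) ∧
      ∀ t ∈ Icc a b, ∀ x, K t (h a x) = h t x := by
  obtain ⟨φ, hφ⟩ := exists_to_infty y
  have hba : 0 < b - a := sub_pos.2 hab
  have hmem : ∀ s : unitInterval, a + s * (b - a) ∈ Icc a b := fun s =>
    ⟨by nlinarith [s.2.1], by nlinarith [s.2.2]⟩
  have hne : ∀ (s : unitInterval) x, φ (h (a + s * (b - a)) x) ≠ OnePoint.infty := by
    intro s x e
    rw [← hφ] at e
    exact hy _ (hmem s) x (φ.injective e)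
  choose g hg using fun (s : unitInterval) x => OnePoint.ne_infty_iff_exists.1 (hne s x)
  let G : Isot X :=
    { g := g
      cont := by
        rw [OnePoint.isOpenEmbedding_coe.isInducing.continuous_iff]
        have : ((↑) : ℂ → OnePoint ℂ) ∘ (fun p : unitInterval × X => g p.1 p.2)
            = fun p : unitInterval × X => φ (h (a + p.1 * (b - a)) p.2) := by
          funext p; exact hg p.1 p.2
        rw [this]
        exact φ.continuous.comp (hc.comp (f := fun p : unitInterval × X => (a + p.1 * (b - a), p.2))
          (by fun_prop))
      inj := by
        intro t x x' e
        have := congrArg ((↑) : ℂ → OnePoint ℂ) e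
        rw [hg, hg] at this
        exact hi _ (φ.injective this) }
  obtain ⟨H, h1, h2, h3, h4⟩ := G.planar
  let τ : ℝ → unitInterval := fun t => projIcc 0 1 zero_le_one ((t - a) / (b - a))
  have hτ : Continuous τ := continuous_projIcc.comp (by fun_prop)
  refine ⟨fun t c => φ.symm (H (τ t) (φ c)), ?_, fun t => ?_, fun t ht c => ?_, fun t ht x => ?_⟩
  · exact φ.symm.continuous.comp (h1.comp (f := fun p : ℝ × OnePoint ℂ => (τ p.1, φ p.2))
      ((hτ.comp continuous_fst).prodMk (φ.continuous.comp continuous_snd)))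
  · exact φ.symm.bijective.comp ((h2 _).comp φ.bijective)
  · have : τ t = 0 := projIcc_of_le_left _ (div_nonpos_of_nonpos_of_nonneg (by linarith) hba.le)
    beta_reduce
    rw [this, h3, φ.symm_apply_apply]
  · have e0 : φ (h a x) = G.g 0 x := by
      have := hg 0 x
      rw [show a + ((0 : unitInterval) : ℝ) * (b - a) = a by simp] at this
      exact this.symm
    have hmt : (t - a) / (b - a) ∈ Icc (0 : ℝ) 1 :=
      ⟨div_nonneg (by linarith [ht.1]) hba.le, (div_le_one hba).2 (by linarith [ht.2])⟩
    have e1 : φ (h t x) = G.g (τ t) x := by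
      have := hg (τ t) x
      have e : ((τ t : unitInterval) : ℝ) = (t - a) / (b - a) := by
        change ((projIcc 0 1 zero_le_one ((t - a) / (b - a)) : unitInterval) : ℝ) = _
        rw [projIcc_of_mem _ hmt]
      rw [e, div_mul_cancel₀ _ hba.ne', add_sub_cancel] at this
      exact this.symm
    beta_reduce
    rw [e0, h4, ← e1, φ.symm_apply_apply]

lemma sphere_all (h : ℝ → X → OnePoint ℂ) (hc : Continuous fun p : ℝ × X => h p.1 p.2)
    (hi : ∀ t, Function.Injective (h t)) (hmiss : ∀ t, ∃ y, ∀ x, h t x ≠ y) :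
    ∃ K : ℝ → OnePoint ℂ → OnePoint ℂ, Continuous (fun p : ℝ × OnePoint ℂ => K p.1 p.2) ∧
      (∀ t, Function.Bijective (K t)) ∧ (∀ c, K 0 c = c) ∧
      ∀ t ∈ Icc (0 : ℝ) 1, ∀ x, K t (h 0 x) = h t x := by
  have ho : ∀ y, IsOpen {t : ℝ | ∀ x, h t x ≠ y} := by
    intro y
    have h1 : IsClosed {p : ℝ × X | h p.1 p.2 = y} := isClosed_eq hc continuous_const
    have h2 := isClosedMap_fst_of_compactSpace _ h1
    convert h2.isOpen_compl using 1
    ext t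
    simp
  obtain ⟨δ, hδ, hL⟩ := lebesgue_number_lemma_of_metric (isCompact_Icc (a := (0 : ℝ)) (b := 1)) ho
    (fun t _ => by
      obtain ⟨y, hy⟩ := hmiss t
      exact mem_iUnion.2 ⟨y, hy⟩)
  have main : ∀ n : ℕ, ∃ K : ℝ → OnePoint ℂ → OnePoint ℂ,
      Continuous (fun p : ℝ × OnePoint ℂ => K p.1 p.2) ∧
      (∀ t, Function.Bijective (K t)) ∧ (∀ c, K 0 c = c) ∧
      ∀ t ∈ Icc (0 : ℝ) (min 1 (n * (δ / 2))), ∀ x, K t (h 0 x) = h t x := by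
    intro n
    induction n with
    | zero =>
      refine ⟨fun _ c => c, continuous_snd, fun t => Function.bijective_id, fun c => rfl, ?_⟩
      intro t ht x
      have : t = 0 := le_antisymm (ht.2.trans (by simp)) ht.1
      rw [this]
    | succ n ih =>
      obtain ⟨H, h1, h2, h3, h4⟩ := ih
      set a : ℝ := min 1 (n * (δ / 2)) with ha
      have ha0 : 0 ≤ a := le_min zero_le_one (by positivity)
      obtain ⟨y, hy⟩ := hL a ⟨ha0, min_le_left _ _⟩
      obtain ⟨K, k1, k2, k3, k4⟩ := sphere_step h hc hi (a := a) (b := a + δ / 2) (by linarith) y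
        (fun t ht => by
          refine hy ?_
          rw [mem_ball, Real.dist_eq, abs_of_nonneg (by linarith [ht.1])]
          linarith [ht.2])
      refine ⟨fun t c => K t (H (min t a) c), ?_, fun t => (k2 t).comp (h2 _), fun c => ?_, ?_⟩
      · have : Continuous fun p : ℝ × OnePoint ℂ => H (min p.1 a) p.2 :=
          h1.comp (f := fun p : ℝ × OnePoint ℂ => (min p.1 a, p.2)) (by fun_prop)
        exact k1.comp (f := fun p : ℝ × OnePoint ℂ => (p.1, H (min p.1 a) p.2)) (by fun_prop)
      · beta_reduce
        rw [min_eq_left ha0, h3, k3 0 ha0]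
      · intro t ht x
        beta_reduce
        rcases le_total t a with hta | hta
        · rw [k3 t hta, min_eq_left hta, h4 t ⟨ht.1, hta⟩]
        · rw [min_eq_right hta, h4 a ⟨ha0, le_rfl⟩, k4 t ⟨hta, ?_⟩]
          refine ht.2.trans ?_
          rw [ha]
          push_cast
          rcases le_total 1 ((n : ℝ) * (δ / 2)) with h | h
          · rw [min_eq_left h]; exact (min_le_left _ _).trans (by linarith)
          · rw [min_eq_right h]; exact (min_le_right _ _).trans (by linarith)
  obtain ⟨n, hn⟩ := exists_nat_gt (1 / (δ / 2))
  have hn' : 1 ≤ n * (δ / 2) := by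
    rw [div_lt_iff₀ (by positivity)] at hn
    exact hn.le
  obtain ⟨K, h1, h2, h3, h4⟩ := main n
  rw [min_eq_left hn'] at h4
  exact ⟨K, h1, h2, h3, h4⟩

/-- a compact plane set does not map bijectively onto the sphere -/
lemma misses {Z : Set ℂ} (hZ : IsCompact Z) (f : Z → OnePoint ℂ) (hf : Continuous f)
    (hi : Function.Injective f) : ∃ y, ∀ x, f x ≠ y := by
  by_contra hcon
  push Not at hcon
  haveI : CompactSpace Z := isCompact_iff_compactSpace.1 hZ
  let e := Equiv.ofBijective f ⟨hi, hcon⟩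
  let e' : Z ≃ₜ OnePoint ℂ := Continuous.homeoOfEquivCompactToT2 (f := e) hf
  exact no_sphere_embed (fun c => (e'.symm c : ℂ)) (continuous_subtype_val.comp e'.symm.continuous)
    (Subtype.val_injective.comp e'.symm.injective)

end IsoExt
end

/-- Every isotopy (in the sphere ℂ* = OnePoint ℂ) of a plane continuum,
starting at the inclusion, extends to an isotopy of the sphere starting at the identity. -/
theorem isotopy_extension_sphere
    (Z : Set ℂ) (hZne : Z.Nonempty) (hZcpt : IsCompact Z) (hZconn : IsConnected Z)
    (h : ℂ → ℝ → OnePoint ℂ)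
    (hcont : ContinuousOn (fun p : ℂ × ℝ => h p.1 p.2) (Z ×ˢ Set.Icc 0 1))
    (hinj : ∀ t ∈ Set.Icc (0:ℝ) 1, Set.InjOn (fun z => h z t) Z)
    (hid : ∀ z ∈ Z, h z 0 = (z : OnePoint ℂ)) :
    ∃ H : OnePoint ℂ → ℝ → OnePoint ℂ,
      ContinuousOn (fun p : OnePoint ℂ × ℝ => H p.1 p.2) (Set.univ ×ˢ Set.Icc 0 1) ∧
      (∀ z : OnePoint ℂ, H z 0 = z) ∧
      (∀ t ∈ Set.Icc (0:ℝ) 1, ∃ e : OnePoint ℂ ≃ₜ OnePoint ℂ, ∀ z : OnePoint ℂ, e z = H z t) ∧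
      (∀ z ∈ Z, ∀ t ∈ Set.Icc (0:ℝ) 1, H (z : OnePoint ℂ) t = h z t) := by
  haveI : CompactSpace Z := isCompact_iff_compactSpace.1 hZcpt
  haveI : ConnectedSpace Z := isConnected_iff_connectedSpace.1 hZconn
  let τ : ℝ → ℝ := fun t => projIcc (0 : ℝ) 1 zero_le_one t
  have hτ : Continuous τ := continuous_subtype_val.comp continuous_projIcc
  have hτm : ∀ t, τ t ∈ Icc (0 : ℝ) 1 := fun t => (projIcc (0 : ℝ) 1 zero_le_one t).2
  have hτe : ∀ t ∈ Icc (0 : ℝ) 1, τ t = t := fun t ht => by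
    simp only [τ]; rw [projIcc_of_mem _ ht]
  let k : ℝ → Z → OnePoint ℂ := fun t x => h x (τ t)
  have kc : Continuous fun p : ℝ × Z => k p.1 p.2 :=
    hcont.comp_continuous (f := fun p : ℝ × Z => ((p.2 : ℂ), τ p.1)) (by fun_prop)
      (fun p => ⟨p.2.2, hτm _⟩)
  have ki : ∀ t, Function.Injective (k t) := fun t x x' e =>
    Subtype.ext (hinj (τ t) (hτm t) x.2 x'.2 e)
  obtain ⟨K, h1, h2, h3, h4⟩ := IsoExt.sphere_all k kc ki (fun t => IsoExt.misses hZcpt (k t)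
    (kc.comp (f := fun x : Z => (t, x)) (by fun_prop)) (ki t))
  have hk0 : ∀ x : Z, k 0 x = ((x : ℂ) : OnePoint ℂ) := fun x => by
    change h x (τ 0) = _
    rw [hτe 0 (by simp), hid _ x.2]
  refine ⟨fun c t => K t c, ?_, h3, fun t _ => ?_, fun z hz t ht => ?_⟩
  · exact (h1.comp (f := fun p : OnePoint ℂ × ℝ => (p.2, p.1)) (by fun_prop)).continuousOn
  · have hc : Continuous (K t) := h1.comp (f := fun c => (t, c)) (by fun_prop)
    exact ⟨Continuous.homeoOfEquivCompactToT2 (f := Equiv.ofBijective (K t) (h2 t)) hc, fun z => rfl⟩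
  · have := h4 t ht ⟨z, hz⟩
    rw [hk0] at this
    refine this.trans ?_
    change h z (τ t) = h z t
    rw [hτe t ht]
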